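/- Let p ∈ (2,3]. Let (d_n)_{n∈ℤ} be an ℝ^d-valued stationary sequence of reversed martingale differences in L^p with respect to a stationary non-increasing sequence (𝒢_n)_{n∈ℤ} of σ-algebras: each d_n is 𝒢_n-measurable and E(d_n | 𝒢_{n+1}) = 0 a.s. Set M_n = Σ_{k=1}^n d_k and assume the reversed conditions (C1rev) and (C2rev). Then for any ε > 0, enlarging the probability space if necessary, there exists a sequence (N_i)_{i≥1} of i.i.d. ℝ^d-valued centered Gaussian random variables with covariance E(d_0 d_0^t) such that M_n − Σ_{i=1}^n N_i = o(n^{1/p} (log n)^{(p+1)/(2p)+ε}) almost surely if p ∈ (2,3), and o(n^{1/3} (log n)^{1+ε}) almost surely if p = 3. -/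

import Mathlib

open MeasureTheory ProbabilityTheory Filter Asymptotics
open scoped ENNReal NNReal Topology

noncomputable section

/-- Standard normal cumulative distribution function Φ. -/
def stdNormalCDF (x : ℝ) : ℝ := ((gaussianReal 0 1) (Set.Iic x)).toReal

/-- Generalized inverse Φ⁻¹. -/
def stdNormalCDFInv (y : ℝ) : ℝ := sInf {x : ℝ | y ≤ stdNormalCDF x}

/-- Quantile function of `|X|`: the cadlag inverse of the tail function `x ↦ ℙ(|X| > x)`. -/
def absQuantile {Ω : Type*} [MeasurableSpace Ω] (P : Measure Ω) (X : Ω → ℝ) (u : ℝ) : ℝ :=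
  sInf {x : ℝ | (P {ω | x < |X ω|}).toReal ≤ u}

/-- The envelope norm `‖X‖_{1,Φ,p} = ∫₀¹ (1 ∨ Φ⁻¹(1-u/2))^{p-2} Q_X(u) du`. -/
def envNorm {Ω : Type*} [MeasurableSpace Ω] (P : Measure Ω) (p : ℝ) (X : Ω → ℝ) : ℝ≥0∞ :=
  ∫⁻ u in Set.Ioo (0:ℝ) 1,
    ENNReal.ofReal ((max 1 (stdNormalCDFInv (1 - u/2))) ^ (p - 2) * absQuantile P X u)

/-- `γ` is the centered Gaussian law on `ℝ^D` with covariance matrix `S`. -/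
def IsCenteredGaussianCov (D : ℕ) (S : Matrix (Fin D) (Fin D) ℝ)
    (γ : Measure (EuclideanSpace ℝ (Fin D))) : Prop :=
  IsProbabilityMeasure γ ∧
    ∀ t : Fin D → ℝ,
      Measure.map (fun x => ∑ i, t i * x i) γ =
        gaussianReal 0 (Real.toNNReal (∑ i, ∑ j, t i * S i j * t j))

/-- Partial sums `M_n = ∑_{k=1}^n d_k`. -/
def partialSum {Ω : Type*} {D : ℕ} (d : ℤ → Ω → EuclideanSpace ℝ (Fin D)) (n : ℕ) (ω : Ω) :
    EuclideanSpace ℝ (Fin D) :=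
  ∑ k ∈ Finset.Icc (1 : ℤ) (n : ℤ), d k ω

section

/-- The shift by `n` on sequences. -/
def seqShift {E : Type*} (n : ℕ) (w : ℕ → E) : ℕ → E := fun k => w (k + n)

/-- The sum of the first `n` terms of a sequence. -/
def seqSum {E : Type*} [AddCommMonoid E] (n : ℕ) (w : ℕ → E) : E := ∑ k ∈ Finset.range n, w k

/-- The standard Gaussian measure on `ι → ℝ`. -/
def stdG (ι : Type*) [Fintype ι] : Measure (ι → ℝ) := Measure.pi fun _ => gaussianReal 0 1

instance (ι : Type*) [Fintype ι] : IsProbabilityMeasure (stdG ι) := by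
  unfold stdG; infer_instance

section seq

variable {E : Type*}

lemma seqShift_zero (w : ℕ → E) : seqShift 0 w = w := rfl

lemma seqShift_seqShift (m n : ℕ) (w : ℕ → E) :
    seqShift m (seqShift n w) = seqShift (m + n) w := by
  funext k; simp [seqShift, add_assoc]

lemma seqSum_add [AddCommMonoid E] (m n : ℕ) (w : ℕ → E) :
    seqSum (m + n) w = seqSum m w + seqSum n (seqShift m w) := by
  simp only [seqSum, seqShift, Finset.sum_range_add]
  congr 1
  exact Finset.sum_congr rfl fun k _ => by rw [add_comm]

@[fun_prop]
lemma measurable_seqShift [MeasurableSpace E] (n : ℕ) :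
    Measurable (seqShift n : (ℕ → E) → ℕ → E) := by
  unfold seqShift; fun_prop

@[fun_prop]
lemma measurable_seqSum [AddCommMonoid E] [MeasurableSpace E] [MeasurableAdd₂ E] (n : ℕ) :
    Measurable (seqSum n : (ℕ → E) → E) := by
  unfold seqSum; fun_prop

lemma measurePreserving_seqShift [MeasurableSpace E] {μ : Measure (ℕ → E)}
    (h : MeasurePreserving (seqShift 1) μ μ) (n : ℕ) : MeasurePreserving (seqShift n) μ μ := by
  induction n with
  | zero => exact MeasurePreserving.id μ
  | succ n ih =>
    have := h.comp ih
    convert this using 1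
    funext w
    simp [seqShift_seqShift, add_comm]

end seq

section gauss

variable {ι : Type*} [Fintype ι]

lemma stdG_eval (a : ι) : MeasurePreserving (fun x : ι → ℝ => x a) (stdG ι) (gaussianReal 0 1) :=
  measurePreserving_eval _ a

lemma stdG_memLp_eval (a : ι) (q : ℝ≥0∞) (hq : q ≠ ∞) :
    MemLp (fun x : ι → ℝ => x a) q (stdG ι) :=
  (memLp_id_gaussianReal' q hq).comp_measurePreserving (stdG_eval a)

lemma stdG_memLp (q : ℝ≥0∞) (hq : q ≠ ∞) : MemLp (fun x : ι → ℝ => x) q (stdG ι) :=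
  memLp_pi_iff.2 fun a => stdG_memLp_eval a q hq

lemma stdG_integral_comp_eval (a : ι) {f : ℝ → ℝ} (hf : Measurable f) :
    ∫ x, f (x a) ∂(stdG ι) = ∫ y, f y ∂(gaussianReal 0 1) := by
  rw [← (stdG_eval a).map_eq, integral_map (measurable_pi_apply a).aemeasurable
    hf.aestronglyMeasurable]

lemma stdG_integral_eval (a : ι) : ∫ x, x a ∂(stdG ι) = 0 := by
  rw [stdG_integral_comp_eval a (f := fun y => y) measurable_id, integral_id_gaussianReal]

lemma stdG_integral_eval_mul [DecidableEq ι] (a b : ι) :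
    ∫ x, x a * x b ∂(stdG ι) = if a = b then 1 else 0 := by
  split_ifs with h
  · subst h
    rw [stdG_integral_comp_eval a (f := fun y => y * y) (by fun_prop)]
    have h1 := variance_fun_id_gaussianReal (μ := 0) (v := 1)
    rw [variance_eq_integral (by fun_prop), integral_id_gaussianReal] at h1
    simpa [sq] using h1
  · have hi : iIndepFun (fun (i : ι) (x : ι → ℝ) => x i) (stdG ι) :=
      iIndepFun_pi (X := fun _ => id) (fun _ => aemeasurable_id)
    have := (hi.indepFun h).integral_mul_eq_mul_integral
      (stdG_memLp_eval a 2 (by simp)).1 (stdG_memLp_eval b 2 (by simp)).1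
    simpa [stdG_integral_eval] using this

lemma gaussianReal_prod_map {s t u : ℝ} (h : s ^ 2 + t ^ 2 = u ^ 2) :
    ((gaussianReal 0 1).prod (gaussianReal 0 1)).map (fun z : ℝ × ℝ => s * z.1 + t * z.2)
      = (gaussianReal 0 1).map (fun y => u * y) := by
  have h1 : (fun z : ℝ × ℝ => s * z.1 + t * z.2)
      = (fun z : ℝ × ℝ => z.1 + z.2) ∘ (Prod.map (fun y => s * y) (fun y => t * y)) := rfl
  rw [h1, ← Measure.map_map (by fun_prop) (by fun_prop), ← Measure.map_prod_map _ _ (by fun_prop)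
    (by fun_prop), gaussianReal_map_const_mul, gaussianReal_map_const_mul,
    gaussianReal_map_const_mul]
  have := gaussianReal_conv_gaussianReal (m₁ := s * 0) (m₂ := t * 0)
    (v₁ := .mk (s ^ 2) (sq_nonneg _) * 1) (v₂ := .mk (t ^ 2) (sq_nonneg _) * 1)
  rw [Measure.conv] at this
  rw [this]
  congr 1
  · simp
  · ext; simp [h]

lemma stdG_map_smul (s : ℝ) :
    (stdG ι).map (fun x => s • x) = Measure.pi fun _ : ι => (gaussianReal 0 1).map (s * ·) := by
  have := Measure.pi_map_pi (μ := fun _ : ι => gaussianReal 0 1) (f := fun _ y => s * y)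
    (fun _ => by fun_prop)
  rw [← this]
  rfl

lemma stdG_prod_map {s t u : ℝ} (h : s ^ 2 + t ^ 2 = u ^ 2) :
    ((stdG ι).prod (stdG ι)).map (fun z => s • z.1 + t • z.2)
      = (stdG ι).map (fun x => u • x) := by
  rw [stdG_map_smul, ← gaussianReal_prod_map h, ← Measure.pi_map_pi
    (f := fun _ (z : ℝ × ℝ) => s * z.1 + t * z.2) (fun _ => by fun_prop)]
  have h2 := measurePreserving_arrowProdEquivProdArrow ℝ ℝ ι (fun _ => gaussianReal 0 1)
    (fun _ => gaussianReal 0 1)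
  rw [stdG, ← h2.map_eq, Measure.map_map (by fun_prop) (by fun_prop)]
  rfl

/-- The Cameron–Martin density. -/
def cmKer (η x : ι → ℝ) : ℝ := Real.exp (∑ a, x a * η a - (∑ a, η a ^ 2) / 2)

lemma cmKer_eq_prod (η x : ι → ℝ) :
    cmKer η x = ∏ a, Real.exp (x a * η a - η a ^ 2 / 2) := by
  rw [cmKer, ← Real.exp_sum, Finset.sum_sub_distrib, Finset.sum_div]

lemma measurable_cmKer : Measurable (fun z : (ι → ℝ) × (ι → ℝ) => cmKer z.1 z.2) := by
  unfold cmKer; fun_prop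

lemma gaussianReal_map_add_eq (y : ℝ) :
    (gaussianReal 0 1).map (· + y) = (gaussianReal 0 1).withDensity
      (fun x => ENNReal.ofReal (Real.exp (x * y - y ^ 2 / 2))) := by
  rw [gaussianReal_map_add_const, gaussianReal_of_var_ne_zero _ one_ne_zero,
    gaussianReal_of_var_ne_zero _ one_ne_zero, ← withDensity_mul _ (measurable_gaussianPDF _ _)
      (by fun_prop)]
  congr 1
  ext x
  simp only [gaussianPDF, gaussianPDFReal, Pi.mul_apply]
  rw [← ENNReal.ofReal_mul (by positivity), mul_assoc _ (Real.exp _), ← Real.exp_add]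
  congr 3
  simp
  ring

lemma stdG_map_add (η : ι → ℝ) :
    (stdG ι).map (· + η) = (stdG ι).withDensity (fun x => ENNReal.ofReal (cmKer η x)) := by
  have h0 : (stdG ι).map (· + η) = Measure.pi fun a : ι => (gaussianReal 0 1).map (· + η a) := by
    have := Measure.pi_map_pi (μ := fun _ : ι => gaussianReal 0 1) (f := fun a y => y + η a)
      (fun _ => by fun_prop)
    rw [← this]
    rfl
  rw [h0]
  have : ∀ a, IsProbabilityMeasure ((gaussianReal 0 1).map (· + η a)) := fun a =>
    Measure.isProbabilityMeasure_map (by fun_prop)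
  refine Measure.pi_eq fun s hs => ?_
  have hint : ∀ a, Integrable (fun x => Real.exp (x * η a - η a ^ 2 / 2)) (gaussianReal 0 1) := by
    intro a
    simp_rw [Real.exp_sub]
    have := integrable_exp_mul_gaussianReal (μ := 0) (v := 1) (η a)
    simp_rw [mul_comm (η a)] at this
    exact this.div_const _
  have h1 : ∀ a, ((gaussianReal 0 1).map (· + η a)) (s a) = ENNReal.ofReal
      (∫ x, (s a).indicator (fun x => Real.exp (x * η a - η a ^ 2 / 2)) x
        ∂(gaussianReal 0 1)) := by
    intro a
    rw [gaussianReal_map_add_eq, withDensity_apply _ (hs a), integral_indicator (hs a),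
      ofReal_integral_eq_lintegral_ofReal (hint a).integrableOn (ae_of_all _ fun _ => by positivity)]
  have hms : MeasurableSet (Set.univ.pi s) := MeasurableSet.univ_pi hs
  have hpi : ∀ x : ι → ℝ, (Set.univ.pi s).indicator (cmKer η) x =
      ∏ a, (s a).indicator (fun x => Real.exp (x * η a - η a ^ 2 / 2)) (x a) := by
    intro x
    classical
    by_cases hx : x ∈ Set.univ.pi s
    · rw [Set.indicator_of_mem hx, cmKer_eq_prod]
      exact Finset.prod_congr rfl fun a _ => by
        rw [Set.indicator_of_mem (hx a (Set.mem_univ _))]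
    · rw [Set.indicator_of_notMem hx]
      have : ∃ a, x a ∉ s a := by simpa [Set.mem_pi] using hx
      obtain ⟨a, ha⟩ := this
      exact (Finset.prod_eq_zero (Finset.mem_univ a) (Set.indicator_of_notMem ha _)).symm
  simp_rw [h1]
  rw [← ENNReal.ofReal_prod_of_nonneg (fun a _ => integral_nonneg fun x =>
    Set.indicator_nonneg (fun _ _ => by positivity) _), ← integral_fintype_prod_eq_prod,
    withDensity_apply _ hms]
  rw [← ofReal_integral_eq_lintegral_ofReal, ← integral_indicator hms]
  · congr 1
    exact integral_congr_ae (ae_of_all _ hpi)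
  · have hI : Integrable (fun x : ι → ℝ => ∏ a, Real.exp (x a * η a - η a ^ 2 / 2)) (stdG ι) :=
      Integrable.fintype_prod hint
    refine Integrable.integrableOn ?_
    convert hI using 1
    funext x
    exact cmKer_eq_prod η x
  · exact ae_of_all _ fun _ => by unfold cmKer; positivity

lemma stdG_integral_add (η : ι → ℝ) {f : (ι → ℝ) → ℝ} (hf : Measurable f) :
    ∫ x, f (x + η) ∂(stdG ι) = ∫ x, cmKer η x * f x ∂(stdG ι) := by
  have h1 : ∫ x, f (x + η) ∂(stdG ι) = ∫ x, f x ∂((stdG ι).map (· + η)) :=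
    (integral_map (by fun_prop) hf.aestronglyMeasurable).symm
  have hm : Measurable (cmKer η) := measurable_cmKer.comp (measurable_const.prodMk measurable_id)
  rw [h1, stdG_map_add, integral_withDensity_eq_integral_toReal_smul (by fun_prop)
    (ae_of_all _ fun _ => by simp)]
  refine integral_congr_ae (ae_of_all _ fun x => ?_)
  simp only [smul_eq_mul]
  rw [ENNReal.toReal_ofReal (by unfold cmKer; positivity)]

end gauss

end

section

lemma integrable_of_abs_le {α : Type*} [MeasurableSpace α] {μ : Measure α} [IsFiniteMeasure μ]
    {f : α → ℝ} (hf : Measurable f) {B : ℝ} (hB : ∀ x, |f x| ≤ B) : Integrable f μ :=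
  Integrable.of_bound hf.aestronglyMeasurable B (ae_of_all _ hB)

lemma MeasureTheory.Integrable.abs_le_mul {α : Type*} [MeasurableSpace α] {μ : Measure α}
    {f g : α → ℝ} (hg : Integrable g μ) (hf : Measurable f) {B : ℝ} (hB : ∀ x, |f x| ≤ B) :
    Integrable (fun x => f x * g x) μ :=
  hg.bdd_mul hf.aestronglyMeasurable (ae_of_all _ hB)

lemma MeasureTheory.MemLp.abs_le_mul {α : Type*} [MeasurableSpace α] {μ : Measure α}
    {f g : α → ℝ} {q : ℝ≥0∞} (hg : MemLp g q μ) (hf : Measurable f) {B : ℝ}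
    (hB : ∀ x, |f x| ≤ B) : MemLp (fun x => f x * g x) q μ :=
  hg.of_le_mul (c := B) (hf.aestronglyMeasurable.mul hg.1) (ae_of_all _ fun x => by
    rw [norm_mul]; exact mul_le_mul_of_nonneg_right (hB x) (norm_nonneg _))

lemma MeasureTheory.MemLp.integrable_fun_mul {α : Type*} [MeasurableSpace α] {μ : Measure α}
    {f g : α → ℝ} (hf : MemLp f 2 μ) (hg : MemLp g 2 μ) : Integrable (fun x => f x * g x) μ :=
  hf.integrable_mul hg

lemma MeasureTheory.integral_fun_add₄ {α : Type*} [MeasurableSpace α] {μ : Measure α}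
    {f₁ f₂ f₃ f₄ : α → ℝ} (h₁ : Integrable f₁ μ) (h₂ : Integrable f₂ μ) (h₃ : Integrable f₃ μ)
    (h₄ : Integrable f₄ μ) : ∫ x, (f₁ x + f₂ x + f₃ x + f₄ x) ∂μ
      = ∫ x, f₁ x ∂μ + ∫ x, f₂ x ∂μ + ∫ x, f₃ x ∂μ + ∫ x, f₄ x ∂μ := by
  rw [integral_add (f := fun x => f₁ x + f₂ x + f₃ x) ((h₁.add h₂).add h₃) h₄,
    integral_add (f := fun x => f₁ x + f₂ x) (h₁.add h₂) h₃, integral_add h₁ h₂]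

lemma MeasureTheory.MeasurePreserving.integral_comp_of_measurable {α β : Type*}
    [MeasurableSpace α] [MeasurableSpace β] {μ : Measure α} {ν : Measure β} {T : α → β}
    (hT : MeasurePreserving T μ ν) {f : β → ℝ} (hf : Measurable f) :
    ∫ x, f (T x) ∂μ = ∫ y, f y ∂ν := by
  rw [← hT.map_eq, integral_map hT.measurable.aemeasurable hf.aestronglyMeasurable]

/-- A stationary square integrable reversed martingale difference sequence, described on its path
space. -/
structure RevStationary {ι : Type*} [Fintype ι] (μ : Measure (ℕ → ι → ℝ)) : Prop where
  prob : IsProbabilityMeasure μ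
  mp : MeasurePreserving (seqShift 1) μ μ
  memLp_two : MemLp (fun w : ℕ → ι → ℝ => w 0) 2 μ
  orth : ∀ Z : (ℕ → ι → ℝ) → ℝ, Measurable Z → MemLp Z 2 μ →
    ∀ a, ∫ w, Z (seqShift 1 w) * w 0 a ∂μ = 0

namespace RevStationary

variable {ι : Type*} [Fintype ι] {μ : Measure (ℕ → ι → ℝ)}

lemma mpn (hc : RevStationary μ) (n : ℕ) : MeasurePreserving (seqShift n) μ μ :=
  measurePreserving_seqShift hc.mp n

lemma memLp_two_seqSum_eval (hc : RevStationary μ) (n : ℕ) (a : ι) :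
    MemLp (fun w : ℕ → ι → ℝ => seqSum n w a) 2 μ := by
  have : MemLp (fun w : ℕ → ι → ℝ => seqSum n w) 2 μ := by
    unfold seqSum
    refine memLp_finsetSum _ fun k _ => ?_
    have := hc.memLp_two.comp_measurePreserving (hc.mpn k)
    simpa [Function.comp_def, seqShift] using this
  exact memLp_pi_iff.1 this a

lemma integrable_mul_seqSum (hc : RevStationary μ) (n : ℕ) (a b : ι) :
    Integrable (fun w : ℕ → ι → ℝ => seqSum n w a * seqSum n w b) μ :=
  (hc.memLp_two_seqSum_eval n a).integrable_fun_mul (hc.memLp_two_seqSum_eval n b)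

lemma orth_seqSum (hc : RevStationary μ) (n : ℕ) {Z : (ℕ → ι → ℝ) → ℝ} (hZ : Measurable Z)
    (hZ2 : MemLp Z 2 μ) (a : ι) : ∫ w, Z (seqShift n w) * seqSum n w a ∂μ = 0 := by
  induction n with
  | zero => simp [seqSum]
  | succ n ih =>
    have h1 : ∀ w : ℕ → ι → ℝ, Z (seqShift (n + 1) w) * seqSum (n + 1) w a =
        Z (seqShift n (seqShift 1 w)) * w 0 a
        + Z (seqShift n (seqShift 1 w)) * seqSum n (seqShift 1 w) a := by
      intro w
      rw [add_comm n 1, seqSum_add, seqShift_seqShift, add_comm 1 n, Pi.add_apply, mul_add]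
      simp [seqSum]
    have hZn : MemLp (fun w => Z (seqShift n w)) 2 μ := hZ2.comp_measurePreserving (hc.mpn n)
    have hZn1 : MemLp (fun w => Z (seqShift n (seqShift 1 w))) 2 μ :=
      hZn.comp_measurePreserving hc.mp
    have hmn : Measurable fun w : ℕ → ι → ℝ => seqSum n w a := by fun_prop
    simp_rw [h1]
    rw [integral_add (hZn1.integrable_fun_mul (memLp_pi_iff.1 hc.memLp_two a))
      (hZn1.integrable_fun_mul (g := fun w : ℕ → ι → ℝ => seqSum n (seqShift 1 w) a)
        ((hc.memLp_two_seqSum_eval n a).comp_measurePreserving hc.mp)),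
      hc.orth (fun w => Z (seqShift n w)) (by fun_prop) hZn a, zero_add,
      hc.mp.integral_comp_of_measurable (f := fun w => Z (seqShift n w) * seqSum n w a)
        (by fun_prop), ih]

/-- Additivity of the conditional expectations given the future of the products of partial
sums. -/
lemma integral_mul_add (hc : RevStationary μ) {a b : ι} {e : ℝ}
    {m n : ℕ} {f g h : (ℕ → ι → ℝ) → ℝ}
    (hf : ∀ Z : (ℕ → ι → ℝ) → ℝ, Measurable Z → (∃ B, ∀ w, |Z w| ≤ B) →
      ∫ w, Z (seqShift m w) * (seqSum m w a * seqSum m w b - m * e) ∂μ = ∫ w, Z w * f w ∂μ)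
    (hg : ∀ Z : (ℕ → ι → ℝ) → ℝ, Measurable Z → (∃ B, ∀ w, |Z w| ≤ B) →
      ∫ w, Z (seqShift n w) * (seqSum n w a * seqSum n w b - n * e) ∂μ = ∫ w, Z w * g w ∂μ)
    (hh : ∀ Z : (ℕ → ι → ℝ) → ℝ, Measurable Z → (∃ B, ∀ w, |Z w| ≤ B) →
      ∫ w, Z (seqShift (m + n) w) *
        (seqSum (m + n) w a * seqSum (m + n) w b - (m + n : ℕ) * e) ∂μ = ∫ w, Z w * h w ∂μ)
    {Z : (ℕ → ι → ℝ) → ℝ} (hZ : Measurable Z) {B : ℝ} (hB : ∀ w, |Z w| ≤ B) :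
    ∫ w, Z w * h w ∂μ
      = ∫ w, Z (seqShift m w) * g w ∂μ + ∫ w, Z w * f w ∂μ := by
  have := hc.prob
  have hm : ∀ n c, Measurable fun w : ℕ → ι → ℝ => seqSum n w c := by intros; fun_prop
  rw [← hh Z hZ ⟨B, hB⟩, ← hf Z hZ ⟨B, hB⟩,
    ← hg (fun w => Z (seqShift m w)) (by fun_prop) ⟨B, fun w => hB _⟩]
  have hZ' : Measurable fun w => Z (seqShift m (seqShift n w)) := by fun_prop
  have hpt : ∀ w : ℕ → ι → ℝ, Z (seqShift (m + n) w) *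
      (seqSum (m + n) w a * seqSum (m + n) w b - (m + n : ℕ) * e)
      = Z (seqShift m (seqShift n w)) * (seqSum n w a * seqSum n w b - n * e)
      + Z (seqShift m (seqShift n w)) *
        (seqSum m (seqShift n w) a * seqSum m (seqShift n w) b - m * e)
      + Z (seqShift m (seqShift n w)) * seqSum m (seqShift n w) b * seqSum n w a
      + Z (seqShift m (seqShift n w)) * seqSum m (seqShift n w) a * seqSum n w b := by
    intro w
    rw [← seqShift_seqShift, add_comm m n, seqSum_add]
    simp only [Pi.add_apply]
    push_cast
    ring
  have hMc : ∀ c, MemLp (fun w : ℕ → ι → ℝ => Z (seqShift m w) * seqSum m w c) 2 μ := fun c =>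
    (hc.memLp_two_seqSum_eval m c).abs_le_mul (by fun_prop) (fun w => hB _)
  have hMc' : ∀ c, MemLp (fun w : ℕ → ι → ℝ =>
      Z (seqShift m (seqShift n w)) * seqSum m (seqShift n w) c) 2 μ := fun c =>
    (hMc c).comp_measurePreserving (hc.mpn n)
  have i1 : Integrable (fun w : ℕ → ι → ℝ => Z (seqShift m (seqShift n w)) *
      (seqSum n w a * seqSum n w b - n * e)) μ :=
    ((hc.integrable_mul_seqSum n a b).sub (integrable_const _)).abs_le_mul hZ' (fun w => hB _)
  have i2 : Integrable (fun w : ℕ → ι → ℝ => Z (seqShift m w) *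
      (seqSum m w a * seqSum m w b - m * e)) μ :=
    ((hc.integrable_mul_seqSum m a b).sub (integrable_const _)).abs_le_mul (by fun_prop)
      (fun w => hB _)
  have i2' : Integrable (fun w : ℕ → ι → ℝ => Z (seqShift m (seqShift n w)) *
      (seqSum m (seqShift n w) a * seqSum m (seqShift n w) b - m * e)) μ :=
    (hc.mpn n).integrable_comp_of_integrable i2
  have i3 := fun c c' => (hMc' c).integrable_fun_mul (hc.memLp_two_seqSum_eval n c')
  have z3 := fun c c' => hc.orth_seqSum n (Z := fun w => Z (seqShift m w) * seqSum m w c)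
    (by fun_prop) (hMc c) c'
  simp_rw [hpt]
  rw [integral_fun_add₄ i1 i2' (i3 b a) (i3 a b), z3, z3, add_zero, add_zero]
  congr 1
  exact (hc.mpn n).integral_comp_of_measurable (f := fun w => Z (seqShift m w) *
      (seqSum m w a * seqSum m w b - m * e)) (by fun_prop)

end RevStationary

variable {ι : Type*} [Fintype ι] [DecidableEq ι]

/-- A stationary reversed martingale difference sequence with identity covariance, described on
its path space, together with the conditional expectations `h i` of the centered products of
the block sums of length `2 ^ i` given the future. -/
structure RevCore (p : ℝ) (μ : Measure (ℕ → ι → ℝ))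
    (h : ℕ → ι → ι → (ℕ → ι → ℝ) → ℝ) : Prop where
  prob : IsProbabilityMeasure μ
  two_lt : 2 < p
  le_three : p ≤ 3
  mp : MeasurePreserving (seqShift 1) μ μ
  memLp : MemLp (fun w : ℕ → ι → ℝ => w 0) (ENNReal.ofReal p) μ
  orth : ∀ Z : (ℕ → ι → ℝ) → ℝ, Measurable Z → MemLp Z 2 μ →
    ∀ a, ∫ w, Z (seqShift 1 w) * w 0 a ∂μ = 0
  cov : ∀ a b, ∫ w, w 0 a * w 0 b ∂μ = if a = b then 1 else 0
  h_meas : ∀ i a b, Measurable (h i a b)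
  h_memLp : ∀ i a b, MemLp (h i a b) (ENNReal.ofReal (p / 2)) μ
  h_spec : ∀ i a b (Z : (ℕ → ι → ℝ) → ℝ), Measurable Z → (∃ B, ∀ w, |Z w| ≤ B) →
    ∫ w, Z (seqShift (2 ^ i) w) *
      (seqSum (2 ^ i) w a * seqSum (2 ^ i) w b - 2 ^ i * if a = b then 1 else 0) ∂μ
      = ∫ w, Z w * h i a b w ∂μ
  sum_one : ∀ a b, ∑' i : ℕ, ENNReal.ofReal ((2 : ℝ) ^ ((i : ℝ) * (p / 2 - 2))) *
    eLpNorm (h i a b) 1 μ < ∞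
  sum_half : ∀ a b, ∑' i : ℕ, ENNReal.ofReal ((2 : ℝ) ^ (-(i : ℝ) * (2 / p))) *
    eLpNorm (h i a b) (ENNReal.ofReal (p / 2)) μ < ∞

/-- Total size of the matrix `h i`. -/
def hNorm (h : ℕ → ι → ι → (ℕ → ι → ℝ) → ℝ) (i : ℕ) (w : ℕ → ι → ℝ) : ℝ≥0∞ :=
  ∑ a, ∑ b, ‖h i a b w‖ₑ

namespace RevCore

variable {p : ℝ} {μ : Measure (ℕ → ι → ℝ)} {h : ℕ → ι → ι → (ℕ → ι → ℝ) → ℝ}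

lemma memLp_two (hc : RevCore p μ h) : MemLp (fun w : ℕ → ι → ℝ => w 0) 2 μ := by
  have := hc.prob
  refine hc.memLp.mono_exponent ?_
  rw [← ENNReal.ofReal_ofNat 2]
  exact ENNReal.ofReal_le_ofReal hc.two_lt.le

lemma revStationary (hc : RevCore p μ h) : RevStationary μ :=
  ⟨hc.prob, hc.mp, hc.memLp_two, hc.orth⟩

lemma mpn (hc : RevCore p μ h) (n : ℕ) : MeasurePreserving (seqShift n) μ μ :=
  hc.revStationary.mpn n

lemma memLp_two_seqSum (hc : RevCore p μ h) (n : ℕ) :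
    MemLp (fun w : ℕ → ι → ℝ => seqSum n w) 2 μ :=
  memLp_pi_iff.2 (hc.revStationary.memLp_two_seqSum_eval n)

lemma memLp_two_seqSum_eval (hc : RevCore p μ h) (n : ℕ) (a : ι) :
    MemLp (fun w : ℕ → ι → ℝ => seqSum n w a) 2 μ :=
  hc.revStationary.memLp_two_seqSum_eval n a

lemma integrable_mul_seqSum (hc : RevCore p μ h) (n : ℕ) (a b : ι) :
    Integrable (fun w : ℕ → ι → ℝ => seqSum n w a * seqSum n w b) μ :=
  hc.revStationary.integrable_mul_seqSum n a b

lemma orth_seqSum (hc : RevCore p μ h) (n : ℕ) {Z : (ℕ → ι → ℝ) → ℝ} (hZ : Measurable Z)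
    (hZ2 : MemLp Z 2 μ) (a : ι) : ∫ w, Z (seqShift n w) * seqSum n w a ∂μ = 0 :=
  hc.revStationary.orth_seqSum n hZ hZ2 a

lemma integrable_h (hc : RevCore p μ h) (i : ℕ) (a b : ι) : Integrable (h i a b) μ := by
  have := hc.prob
  refine (hc.h_memLp i a b).integrable ?_
  rw [← ENNReal.ofReal_one]
  exact ENNReal.ofReal_le_ofReal (by linarith [hc.two_lt])

lemma measurable_hNorm (hc : RevCore p μ h) (i : ℕ) : Measurable (hNorm h i) := by
  have := hc.h_meas
  unfold hNorm
  fun_prop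

lemma h_double (hc : RevCore p μ h) (i : ℕ) (a b : ι) {Z : (ℕ → ι → ℝ) → ℝ} (hZ : Measurable Z)
    {B : ℝ} (hB : ∀ w, |Z w| ≤ B) :
    ∫ w, Z w * h (i + 1) a b w ∂μ
      = ∫ w, Z (seqShift (2 ^ i) w) * h i a b w ∂μ + ∫ w, Z w * h i a b w ∂μ := by
  have hs : ∀ Z : (ℕ → ι → ℝ) → ℝ, Measurable Z → (∃ B, ∀ w, |Z w| ≤ B) →
      ∫ w, Z (seqShift (2 ^ i) w) * (seqSum (2 ^ i) w a * seqSum (2 ^ i) w b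
        - (2 ^ i : ℕ) * if a = b then 1 else 0) ∂μ = ∫ w, Z w * h i a b w ∂μ := fun Z hZ hB => by
    rw [← hc.h_spec i a b Z hZ hB]
    push_cast
    rfl
  refine hc.revStationary.integral_mul_add hs hs (fun Z hZ hB => ?_) hZ hB
  rw [← hc.h_spec (i + 1) a b Z hZ hB, ← two_mul, ← pow_succ']
  push_cast
  rfl

end RevCore

end

section

variable {ι : Type*} [Fintype ι]

/-- A bounded function `v`, of two variables, with a second order Taylor expansion in the second
one: `g` and `H` are its gradient and its Hessian, and `m` is a modulus of continuity. -/
structure IsJet {W : Type*} [MeasurableSpace W] (B : ℝ) (m : ℝ → ℝ) (v : W → (ι → ℝ) → ℝ)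
    (g : W → (ι → ℝ) → ι → ℝ) (H : W → (ι → ℝ) → ι → ι → ℝ) : Prop where
  mv : Measurable (Function.uncurry v)
  mg : ∀ a, Measurable (fun z : W × (ι → ℝ) => g z.1 z.2 a)
  mH : ∀ a b, Measurable (fun z : W × (ι → ℝ) => H z.1 z.2 a b)
  bv : ∀ w x, |v w x| ≤ B
  bg : ∀ w x a, |g w x a| ≤ B
  bH : ∀ w x a b, |H w x a b| ≤ B
  taylor : ∀ w x y, |v w (x + y) - v w x - ∑ a, g w x a * y a
    - (1 / 2) * ∑ a, ∑ b, H w x a b * (y a * y b)| ≤ m ‖y‖ * ‖y‖ ^ 2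
  lip : ∀ w x y a b, |H w (x + y) a b - H w x a b| ≤ m ‖y‖

namespace IsJet

variable {W : Type*} [MeasurableSpace W] {B : ℝ} {m : ℝ → ℝ} {v : W → (ι → ℝ) → ℝ}
    {g : W → (ι → ℝ) → ι → ℝ} {H : W → (ι → ℝ) → ι → ι → ℝ}

lemma comp (hj : IsJet B m v g H) {W' : Type*} [MeasurableSpace W'] {T : W' → W}
    (hT : Measurable T) {u : W' → ι → ℝ} (hu : Measurable u) :
    IsJet B m (fun w x => v (T w) (x + u w)) (fun w x => g (T w) (x + u w))
      (fun w x => H (T w) (x + u w)) where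
  mv := hj.mv.comp (f := fun z : W' × (ι → ℝ) => (T z.1, z.2 + u z.1)) (by fun_prop)
  mg a := (hj.mg a).comp (f := fun z : W' × (ι → ℝ) => (T z.1, z.2 + u z.1)) (by fun_prop)
  mH a b := (hj.mH a b).comp (f := fun z : W' × (ι → ℝ) => (T z.1, z.2 + u z.1)) (by fun_prop)
  bv w x := hj.bv _ _
  bg w x := hj.bg _ _
  bH w x := hj.bH _ _
  taylor w x y := by
    have := hj.taylor (T w) (x + u w) y
    rwa [add_right_comm] at this
  lip w x y a b := by
    have := hj.lip (T w) (x + u w) y a b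
    rwa [add_right_comm] at this

lemma measurable_v (hj : IsJet B m v g H) {α : Type*} [MeasurableSpace α] {f : α → W}
    {u : α → ι → ℝ} (hf : Measurable f) (hu : Measurable u) :
    Measurable fun x => v (f x) (u x) := hj.mv.comp (hf.prodMk hu)

lemma measurable_g (hj : IsJet B m v g H) {α : Type*} [MeasurableSpace α] {f : α → W}
    {u : α → ι → ℝ} (hf : Measurable f) (hu : Measurable u) (a : ι) :
    Measurable fun x => g (f x) (u x) a := (hj.mg a).comp (hf.prodMk hu)

lemma measurable_H (hj : IsJet B m v g H) {α : Type*} [MeasurableSpace α] {f : α → W}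
    {u : α → ι → ℝ} (hf : Measurable f) (hu : Measurable u) (a b : ι) :
    Measurable fun x => H (f x) (u x) a b := (hj.mH a b).comp (hf.prodMk hu)

lemma abs_integral_le {α : Type*} [MeasurableSpace α] {μ : Measure α} [IsProbabilityMeasure μ]
    {f : α → ℝ} {C : ℝ} (hC : ∀ x, |f x| ≤ C) : |∫ x, f x ∂μ| ≤ C := by
  have := norm_integral_le_of_norm_le_const (μ := μ) (f := f) (ae_of_all _ hC)
  simpa using this

lemma average (hj : IsJet B m v g H) (r : ℝ) :
    IsJet B m (fun w x => ∫ y, v w (r • y + x) ∂(stdG ι))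
      (fun w x a => ∫ y, g w (r • y + x) a ∂(stdG ι))
      (fun w x a b => ∫ y, H w (r • y + x) a b ∂(stdG ι)) where
  mv := by
    have : Measurable (fun z : (W × (ι → ℝ)) × (ι → ℝ) => v z.1.1 (r • z.2 + z.1.2)) :=
      hj.measurable_v (by fun_prop) (by fun_prop)
    exact this.stronglyMeasurable.integral_prod_right.measurable
  mg a := by
    have : Measurable (fun z : (W × (ι → ℝ)) × (ι → ℝ) => g z.1.1 (r • z.2 + z.1.2) a) :=
      hj.measurable_g (by fun_prop) (by fun_prop) a
    exact this.stronglyMeasurable.integral_prod_right.measurable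
  mH a b := by
    have : Measurable (fun z : (W × (ι → ℝ)) × (ι → ℝ) => H z.1.1 (r • z.2 + z.1.2) a b) :=
      hj.measurable_H (by fun_prop) (by fun_prop) a b
    exact this.stronglyMeasurable.integral_prod_right.measurable
  bv w x := abs_integral_le fun y => hj.bv _ _
  bg w x a := abs_integral_le fun y => hj.bg _ _ _
  bH w x a b := abs_integral_le fun y => hj.bH _ _ _ _
  taylor w x y := by
    have iv : ∀ x, Integrable (fun z => v w (r • z + x)) (stdG ι) := fun x =>
      integrable_of_abs_le (hj.measurable_v (by fun_prop) (by fun_prop)) fun z => hj.bv _ _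
    have ig : ∀ a, Integrable (fun z => g w (r • z + x) a * y a) (stdG ι) := fun a =>
      (integrable_of_abs_le (hj.measurable_g (by fun_prop) (by fun_prop) a)
        fun z => hj.bg _ _ a).mul_const _
    have iH : ∀ a b, Integrable (fun z => H w (r • z + x) a b * (y a * y b)) (stdG ι) :=
      fun a b => (integrable_of_abs_le (hj.measurable_H (by fun_prop) (by fun_prop) a b)
        fun z => hj.bH _ _ a b).mul_const _
    have key : ∫ z, (v w (r • z + x + y) - v w (r • z + x) - ∑ a, g w (r • z + x) a * y a
        - (1 / 2) * ∑ a, ∑ b, H w (r • z + x) a b * (y a * y b)) ∂(stdG ι)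
        = (∫ z, v w (r • z + (x + y)) ∂(stdG ι)) - (∫ z, v w (r • z + x) ∂(stdG ι))
          - ∑ a, (∫ z, g w (r • z + x) a ∂(stdG ι)) * y a
          - (1 / 2) * ∑ a, ∑ b, (∫ z, H w (r • z + x) a b ∂(stdG ι)) * (y a * y b) := by
      have e : ∀ z : ι → ℝ, r • z + x + y = r • z + (x + y) := fun z => add_assoc _ _ _
      simp_rw [e]
      have I1 := (iv (x + y)).sub (iv x)
      have I2 : Integrable (fun z => ∑ a, g w (r • z + x) a * y a) (stdG ι) :=
        integrable_finsetSum _ fun a _ => ig a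
      have I3 : Integrable (fun z => (1 / 2 : ℝ) * ∑ a, ∑ b, H w (r • z + x) a b * (y a * y b))
          (stdG ι) :=
        (integrable_finsetSum _ fun a _ => integrable_finsetSum _ fun b _ => iH a b).const_mul _
      rw [integral_sub (f := fun z => v w (r • z + (x + y)) - v w (r • z + x)
        - ∑ a, g w (r • z + x) a * y a) (I1.sub I2) I3,
        integral_sub (f := fun z => v w (r • z + (x + y)) - v w (r • z + x)) I1 I2,
        integral_sub (iv _) (iv _), integral_const_mul, integral_finsetSum _ fun a _ => ig a,
        integral_finsetSum _ fun a _ => integrable_finsetSum _ fun b _ => iH a b]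
      simp_rw [integral_finsetSum _ fun b _ => iH _ b, integral_mul_const]
    rw [← key]
    exact abs_integral_le fun z => hj.taylor w _ y
  lip w x y a b := by
    have iH : ∀ x, Integrable (fun z => H w (r • z + x) a b) (stdG ι) :=
      fun x => integrable_of_abs_le (hj.measurable_H (by fun_prop) (by fun_prop) a b)
        fun z => hj.bH _ _ a b
    rw [← integral_sub (iH _) (iH _)]
    refine abs_integral_le fun z => ?_
    rw [← add_assoc]
    exact hj.lip w _ y a b

end IsJet

/-- The error term in the dyadic Lindeberg scheme at level `i`. -/
def lindErr (μ : Measure (ℕ → ι → ℝ)) (h : ℕ → ι → ι → (ℕ → ι → ℝ) → ℝ) (m : ℝ → ℝ) : ℕ → ℝ≥0∞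
  | 0 => ∫⁻ w, ENNReal.ofReal (m ‖w 0‖ * ‖w 0‖ ^ 2) ∂μ
      + ∫⁻ y, ENNReal.ofReal (m ‖y‖ * ‖y‖ ^ 2) ∂(stdG ι)
  | i + 1 => 2 * lindErr μ h m i
      + (∫⁻ w, ENNReal.ofReal (m ‖seqSum (2 ^ i) w‖) * hNorm h i w ∂μ
        + (∫⁻ y, ENNReal.ofReal (m ‖√(2 ^ i) • y‖) ∂(stdG ι)) * ∫⁻ w, hNorm h i w ∂μ)

variable [DecidableEq ι] {p : ℝ} {μ : Measure (ℕ → ι → ℝ)} {h : ℕ → ι → ι → (ℕ → ι → ℝ) → ℝ}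

namespace RevCore

lemma lindeberg_base (hc : RevCore p μ h) {B : ℝ} {m : ℝ → ℝ} {v : (ℕ → ι → ℝ) → (ι → ℝ) → ℝ}
    {g : (ℕ → ι → ℝ) → (ι → ℝ) → ι → ℝ} {H : (ℕ → ι → ℝ) → (ι → ℝ) → ι → ι → ℝ}
    (hj : IsJet B m v g H) :
    ‖∫ w, v (seqShift 1 w) (w 0) ∂μ - ∫ w, ∫ y, v w y ∂(stdG ι) ∂μ
      - (1 / 2) * ∑ a, ∑ b, ∫ w, H w 0 a b * h 0 a b w ∂μ‖ₑ ≤ lindErr μ h m 0 := by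
  have := hc.prob
  have m1 : Measurable fun w : ℕ → ι → ℝ => w 0 := by fun_prop
  have ms : Measurable (seqShift 1 : (ℕ → ι → ℝ) → _) := by fun_prop
  have m0 : Measurable fun _ : ℕ → ι → ℝ => (0 : ι → ℝ) := by fun_prop
  -- the path term
  have L2 : ∀ a, MemLp (fun w : ℕ → ι → ℝ => w 0 a) 2 μ := fun a => memLp_pi_iff.1 hc.memLp_two a
  have iv : Integrable (fun w => v (seqShift 1 w) (w 0)) μ :=
    integrable_of_abs_le (hj.measurable_v ms m1) fun _ => hj.bv _ _
  have iv0 : Integrable (fun w => v (seqShift 1 w) 0) μ :=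
    integrable_of_abs_le (hj.measurable_v ms m0) fun _ => hj.bv _ _
  have ig : ∀ a, Integrable (fun w : ℕ → ι → ℝ => g (seqShift 1 w) 0 a * w 0 a) μ := fun a =>
    ((L2 a).integrable (by norm_num)).abs_le_mul (hj.measurable_g ms m0 a) fun _ => hj.bg _ _ a
  have iH : ∀ a b, Integrable (fun w : ℕ → ι → ℝ => H (seqShift 1 w) 0 a b * (w 0 a * w 0 b)) μ :=
    fun a b => ((L2 a).integrable_fun_mul (L2 b)).abs_le_mul (hj.measurable_H ms m0 a b)
      fun _ => hj.bH _ _ a b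
  have zg : ∀ a, ∫ w : ℕ → ι → ℝ, g (seqShift 1 w) 0 a * w 0 a ∂μ = 0 := fun a =>
    hc.orth (fun w => g w 0 a) (hj.measurable_g measurable_id m0 a)
      (MemLp.of_bound (hj.measurable_g measurable_id m0 a).aestronglyMeasurable B
        (ae_of_all _ fun _ => hj.bg _ _ a)) a
  have mH0 : ∀ a b, Measurable fun w => H w 0 a b := fun a b =>
    hj.measurable_H measurable_id m0 a b
  have iH0 : ∀ a b, Integrable (fun w => H (seqShift 1 w) 0 a b) μ := fun a b =>
    integrable_of_abs_le (hj.measurable_H ms m0 a b) fun _ => hj.bH _ _ a b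
  have eH : ∀ a b, ∫ w : ℕ → ι → ℝ, H (seqShift 1 w) 0 a b * (w 0 a * w 0 b) ∂μ
      = ∫ w, H w 0 a b * h 0 a b w ∂μ + (∫ w, H w 0 a b ∂μ) * (if a = b then 1 else 0) := by
    intro a b
    rw [← hc.h_spec 0 a b _ (mH0 a b) ⟨B, fun _ => hj.bH _ _ a b⟩,
      ← hc.mp.integral_comp_of_measurable (mH0 a b), ← integral_mul_const, ← integral_add]
    · refine integral_congr_ae (ae_of_all _ fun w => ?_)
      simp only [pow_zero, seqSum, Finset.sum_range_one]
      ring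
    · simpa [seqSum] using (((L2 a).integrable_fun_mul (L2 b)).sub
        (integrable_const (if a = b then 1 else 0))).abs_le_mul (hj.measurable_H ms m0 a b)
        fun _ => hj.bH _ _ a b
    · exact (iH0 a b).mul_const _
  have ev0 : ∫ w, v (seqShift 1 w) 0 ∂μ = ∫ w, v w 0 ∂μ :=
    hc.mp.integral_comp_of_measurable (hj.measurable_v measurable_id m0)
  have key1 : ∫ w : ℕ → ι → ℝ, (v (seqShift 1 w) (0 + w 0) - v (seqShift 1 w) 0
      - ∑ a, g (seqShift 1 w) 0 a * w 0 a
      - (1 / 2) * ∑ a, ∑ b, H (seqShift 1 w) 0 a b * (w 0 a * w 0 b)) ∂μ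
      = ∫ w, v (seqShift 1 w) (w 0) ∂μ - ∫ w, v w 0 ∂μ
        - (1 / 2) * ∑ a, ∑ b, (∫ w, H w 0 a b * h 0 a b w ∂μ
          + (∫ w, H w 0 a b ∂μ) * (if a = b then 1 else 0)) := by
    simp_rw [zero_add]
    have I2 : Integrable (fun w : ℕ → ι → ℝ => ∑ a, g (seqShift 1 w) 0 a * w 0 a) μ :=
      integrable_finsetSum _ fun a _ => ig a
    have I3 : Integrable (fun w : ℕ → ι → ℝ =>
        (1 / 2 : ℝ) * ∑ a, ∑ b, H (seqShift 1 w) 0 a b * (w 0 a * w 0 b)) μ :=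
      (integrable_finsetSum _ fun a _ => integrable_finsetSum _ fun b _ => iH a b).const_mul _
    rw [integral_sub (f := fun w => v (seqShift 1 w) (w 0) - v (seqShift 1 w) 0
      - ∑ a, g (seqShift 1 w) 0 a * w 0 a) ((iv.sub iv0).sub I2) I3,
      integral_sub (f := fun w => v (seqShift 1 w) (w 0) - v (seqShift 1 w) 0) (iv.sub iv0) I2,
      integral_sub iv iv0, integral_const_mul, integral_finsetSum _ fun a _ => ig a,
      integral_finsetSum _ fun a _ => integrable_finsetSum _ fun b _ => iH a b]
    simp_rw [integral_finsetSum _ fun b _ => iH _ b, eH, zg, ev0]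
    simp
  -- the Gaussian term
  have G2 : ∀ a, MemLp (fun y : ι → ℝ => y a) 2 (stdG ι) := fun a =>
    stdG_memLp_eval a 2 (by simp)
  have key2 : ∀ w, ∫ y, (v w (0 + y) - v w 0 - ∑ a, g w 0 a * y a
      - (1 / 2) * ∑ a, ∑ b, H w 0 a b * (y a * y b)) ∂(stdG ι)
      = ∫ y, v w y ∂(stdG ι) - v w 0
        - (1 / 2) * ∑ a, ∑ b, H w 0 a b * (if a = b then 1 else 0) := by
    intro w
    simp_rw [zero_add]
    have jv : Integrable (fun y => v w y) (stdG ι) :=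
      integrable_of_abs_le (hj.measurable_v measurable_const measurable_id) fun _ => hj.bv _ _
    have jg : ∀ a, Integrable (fun y : ι → ℝ => g w 0 a * y a) (stdG ι) := fun a =>
      ((G2 a).integrable (by norm_num)).const_mul _
    have jH : ∀ a b, Integrable (fun y : ι → ℝ => H w 0 a b * (y a * y b)) (stdG ι) :=
      fun a b => ((G2 a).integrable_fun_mul (G2 b)).const_mul _
    have I1 : Integrable (fun y => v w y - v w 0) (stdG ι) := jv.sub (integrable_const _)
    have I2 : Integrable (fun y : ι → ℝ => ∑ a, g w 0 a * y a) (stdG ι) :=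
      integrable_finsetSum _ fun a _ => jg a
    have I3 : Integrable (fun y : ι → ℝ => (1 / 2 : ℝ) * ∑ a, ∑ b, H w 0 a b * (y a * y b))
        (stdG ι) :=
      (integrable_finsetSum _ fun a _ => integrable_finsetSum _ fun b _ => jH a b).const_mul _
    rw [integral_sub (f := fun y => v w y - v w 0 - ∑ a, g w 0 a * y a) (I1.sub I2) I3,
      integral_sub (f := fun y => v w y - v w 0) I1 I2,
      integral_sub jv (integrable_const _), integral_const_mul,
      integral_finsetSum _ fun a _ => jg a,
      integral_finsetSum _ fun a _ => integrable_finsetSum _ fun b _ => jH a b]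
    simp_rw [integral_finsetSum _ fun b _ => jH _ b, integral_const_mul, stdG_integral_eval,
      stdG_integral_eval_mul]
    simp
  set F1 := fun w : ℕ → ι → ℝ => (v (seqShift 1 w) (0 + w 0) - v (seqShift 1 w) 0
      - ∑ a, g (seqShift 1 w) 0 a * w 0 a
      - (1 / 2) * ∑ a, ∑ b, H (seqShift 1 w) 0 a b * (w 0 a * w 0 b)) with hF1
  set F2 := fun (w : ℕ → ι → ℝ) (y : ι → ℝ) => (v w (0 + y) - v w 0 - ∑ a, g w 0 a * y a
      - (1 / 2) * ∑ a, ∑ b, H w 0 a b * (y a * y b)) with hF2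
  have key3 : ∫ w, ∫ y, F2 w y ∂(stdG ι) ∂μ = ∫ w, ∫ y, v w y ∂(stdG ι) ∂μ - ∫ w, v w 0 ∂μ
      - (1 / 2) * ∑ a, ∑ b, (∫ w, H w 0 a b ∂μ) * (if a = b then 1 else 0) := by
    simp_rw [hF2, key2]
    have jv : Integrable (fun w => ∫ y, v w y ∂(stdG ι)) μ :=
      integrable_of_abs_le (hj.mv.stronglyMeasurable.integral_prod_right.measurable)
        fun _ => IsJet.abs_integral_le fun _ => hj.bv _ _
    have jv0 : Integrable (fun w => v w 0) μ :=
      integrable_of_abs_le (hj.measurable_v measurable_id m0) fun _ => hj.bv _ _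
    have jH : ∀ a b, Integrable (fun w => H w 0 a b * (if a = b then 1 else 0)) μ := fun a b =>
      (integrable_of_abs_le (mH0 a b) fun _ => hj.bH _ _ a b).mul_const _
    have I3 : Integrable (fun w => (1 / 2 : ℝ) * ∑ a, ∑ b, H w 0 a b * (if a = b then 1 else 0))
        μ :=
      (integrable_finsetSum _ fun a _ => integrable_finsetSum _ fun b _ => jH a b).const_mul _
    rw [integral_sub (f := fun w => ∫ y, v w y ∂(stdG ι) - v w 0) (jv.sub jv0) I3,
      integral_sub jv jv0, integral_const_mul,
      integral_finsetSum _ fun a _ => integrable_finsetSum _ fun b _ => jH a b]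
    simp_rw [integral_finsetSum _ fun b _ => jH _ b, integral_mul_const]
  have hfin : ∫ w, v (seqShift 1 w) (w 0) ∂μ - ∫ w, ∫ y, v w y ∂(stdG ι) ∂μ
      - (1 / 2) * ∑ a, ∑ b, ∫ w, H w 0 a b * h 0 a b w ∂μ
      = ∫ w, F1 w ∂μ - ∫ w, ∫ y, F2 w y ∂(stdG ι) ∂μ := by
    rw [key1, key3]
    simp_rw [Finset.sum_add_distrib]
    ring
  rw [hfin]
  refine (enorm_sub_le).trans (add_le_add ?_ ?_)
  · refine (enorm_integral_le_lintegral_enorm _).trans (lintegral_mono fun w => ?_)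
    rw [Real.enorm_eq_ofReal_abs]
    exact ENNReal.ofReal_le_ofReal (hj.taylor _ 0 (w 0))
  · refine (enorm_integral_le_lintegral_enorm _).trans ?_
    calc ∫⁻ w, ‖∫ y, F2 w y ∂(stdG ι)‖ₑ ∂μ
        ≤ ∫⁻ _, (∫⁻ y, ENNReal.ofReal (m ‖y‖ * ‖y‖ ^ 2) ∂(stdG ι)) ∂μ := by
          refine lintegral_mono fun w => ?_
          refine (enorm_integral_le_lintegral_enorm _).trans (lintegral_mono fun y => ?_)
          rw [Real.enorm_eq_ofReal_abs]
          exact ENNReal.ofReal_le_ofReal (hj.taylor _ 0 y)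
      _ = _ := by simp

lemma enorm_half_sum_integral_le (hc : RevCore p μ h) (i : ℕ)
    {D : ι → ι → (ℕ → ι → ℝ) → ℝ} {c : (ℕ → ι → ℝ) → ℝ≥0∞} (hcm : Measurable c)
    (hD : ∀ a b w, ‖D a b w‖ₑ ≤ c w) :
    ‖(1 / 2 : ℝ) * ∑ a, ∑ b, ∫ w, D a b w * h i a b w ∂μ‖ₑ ≤ ∫⁻ w, c w * hNorm h i w ∂μ := by
  have hm := hc.h_meas
  have h1 : ‖(1 / 2 : ℝ)‖ₑ ≤ 1 := by
    rw [Real.enorm_eq_ofReal (by norm_num)]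
    exact ENNReal.ofReal_le_one.2 (by norm_num)
  rw [enorm_mul]
  calc ‖(1 / 2 : ℝ)‖ₑ * ‖∑ a, ∑ b, ∫ w, D a b w * h i a b w ∂μ‖ₑ
      ≤ 1 * ∑ a, ∑ b, ∫⁻ w, c w * ‖h i a b w‖ₑ ∂μ := by
        refine mul_le_mul' h1 ((enorm_sum_le _ _).trans (Finset.sum_le_sum fun a _ =>
          (enorm_sum_le _ _).trans (Finset.sum_le_sum fun b _ => ?_)))
        refine (enorm_integral_le_lintegral_enorm _).trans (lintegral_mono fun w => ?_)
        rw [enorm_mul]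
        exact mul_le_mul_left (hD a b w) _
    _ = ∫⁻ w, c w * hNorm h i w ∂μ := by
        simp_rw [hNorm, Finset.mul_sum, one_mul]
        rw [lintegral_finsetSum _ fun a _ => by fun_prop]
        refine Finset.sum_congr rfl fun a _ => ?_
        rw [lintegral_finsetSum _ fun b _ => by fun_prop]

lemma lindeberg (hc : RevCore p μ h) {m : ℝ → ℝ} (hm : Measurable m) (i : ℕ) :
    ∀ {B : ℝ} {v : (ℕ → ι → ℝ) → (ι → ℝ) → ℝ} {g : (ℕ → ι → ℝ) → (ι → ℝ) → ι → ℝ}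
    {H : (ℕ → ι → ℝ) → (ι → ℝ) → ι → ι → ℝ}, IsJet B m v g H →
    ‖∫ w, v (seqShift (2 ^ i) w) (seqSum (2 ^ i) w) ∂μ
      - ∫ w, ∫ y, v w (√(2 ^ i) • y) ∂(stdG ι) ∂μ
      - (1 / 2) * ∑ a, ∑ b, ∫ w, H w 0 a b * h i a b w ∂μ‖ₑ ≤ lindErr μ h m i := by
  have := hc.prob
  induction i with
  | zero =>
    intro B v g H hj
    simpa [seqSum] using hc.lindeberg_base hj
  | succ i ih =>
    intro B v g H hj
    set n := 2 ^ i with hn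
    set r := √(2 ^ i : ℝ) with hr
    have ms : Measurable (seqShift n : (ℕ → ι → ℝ) → _) := by fun_prop
    have mS : Measurable (seqSum n : (ℕ → ι → ℝ) → _) := by fun_prop
    have m0 : Measurable fun _ : ℕ → ι → ℝ => (0 : ι → ℝ) := by fun_prop
    have h2n : 2 ^ (i + 1) = n + n := by rw [hn, pow_succ]; ring
    have hj1 := hj.comp ms mS
    have hj2 := hj.average r
    have E1 := ih hj1
    have E2 := ih hj2
    have e1 : ∀ w : ℕ → ι → ℝ, v (seqShift n (seqShift n w)) (seqSum n w + seqSum n (seqShift n w))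
        = v (seqShift (2 ^ (i + 1)) w) (seqSum (2 ^ (i + 1)) w) := by
      intro w; rw [h2n, seqSum_add, seqShift_seqShift]
    have e2 : ∀ w, ∫ y', ∫ y, v w (r • y + r • y') ∂(stdG ι) ∂(stdG ι)
        = ∫ y, v w (√(2 ^ (i + 1)) • y) ∂(stdG ι) := by
      intro w
      have mw : Measurable fun z : (ι → ℝ) × (ι → ℝ) => v w (r • z.2 + r • z.1) :=
        hj.measurable_v measurable_const (by fun_prop)
      have mw' : Measurable (v w) := hj.measurable_v measurable_const measurable_id
      rw [← integral_prod (fun z : (ι → ℝ) × (ι → ℝ) => v w (r • z.2 + r • z.1))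
        (integrable_of_abs_le mw fun _ => hj.bv _ _)]
      have hrr : r ^ 2 + r ^ 2 = √(2 ^ (i + 1) : ℝ) ^ 2 := by
        rw [hr, Real.sq_sqrt (by positivity), Real.sq_sqrt (by positivity), pow_succ]; ring
      rw [← integral_map (φ := fun x : ι → ℝ => √(2 ^ (i + 1)) • x) (f := v w) (by fun_prop)
        mw'.aestronglyMeasurable, ← stdG_prod_map hrr,
        integral_map (by fun_prop) mw'.aestronglyMeasurable]
      exact integral_congr_ae (ae_of_all _ fun z => by simp only [add_comm])
    simp_rw [e1, zero_add] at E1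
    simp_rw [e2, add_zero] at E2
    have mH0 : ∀ a b, Measurable fun w => H w 0 a b := fun a b =>
      hj.measurable_H measurable_id m0 a b
    have e3 : ∀ a b, ∫ w, H w 0 a b * h (i + 1) a b w ∂μ
        = ∫ w, H (seqShift n w) 0 a b * h i a b w ∂μ + ∫ w, H w 0 a b * h i a b w ∂μ :=
      fun a b => hc.h_double i a b (mH0 a b) fun _ => hj.bH _ _ a b
    have iav : ∀ w a b, Integrable (fun y => H w (r • y) a b) (stdG ι) := fun w a b =>
      integrable_of_abs_le (hj.measurable_H measurable_const (by fun_prop) a b)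
        fun _ => hj.bH _ _ a b
    have D1 := hc.enorm_half_sum_integral_le i
      (D := fun a b w => H (seqShift n w) (seqSum n w) a b - H (seqShift n w) 0 a b)
      (c := fun w => ENNReal.ofReal (m ‖seqSum n w‖)) (by fun_prop) (fun a b w => by
        rw [Real.enorm_eq_ofReal_abs]
        have := hj.lip (seqShift n w) 0 (seqSum n w) a b
        rw [zero_add] at this
        exact ENNReal.ofReal_le_ofReal this)
    have D2 := hc.enorm_half_sum_integral_le i
      (D := fun a b w => ∫ y, H w (r • y) a b ∂(stdG ι) - H w 0 a b)
      (c := fun w => ∫⁻ y, ENNReal.ofReal (m ‖r • y‖) ∂(stdG ι)) (by fun_prop) (fun a b w => by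
        have : ∫ y, H w (r • y) a b ∂(stdG ι) - H w 0 a b
            = ∫ y, (H w (r • y) a b - H w 0 a b) ∂(stdG ι) := by
          rw [integral_sub (iav w a b) (integrable_const _)]; simp
        rw [this]
        refine (enorm_integral_le_lintegral_enorm _).trans (lintegral_mono fun y => ?_)
        rw [Real.enorm_eq_ofReal_abs]
        have := hj.lip w 0 (r • y) a b
        rw [zero_add] at this
        exact ENNReal.ofReal_le_ofReal this)
    have hI : ∀ (f : (ℕ → ι → ℝ) → ℝ), Measurable f → (∀ w, |f w| ≤ B) → ∀ a b,
        Integrable (fun w => f w * h i a b w) μ := fun f hf hB a b =>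
      (hc.integrable_h i a b).abs_le_mul hf hB
    have i1 : ∀ a b, Integrable (fun w => H (seqShift n w) (seqSum n w) a b * h i a b w) μ :=
      fun a b => hI _ (hj.measurable_H ms mS a b) (fun _ => hj.bH _ _ a b) a b
    have i2 : ∀ a b, Integrable (fun w => H (seqShift n w) 0 a b * h i a b w) μ :=
      fun a b => hI _ (hj.measurable_H ms m0 a b) (fun _ => hj.bH _ _ a b) a b
    have i3 : ∀ a b, Integrable (fun w => H w 0 a b * h i a b w) μ :=
      fun a b => hI _ (mH0 a b) (fun _ => hj.bH _ _ a b) a b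
    have i4 : ∀ a b, Integrable (fun w => (∫ y, H w (r • y) a b ∂(stdG ι)) * h i a b w) μ := by
      intro a b
      refine hI _ ?_ (fun _ => IsJet.abs_integral_le fun _ => hj.bH _ _ a b) a b
      have : Measurable fun z : (ℕ → ι → ℝ) × (ι → ℝ) => H z.1 (r • z.2) a b :=
        hj.measurable_H (by fun_prop) (by fun_prop) a b
      exact this.stronglyMeasurable.integral_prod_right.measurable
    have s1 : ∀ a b, ∫ w, (H (seqShift n w) (seqSum n w) a b - H (seqShift n w) 0 a b)
        * h i a b w ∂μ = ∫ w, H (seqShift n w) (seqSum n w) a b * h i a b w ∂μ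
        - ∫ w, H (seqShift n w) 0 a b * h i a b w ∂μ := fun a b => by
      rw [← integral_sub (i1 a b) (i2 a b)]; simp_rw [sub_mul]
    have s2 : ∀ a b, ∫ w, (∫ y, H w (r • y) a b ∂(stdG ι) - H w 0 a b) * h i a b w ∂μ
        = ∫ w, (∫ y, H w (r • y) a b ∂(stdG ι)) * h i a b w ∂μ
        - ∫ w, H w 0 a b * h i a b w ∂μ := fun a b => by
      rw [← integral_sub (i4 a b) (i3 a b)]; simp_rw [sub_mul]
    simp_rw [s1, Finset.sum_sub_distrib] at D1
    simp_rw [s2, Finset.sum_sub_distrib] at D2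
    simp_rw [e3, Finset.sum_add_distrib]
    rw [lintegral_const_mul _ (hc.measurable_hNorm i)] at D2
    refine le_trans (le_of_eq_of_le (congrArg _ ?_) ((enorm_add_le _ _).trans (add_le_add
      ((enorm_add_le _ _).trans (add_le_add E1 E2))
      ((enorm_add_le _ _).trans (add_le_add D1 D2))))) (le_of_eq ?_)
    · ring
    · rw [lindErr, two_mul]

end RevCore

end

section

section pointwise

lemma abs_exp_sub_taylor_two_le (z : ℝ) :
    |Real.exp z - 1 - z - z ^ 2 / 2| ≤ |z| ^ 3 * Real.exp |z| := by
  have := Complex.norm_exp_sub_sum_le_norm_mul_exp (z : ℂ) 3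
  simp only [Finset.sum_range_succ, Finset.sum_range_zero, Nat.factorial] at this
  have h2 : Complex.exp z - (0 + (z : ℂ) ^ 0 / ((1 : ℕ) : ℂ) + (z : ℂ) ^ 1 / ((0 + 1) * 1 : ℕ)
      + (z : ℂ) ^ 2 / ((1 + 1) * ((0 + 1) * 1) : ℕ))
      = ((Real.exp z - 1 - z - z ^ 2 / 2 : ℝ) : ℂ) := by
    push_cast; ring
  rw [h2, Complex.norm_real, Complex.norm_real] at this
  exact this

lemma abs_exp_sub_one_le_mul_exp (z : ℝ) : |Real.exp z - 1| ≤ |z| * Real.exp |z| := by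
  have := Complex.norm_exp_sub_sum_le_norm_mul_exp (z : ℂ) 1
  simp only [Finset.sum_range_succ, Finset.sum_range_zero, Nat.factorial] at this
  have h2 : Complex.exp z - (0 + (z : ℂ) ^ 0 / ((1 : ℕ) : ℂ))
      = ((Real.exp z - 1 : ℝ) : ℂ) := by
    push_cast; ring
  rw [h2, Complex.norm_real, Complex.norm_real, pow_one] at this
  exact this

variable {A n s q : ℝ}

lemma cm_taylor_small (hA : 0 ≤ A) (hn : 0 ≤ n) (hn1 : n ≤ 1) (hs : |s| ≤ n * A) (hq : 0 ≤ q)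
    (hqn : q ≤ n ^ 2 * A) (hz : |s - q / 2| ≤ n * A) :
    |Real.exp (s - q / 2) - 1 - s - (1 / 2) * (s ^ 2 - q)| ≤ 8 * n ^ 3 * Real.exp (4 * A) := by
  have h1 := abs_exp_sub_taylor_two_le (s - q / 2)
  set z := s - q / 2 with hzd
  have hzA : |z| ≤ A := hz.trans (by nlinarith)
  have e3 : A ^ 3 ≤ 6 * Real.exp A := by
    have := Real.pow_div_factorial_le_exp A hA 3
    norm_num [Nat.factorial] at this; linarith
  have e2 : A ^ 2 ≤ 2 * Real.exp A := by
    have := Real.pow_div_factorial_le_exp A hA 2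
    norm_num [Nat.factorial] at this; linarith
  have h2 : |z| ^ 3 * Real.exp |z| ≤ (n * A) ^ 3 * Real.exp A := by gcongr
  have h3 : |s * q| ≤ n ^ 3 * A ^ 2 := by
    rw [abs_mul, abs_of_nonneg hq]
    calc |s| * q ≤ (n * A) * (n ^ 2 * A) := by gcongr
      _ = _ := by ring
  have h4 : q ^ 2 ≤ n ^ 3 * A ^ 2 := by
    calc q ^ 2 ≤ (n ^ 2 * A) ^ 2 := by gcongr
      _ = n * (n ^ 3 * A ^ 2) := by ring
      _ ≤ 1 * (n ^ 3 * A ^ 2) := by gcongr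
      _ = _ := one_mul _
  have hid : Real.exp z - 1 - s - (1 / 2) * (s ^ 2 - q)
      = (Real.exp z - 1 - z - z ^ 2 / 2) - (1 / 2) * (s * q) + q ^ 2 / 8 := by
    rw [hzd]; ring
  have h5 : |Real.exp z - 1 - s - (1 / 2) * (s ^ 2 - q)|
      ≤ |z| ^ 3 * Real.exp |z| + (1 / 2) * |s * q| + q ^ 2 / 8 := by
    rw [hid]
    refine (abs_add_le _ _).trans (add_le_add ((abs_sub _ _).trans (add_le_add h1 ?_)) ?_)
    · rw [abs_mul]; norm_num
    · rw [abs_of_nonneg (by positivity)]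
  have ee : Real.exp (4 * A) = Real.exp A * Real.exp (3 * A) := by rw [← Real.exp_add]; ring_nf
  have ea : Real.exp A ≤ Real.exp (3 * A) := Real.exp_le_exp.2 (by linarith)
  have e1 : 1 ≤ Real.exp A := Real.one_le_exp hA
  calc |Real.exp z - 1 - s - (1 / 2) * (s ^ 2 - q)|
      ≤ n ^ 3 * (A ^ 3 * Real.exp A + A ^ 2) := by
        have : 0 ≤ n ^ 3 * A ^ 2 := by positivity
        nlinarith
    _ ≤ n ^ 3 * (6 * Real.exp A * Real.exp (3 * A) + 2 * (Real.exp A * Real.exp (3 * A))) := by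
        gcongr
        nlinarith [Real.exp_pos A]
    _ = _ := by rw [ee]; ring

lemma cm_taylor_large (hA : 0 ≤ A) (hn1 : 1 ≤ n) (hs : |s| ≤ n * A) (hq : 0 ≤ q)
    (hqn : q ≤ n ^ 2 * A) :
    |Real.exp (s - q / 2) - 1 - s - (1 / 2) * (s ^ 2 - q)|
      ≤ Real.exp (s - q / 2) + 2 * n ^ 2 * Real.exp (4 * A) := by
  have e2 := Real.quadratic_le_exp_of_nonneg hA
  have hee : Real.exp A ≤ Real.exp (4 * A) := Real.exp_le_exp.2 (by linarith)
  have hs2 : s ^ 2 ≤ n ^ 2 * A ^ 2 := by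
    rw [← sq_abs]; calc |s| ^ 2 ≤ (n * A) ^ 2 := by gcongr
      _ = _ := by ring
  have hs1 : |s| ≤ n ^ 2 * A := hs.trans (by gcongr; nlinarith)
  have hn2 : 1 ≤ n ^ 2 := by nlinarith
  have ep := Real.exp_pos (s - q / 2)
  have := abs_le.1 hs1
  have h6 : n ^ 2 * (1 + A + A ^ 2 / 2) ≤ n ^ 2 * Real.exp (4 * A) := by
    gcongr; linarith
  have h7 : 0 ≤ n ^ 2 * A := by positivity
  have h8 : 0 ≤ n ^ 2 * A ^ 2 := by positivity
  have h9 : s ^ 2 ≥ 0 := sq_nonneg s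
  rw [abs_le]
  constructor <;> nlinarith

lemma cm_hess_small {x y u v δ : ℝ} (hA : 0 ≤ A) (hn : 0 ≤ n) (hn1 : n ≤ 1) (hx : |x| ≤ A)
    (hy : |y| ≤ A) (hu : |u| ≤ n) (hv : |v| ≤ n) (hδ : |δ| ≤ 1) {z : ℝ} (hz : |z| ≤ n * A) :
    |((x - u) * (y - v) - δ) * Real.exp z - (x * y - δ)| ≤ 3 * n * Real.exp (4 * A) := by
  have hzA : |z| ≤ A := hz.trans (by nlinarith)
  have h1 : |Real.exp z - 1| ≤ n * Real.exp (2 * A) := by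
    refine (abs_exp_sub_one_le_mul_exp z).trans ?_
    have : A ≤ Real.exp A := by linarith [Real.add_one_le_exp A]
    calc |z| * Real.exp |z| ≤ (n * Real.exp A) * Real.exp A := by gcongr; exact hz.trans (by gcongr)
      _ = _ := by rw [mul_assoc, ← Real.exp_add]; ring_nf
  have h2 : |(x - u) * (y - v) - δ| ≤ 2 * Real.exp (2 * A) := by
    have ha : |x - u| ≤ Real.exp A := by
      linarith [abs_sub x u, Real.add_one_le_exp A]
    have hb : |y - v| ≤ Real.exp A := by
      linarith [abs_sub y v, Real.add_one_le_exp A]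
    have : (1 : ℝ) ≤ Real.exp (2 * A) := Real.one_le_exp (by linarith)
    calc _ ≤ |(x - u) * (y - v)| + |δ| := abs_sub _ _
      _ ≤ Real.exp A * Real.exp A + 1 := by rw [abs_mul]; gcongr
      _ = Real.exp (2 * A) + 1 := by rw [← Real.exp_add]; ring_nf
      _ ≤ _ := by linarith
  have h3 : |(x - u) * (y - v) - x * y| ≤ n * Real.exp (4 * A) := by
    have : (x - u) * (y - v) - x * y = -(x * v) - u * y + u * v := by ring
    rw [this]
    have e1 : 1 + 2 * A ≤ Real.exp (4 * A) := by linarith [Real.add_one_le_exp (4 * A)]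
    calc _ ≤ |x| * |v| + |u| * |y| + |u| * |v| := by
          refine (abs_add_le _ _).trans (add_le_add ((abs_sub _ _).trans (add_le_add ?_ ?_)) ?_)
          · rw [abs_neg, abs_mul]
          · rw [abs_mul]
          · rw [abs_mul]
      _ ≤ A * n + n * A + n * 1 := by gcongr; linarith
      _ ≤ n * Real.exp (4 * A) := by nlinarith
  have hid : ((x - u) * (y - v) - δ) * Real.exp z - (x * y - δ)
      = ((x - u) * (y - v) - δ) * (Real.exp z - 1) + ((x - u) * (y - v) - x * y) := by ring
  rw [hid]
  calc _ ≤ 2 * Real.exp (2 * A) * (n * Real.exp (2 * A)) + n * Real.exp (4 * A) := by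
        refine (abs_add_le _ _).trans (add_le_add ?_ h3)
        rw [abs_mul]; gcongr
    _ = _ := by
        have : Real.exp (4 * A) = Real.exp (2 * A) * Real.exp (2 * A) := by
          rw [← Real.exp_add]; ring_nf
        rw [this]; ring

end pointwise

variable {ι : Type*} [Fintype ι]

/-- A convenient size functional on `ι → ℝ`. -/
def gSize (x : ι → ℝ) : ℝ := ∑ a, |x a| + Fintype.card ι

lemma gSize_nonneg (x : ι → ℝ) : 0 ≤ gSize x := by unfold gSize; positivity

lemma abs_le_gSize (x : ι → ℝ) (a : ι) : |x a| ≤ gSize x := by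
  have := Finset.single_le_sum (f := fun a => |x a|) (fun _ _ => abs_nonneg _) (Finset.mem_univ a)
  unfold gSize
  have h2 : (0 : ℝ) ≤ Fintype.card ι := by positivity
  linarith

lemma measurable_gSize : Measurable (gSize : (ι → ℝ) → ℝ) := by unfold gSize; fun_prop

lemma abs_sum_mul_le (x η : ι → ℝ) : |∑ a, x a * η a| ≤ ‖η‖ * ∑ a, |x a| := by
  rw [Finset.mul_sum]
  refine (Finset.abs_sum_le_sum_abs _ _).trans (Finset.sum_le_sum fun a _ => ?_)
  rw [abs_mul, mul_comm]
  exact mul_le_mul_of_nonneg_right (norm_le_pi_norm η a) (abs_nonneg _)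

lemma sum_sq_le (η : ι → ℝ) : ∑ a, η a ^ 2 ≤ ‖η‖ ^ 2 * Fintype.card ι := by
  calc ∑ a, η a ^ 2 ≤ ∑ _a : ι, ‖η‖ ^ 2 := Finset.sum_le_sum fun a _ => by
        rw [← sq_abs]; exact pow_le_pow_left₀ (abs_nonneg _) (norm_le_pi_norm η a) 2
    _ = _ := by rw [Finset.sum_const, nsmul_eq_mul, Finset.card_univ, mul_comm]

lemma integrable_exp_gSize (c : ℝ) :
    Integrable (fun x : ι → ℝ => Real.exp (c * gSize x)) (stdG ι) := by
  have h1 : Integrable (fun y => Real.exp (c * y) + Real.exp (-c * y)) (gaussianReal 0 1) :=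
    (integrable_exp_mul_gaussianReal c).add (integrable_exp_mul_gaussianReal (-c))
  have h2 : Integrable (fun x : ι → ℝ => ∏ a, (Real.exp (c * x a) + Real.exp (-c * x a)))
    (stdG ι) := Integrable.fintype_prod fun _ => h1
  refine (h2.const_mul (Real.exp (c * Fintype.card ι))).mono'
    ((measurable_gSize.const_mul c).exp.aestronglyMeasurable) (ae_of_all _ fun x => ?_)
  rw [Real.norm_eq_abs, abs_of_pos (Real.exp_pos _), gSize, mul_add, add_comm, Real.exp_add,
    Finset.mul_sum, Real.exp_sum]
  gcongr with a _
  rcases abs_cases (x a) with ⟨h, _⟩ | ⟨h, _⟩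
  · rw [h]; linarith [Real.exp_pos (-c * x a)]
  · rw [h, mul_neg, ← neg_mul]; linarith [Real.exp_pos (c * x a)]

/-- The exponential moment controlling Gaussian smoothing. -/
def gJ (ι : Type*) [Fintype ι] : ℝ := ∫ x : ι → ℝ, Real.exp (4 * gSize x) ∂(stdG ι)

lemma one_le_gJ : 1 ≤ gJ ι := by
  have : ∫ _ : ι → ℝ, (1 : ℝ) ∂(stdG ι) ≤ gJ ι :=
    integral_mono (integrable_const _) (integrable_exp_gSize 4) fun x =>
      Real.one_le_exp (mul_nonneg (by norm_num) (gSize_nonneg x))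
  simpa using this

lemma integrable_cmKer (η : ι → ℝ) : Integrable (cmKer η) (stdG ι) := by
  have hm : Measurable (cmKer η) := measurable_cmKer.comp (measurable_const.prodMk measurable_id)
  refine (integrable_exp_gSize (ι := ι) ‖η‖).mono' hm.aestronglyMeasurable
    (ae_of_all _ fun x => ?_)
  rw [Real.norm_eq_abs, cmKer, abs_of_pos (Real.exp_pos _)]
  refine Real.exp_le_exp.2 ?_
  have h1 := (abs_le.1 (abs_sum_mul_le x η)).2
  have h2 : 0 ≤ ∑ a, η a ^ 2 := by positivity
  have h3 : 0 ≤ ‖η‖ * Fintype.card ι := by positivity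
  rw [gSize, mul_add]
  linarith

lemma integral_cmKer (η : ι → ℝ) : ∫ x, cmKer η x ∂(stdG ι) = 1 := by
  have := stdG_integral_add η (f := fun _ => 1) measurable_const
  simpa using this.symm

lemma cm_bounds (x η : ι → ℝ) : |∑ a, x a * η a| ≤ ‖η‖ * gSize x ∧
    ∑ a, η a ^ 2 ≤ ‖η‖ ^ 2 * gSize x ∧
    (‖η‖ ≤ 1 → |∑ a, x a * η a - (∑ a, η a ^ 2) / 2| ≤ ‖η‖ * gSize x) := by
  have h1 := abs_sum_mul_le x η
  have h2 := sum_sq_le η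
  have h3 : 0 ≤ ‖η‖ := norm_nonneg _
  have h4 : (0 : ℝ) ≤ Fintype.card ι := by positivity
  have h5 : 0 ≤ ∑ a, |x a| := by positivity
  have h0 : 0 ≤ ∑ a, η a ^ 2 := by positivity
  refine ⟨h1.trans ?_, h2.trans ?_, fun hn => ?_⟩
  · unfold gSize; gcongr; linarith
  · unfold gSize; gcongr; linarith
  · have h6 : ∑ a, η a ^ 2 ≤ ‖η‖ * Fintype.card ι := h2.trans (by gcongr; nlinarith)
    have h7 : 0 ≤ ‖η‖ * Fintype.card ι := by positivity
    have := abs_le.1 h1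
    rw [gSize, mul_add, abs_le]
    constructor <;> linarith

lemma cm_taylor_integral (η : ι → ℝ) {f : (ι → ℝ) → ℝ}
    (hf1 : ∀ x, |f x| ≤ 1) :
    |∫ x, f x * (cmKer η x - 1 - ∑ a, x a * η a
      - (1 / 2) * ((∑ a, x a * η a) ^ 2 - ∑ a, η a ^ 2)) ∂(stdG ι)|
      ≤ 8 * gJ ι * min 1 ‖η‖ * ‖η‖ ^ 2 := by
  have hI := integrable_exp_gSize (ι := ι) 4
  have key : ∀ x, |f x * (cmKer η x - 1 - ∑ a, x a * η a
      - (1 / 2) * ((∑ a, x a * η a) ^ 2 - ∑ a, η a ^ 2))| ≤ |cmKer η x - 1 - ∑ a, x a * η a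
      - (1 / 2) * ((∑ a, x a * η a) ^ 2 - ∑ a, η a ^ 2)| := fun x => by
    rw [abs_mul]; exact mul_le_of_le_one_left (abs_nonneg _) (hf1 x)
  have hq : 0 ≤ ∑ a, η a ^ 2 := by positivity
  rcases le_total ‖η‖ 1 with hn | hn
  · rw [min_eq_right hn]
    have hb : ∀ x, |cmKer η x - 1 - ∑ a, x a * η a
      - (1 / 2) * ((∑ a, x a * η a) ^ 2 - ∑ a, η a ^ 2)| ≤ 8 * ‖η‖ ^ 3 * Real.exp (4 * gSize x) :=
      fun x => by
        obtain ⟨b1, b2, b3⟩ := cm_bounds x η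
        exact cm_taylor_small (gSize_nonneg x) (norm_nonneg _) hn b1 hq b2 (b3 hn)
    have := norm_integral_le_of_norm_le (f := fun x => f x * (cmKer η x - 1 - ∑ a, x a * η a
      - (1 / 2) * ((∑ a, x a * η a) ^ 2 - ∑ a, η a ^ 2))) (hI.const_mul (8 * ‖η‖ ^ 3))
      (ae_of_all (stdG ι) fun x => (key x).trans (hb x))
    rw [integral_const_mul] at this
    refine this.trans (le_of_eq ?_)
    rw [gJ]; ring
  · rw [min_eq_left hn]
    have hb : ∀ x, |cmKer η x - 1 - ∑ a, x a * η a
      - (1 / 2) * ((∑ a, x a * η a) ^ 2 - ∑ a, η a ^ 2)|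
        ≤ cmKer η x + 2 * ‖η‖ ^ 2 * Real.exp (4 * gSize x) :=
      fun x => by
        obtain ⟨b1, b2, b3⟩ := cm_bounds x η
        exact cm_taylor_large (gSize_nonneg x) hn b1 hq b2
    have := norm_integral_le_of_norm_le (f := fun x => f x * (cmKer η x - 1 - ∑ a, x a * η a
      - (1 / 2) * ((∑ a, x a * η a) ^ 2 - ∑ a, η a ^ 2))) ((integrable_cmKer η).add (hI.const_mul (2 * ‖η‖ ^ 2)))
      (ae_of_all (stdG ι) fun x => (key x).trans (hb x))
    refine this.trans ?_
    simp only [Pi.add_apply]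
    rw [integral_add (integrable_cmKer η) (hI.const_mul _), integral_const_mul, integral_cmKer]
    have h1 := one_le_gJ (ι := ι)
    have h2 : 1 ≤ ‖η‖ ^ 2 := by nlinarith
    change 1 + 2 * ‖η‖ ^ 2 * gJ ι ≤ _
    nlinarith

variable [DecidableEq ι]

lemma hermite_two_le (x : ι → ℝ) (a b : ι) :
    |x a * x b - (if a = b then 1 else 0)| ≤ Real.exp (4 * gSize x) := by
  have ha := abs_le_gSize x a
  have hb := abs_le_gSize x b
  have h0 := gSize_nonneg x
  have e2 := Real.quadratic_le_exp_of_nonneg (x := 2 * gSize x) (by linarith)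
  have hee : Real.exp (2 * gSize x) ≤ Real.exp (4 * gSize x) :=
    Real.exp_le_exp.2 (by linarith)
  have hab : |x a * x b| ≤ gSize x * gSize x := by
    rw [abs_mul]; exact mul_le_mul ha hb (abs_nonneg _) h0
  calc _ ≤ |x a * x b| + |(if a = b then (1 : ℝ) else 0)| := abs_sub _ _
    _ ≤ gSize x * gSize x + 1 := by
        refine add_le_add hab ?_
        split_ifs <;> simp
    _ ≤ _ := by nlinarith

lemma integrable_hermite_two (a b : ι) :
    Integrable (fun x : ι → ℝ => x a * x b - (if a = b then 1 else 0)) (stdG ι) :=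
  (integrable_exp_gSize 4).mono' (by fun_prop) (ae_of_all _ fun x => hermite_two_le x a b)

lemma abs_integral_hermite_two_le {f : (ι → ℝ) → ℝ} (hf1 : ∀ x, |f x| ≤ 1) (a b : ι) :
    |∫ x, (x a * x b - (if a = b then 1 else 0)) * f x ∂(stdG ι)| ≤ gJ ι :=
  norm_integral_le_of_norm_le (f := fun x : ι → ℝ => (x a * x b - (if a = b then 1 else 0)) * f x)
    (integrable_exp_gSize 4) (ae_of_all _ fun x => by
      rw [Real.norm_eq_abs, abs_mul]
      exact (mul_le_of_le_one_right (abs_nonneg _) (hf1 x)).trans (hermite_two_le x a b))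

lemma cm_hess_integral (η : ι → ℝ) {f : (ι → ℝ) → ℝ} (hf : Measurable f)
    (hf1 : ∀ x, |f x| ≤ 1) (a b : ι) :
    |∫ x, (x a * x b - (if a = b then 1 else 0)) * f (x + η) ∂(stdG ι)
      - ∫ x, (x a * x b - (if a = b then 1 else 0)) * f x ∂(stdG ι)| ≤ 8 * gJ ι * min 1 ‖η‖ := by
  have hI := integrable_exp_gSize (ι := ι) 4
  have hJ := one_le_gJ (ι := ι)
  rcases le_total ‖η‖ 1 with hn | hn
  · rw [min_eq_right hn]
    have hm : Measurable (fun x : ι → ℝ => cmKer η x) :=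
      measurable_cmKer.comp (measurable_const.prodMk measurable_id)
    have h1 : ∫ x, (x a * x b - (if a = b then 1 else 0)) * f (x + η) ∂(stdG ι)
        = ∫ x, cmKer η x * (((x a - η a) * (x b - η b) - (if a = b then 1 else 0)) * f x)
          ∂(stdG ι) := by
      rw [← stdG_integral_add η
        (f := fun x => ((x a - η a) * (x b - η b) - (if a = b then 1 else 0)) * f x) (by fun_prop)]
      simp
    have hb : ∀ x : ι → ℝ, |((x a - η a) * (x b - η b) - (if a = b then 1 else 0)) * cmKer η x
        - (x a * x b - (if a = b then 1 else 0))| ≤ 3 * ‖η‖ * Real.exp (4 * gSize x) := fun x => by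
      obtain ⟨b1, b2, b3⟩ := cm_bounds x η
      exact cm_hess_small (gSize_nonneg x) (norm_nonneg _) hn (abs_le_gSize x a)
        (abs_le_gSize x b) (norm_le_pi_norm η a) (norm_le_pi_norm η b)
        (by split_ifs <;> simp) (b3 hn)
    have i2 : Integrable (fun x : ι → ℝ => (x a * x b - (if a = b then 1 else 0)) * f x)
        (stdG ι) := by
      simp_rw [mul_comm _ (f _)]
      exact (integrable_hermite_two a b).abs_le_mul hf hf1
    have i3 : Integrable (fun x : ι → ℝ =>
        (((x a - η a) * (x b - η b) - (if a = b then 1 else 0)) * cmKer η x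
        - (x a * x b - (if a = b then 1 else 0))) * f x) (stdG ι) := by
      refine (hI.const_mul (3 * ‖η‖)).mono' (by fun_prop) (ae_of_all _ fun x => ?_)
      rw [Real.norm_eq_abs, abs_mul]
      exact (mul_le_of_le_one_right (abs_nonneg _) (hf1 x)).trans (hb x)
    have h2 : ∫ x, cmKer η x * (((x a - η a) * (x b - η b) - (if a = b then 1 else 0)) * f x)
          ∂(stdG ι) - ∫ x, (x a * x b - (if a = b then 1 else 0)) * f x ∂(stdG ι)
        = ∫ x, (((x a - η a) * (x b - η b) - (if a = b then 1 else 0)) * cmKer η x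
        - (x a * x b - (if a = b then 1 else 0))) * f x ∂(stdG ι) := by
      rw [sub_eq_iff_eq_add, ← integral_add i3 i2]
      refine integral_congr_ae (ae_of_all _ fun x => ?_)
      simp only
      ring
    rw [h1, h2]
    have := norm_integral_le_of_norm_le
      (f := fun x : ι → ℝ => (((x a - η a) * (x b - η b) - (if a = b then 1 else 0)) * cmKer η x
        - (x a * x b - (if a = b then 1 else 0))) * f x) (hI.const_mul (3 * ‖η‖))
      (ae_of_all (stdG ι) fun x => by
        rw [Real.norm_eq_abs, abs_mul]
        exact (mul_le_of_le_one_right (abs_nonneg _) (hf1 x)).trans (hb x))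
    rw [integral_const_mul, Real.norm_eq_abs] at this
    refine this.trans ?_
    change 3 * ‖η‖ * gJ ι ≤ _
    nlinarith [mul_nonneg (norm_nonneg η) (zero_le_one.trans hJ)]
  · rw [min_eq_left hn]
    have h1 := abs_integral_hermite_two_le hf1 a b
    have h2 := abs_integral_hermite_two_le (f := fun x => f (x + η)) (fun x => hf1 _) a b
    refine (abs_sub _ _).trans ?_
    linarith

/-! ### Gaussian smoothing -/

section smoothing

variable {W : Type*} [MeasurableSpace W]

/-- Gaussian smoothing at scale `s`. -/
def gsVal (s : ℝ) (F : W → (ι → ℝ) → ℝ) (w : W) (x : ι → ℝ) : ℝ :=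
  ∫ ξ, F w (x + s • ξ) ∂(stdG ι)

/-- Gradient of the Gaussian smoothing. -/
def gsGrad (s : ℝ) (F : W → (ι → ℝ) → ℝ) (w : W) (x : ι → ℝ) (a : ι) : ℝ :=
  s⁻¹ * ∫ ξ, ξ a * F w (x + s • ξ) ∂(stdG ι)

/-- Hessian of the Gaussian smoothing. -/
def gsHess (s : ℝ) (F : W → (ι → ℝ) → ℝ) (w : W) (x : ι → ℝ) (a b : ι) : ℝ :=
  (s⁻¹) ^ 2 * ∫ ξ, (ξ a * ξ b - (if a = b then 1 else 0)) * F w (x + s • ξ) ∂(stdG ι)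

/-- Modulus of continuity of the Hessian of a Gaussian smoothing. -/
def gsMod (ι : Type*) [Fintype ι] (s : ℝ) (ρ : ℝ) : ℝ := 8 * gJ ι * (s⁻¹) ^ 2 * min 1 (s⁻¹ * ρ)

omit [MeasurableSpace W] in
lemma abs_gsHess_le {s : ℝ} {F : W → (ι → ℝ) → ℝ} (hF1 : ∀ w x, |F w x| ≤ 1) (w : W)
    (x : ι → ℝ) (a b : ι) : |gsHess s F w x a b| ≤ (s⁻¹) ^ 2 * gJ ι := by
  rw [gsHess, abs_mul, abs_of_nonneg (sq_nonneg s⁻¹)]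
  gcongr
  exact abs_integral_hermite_two_le (f := fun ξ => F w (x + s • ξ)) (fun ξ => hF1 _ _) a b

lemma isJet_smoothing {s : ℝ} (hs : 0 < s) {F : W → (ι → ℝ) → ℝ}
    (hF : Measurable (Function.uncurry F)) (hF1 : ∀ w x, |F w x| ≤ 1) :
    IsJet (1 + s⁻¹ * gJ ι + (s⁻¹) ^ 2 * gJ ι) (gsMod ι s) (gsVal s F) (gsGrad s F)
      (gsHess s F) := by
  have hJ := one_le_gJ (ι := ι)
  have hs' : 0 < s⁻¹ := by positivity
  have hFm : Measurable (fun z : (W × (ι → ℝ)) × (ι → ℝ) => F z.1.1 (z.1.2 + s • z.2)) :=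
    hF.comp (f := fun z : (W × (ι → ℝ)) × (ι → ℝ) => (z.1.1, z.1.2 + s • z.2)) (by fun_prop)
  have hf : ∀ w x, Measurable (fun ξ : ι → ℝ => F w (x + s • ξ)) := fun w x =>
    hFm.comp (f := fun ξ : ι → ℝ => ((w, x), ξ)) (by fun_prop)
  have hsh : ∀ x y ξ : ι → ℝ, x + y + s • ξ = x + s • (ξ + s⁻¹ • y) := fun x y ξ => by
    rw [smul_add, smul_smul, mul_inv_cancel₀ hs.ne', one_smul, add_assoc, add_comm y]
  have hnorm : ∀ y : ι → ℝ, ‖s⁻¹ • y‖ = s⁻¹ * ‖y‖ := fun y => by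
    rw [norm_smul, Real.norm_of_nonneg hs'.le]
  refine ⟨?_, fun a => ?_, fun a b => ?_, fun w x => ?_, fun w x a => ?_, fun w x a b => ?_,
    fun w x y => ?_, fun w x y a b => ?_⟩
  · exact (hFm.stronglyMeasurable.integral_prod_right (ν := stdG ι)).measurable
  · have : Measurable (fun z : (W × (ι → ℝ)) × (ι → ℝ) => z.2 a * F z.1.1 (z.1.2 + s • z.2)) := by
      fun_prop
    exact (this.stronglyMeasurable.integral_prod_right (ν := stdG ι)).measurable.const_mul _
  · have : Measurable (fun z : (W × (ι → ℝ)) × (ι → ℝ) =>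
        (z.2 a * z.2 b - (if a = b then 1 else 0)) * F z.1.1 (z.1.2 + s • z.2)) := by
      fun_prop
    exact (this.stronglyMeasurable.integral_prod_right (ν := stdG ι)).measurable.const_mul _
  · have := norm_integral_le_of_norm_le_const (μ := stdG ι) (C := 1)
      (f := fun ξ => F w (x + s • ξ)) (ae_of_all _ fun ξ => hF1 _ _)
    simp only [probReal_univ, mul_one, Real.norm_eq_abs] at this
    have h1 : 0 ≤ s⁻¹ * gJ ι + (s⁻¹) ^ 2 * gJ ι := by positivity
    unfold gsVal
    linarith
  · have : |∫ ξ, ξ a * F w (x + s • ξ) ∂(stdG ι)| ≤ gJ ι :=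
      norm_integral_le_of_norm_le (f := fun ξ : ι → ℝ => ξ a * F w (x + s • ξ))
        (integrable_exp_gSize 4) (ae_of_all _ fun ξ => by
          rw [Real.norm_eq_abs, abs_mul]
          refine (mul_le_of_le_one_right (abs_nonneg _) (hF1 _ _)).trans
            ((abs_le_gSize ξ a).trans ?_)
          linarith [Real.add_one_le_exp (4 * gSize ξ), gSize_nonneg ξ])
    have h1 : 0 ≤ (s⁻¹) ^ 2 * gJ ι := by positivity
    rw [gsGrad, abs_mul, abs_of_pos hs']
    have := mul_le_mul_of_nonneg_left this hs'.le
    linarith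
  · have := abs_gsHess_le (s := s) hF1 w x a b
    have h1 : 0 ≤ s⁻¹ * gJ ι := by positivity
    linarith
  · set η := s⁻¹ • y with hη
    set f : (ι → ℝ) → ℝ := fun ξ => F w (x + s • ξ) with hfd
    have hf1 : ∀ ξ, |f ξ| ≤ 1 := fun ξ => hF1 _ _
    have key := cm_taylor_integral η hf1
    have e1 : gsVal s F w (x + y) = ∫ ξ, cmKer η ξ * f ξ ∂(stdG ι) := by
      rw [← stdG_integral_add η (hf w x), gsVal]
      simp_rw [hsh]
      rfl
    have hfi : Integrable f (stdG ι) := integrable_of_abs_le (hf w x) hf1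
    have hKi : Integrable (fun ξ => cmKer η ξ * f ξ) (stdG ι) := by
      simp_rw [mul_comm _ (f _)]
      exact (integrable_cmKer η).abs_le_mul (hf w x) hf1
    have hxi : ∀ a, Integrable (fun ξ : ι → ℝ => ξ a * f ξ) (stdG ι) := fun a => by
      simp_rw [mul_comm _ (f _)]
      exact (memLp_one_iff_integrable.1 (stdG_memLp_eval a 1 (by simp))).abs_le_mul (hf w x) hf1
    have hhi : ∀ a b, Integrable (fun ξ : ι → ℝ =>
        (ξ a * ξ b - (if a = b then 1 else 0)) * f ξ) (stdG ι) := fun a b => by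
      simp_rw [mul_comm _ (f _)]
      exact (integrable_hermite_two a b).abs_le_mul (hf w x) hf1
    have hηa : ∀ a, η a = s⁻¹ * y a := fun a => by simp [hη]
    have e2 : ∑ a, gsGrad s F w x a * y a = ∫ ξ, ∑ a, η a * (ξ a * f ξ) ∂(stdG ι) := by
      rw [integral_finsetSum _ fun a _ => (hxi a).const_mul _]
      refine Finset.sum_congr rfl fun a _ => ?_
      rw [integral_const_mul, hηa, gsGrad]; ring
    have e3 : (1 / 2) * ∑ a, ∑ b, gsHess s F w x a b * (y a * y b)
        = ∫ ξ, ∑ a, ∑ b, (1 / 2) * (η a * η b) *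
          ((ξ a * ξ b - (if a = b then 1 else 0)) * f ξ) ∂(stdG ι) := by
      rw [integral_finsetSum _ fun a _ => integrable_finsetSum _ fun b _ => (hhi a b).const_mul _,
        Finset.mul_sum]
      refine Finset.sum_congr rfl fun a _ => ?_
      rw [integral_finsetSum _ fun b _ => (hhi a b).const_mul _, Finset.mul_sum]
      refine Finset.sum_congr rfl fun b _ => ?_
      rw [integral_const_mul, hηa, hηa, gsHess]; ring
    have i2 : Integrable (fun ξ : ι → ℝ => ∑ a, η a * (ξ a * f ξ)) (stdG ι) :=
      integrable_finsetSum _ fun a _ => (hxi a).const_mul _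
    have i3 : Integrable (fun ξ : ι → ℝ => ∑ a, ∑ b, (1 / 2) * (η a * η b) *
        ((ξ a * ξ b - (if a = b then 1 else 0)) * f ξ)) (stdG ι) :=
      integrable_finsetSum _ fun a _ => integrable_finsetSum _ fun b _ => (hhi a b).const_mul _
    have e0 : gsVal s F w x = ∫ ξ, f ξ ∂(stdG ι) := rfl
    rw [e1, e2, e3, e0, ← integral_sub hKi hfi,
      ← integral_sub (f := fun ξ => cmKer η ξ * f ξ - f ξ) (hKi.sub hfi) i2,
      ← integral_sub (f := fun ξ => cmKer η ξ * f ξ - f ξ - ∑ a, η a * (ξ a * f ξ))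
        ((hKi.sub hfi).sub i2) i3]
    have hsq : ∀ ξ : ι → ℝ, (∑ a, ξ a * η a) ^ 2 - ∑ a, η a ^ 2
        = ∑ a, ∑ b, (η a * η b) * (ξ a * ξ b - (if a = b then 1 else 0)) := fun ξ => by
      simp only [mul_sub, mul_ite, mul_one, mul_zero, Finset.sum_sub_distrib, Finset.sum_ite_eq,
        Finset.mem_univ, if_true]
      congr 1
      · rw [sq, Finset.sum_mul_sum]
        exact Finset.sum_congr rfl fun a _ => Finset.sum_congr rfl fun b _ => by ring
      · exact Finset.sum_congr rfl fun a _ => by ring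
    have hint : ∀ ξ, cmKer η ξ * f ξ - f ξ - ∑ a, η a * (ξ a * f ξ)
        - ∑ a, ∑ b, (1 / 2) * (η a * η b) * ((ξ a * ξ b - (if a = b then 1 else 0)) * f ξ)
        = f ξ * (cmKer η ξ - 1 - ∑ a, ξ a * η a
          - (1 / 2) * ((∑ a, ξ a * η a) ^ 2 - ∑ a, η a ^ 2)) := fun ξ => by
      rw [hsq]
      have t1 : ∑ a, η a * (ξ a * f ξ) = f ξ * ∑ a, ξ a * η a := by
        rw [Finset.mul_sum]; exact Finset.sum_congr rfl fun a _ => by ring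
      have t2 : ∑ a, ∑ b, (1 / 2) * (η a * η b) * ((ξ a * ξ b - (if a = b then 1 else 0)) * f ξ)
          = f ξ * (1 / 2 * ∑ a, ∑ b, (η a * η b) * (ξ a * ξ b - (if a = b then 1 else 0))) := by
        simp only [Finset.mul_sum]
        exact Finset.sum_congr rfl fun a _ => Finset.sum_congr rfl fun b _ => by ring
      rw [t1, t2]; ring
    simp only [hint]
    refine key.trans (le_of_eq ?_)
    rw [gsMod, hη, hnorm]; ring
  · rw [gsHess, gsHess, ← mul_sub, abs_mul, abs_of_nonneg (sq_nonneg s⁻¹)]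
    simp_rw [hsh]
    have := cm_hess_integral (s⁻¹ • y) (hf w x) (fun ξ => hF1 _ _) a b
    rw [hnorm] at this
    calc _ ≤ s⁻¹ ^ 2 * (8 * gJ ι * min 1 (s⁻¹ * ‖y‖)) := by gcongr
      _ = _ := by rw [gsMod]; ring

end smoothing

end

/-! ### Sums over dyadic scales -/

/-- The exponent `1/2` for `p < 3` and `3/2` for `p = 3`. -/
def cExp (p : ℝ) : ℝ := if p = 3 then 3 / 2 else 1 / 2

lemma cExp_pos (p : ℝ) : 0 < cExp p := by unfold cExp; split_ifs <;> norm_num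

/-- The dyadic scale `√(2 ^ j)`. -/
def dScale (j : ℕ) : ℝ := Real.sqrt (2 ^ j)

lemma dScale_pos (j : ℕ) : 0 < dScale j := Real.sqrt_pos.2 (by positivity)

lemma dScale_sq (j : ℕ) : dScale j ^ 2 = 2 ^ j := Real.sq_sqrt (by positivity)

lemma dScale_succ (j : ℕ) : dScale (j + 1) = dScale j * Real.sqrt 2 := by
  rw [dScale, dScale, pow_succ, Real.sqrt_mul (by positivity)]

lemma dScale_rpow (j : ℕ) (q : ℝ) : dScale j ^ q = 2 ^ ((j : ℝ) * (q / 2)) := by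
  rw [dScale, Real.sqrt_eq_rpow, ← Real.rpow_natCast, ← Real.rpow_mul (by norm_num),
    ← Real.rpow_mul (by norm_num)]
  congr 1; ring

lemma dScale_rpow_succ (j : ℕ) (q : ℝ) :
    dScale (j + 1) ^ q = dScale j ^ q * Real.sqrt 2 ^ q := by
  rw [dScale_succ, Real.mul_rpow (dScale_pos j).le (Real.sqrt_nonneg 2)]

lemma sqrt_two_lt_two : Real.sqrt 2 < 2 := by
  rw [Real.sqrt_lt' (by norm_num)]; norm_num

lemma one_lt_sqrt_two : 1 < Real.sqrt 2 := by
  rw [Real.lt_sqrt (by norm_num)]; norm_num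

lemma sum_dScale_low {r ρ : ℝ} (hr : 0 < r) (hρ : 0 < ρ) (n : ℕ) :
    ∑ j ∈ Finset.range n, (if dScale j ≤ ρ then dScale j ^ r else 0)
      ≤ (Real.sqrt 2 ^ r - 1)⁻¹ * (min (dScale n) (2 * ρ)) ^ r := by
  have hq : 1 < Real.sqrt 2 ^ r := Real.one_lt_rpow one_lt_sqrt_two hr
  have hC : 0 < (Real.sqrt 2 ^ r - 1)⁻¹ := inv_pos.2 (by linarith)
  induction n with
  | zero =>
    have : 0 ≤ min (dScale 0) (2 * ρ) := le_min (dScale_pos _).le (by linarith)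
    simp only [Finset.range_zero, Finset.sum_empty]
    positivity
  | succ n ih =>
    rw [Finset.sum_range_succ]
    split_ifs with h
    · have h0 := dScale_pos n
      have h1 : dScale (n + 1) ≤ 2 * ρ := by
        rw [dScale_succ]; nlinarith [sqrt_two_lt_two]
      rw [min_eq_left (by linarith)] at ih
      rw [min_eq_left h1, dScale_rpow_succ]
      have : (Real.sqrt 2 ^ r - 1)⁻¹ * (dScale n ^ r * Real.sqrt 2 ^ r)
          = (Real.sqrt 2 ^ r - 1)⁻¹ * dScale n ^ r + dScale n ^ r := by
        field_simp [(by linarith : Real.sqrt 2 ^ r - 1 ≠ 0)]; ring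
      linarith
    · rw [add_zero]
      refine ih.trans ?_
      have h0 := dScale_pos n
      have h1 : dScale n ≤ dScale (n + 1) := by rw [dScale_succ]; nlinarith [one_lt_sqrt_two]
      have : 0 ≤ min (dScale n) (2 * ρ) := le_min h0.le (by linarith)
      gcongr

lemma sum_dScale_high {r ρ : ℝ} (hr : r < 1) (hρ : 0 < ρ) (n : ℕ) :
    ∑ j ∈ Finset.range n, (if dScale j ≤ ρ then 0 else ρ * dScale j ^ (r - 1))
      ≤ (1 - Real.sqrt 2 ^ (r - 1))⁻¹ * (ρ * (ρ ^ (r - 1) - (max (dScale n) ρ) ^ (r - 1))) := by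
  have hq : Real.sqrt 2 ^ (r - 1) < 1 := Real.rpow_lt_one_of_one_lt_of_neg one_lt_sqrt_two
    (by linarith)
  have hC : 0 < (1 - Real.sqrt 2 ^ (r - 1))⁻¹ := inv_pos.2 (by linarith)
  induction n with
  | zero =>
    simp only [Finset.range_zero, Finset.sum_empty]
    have : (max (dScale 0) ρ) ^ (r - 1) ≤ ρ ^ (r - 1) :=
      Real.rpow_le_rpow_of_nonpos hρ (le_max_right _ _) (by linarith)
    have : 0 ≤ ρ ^ (r - 1) - (max (dScale 0) ρ) ^ (r - 1) := by linarith
    positivity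
  | succ n ih =>
    rw [Finset.sum_range_succ]
    have h0 := dScale_pos n
    have h1 : dScale n ≤ dScale (n + 1) := by rw [dScale_succ]; nlinarith [one_lt_sqrt_two]
    split_ifs with h
    · rw [add_zero]
      refine ih.trans ?_
      have : (max (dScale (n + 1)) ρ) ^ (r - 1) ≤ (max (dScale n) ρ) ^ (r - 1) :=
        Real.rpow_le_rpow_of_nonpos (lt_max_of_lt_left h0) (max_le_max_right _ h1) (by linarith)
      gcongr
    · push Not at h
      rw [max_eq_left h.le] at ih
      rw [max_eq_left (by linarith), dScale_rpow_succ]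
      have : (1 - Real.sqrt 2 ^ (r - 1))⁻¹
            * (ρ * (ρ ^ (r - 1) - dScale n ^ (r - 1) * Real.sqrt 2 ^ (r - 1)))
          = (1 - Real.sqrt 2 ^ (r - 1))⁻¹ * (ρ * (ρ ^ (r - 1) - dScale n ^ (r - 1)))
            + ρ * dScale n ^ (r - 1) := by
        field_simp [(by linarith : 1 - Real.sqrt 2 ^ (r - 1) ≠ 0)]; ring
      linarith

lemma sum_dScale_min_le {r ρ : ℝ} (hr : 0 < r) (hr1 : r < 1) (hρ : 0 < ρ) (n : ℕ) :
    ∑ j ∈ Finset.range n, dScale j ^ r * min 1 ((dScale j)⁻¹ * ρ)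
      ≤ (2 * (Real.sqrt 2 ^ r - 1)⁻¹ + (1 - Real.sqrt 2 ^ (r - 1))⁻¹) * ρ ^ r := by
  have hq : 1 < Real.sqrt 2 ^ r := Real.one_lt_rpow one_lt_sqrt_two hr
  have hC : 0 < (Real.sqrt 2 ^ r - 1)⁻¹ := inv_pos.2 (by linarith)
  have hq' : Real.sqrt 2 ^ (r - 1) < 1 := Real.rpow_lt_one_of_one_lt_of_neg one_lt_sqrt_two
    (by linarith)
  have hC' : 0 < (1 - Real.sqrt 2 ^ (r - 1))⁻¹ := inv_pos.2 (by linarith)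
  have e1 : (min (dScale n) (2 * ρ)) ^ r ≤ 2 * ρ ^ r := by
    calc _ ≤ (2 * ρ) ^ r := by
          have : 0 ≤ min (dScale n) (2 * ρ) := le_min (dScale_pos n).le (by linarith)
          gcongr; exact min_le_right _ _
      _ = 2 ^ r * ρ ^ r := Real.mul_rpow (by norm_num) hρ.le
      _ ≤ 2 ^ (1 : ℝ) * ρ ^ r := by gcongr; norm_num
      _ = _ := by rw [Real.rpow_one]
  have e2 : ρ * (ρ ^ (r - 1) - (max (dScale n) ρ) ^ (r - 1)) ≤ ρ ^ r := by
    have : 0 ≤ (max (dScale n) ρ) ^ (r - 1) :=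
      Real.rpow_nonneg (le_max_of_le_right hρ.le) _
    calc _ ≤ ρ * ρ ^ (r - 1) := by gcongr; linarith
      _ = ρ ^ r := by
        nth_rewrite 1 [← Real.rpow_one ρ]
        rw [← Real.rpow_add hρ]; congr 1; ring
  calc _ ≤ ∑ j ∈ Finset.range n, ((if dScale j ≤ ρ then dScale j ^ r else 0)
        + (if dScale j ≤ ρ then 0 else ρ * dScale j ^ (r - 1))) := by
        refine Finset.sum_le_sum fun j _ => ?_
        have h0 := dScale_pos j
        split_ifs with h
        · rw [add_zero]
          exact mul_le_of_le_one_right (by positivity) (min_le_left _ _)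
        · rw [zero_add, Real.rpow_sub h0, Real.rpow_one]
          calc _ ≤ dScale j ^ r * ((dScale j)⁻¹ * ρ) := by gcongr; exact min_le_right _ _
            _ = _ := by field_simp
    _ ≤ (Real.sqrt 2 ^ r - 1)⁻¹ * (2 * ρ ^ r) + (1 - Real.sqrt 2 ^ (r - 1))⁻¹ * ρ ^ r := by
        rw [Finset.sum_add_distrib]
        refine add_le_add ((sum_dScale_low hr hρ n).trans (by gcongr))
          ((sum_dScale_high hr1 hρ n).trans (by gcongr))
    _ = _ := by ring

lemma rpow_neg_three_half_le {x : ℝ} (hx : 1 ≤ x) :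
    x ^ (-(3 / 2) : ℝ) ≤ 4 * (x ^ (-(1 / 2) : ℝ) - (x + 1) ^ (-(1 / 2) : ℝ)) := by
  have hx0 : 0 < x := by linarith
  set a := Real.sqrt x
  set b := Real.sqrt (x + 1)
  have ha : 0 < a := Real.sqrt_pos.2 hx0
  have hb : 0 < b := Real.sqrt_pos.2 (by linarith)
  have ha2 : a ^ 2 = x := Real.sq_sqrt hx0.le
  have hb2 : b ^ 2 = x + 1 := Real.sq_sqrt (by linarith)
  have e1 : x ^ (-(1 / 2) : ℝ) = a⁻¹ := by rw [Real.rpow_neg hx0.le, ← Real.sqrt_eq_rpow]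
  have e2 : (x + 1) ^ (-(1 / 2) : ℝ) = b⁻¹ := by
    rw [Real.rpow_neg (by linarith), ← Real.sqrt_eq_rpow]
  have e3 : x ^ (-(3 / 2) : ℝ) = (a * x)⁻¹ := by
    rw [Real.rpow_neg hx0.le, (by norm_num : (3 / 2 : ℝ) = 1 / 2 + 1), Real.rpow_add hx0,
      ← Real.sqrt_eq_rpow, Real.rpow_one]
  have hab : a ≤ b := Real.sqrt_le_sqrt (by linarith)
  have hba : b ≤ 3 / 2 * a := by
    refine abs_le_of_sq_le_sq' ?_ (by positivity) |>.2
    nlinarith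
  rw [e1, e2, e3]
  have h1 : a⁻¹ - b⁻¹ = (a * b * (a + b))⁻¹ := by
    have : (b - a) * (a + b) = 1 := by nlinarith
    field_simp
    linarith
  rw [h1, ← div_eq_mul_inv, inv_eq_one_div, div_le_div_iff₀ (by positivity) (by positivity)]
  have : b * (a + b) ≤ 4 * a ^ 2 := by nlinarith
  calc 1 * (a * b * (a + b)) = a * (b * (a + b)) := by ring
    _ ≤ a * (4 * a ^ 2) := by gcongr
    _ = 4 * (a * x) := by rw [ha2]; ring

/-- Weight of the scale `j`. -/
def scaleWeight (p : ℝ) (j : ℕ) : ℝ := ((j : ℝ) + 1) ^ (-cExp p) * dScale j ^ (p - 2)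

lemma scaleWeight_nonneg (p : ℝ) (j : ℕ) : 0 ≤ scaleWeight p j := by
  unfold scaleWeight; have := (dScale_pos j).le; positivity

lemma exists_sum_scaleWeight_min_le {p : ℝ} (hp : 2 < p) (hp3 : p ≤ 3) :
    ∃ C : ℝ, 0 ≤ C ∧ ∀ (i n : ℕ) (ρ : ℝ),
      ∑ j ∈ Finset.range n, (if i ≤ j then scaleWeight p j * max 0 (min 1 ((dScale j)⁻¹ * ρ))
        else 0) ≤ C * ((i : ℝ) + 1) ^ (-(1 / 2) : ℝ) * |ρ| ^ (p - 2) := by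
  rcases eq_or_lt_of_le hp3 with rfl | hp3'
  · refine ⟨4, by norm_num, fun i n ρ => ?_⟩
    have key : ∀ n : ℕ, ∑ j ∈ Finset.range n, (if i ≤ j then ((j : ℝ) + 1) ^ (-(3 / 2) : ℝ) else 0)
        ≤ 4 * (((i : ℝ) + 1) ^ (-(1 / 2) : ℝ) - ((max i n : ℕ) + 1 : ℝ) ^ (-(1 / 2) : ℝ)) := by
      intro n
      induction n with
      | zero => simp
      | succ n ih =>
        rw [Finset.sum_range_succ]
        split_ifs with h
        · rw [max_eq_right h] at ih
          rw [max_eq_right (by lia)]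
          have := rpow_neg_three_half_le (x := (n : ℝ) + 1) (by simp)
          push_cast
          linarith
        · rw [max_eq_left (by lia)] at ih ⊢
          linarith
    calc _ ≤ ∑ j ∈ Finset.range n, (if i ≤ j then ((j : ℝ) + 1) ^ (-(3 / 2) : ℝ) else 0) * |ρ| := by
          refine Finset.sum_le_sum fun j _ => ?_
          split_ifs with h
          · have h0 := dScale_pos j
            rw [scaleWeight, cExp, if_pos rfl, (by norm_num : (3 : ℝ) - 2 = 1), Real.rpow_one,
              mul_assoc]
            refine mul_le_mul_of_nonneg_left ?_ (by positivity)
            have : max 0 (min 1 ((dScale j)⁻¹ * ρ)) ≤ (dScale j)⁻¹ * |ρ| :=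
              max_le (by positivity) ((min_le_right _ _).trans (by gcongr; exact le_abs_self _))
            calc _ ≤ dScale j * ((dScale j)⁻¹ * |ρ|) := by gcongr
              _ = _ := by field_simp
          · simp
      _ ≤ _ := by
          rw [← Finset.sum_mul, (by norm_num : (3 : ℝ) - 2 = 1), Real.rpow_one]
          refine mul_le_mul_of_nonneg_right ((key n).trans ?_) (abs_nonneg _)
          have : (0 : ℝ) ≤ ((max i n : ℕ) + 1 : ℝ) ^ (-(1 / 2) : ℝ) := by positivity
          linarith
  · have hr : 0 < p - 2 := by linarith
    have hr1 : p - 2 < 1 := by linarith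
    set C := 2 * (Real.sqrt 2 ^ (p - 2) - 1)⁻¹ + (1 - Real.sqrt 2 ^ (p - 2 - 1))⁻¹
    have hq : 1 < Real.sqrt 2 ^ (p - 2) := Real.one_lt_rpow one_lt_sqrt_two hr
    have hC1 : 0 < (Real.sqrt 2 ^ (p - 2) - 1)⁻¹ := inv_pos.2 (by linarith)
    have hq' : Real.sqrt 2 ^ (p - 2 - 1) < 1 := Real.rpow_lt_one_of_one_lt_of_neg one_lt_sqrt_two
      (by linarith)
    have hC' : 0 < (1 - Real.sqrt 2 ^ (p - 2 - 1))⁻¹ := inv_pos.2 (by linarith)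
    have hC : 0 ≤ C := by positivity
    refine ⟨C, hC, fun i n ρ => ?_⟩
    rcases le_or_gt ρ 0 with hρ | hρ
    · refine (Finset.sum_nonpos fun j _ => ?_).trans (by positivity)
      have h0 := dScale_pos j
      have : min 1 ((dScale j)⁻¹ * ρ) ≤ 0 :=
        (min_le_right _ _).trans (mul_nonpos_of_nonneg_of_nonpos (by positivity) hρ)
      rw [max_eq_left this]; simp
    · rw [abs_of_pos hρ]
      calc _ ≤ ∑ j ∈ Finset.range n, ((i : ℝ) + 1) ^ (-(1 / 2) : ℝ) *
            (dScale j ^ (p - 2) * min 1 ((dScale j)⁻¹ * ρ)) := by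
            refine Finset.sum_le_sum fun j _ => ?_
            have h0 := dScale_pos j
            have h1 : 0 ≤ min 1 ((dScale j)⁻¹ * ρ) := le_min zero_le_one (by positivity)
            split_ifs with h
            · rw [scaleWeight, cExp, if_neg hp3'.ne, max_eq_right h1, ← mul_assoc]
              gcongr ?_ * _ * _
              exact Real.rpow_le_rpow_of_nonpos (by positivity)
                (by gcongr) (by norm_num)
            · positivity
        _ ≤ _ := by
            rw [← Finset.mul_sum, mul_comm C, mul_assoc]
            gcongr
            exact sum_dScale_min_le hr hr1 hρ n

section

/-! ### A bounded `C²` substitute for the `p`-th power of the positive part -/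

/-- The tent function supported in `[0, 2L]`. -/
def tent (L u : ℝ) : ℝ := max 0 (L - |u - L|)

lemma tent_nonneg (L u : ℝ) : 0 ≤ tent L u := le_max_left _ _

lemma tent_le (L u : ℝ) (hL : 0 ≤ L) : tent L u ≤ L :=
  max_le hL (by linarith [abs_nonneg (u - L)])

lemma tent_le_pos (L u : ℝ) : tent L u ≤ max 0 u :=
  max_le_max_left _ (by linarith [neg_abs_le (u - L)])

lemma tent_of_nonpos {L u : ℝ} (h : u ≤ 0) : tent L u = 0 :=
  max_eq_left (by linarith [neg_abs_le (u - L)])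

lemma tent_of_ge {L u : ℝ} (h : 2 * L ≤ u) : tent L u = 0 :=
  max_eq_left (by linarith [le_abs_self (u - L)])

lemma tent_of_mem {L u : ℝ} (h0 : 0 ≤ u) (h : u ≤ L) : tent L u = u := by
  rw [tent, abs_of_nonpos (by linarith), max_eq_right] <;> linarith

lemma tent_lip (L u v : ℝ) : |tent L u - tent L v| ≤ |u - v| := by
  refine (abs_max_sub_max_le_max _ _ _ _).trans ?_
  simp only [sub_self, abs_zero]
  refine max_le (abs_nonneg _) ?_
  have := abs_abs_sub_abs_le_abs_sub (v - L) (u - L)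
  rw [abs_sub_comm u v]
  calc _ = |(|v - L| - |u - L|)| := by congr 1; ring
    _ ≤ _ := this.trans (by ring_nf; rfl)

lemma abs_rpow_sub_rpow_le {r x y : ℝ} (hr : 0 ≤ r) (hr1 : r ≤ 1) (hx : 0 ≤ x) (hy : 0 ≤ y) :
    |x ^ r - y ^ r| ≤ |x - y| ^ r := by
  wlog h : y ≤ x generalizing x y
  · rw [abs_sub_comm, abs_sub_comm x]
    exact this hy hx (by linarith)
  rw [abs_of_nonneg (sub_nonneg.2 (by gcongr)), abs_of_nonneg (by linarith : 0 ≤ x - y)]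
  have := Real.rpow_add_le_add_rpow (by linarith : 0 ≤ x - y) hy hr hr1
  rw [sub_add_cancel] at this
  linarith

/-- Second derivative of the substitute. -/
def bumpD2 (r L u : ℝ) : ℝ := tent L u ^ r - tent L (u - 2 * L) ^ r

/-- Primitive of a power of the tent. -/
def tentInt (r L x : ℝ) : ℝ := ∫ u in (0 : ℝ)..x, tent L u ^ r

/-- First derivative of the substitute. -/
def bumpD1 (r L x : ℝ) : ℝ := tentInt r L x - tentInt r L (x - 2 * L)

/-- The substitute for `x ↦ (max 0 x) ^ (r + 2)`. -/
def bump (r L x : ℝ) : ℝ := ∫ u in (0 : ℝ)..x, bumpD1 r L u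

section bump

variable {r L : ℝ}

lemma continuous_tent : Continuous (tent L) := by unfold tent; fun_prop

lemma continuous_tent_rpow (hr : 0 < r) : Continuous (fun u => tent L u ^ r) :=
  continuous_tent.rpow_const fun _ => Or.inr hr.le

lemma hasDerivAt_tentInt (hr : 0 < r) (x : ℝ) :
    HasDerivAt (tentInt r L) (tent L x ^ r) x :=
  intervalIntegral.integral_hasDerivAt_right ((continuous_tent_rpow hr).intervalIntegrable _ _)
    ((continuous_tent_rpow hr).stronglyMeasurableAtFilter _ _) (continuous_tent_rpow hr).continuousAt

lemma hasDerivAt_bumpD1 (hr : 0 < r) (x : ℝ) : HasDerivAt (bumpD1 r L) (bumpD2 r L x) x := by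
  have h1 := hasDerivAt_tentInt (L := L) hr x
  have h2 : HasDerivAt (fun y : ℝ => tentInt r L (y - 2 * L)) (tent L (x - 2 * L) ^ r) x :=
    HasDerivAt.comp_sub_const x (2 * L) (hasDerivAt_tentInt (L := L) hr (x - 2 * L))
  exact h1.sub h2

lemma continuous_bumpD1 (hr : 0 < r) : Continuous (bumpD1 r L) :=
  continuous_iff_continuousAt.2 fun x => (hasDerivAt_bumpD1 hr x).continuousAt

lemma hasDerivAt_bump (hr : 0 < r) (x : ℝ) : HasDerivAt (bump r L) (bumpD1 r L x) x :=
  intervalIntegral.integral_hasDerivAt_right ((continuous_bumpD1 hr).intervalIntegrable _ _)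
    ((continuous_bumpD1 hr).stronglyMeasurableAtFilter _ _) (continuous_bumpD1 hr).continuousAt

lemma continuous_bump (hr : 0 < r) : Continuous (bump r L) :=
  continuous_iff_continuousAt.2 fun x => (hasDerivAt_bump hr x).continuousAt

lemma continuous_bumpD2 (hr : 0 < r) : Continuous (bumpD2 r L) :=
  (continuous_tent_rpow hr).sub ((continuous_tent_rpow hr).comp (by fun_prop))

lemma monotone_tentInt (hr : 0 < r) : Monotone (tentInt r L) :=
  monotone_of_hasDerivAt_nonneg (hasDerivAt_tentInt hr) fun x =>
    Real.rpow_nonneg (tent_nonneg L x) r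

lemma tentInt_of_nonpos (hr : 0 < r) {x : ℝ} (hx : x ≤ 0) : tentInt r L x = 0 := by
  rw [tentInt, intervalIntegral.integral_congr (g := fun _ => (0 : ℝ))]
  · simp
  · intro u hu
    rw [Set.uIcc_of_ge hx] at hu
    simp only
    rw [tent_of_nonpos hu.2, Real.zero_rpow hr.ne']

lemma tentInt_of_ge (hr : 0 < r) {x : ℝ} (hx : 2 * L ≤ x) :
    tentInt r L x = tentInt r L (2 * L) := by
  have hi := fun a b => (continuous_tent_rpow (L := L) hr).intervalIntegrable (μ := volume) a b
  rw [tentInt, tentInt, ← sub_eq_zero, intervalIntegral.integral_interval_sub_left (hi _ _) (hi _ _),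
    intervalIntegral.integral_congr (g := fun _ => (0 : ℝ))]
  · simp
  · intro u hu
    rw [Set.uIcc_of_le hx] at hu
    simp only
    rw [tent_of_ge hu.1, Real.zero_rpow hr.ne']

lemma tentInt_nonneg (hr : 0 < r) (x : ℝ) : 0 ≤ tentInt r L x := by
  rcases le_total x 0 with h | h
  · rw [tentInt_of_nonpos hr h]
  · rw [← tentInt_of_nonpos (L := L) hr le_rfl]; exact monotone_tentInt hr h

lemma tentInt_le (hr : 0 < r) (x : ℝ) : tentInt r L x ≤ tentInt r L (2 * L) := by
  rcases le_total x (2 * L) with h | h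
  · exact monotone_tentInt hr h
  · rw [tentInt_of_ge hr h]

lemma bumpD1_nonneg (hr : 0 < r) (hL : 0 ≤ L) (x : ℝ) : 0 ≤ bumpD1 r L x :=
  sub_nonneg.2 (monotone_tentInt hr (by linarith))

lemma bumpD1_le (hr : 0 < r) (x : ℝ) : bumpD1 r L x ≤ tentInt r L (2 * L) := by
  have := tentInt_nonneg (L := L) hr (x - 2 * L)
  have := tentInt_le (L := L) hr x
  unfold bumpD1; linarith

lemma monotone_bump (hr : 0 < r) (hL : 0 ≤ L) : Monotone (bump r L) :=
  monotone_of_hasDerivAt_nonneg (hasDerivAt_bump hr) (bumpD1_nonneg hr hL)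

lemma bump_zero : bump r L 0 = 0 := by simp [bump]

lemma bump_of_nonpos (hr : 0 < r) (hL : 0 ≤ L) {x : ℝ} (hx : x ≤ 0) : bump r L x = 0 := by
  rw [bump, intervalIntegral.integral_congr (g := fun _ => (0 : ℝ))]
  · simp
  · intro u hu
    rw [Set.uIcc_of_ge hx] at hu
    simp only
    rw [bumpD1, tentInt_of_nonpos hr hu.2, tentInt_of_nonpos hr (by linarith [hu.2]), sub_zero]

lemma bump_nonneg (hr : 0 < r) (hL : 0 ≤ L) (x : ℝ) : 0 ≤ bump r L x := by
  rcases le_total x 0 with h | h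
  · rw [bump_of_nonpos hr hL h]
  · rw [← bump_zero (r := r) (L := L)]; exact monotone_bump hr hL h

lemma bump_le (hr : 0 < r) (hL : 0 ≤ L) (x : ℝ) :
    bump r L x ≤ 4 * L * tentInt r L (2 * L) := by
  have h4 : bump r L x ≤ bump r L (4 * L) := by
    rcases le_total x (4 * L) with h | h
    · exact monotone_bump hr hL h
    · have hi := fun a b => (continuous_bumpD1 (L := L) hr).intervalIntegrable (μ := volume) a b
      refine le_of_eq ?_
      rw [bump, bump, ← sub_eq_zero, intervalIntegral.integral_interval_sub_left (hi _ _) (hi _ _),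
        intervalIntegral.integral_congr (g := fun _ => (0 : ℝ))]
      · simp
      · intro u hu
        rw [Set.uIcc_of_le h] at hu
        simp only
        rw [bumpD1, tentInt_of_ge hr (by linarith [hu.1] : 2 * L ≤ u),
          tentInt_of_ge hr (by linarith [hu.1] : 2 * L ≤ u - 2 * L), sub_self]
  refine h4.trans ?_
  have := intervalIntegral.norm_integral_le_of_norm_le_const (a := 0) (b := 4 * L)
    (f := bumpD1 r L) (C := tentInt r L (2 * L)) fun u _ => by
      rw [Real.norm_of_nonneg (bumpD1_nonneg hr hL u)]; exact bumpD1_le hr u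
  rw [sub_zero, abs_of_nonneg (by linarith)] at this
  calc _ ≤ ‖bump r L (4 * L)‖ := le_abs_self _
    _ ≤ _ := this
    _ = _ := by ring

lemma bumpD1_le_rpow (hr : 0 < r) {x : ℝ} (hx : 0 ≤ x) : bumpD1 r L x ≤ x ^ r * x := by
  have := intervalIntegral.norm_integral_le_of_norm_le_const (a := 0) (b := x)
    (f := fun u => tent L u ^ r) (C := x ^ r) fun u hu => by
      rw [Set.uIoc_of_le hx] at hu
      have h0 := tent_nonneg L u
      rw [Real.norm_of_nonneg (by positivity)]
      gcongr
      exact (tent_le_pos L u).trans (by rw [max_eq_right hu.1.le]; exact hu.2)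
  rw [sub_zero, abs_of_nonneg hx] at this
  calc _ ≤ tentInt r L x := by
        have := tentInt_nonneg (L := L) hr (x - 2 * L); unfold bumpD1; linarith
    _ ≤ ‖tentInt r L x‖ := le_abs_self _
    _ ≤ _ := this

lemma bump_le_rpow (hr : 0 < r) (hL : 0 ≤ L) (x : ℝ) :
    bump r L x ≤ (max 0 x) ^ (r + 2) := by
  rcases le_or_gt x 0 with h | h
  · rw [bump_of_nonpos hr hL h]; positivity
  rw [max_eq_right h.le]
  have := intervalIntegral.norm_integral_le_of_norm_le_const (a := 0) (b := x)
    (f := bumpD1 r L) (C := x ^ r * x) fun u hu => by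
      rw [Set.uIoc_of_le h.le] at hu
      rw [Real.norm_of_nonneg (bumpD1_nonneg hr hL u)]
      have := hu.1
      exact (bumpD1_le_rpow hr hu.1.le).trans (by gcongr <;> exact hu.2)
  rw [sub_zero, abs_of_pos h] at this
  calc _ ≤ ‖bump r L x‖ := le_abs_self _
    _ ≤ _ := this
    _ = _ := by rw [Real.rpow_add h, Real.rpow_ofNat]; ring

lemma rpow_le_bump (hr : 0 < r) {x : ℝ} (hx : 0 ≤ x) (hxL : x ≤ L) :
    4⁻¹ ^ (r + 2) * x ^ (r + 2) ≤ bump r L x := by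
  have hL : 0 ≤ L := hx.trans hxL
  have hi := fun a b => (continuous_bumpD1 (L := L) hr).intervalIntegrable (μ := volume) a b
  have hi2 := fun a b => (continuous_tent_rpow (L := L) hr).intervalIntegrable (μ := volume) a b
  have h1 : ∀ u ∈ Set.Icc (x / 2) x, (x / 4) ^ r * (x / 4) ≤ bumpD1 r L u := by
    intro u hu
    have hu2 : u - 2 * L ≤ 0 := by linarith [hu.2]
    rw [bumpD1, tentInt_of_nonpos hr hu2, sub_zero]
    have : ∫ _ in (x / 4)..(x / 2), (x / 4) ^ r ≤ ∫ v in (x / 4)..(x / 2), tent L v ^ r := by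
      refine intervalIntegral.integral_mono_on (by linarith) (by simp) (hi2 _ _) fun v hv => ?_
      rw [tent_of_mem (by linarith [hv.1]) (by linarith [hv.2])]
      gcongr; exact hv.1
    rw [intervalIntegral.integral_const, smul_eq_mul] at this
    have h3 := intervalIntegral.integral_add_adjacent_intervals (hi2 0 (x / 4)) (hi2 (x / 4) (x / 2))
    have h4 := tentInt_nonneg (L := L) hr (x / 4)
    have h5 : tentInt r L (x / 2) ≤ tentInt r L u := monotone_tentInt hr hu.1
    change tentInt r L (x / 4) + _ = tentInt r L (x / 2) at h3
    have h6 : (x / 2 - x / 4) * (x / 4) ^ r = (x / 4) ^ r * (x / 4) := by ring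
    linarith
  have h2 : ∫ _ in (x / 2)..x, (x / 4) ^ r * (x / 4) ≤ ∫ v in (x / 2)..x, bumpD1 r L v :=
    intervalIntegral.integral_mono_on (by linarith) (by simp) (hi _ _) h1
  rw [intervalIntegral.integral_const, smul_eq_mul] at h2
  have h3 := intervalIntegral.integral_add_adjacent_intervals (hi 0 (x / 2)) (hi (x / 2) x)
  change bump r L (x / 2) + _ = bump r L x at h3
  have h4 := bump_nonneg hr hL (x / 2)
  have h5 : 4⁻¹ ^ (r + 2) * x ^ (r + 2) = (x / 4) ^ r * (x / 4) * (x / 4) := by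
    rw [← Real.mul_rpow (by norm_num) hx, inv_mul_eq_div, Real.rpow_add_of_nonneg (by positivity) hr.le
      (by norm_num), Real.rpow_ofNat]; ring
  have h6 : 0 ≤ (x / 4) ^ r * (x / 4) * (x / 4) := by positivity
  have h7 : (x - x / 2) * ((x / 4) ^ r * (x / 4)) = 2 * ((x / 4) ^ r * (x / 4) * (x / 4)) := by ring
  linarith

lemma bumpD2_lip (hr : 0 < r) (hr1 : r ≤ 1) (x y : ℝ) :
    |bumpD2 r L x - bumpD2 r L y| ≤ 2 * |x - y| ^ r := by
  have h : ∀ u v, |tent L u ^ r - tent L v ^ r| ≤ |u - v| ^ r := fun u v =>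
    (abs_rpow_sub_rpow_le hr.le hr1 (tent_nonneg _ _) (tent_nonneg _ _)).trans
      (Real.rpow_le_rpow (abs_nonneg _) (tent_lip L u v) hr.le)
  have h1 := h x y
  have h2 := h (x - 2 * L) (y - 2 * L)
  rw [sub_sub_sub_cancel_right] at h2
  calc _ = |(tent L x ^ r - tent L y ^ r) - (tent L (x - 2 * L) ^ r - tent L (y - 2 * L) ^ r)| := by
        unfold bumpD2; congr 1; ring
    _ ≤ _ := (abs_sub _ _).trans (by linarith)

lemma abs_bumpD2_le (hr : 0 ≤ r) (hL : 0 ≤ L) (x : ℝ) : |bumpD2 r L x| ≤ L ^ r := by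
  have h : ∀ u, tent L u ^ r ∈ Set.Icc 0 (L ^ r) := fun u =>
    ⟨Real.rpow_nonneg (tent_nonneg _ _) _, by
      have := tent_nonneg L u; gcongr; exact tent_le L u hL⟩
  have h1 := h x
  have h2 := h (x - 2 * L)
  rw [bumpD2, abs_le]
  constructor <;> linarith [h1.1, h1.2, h2.1, h2.2]

lemma bumpD2_of_nonpos (hL : 0 ≤ L) {x : ℝ} (hx : x ≤ 0) : bumpD2 r L x = 0 := by
  rw [bumpD2, tent_of_nonpos hx, tent_of_nonpos (by linarith), sub_self]

lemma bump_taylor (hr : 0 < r) (hr1 : r ≤ 1) (x y : ℝ) :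
    |bump r L (x + y) - bump r L x - bumpD1 r L x * y - (1 / 2) * bumpD2 r L x * y ^ 2|
      ≤ 2 * |y| ^ r * y ^ 2 := by
  have hs : ∀ t : ℝ, ∀ s ∈ Set.uIcc 0 t, |s| ≤ |t| := fun t s h => by
    have := Set.abs_sub_left_of_mem_uIcc h
    simpa using this
  have h1 : ∀ t : ℝ, |bumpD1 r L (x + t) - bumpD1 r L x - bumpD2 r L x * t| ≤ 2 * |t| ^ r * |t| := by
    intro t
    have := Convex.norm_image_sub_le_of_norm_hasDerivWithin_le (s := Set.uIcc 0 t)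
      (f := fun s => bumpD1 r L (x + s) - bumpD2 r L x * s)
      (f' := fun s => bumpD2 r L (x + s) - bumpD2 r L x) (C := 2 * |t| ^ r) (x := 0) (y := t)
      (fun s _ => (((hasDerivAt_bumpD1 hr (x + s)).comp_const_add x s).sub
        ((hasDerivAt_id s).const_mul (bumpD2 r L x) |>.congr_deriv (mul_one _))).hasDerivWithinAt)
      (fun s hsm => by
        have := bumpD2_lip (L := L) hr hr1 (x + s) x
        rw [add_sub_cancel_left] at this
        refine this.trans ?_
        have := hs t s hsm
        gcongr)
      (convex_uIcc 0 t) Set.left_mem_uIcc Set.right_mem_uIcc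
    simp only [add_zero, mul_zero, sub_zero, Real.norm_eq_abs] at this
    convert this using 2; ring
  have := Convex.norm_image_sub_le_of_norm_hasDerivWithin_le (s := Set.uIcc 0 y)
      (f := fun s => bump r L (x + s) - bumpD1 r L x * s - (1 / 2) * bumpD2 r L x * s ^ 2)
      (f' := fun s => bumpD1 r L (x + s) - bumpD1 r L x - bumpD2 r L x * s)
      (C := 2 * |y| ^ r * |y|) (x := 0) (y := y)
      (fun s _ => ((((hasDerivAt_bump hr (x + s)).comp_const_add x s).sub
        ((hasDerivAt_id s).const_mul (bumpD1 r L x) |>.congr_deriv (mul_one _))).sub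
        (((hasDerivAt_id s).pow 2).const_mul ((1 / 2) * bumpD2 r L x) |>.congr_deriv
          (by simp; ring))).hasDerivWithinAt)
      (fun s hsm => by
        refine (h1 s).trans ?_
        have := hs y s hsm
        gcongr)
      (convex_uIcc 0 y) Set.left_mem_uIcc Set.right_mem_uIcc
  simp only [add_zero, mul_zero, sub_zero, Real.norm_eq_abs, ne_eq, OfNat.ofNat_ne_zero,
    not_false_eq_true, zero_pow] at this
  calc _ = |bump r L (x + y) - bumpD1 r L x * y - 1 / 2 * bumpD2 r L x * y ^ 2 - bump r L x| := by
        congr 1; ring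
    _ ≤ _ := this
    _ = _ := by rw [mul_assoc, ← sq, sq_abs]

end bump

section bumpJet

variable {ι : Type*} [Fintype ι] {r L : ℝ}

/-- Coordinatewise sum of shifted two-sided substitutes. -/
def bumpVal (r L a : ℝ) (x : ι → ℝ) : ℝ := ∑ i, (bump r L (x i - a) + bump r L (-x i - a))

lemma isJet_bump [DecidableEq ι] {W : Type*} [MeasurableSpace W] (hr : 0 < r) (hr1 : r ≤ 1)
    (hL : 0 ≤ L) (a : ℝ) :
    ∃ B, IsJet (W := W) (ι := ι) B (fun ρ => 4 * (Fintype.card ι + 1) * |ρ| ^ r)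
      (fun _ x => bumpVal r L a x)
      (fun _ x i => bumpD1 r L (x i - a) - bumpD1 r L (-x i - a))
      (fun _ x i k => if i = k then bumpD2 r L (x i - a) + bumpD2 r L (-x i - a) else 0) := by
  set T := tentInt r L (2 * L) with hT
  have hT0 : 0 ≤ T := tentInt_nonneg hr _
  have hLr : 0 ≤ L ^ r := by positivity
  have c0 : Measurable (bump r L) := (continuous_bump hr).measurable
  have c1 : Measurable (bumpD1 r L) := (continuous_bumpD1 hr).measurable
  have c2 : Measurable (bumpD2 r L) := (continuous_bumpD2 hr).measurable
  have hn : (0 : ℝ) ≤ Fintype.card ι := by positivity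
  refine ⟨Fintype.card ι * (2 * (4 * L * T)) + 2 * T + 2 * L ^ r, ?_, fun i => ?_, fun i k => ?_,
    fun w x => ?_, fun w x i => ?_, fun w x i k => ?_, fun w x y => ?_, fun w x y i k => ?_⟩
  · unfold Function.uncurry bumpVal; fun_prop
  · fun_prop
  · split_ifs <;> fun_prop
  · have : |bumpVal r L a x| ≤ ∑ _i : ι, 2 * (4 * L * T) :=
      (Finset.abs_sum_le_sum_abs _ _).trans (Finset.sum_le_sum fun i _ => by
        have h1 := bump_nonneg hr hL (x i - a)
        have h2 := bump_nonneg hr hL (-x i - a)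
        have h3 := bump_le hr hL (x i - a)
        have h4 := bump_le hr hL (-x i - a)
        rw [abs_of_nonneg (by linarith)]; linarith)
    rw [Finset.sum_const, nsmul_eq_mul, Finset.card_univ] at this
    linarith
  · have h1 := bumpD1_nonneg hr hL (x i - a)
    have h2 := bumpD1_nonneg hr hL (-x i - a)
    have h3 := bumpD1_le (L := L) hr (x i - a)
    have h4 := bumpD1_le (L := L) hr (-x i - a)
    have h5 : 0 ≤ Fintype.card ι * (2 * (4 * L * T)) := by positivity
    rw [abs_le]; constructor <;> linarith
  · have h5 : 0 ≤ Fintype.card ι * (2 * (4 * L * T)) := by positivity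
    split_ifs
    · have h1 := abs_bumpD2_le hr.le hL (x i - a)
      have h2 := abs_bumpD2_le hr.le hL (-x i - a)
      exact (abs_add_le _ _).trans (by linarith)
    · rw [abs_zero]; positivity
  · have key : bumpVal r L a (x + y) - bumpVal r L a x
        - ∑ i, (bumpD1 r L (x i - a) - bumpD1 r L (-x i - a)) * y i
        - (1 / 2) * ∑ i, ∑ k, (if i = k then bumpD2 r L (x i - a) + bumpD2 r L (-x i - a) else 0)
          * (y i * y k)
        = ∑ i, ((bump r L (x i - a + y i) - bump r L (x i - a) - bumpD1 r L (x i - a) * y i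
            - (1 / 2) * bumpD2 r L (x i - a) * y i ^ 2)
          + (bump r L (-x i - a + -y i) - bump r L (-x i - a) - bumpD1 r L (-x i - a) * -y i
            - (1 / 2) * bumpD2 r L (-x i - a) * (-y i) ^ 2)) := by
      simp only [ite_mul, zero_mul, Finset.sum_ite_eq, Finset.mem_univ, if_true, bumpVal,
        Finset.mul_sum, ← Finset.sum_sub_distrib, Pi.add_apply]
      refine Finset.sum_congr rfl fun i _ => ?_
      rw [show x i + y i - a = x i - a + y i by ring,
        show -(x i + y i) - a = -x i - a + -y i by ring]
      ring
    rw [key]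
    have hy : ∀ i, 2 * |y i| ^ r * y i ^ 2 ≤ 2 * ‖y‖ ^ r * ‖y‖ ^ 2 := fun i => by
      have := norm_le_pi_norm y i
      rw [Real.norm_eq_abs] at this
      rw [← sq_abs (y i)]; gcongr
    calc _ ≤ ∑ _i : ι, 4 * ‖y‖ ^ r * ‖y‖ ^ 2 := by
          refine (Finset.abs_sum_le_sum_abs _ _).trans (Finset.sum_le_sum fun i _ => ?_)
          have h1 := bump_taylor (L := L) hr hr1 (x i - a) (y i)
          have h2 := bump_taylor (L := L) hr hr1 (-x i - a) (-y i)
          rw [abs_neg] at h2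
          have h3 : 2 * |y i| ^ r * (-y i) ^ 2 = 2 * |y i| ^ r * y i ^ 2 := by ring
          refine (abs_add_le _ _).trans ?_
          linarith [hy i]
      _ ≤ _ := by
          rw [Finset.sum_const, nsmul_eq_mul, Finset.card_univ, abs_of_nonneg (norm_nonneg y)]
          have : 0 ≤ ‖y‖ ^ r * ‖y‖ ^ 2 := by positivity
          nlinarith
  · have h0 : 0 ≤ |‖y‖| ^ r := by positivity
    have hy : |y i| ^ r ≤ |‖y‖| ^ r := by
      have := norm_le_pi_norm y i
      rw [Real.norm_eq_abs] at this
      rw [abs_of_nonneg (norm_nonneg y)]; gcongr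
    split_ifs
    · have h1 := bumpD2_lip (L := L) hr hr1 (x i - a + y i) (x i - a)
      have h2 := bumpD2_lip (L := L) hr hr1 (-x i - a + -y i) (-x i - a)
      rw [add_sub_cancel_left] at h1 h2
      rw [abs_neg] at h2
      rw [Pi.add_apply, show x i + y i - a = x i - a + y i by ring,
        show -(x i + y i) - a = -x i - a + -y i by ring]
      calc _ = |(bumpD2 r L (x i - a + y i) - bumpD2 r L (x i - a))
            + (bumpD2 r L (-x i - a + -y i) - bumpD2 r L (-x i - a))| := by congr 1; ring
        _ ≤ 4 * |y i| ^ r := (abs_add_le _ _).trans (by linarith)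
        _ ≤ 4 * |‖y‖| ^ r := by linarith
        _ ≤ _ := by nlinarith [mul_nonneg hn h0]
    · rw [sub_self, abs_zero]; positivity

end bumpJet

end

section

/-! ### Summability of the Lindeberg errors -/

section scalar

lemma ENNReal.rpow_le_add_div {q : ℝ} (hq : 0 < q) (hq2 : q ≤ 1 / 2) {l : ℝ≥0∞} (hl : 1 ≤ l)
    (hl' : l ≠ ∞) (T : ℝ≥0∞) : T ^ q ≤ l + T / l := by
  have hl0 : l ≠ 0 := (zero_lt_one.trans_le hl).ne'
  rcases le_total T (l ^ (2 : ℝ)) with h | h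
  · refine le_add_right ?_
    calc T ^ q ≤ (l ^ (2 : ℝ)) ^ q := by gcongr
      _ = l ^ (2 * q) := by rw [ENNReal.rpow_mul]
      _ ≤ l ^ (1 : ℝ) := ENNReal.rpow_le_rpow_of_exponent_le hl (by linarith)
      _ = l := ENNReal.rpow_one l
  · refine le_add_left ?_
    have hT : 1 ≤ T := (ENNReal.one_le_rpow hl (by norm_num)).trans h
    have h1 : l ≤ T ^ (1 / 2 : ℝ) := by
      calc l = (l ^ (2 : ℝ)) ^ (1 / 2 : ℝ) := by rw [← ENNReal.rpow_mul]; norm_num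
        _ ≤ _ := by gcongr
    rw [ENNReal.le_div_iff_mul_le (Or.inl hl0) (Or.inl hl')]
    calc T ^ q * l ≤ T ^ (1 / 2 : ℝ) * T ^ (1 / 2 : ℝ) := by
          gcongr
      _ = T := by
        rw [← ENNReal.rpow_add_of_nonneg _ _ (by norm_num) (by norm_num)]; norm_num

lemma exists_bound_of_recursion {T θ₁ θ₂ s : ℕ → ℝ≥0∞} {C : ℝ≥0∞} (hC : C ≠ ∞) {q : ℝ}
    (hq : 0 < q) (hq2 : q ≤ 1 / 2) (hs : Monotone s) (hs1 : ∀ j, 1 ≤ s j)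
    (h1 : ∑' i, θ₁ i ≠ ∞) (h2 : ∑' i, θ₂ i ≠ ∞)
    (hT : ∀ j, T j ≤ C * (1 + ∑ i ∈ Finset.range j, (s i * θ₁ i + T i ^ q * θ₂ i))) :
    ∃ B : ℝ≥0∞, B ≠ ∞ ∧ ∀ j, T j ≤ B * s j := by
  set Θ₁ := ∑' i, θ₁ i
  set Θ₂ := ∑' i, θ₂ i
  set l := 2 * C * Θ₂ + 1 with hl
  have hl1 : 1 ≤ l := le_add_self
  have hlt : l ≠ ∞ := by finiteness
  have hl0 : l ≠ 0 := (zero_lt_one.trans_le hl1).ne'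
  set A := C * (1 + Θ₁ + l * Θ₂) with hA
  refine ⟨2 * A, by finiteness, fun j => ?_⟩
  induction j using Nat.strong_induction_on with
  | _ j ih =>
    have hstep : ∀ i ∈ Finset.range j, s i * θ₁ i + T i ^ q * θ₂ i
        ≤ s j * θ₁ i + (s j * l) * θ₂ i + (s j * (2 * A / l)) * θ₂ i := by
      intro i hi
      have hij := Finset.mem_range.1 hi
      have hsij : s i ≤ s j := hs hij.le
      have hTi : T i ^ q ≤ s j * l + s j * (2 * A / l) := by
        refine (ENNReal.rpow_le_add_div hq hq2 hl1 hlt (T i)).trans (add_le_add ?_ ?_)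
        · exact le_mul_of_one_le_left' (hs1 j)
        · rw [← mul_div_assoc, mul_comm (s j)]
          gcongr
          exact (ih i hij).trans (by gcongr)
      calc _ ≤ s j * θ₁ i + (s j * l + s j * (2 * A / l)) * θ₂ i := by gcongr
        _ = _ := by ring
    have hsum1 : ∑ i ∈ Finset.range j, θ₁ i ≤ Θ₁ := ENNReal.sum_le_tsum _
    have hsum2 : ∑ i ∈ Finset.range j, θ₂ i ≤ Θ₂ := ENNReal.sum_le_tsum _
    have hhalf : C * Θ₂ * (2 * A / l) ≤ A := by
      calc C * Θ₂ * (2 * A / l) = (2 * C * Θ₂) * A / l := by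
            rw [← mul_div_assoc]; congr 1; ring
        _ ≤ l * A / l := by gcongr; exact le_self_add
        _ = A := by rw [mul_comm, mul_div_assoc, ENNReal.div_self hl0 hlt, mul_one]
    calc T j ≤ C * (1 + ∑ i ∈ Finset.range j, (s i * θ₁ i + T i ^ q * θ₂ i)) := hT j
      _ ≤ C * (s j + (s j * Θ₁ + (s j * l) * Θ₂ + (s j * (2 * A / l)) * Θ₂)) := by
          gcongr
          · exact hs1 j
          · refine (Finset.sum_le_sum hstep).trans ?_
            simp only [Finset.sum_add_distrib, ← Finset.mul_sum]
            gcongr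
      _ = s j * A + s j * (C * Θ₂ * (2 * A / l)) := by rw [hA]; ring
      _ ≤ s j * A + s j * A := by gcongr
      _ = _ := by ring

end scalar

section gaussTail

lemma lintegral_exp_gaussian_le (t : ℝ) :
    ∫⁻ x, ENNReal.ofReal (Real.exp (t * (|x| - t))) ∂(gaussianReal 0 1)
      ≤ ENNReal.ofReal (2 * Real.exp (-(t ^ 2) / 2)) := by
  have hi : ∀ s : ℝ, Integrable (fun x => Real.exp (s * x)) (gaussianReal 0 1) :=
    fun s => integrable_exp_mul_gaussianReal s
  have hm : ∀ s : ℝ, ∫ x, Real.exp (s * x) ∂(gaussianReal 0 1) = Real.exp (s ^ 2 / 2) := fun s => by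
    have := congrFun (mgf_id_gaussianReal (μ := 0) (v := 1)) s
    simpa [mgf] using this
  calc _ ≤ ∫⁻ x, ENNReal.ofReal (Real.exp (-t ^ 2) * (Real.exp (t * x) + Real.exp (-t * x)))
        ∂(gaussianReal 0 1) := by
        refine lintegral_mono fun x => ENNReal.ofReal_le_ofReal ?_
        rw [show t * (|x| - t) = -t ^ 2 + t * |x| by ring, Real.exp_add]
        gcongr
        rcases abs_cases x with ⟨h, _⟩ | ⟨h, _⟩
        · rw [h]; linarith [Real.exp_pos (-t * x)]
        · rw [h, mul_neg, ← neg_mul]; linarith [Real.exp_pos (t * x)]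
    _ = _ := by
        rw [← ofReal_integral_eq_lintegral_ofReal
          (f := fun x => Real.exp (-t ^ 2) * (Real.exp (t * x) + Real.exp (-t * x)))
          (((hi t).add (hi (-t))).const_mul _) (ae_of_all _ fun x => by positivity), integral_const_mul,
          integral_add (hi t) (hi (-t)), hm, hm]
        congr 1
        rw [neg_sq, ← two_mul, mul_left_comm, ← Real.exp_add]
        congr 2; ring

lemma lintegral_rpow_gaussian_tail_le {p t : ℝ} (hp0 : 0 < p) (hp3 : p ≤ 3) (ht : 1 ≤ t) :
    ∫⁻ x, ENNReal.ofReal ((max 0 (|x| - t)) ^ p) ∂(gaussianReal 0 1)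
      ≤ ENNReal.ofReal (14 * Real.exp (-(t ^ 2) / 2)) := by
  calc _ ≤ ∫⁻ x, ENNReal.ofReal 7 * ENNReal.ofReal (Real.exp (t * (|x| - t)))
        ∂(gaussianReal 0 1) := by
        refine lintegral_mono fun x => ?_
        rw [← ENNReal.ofReal_mul (by norm_num)]
        refine ENNReal.ofReal_le_ofReal ?_
        set u := |x| - t
        rcases le_total u 0 with h | h
        · rw [max_eq_left h, Real.zero_rpow hp0.ne']; positivity
        · rw [max_eq_right h]
          have h1 : u ^ p ≤ 1 + u ^ 3 := by
            rcases le_total u 1 with h1 | h1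
            · have := Real.rpow_le_one h h1 hp0.le
              nlinarith [pow_nonneg h 3]
            · have := Real.rpow_le_rpow_of_exponent_le h1 hp3
              rw [Real.rpow_ofNat] at this; linarith
          have h2 := Real.pow_div_factorial_le_exp u h 3
          norm_num [Nat.factorial] at h2
          have h3 : Real.exp u ≤ Real.exp (t * u) := Real.exp_le_exp.2 (by nlinarith)
          have h4 := Real.one_le_exp h
          linarith
    _ ≤ ENNReal.ofReal 7 * ENNReal.ofReal (2 * Real.exp (-(t ^ 2) / 2)) := by
        rw [lintegral_const_mul _ (by fun_prop)]
        gcongr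
        exact lintegral_exp_gaussian_le t
    _ = _ := by rw [← ENNReal.ofReal_mul (by norm_num)]; congr 1; ring

end gaussTail

section lindMeas

variable {ι : Type*} [Fintype ι]

/-- The measures on the line through which the Lindeberg error depends on the modulus. -/
def lindMeas (μ : Measure (ℕ → ι → ℝ)) (h : ℕ → ι → ι → (ℕ → ι → ℝ) → ℝ) : ℕ → Measure ℝ
  | 0 => (μ.withDensity fun w => ENNReal.ofReal (‖w 0‖ ^ 2)).map (fun w => ‖w 0‖)
      + ((stdG ι).withDensity fun y => ENNReal.ofReal (‖y‖ ^ 2)).map (fun y => ‖y‖)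
  | i + 1 => ((2 : ℝ≥0∞) ^ (i + 1))⁻¹ • ((μ.withDensity (hNorm h i)).map (fun w => ‖seqSum (2 ^ i) w‖)
      + (∫⁻ w, hNorm h i w ∂μ) • (stdG ι).map (fun y => ‖√(2 ^ i) • y‖))

variable {p : ℝ} {μ : Measure (ℕ → ι → ℝ)} {h : ℕ → ι → ι → (ℕ → ι → ℝ) → ℝ}

lemma lintegral_lindMeas_zero {f : ℝ → ℝ≥0∞} (hf : Measurable f) :
    ∫⁻ ρ, f ρ ∂(lindMeas μ h 0) = ∫⁻ w, f ‖w 0‖ * ENNReal.ofReal (‖w 0‖ ^ 2) ∂μ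
      + ∫⁻ y, f ‖y‖ * ENNReal.ofReal (‖y‖ ^ 2) ∂(stdG ι) := by
  have h1 : Measurable fun w : ℕ → ι → ℝ => ‖w 0‖ := by fun_prop
  rw [lindMeas, lintegral_add_measure, lintegral_map hf h1, lintegral_map hf measurable_norm,
    lintegral_withDensity_eq_lintegral_mul _ (by fun_prop) (g := fun w : ℕ → ι → ℝ => f ‖w 0‖) (hf.comp h1),
    lintegral_withDensity_eq_lintegral_mul _ (by fun_prop) (g := fun y : ι → ℝ => f ‖y‖)
      (hf.comp measurable_norm)]
  simp only [Pi.mul_apply, mul_comm]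

lemma lintegral_lindMeas_succ (hh : ∀ i a b, Measurable (h i a b)) {f : ℝ → ℝ≥0∞}
    (hf : Measurable f) (i : ℕ) :
    ∫⁻ ρ, f ρ ∂(lindMeas μ h (i + 1)) = ((2 : ℝ≥0∞) ^ (i + 1))⁻¹ *
      (∫⁻ w, f ‖seqSum (2 ^ i) w‖ * hNorm h i w ∂μ
        + (∫⁻ y, f ‖√(2 ^ i) • y‖ ∂(stdG ι)) * ∫⁻ w, hNorm h i w ∂μ) := by
  have h1 : Measurable fun w : ℕ → ι → ℝ => ‖seqSum (2 ^ i) w‖ := by fun_prop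
  have h2 : Measurable (hNorm h i) := by unfold hNorm; fun_prop
  rw [lindMeas, lintegral_smul_measure, lintegral_add_measure, lintegral_map hf h1,
    lintegral_smul_measure, lintegral_map hf (by fun_prop),
    lintegral_withDensity_eq_lintegral_mul _ h2 (g := fun w => f ‖seqSum (2 ^ i) w‖)
      (hf.comp h1)]
  simp only [Pi.mul_apply, mul_comm, smul_eq_mul]

lemma lindErr_eq (hh : ∀ i a b, Measurable (h i a b)) {m : ℝ → ℝ} (hm : Measurable m) (j : ℕ) :
    lindErr μ h m j = 2 ^ j * ∑ i ∈ Finset.range (j + 1),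
      ∫⁻ ρ, ENNReal.ofReal (m ρ) ∂(lindMeas μ h i) := by
  have hm' : Measurable fun ρ => ENNReal.ofReal (m ρ) := hm.ennreal_ofReal
  induction j with
  | zero =>
    simp only [lindErr, pow_zero, one_mul, zero_add, Finset.range_one, Finset.sum_singleton]
    rw [lintegral_lindMeas_zero hm']
    simp only [ENNReal.ofReal_mul' (sq_nonneg _)]
  | succ j ih =>
    rw [lindErr, ih, Finset.sum_range_succ _ (j + 1), lintegral_lindMeas_succ hh hm', mul_add,
      ← mul_assoc _ ((2 : ℝ≥0∞) ^ (j + 1))⁻¹, ENNReal.mul_inv_cancel (by simp) (by finiteness),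
      one_mul, pow_succ' _ j, mul_assoc]

lemma exists_tsum_lindErr_le (hp : 2 < p) (hp3 : p ≤ 3) (hh : ∀ i a b, Measurable (h i a b)) :
    ∃ C : ℝ≥0∞, C ≠ ∞ ∧
      ∑' j, ENNReal.ofReal (scaleWeight p j) * lindErr μ h (gsMod ι (dScale j)) j
      ≤ C * ∑' i : ℕ, ENNReal.ofReal (((i : ℝ) + 1) ^ (-(1 / 2) : ℝ)) *
        ∫⁻ ρ, ENNReal.ofReal (|ρ| ^ (p - 2)) ∂(lindMeas μ h i) := by
  obtain ⟨C, hC, hG⟩ := exists_sum_scaleWeight_min_le hp hp3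
  have hJ := one_le_gJ (ι := ι)
  refine ⟨ENNReal.ofReal (8 * gJ ι) * ENNReal.ofReal C, by finiteness, ?_⟩
  set f : ℕ → ℕ → ℝ → ℝ := fun i j ρ =>
    if i ≤ j then scaleWeight p j * max 0 (min 1 ((dScale j)⁻¹ * ρ)) else 0 with hf
  have hfm : ∀ i j, Measurable (f i j) := fun i j => by
    simp only [hf]; split_ifs <;> fun_prop
  have h0 : ∀ i j ρ, 0 ≤ f i j ρ := fun i j ρ => by
    simp only [hf]
    have := scaleWeight_nonneg p j
    split_ifs
    · positivity
    · exact le_rfl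
  have e1 : ∀ j, ENNReal.ofReal (scaleWeight p j) * lindErr μ h (gsMod ι (dScale j)) j
      ≤ ENNReal.ofReal (8 * gJ ι) * ∑' i, ∫⁻ ρ, ENNReal.ofReal (f i j ρ) ∂(lindMeas μ h i) := by
    intro j
    have hmm : Measurable (gsMod ι (dScale j)) := by unfold gsMod; fun_prop
    rw [lindErr_eq hh hmm, ← mul_assoc, Finset.mul_sum, ← ENNReal.tsum_mul_left]
    refine le_trans ?_ (ENNReal.sum_le_tsum (Finset.range (j + 1)))
    refine Finset.sum_le_sum fun i hi => ?_
    have hij : i ≤ j := Nat.lt_succ_iff.1 (Finset.mem_range.1 hi)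
    rw [← lintegral_const_mul _ hmm.ennreal_ofReal, ← lintegral_const_mul _ (hfm i j).ennreal_ofReal]
    refine lintegral_mono fun ρ => ?_
    rw [show (2 : ℝ≥0∞) ^ j = ENNReal.ofReal (2 ^ j) by
      rw [ENNReal.ofReal_pow (by norm_num), ENNReal.ofReal_ofNat],
      ← ENNReal.ofReal_mul (scaleWeight_nonneg p j),
      ← ENNReal.ofReal_mul (mul_nonneg (scaleWeight_nonneg p j) (by positivity)),
      ← ENNReal.ofReal_mul (by linarith)]
    refine ENNReal.ofReal_le_ofReal ?_
    have hd := dScale_pos j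
    simp only [hf, if_pos hij, gsMod]
    have hw := scaleWeight_nonneg p j
    calc _ = 8 * gJ ι * (scaleWeight p j * min 1 ((dScale j)⁻¹ * ρ)) := by
          rw [← dScale_sq]; field_simp
      _ ≤ _ := by gcongr; exact le_max_right _ _
  calc _ ≤ ∑' j, ENNReal.ofReal (8 * gJ ι) *
        ∑' i, ∫⁻ ρ, ENNReal.ofReal (f i j ρ) ∂(lindMeas μ h i) := ENNReal.tsum_le_tsum e1
    _ = ENNReal.ofReal (8 * gJ ι) *
        ∑' i, ∫⁻ ρ, ∑' j, ENNReal.ofReal (f i j ρ) ∂(lindMeas μ h i) := by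
        rw [ENNReal.tsum_mul_left, ENNReal.tsum_comm]
        simp_rw [lintegral_tsum fun j => (hfm _ j).ennreal_ofReal.aemeasurable]
    _ ≤ ENNReal.ofReal (8 * gJ ι) * ∑' i : ℕ, ENNReal.ofReal C *
        (ENNReal.ofReal (((i : ℝ) + 1) ^ (-(1 / 2) : ℝ)) *
        ∫⁻ ρ, ENNReal.ofReal (|ρ| ^ (p - 2)) ∂(lindMeas μ h i)) := by
        gcongr with i
        rw [← lintegral_const_mul _ (by fun_prop), ← lintegral_const_mul _ (by fun_prop)]
        refine lintegral_mono fun ρ => ?_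
        rw [← ENNReal.ofReal_mul (by positivity), ← ENNReal.ofReal_mul hC, ← mul_assoc]
        refine ENNReal.tsum_le_of_sum_range_le fun n => ?_
        rw [← ENNReal.ofReal_sum_of_nonneg fun j _ => h0 i j ρ]
        exact ENNReal.ofReal_le_ofReal (hG i n ρ)
    _ = _ := by rw [ENNReal.tsum_mul_left, mul_assoc]

end lindMeas

end

section

/-! ### Truncated moments of dyadic block sums -/

section tailMoment

variable {ι : Type*} [Fintype ι]

/-- The truncation level for block sums of length `2 ^ j`. -/
def tailLevel (j : ℕ) : ℝ := 2 * dScale j * √((j : ℝ) + 1)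

lemma tailLevel_nonneg (j : ℕ) : 0 ≤ tailLevel j := by
  have := dScale_pos j
  unfold tailLevel; positivity

/-- The part of a coordinate of the block sum that exceeds the truncation level. -/
def tailPart (j : ℕ) (w : ℕ → ι → ℝ) (a : ι) : ℝ := max 0 (|seqSum (2 ^ j) w a| - tailLevel j)

omit [Fintype ι] in
lemma tailPart_nonneg (j : ℕ) (w : ℕ → ι → ℝ) (a : ι) : 0 ≤ tailPart j w a := le_max_left _ _

omit [Fintype ι] in
@[fun_prop]
lemma measurable_tailPart (j : ℕ) (a : ι) : Measurable fun w : ℕ → ι → ℝ => tailPart j w a := by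
  unfold tailPart; fun_prop

lemma bumpVal_le {r L : ℝ} (hr : 0 < r) (hL : 0 ≤ L) (a : ℝ) (x : ι → ℝ) :
    bumpVal r L a x ≤ ∑ i, 2 * (max 0 (|x i| - a)) ^ (r + 2) := by
  refine Finset.sum_le_sum fun i _ => ?_
  have h1 : ∀ u, u ≤ |x i| → bump r L (u - a) ≤ (max 0 (|x i| - a)) ^ (r + 2) := fun u hu =>
    (bump_le_rpow hr hL _).trans (by gcongr)
  linarith [h1 _ (le_abs_self (x i)), h1 _ (neg_le_abs (x i))]

lemma le_bumpVal {r L : ℝ} (hr : 0 < r) (hL : 0 ≤ L) (a : ℝ) (x : ι → ℝ) :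
    ∑ i, 4⁻¹ ^ (r + 2) * (min L (max 0 (|x i| - a))) ^ (r + 2) ≤ bumpVal r L a x := by
  refine Finset.sum_le_sum fun i _ => ?_
  have h0 : 0 ≤ min L (max 0 (|x i| - a)) := le_min hL (le_max_left _ _)
  have h1 := rpow_le_bump hr h0 (min_le_left _ _)
  have h2 : bump r L (min L (max 0 (|x i| - a))) ≤ bump r L (|x i| - a) := by
    rcases le_total (|x i| - a) 0 with h | h
    · rw [max_eq_left h, min_eq_right hL, bump_zero]; exact bump_nonneg hr hL _
    · rw [max_eq_right h]; exact monotone_bump hr hL (min_le_right _ _)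
  have h3 := bump_nonneg hr hL (x i - a)
  have h4 := bump_nonneg hr hL (-x i - a)
  rcases abs_choice (x i) with h | h <;> rw [h] at h1 h2 ⊢ <;> linarith

lemma gaussian_tail_scaled_le {p : ℝ} (hp : 2 < p) (hp3 : p ≤ 3) (j : ℕ) :
    ∫⁻ x, ENNReal.ofReal ((max 0 (|√(2 ^ j) * x| - tailLevel j)) ^ p) ∂(gaussianReal 0 1)
      ≤ ENNReal.ofReal (14 * 2 ^ j) := by
  have hd := dScale_pos j
  have hj : (0 : ℝ) ≤ j := Nat.cast_nonneg j
  set t := 2 * √((j : ℝ) + 1) with ht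
  have ht1 : 1 ≤ t := by
    have : 1 ≤ √((j : ℝ) + 1) := Real.one_le_sqrt.2 (by linarith)
    linarith
  have ht2 : t ^ 2 = 4 * (j + 1) := by rw [ht, mul_pow, Real.sq_sqrt (by linarith)]; ring
  have e1 : ∀ x : ℝ, (max 0 (|√(2 ^ j) * x| - tailLevel j)) ^ p
      = dScale j ^ p * (max 0 (|x| - t)) ^ p := fun x => by
    rw [← Real.mul_rpow hd.le (le_max_left _ _), mul_max_of_nonneg _ _ hd.le, mul_zero, mul_sub,
      abs_mul, abs_of_nonneg (Real.sqrt_nonneg _), tailLevel, ht, dScale]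
    congr 3; ring
  simp_rw [e1]
  calc _ = ENNReal.ofReal (dScale j ^ p) *
        ∫⁻ x, ENNReal.ofReal ((max 0 (|x| - t)) ^ p) ∂(gaussianReal 0 1) := by
        rw [← lintegral_const_mul _ (by fun_prop)]
        simp_rw [ENNReal.ofReal_mul (Real.rpow_nonneg hd.le p)]
    _ ≤ ENNReal.ofReal (dScale j ^ p) * ENNReal.ofReal (14 * Real.exp (-(t ^ 2) / 2)) := by
        gcongr; exact lintegral_rpow_gaussian_tail_le (by linarith) hp3 ht1
    _ ≤ _ := by
        rw [← ENNReal.ofReal_mul (by positivity)]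
        refine ENNReal.ofReal_le_ofReal ?_
        have h1 : dScale j ^ p ≤ 2 ^ j * Real.exp j := by
          rw [dScale_rpow]
          calc (2 : ℝ) ^ ((j : ℝ) * (p / 2)) ≤ 2 ^ ((j : ℝ) + j) :=
                Real.rpow_le_rpow_of_exponent_le (by norm_num) (by nlinarith)
            _ = 2 ^ j * 2 ^ j := by rw [Real.rpow_add (by norm_num), Real.rpow_natCast]
            _ ≤ _ := by
                gcongr
                rw [← Real.exp_one_pow j]
                gcongr
                linarith [Real.add_one_le_exp (1 : ℝ)]
        have h2 : Real.exp j * Real.exp (-(t ^ 2) / 2) ≤ 1 := by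
          rw [← Real.exp_add, Real.exp_le_one_iff, ht2]; linarith
        have h3 := Real.exp_pos (-(t ^ 2) / 2)
        calc _ ≤ 2 ^ j * Real.exp j * (14 * Real.exp (-(t ^ 2) / 2)) := by gcongr
          _ = 14 * 2 ^ j * (Real.exp j * Real.exp (-(t ^ 2) / 2)) := by ring
          _ ≤ 14 * 2 ^ j * 1 := by gcongr
          _ = _ := mul_one _

variable [DecidableEq ι] {p : ℝ} {μ : Measure (ℕ → ι → ℝ)} {h : ℕ → ι → ι → (ℕ → ι → ℝ) → ℝ}

/-- Moments of order `p - 2` of the Lindeberg measures. -/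
def lindMoment (p : ℝ) (μ : Measure (ℕ → ι → ℝ)) (h : ℕ → ι → ι → (ℕ → ι → ℝ) → ℝ) (i : ℕ) :
    ℝ≥0∞ := ∫⁻ ρ, ENNReal.ofReal (|ρ| ^ (p - 2)) ∂(lindMeas μ h i)

/-- Normalized truncated moments of order `p`. -/
def tailMoment (p : ℝ) (μ : Measure (ℕ → ι → ℝ)) (j : ℕ) : ℝ≥0∞ :=
  (2 ^ j)⁻¹ * ∫⁻ w, ∑ a, ENNReal.ofReal (tailPart j w a ^ p) ∂μ

namespace RevCore

lemma lintegral_min_tailPart_le (hc : RevCore p μ h) {L : ℝ} (hL : 0 ≤ L) (j : ℕ) :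
    ∫⁻ w, ∑ a, ENNReal.ofReal ((min L (tailPart j w a)) ^ p) ∂μ
      ≤ ENNReal.ofReal (4 ^ p) * (ENNReal.ofReal (28 * Fintype.card ι) +
        ENNReal.ofReal (4 * (Fintype.card ι + 1))) *
        (2 ^ j * (1 + ∑ i ∈ Finset.range (j + 1), lindMoment p μ h i)) := by
  have := hc.prob
  have hp := hc.two_lt
  have hr : 0 < p - 2 := by linarith
  have hr1 : p - 2 ≤ 1 := by linarith [hc.le_three]
  have hrp : p - 2 + 2 = p := by ring
  have ha := tailLevel_nonneg j
  obtain ⟨B, hJ⟩ := isJet_bump (ι := ι) (W := ℕ → ι → ℝ) hr hr1 hL (tailLevel j)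
  have hm : Measurable fun ρ : ℝ => 4 * ((Fintype.card ι : ℝ) + 1) * |ρ| ^ (p - 2) := by fun_prop
  have hlin := hc.lindeberg hm j hJ
  have hH : ∀ a b : ι, (if a = b then bumpD2 (p - 2) L ((0 : ι → ℝ) a - tailLevel j)
      + bumpD2 (p - 2) L (-(0 : ι → ℝ) a - tailLevel j) else 0) = 0 := fun a b => by
    simp only [Pi.zero_apply]
    rw [bumpD2_of_nonpos hL (by linarith), bumpD2_of_nonpos hL (by linarith)]; simp
  simp only [hH, zero_mul, integral_zero, Finset.sum_const_zero, mul_zero, sub_zero] at hlin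
  set v := bumpVal (ι := ι) (p - 2) L (tailLevel j) with hv
  have hvm : Measurable v := hJ.mv.comp (f := fun x : ι → ℝ => ((0 : ℕ → ι → ℝ), x)) (by fun_prop)
  have hv0 : ∀ x, 0 ≤ v x := fun x => Finset.sum_nonneg fun i _ =>
    add_nonneg (bump_nonneg hr hL _) (bump_nonneg hr hL _)
  have hvB : ∀ x, |v x| ≤ B := fun x => hJ.bv 0 x
  rw [lindErr_eq hc.h_meas hm, integral_const, probReal_univ, one_smul] at hlin
  have hK : ∀ i, ∫⁻ ρ, ENNReal.ofReal (4 * ((Fintype.card ι : ℝ) + 1) * |ρ| ^ (p - 2))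
      ∂(lindMeas μ h i) = ENNReal.ofReal (4 * (Fintype.card ι + 1)) * lindMoment p μ h i := by
    intro i
    rw [lindMoment, ← lintegral_const_mul _ (by fun_prop)]
    simp_rw [ENNReal.ofReal_mul (show (0 : ℝ) ≤ 4 * ((Fintype.card ι : ℝ) + 1) by positivity)]
  simp_rw [hK, ← Finset.mul_sum] at hlin
  have hG : ENNReal.ofReal (∫ y, v (√(2 ^ j) • y) ∂(stdG ι))
      ≤ ENNReal.ofReal (28 * Fintype.card ι) * 2 ^ j := by
    rw [ofReal_integral_eq_lintegral_ofReal
      (integrable_of_abs_le (by fun_prop) fun y => hvB _) (ae_of_all _ fun y => hv0 _)]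
    calc _ ≤ ∫⁻ y, ∑ a, 2 * ENNReal.ofReal ((max 0 (|√(2 ^ j) * y a| - tailLevel j)) ^ p)
          ∂(stdG ι) := by
          refine lintegral_mono fun y => (ENNReal.ofReal_le_ofReal (bumpVal_le hr hL _ _)).trans ?_
          rw [ENNReal.ofReal_sum_of_nonneg fun i _ => by positivity, hrp]
          refine Finset.sum_le_sum fun a _ => ?_
          rw [ENNReal.ofReal_mul (by norm_num), ENNReal.ofReal_ofNat]
          simp
      _ = ∑ a : ι, 2 * ∫⁻ x, ENNReal.ofReal ((max 0 (|√(2 ^ j) * x| - tailLevel j)) ^ p)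
          ∂(gaussianReal 0 1) := by
          rw [lintegral_finsetSum _ fun a _ => by fun_prop]
          refine Finset.sum_congr rfl fun a _ => ?_
          rw [lintegral_const_mul _ (by fun_prop), ← (stdG_eval a).lintegral_comp (by fun_prop)]
      _ ≤ ∑ _a : ι, 2 * ENNReal.ofReal (14 * 2 ^ j) := by
          gcongr; exact gaussian_tail_scaled_le hp hc.le_three j
      _ = _ := by
          rw [Finset.sum_const, Finset.card_univ, nsmul_eq_mul,
            show (28 : ℝ) * Fintype.card ι = Fintype.card ι * (2 * 14) by ring,
            ENNReal.ofReal_mul (by positivity), ENNReal.ofReal_mul (by norm_num),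
            ENNReal.ofReal_mul (by norm_num), ENNReal.ofReal_natCast, ENNReal.ofReal_pow (by norm_num)]
          simp only [ENNReal.ofReal_ofNat]; ring
  set A := ∫ w : ℕ → ι → ℝ, v (seqSum (2 ^ j) w) ∂μ
  set G := ∫ y, v (√(2 ^ j) • y) ∂(stdG ι)
  have hA : ENNReal.ofReal A ≤ ENNReal.ofReal G + ‖A - G‖ₑ := by
    rw [Real.enorm_eq_ofReal_abs]
    refine le_trans (ENNReal.ofReal_le_ofReal ?_) ENNReal.ofReal_add_le
    linarith [le_abs_self (A - G)]
  calc _ ≤ ∫⁻ w, ENNReal.ofReal (4 ^ p) * ENNReal.ofReal (v (seqSum (2 ^ j) w)) ∂μ := by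
        refine lintegral_mono fun w => ?_
        rw [← ENNReal.ofReal_mul (by positivity), ← ENNReal.ofReal_sum_of_nonneg fun a _ =>
          Real.rpow_nonneg (le_min hL (tailPart_nonneg _ _ _)) _]
        refine ENNReal.ofReal_le_ofReal ?_
        have := le_bumpVal hr hL (tailLevel j) (seqSum (2 ^ j) w)
        rw [← Finset.mul_sum, hrp] at this
        calc _ = 4 ^ p * (4⁻¹ ^ p * ∑ a, (min L (tailPart j w a)) ^ p) := by
              rw [← mul_assoc, ← Real.mul_rpow (by norm_num) (by norm_num)]; norm_num
          _ ≤ _ := by gcongr; exact this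
    _ = ENNReal.ofReal (4 ^ p) * ENNReal.ofReal A := by
        rw [lintegral_const_mul _ (by fun_prop), ofReal_integral_eq_lintegral_ofReal
          (integrable_of_abs_le (by fun_prop) fun y => hvB _) (ae_of_all _ fun y => hv0 _)]
    _ ≤ ENNReal.ofReal (4 ^ p) * (ENNReal.ofReal (28 * Fintype.card ι) * 2 ^ j +
        2 ^ j * (ENNReal.ofReal (4 * (Fintype.card ι + 1)) *
          ∑ i ∈ Finset.range (j + 1), lindMoment p μ h i)) := by
        gcongr; exact hA.trans (add_le_add hG hlin)
    _ ≤ _ := by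
        set c₁ := ENNReal.ofReal (28 * Fintype.card ι)
        set c₂ := ENNReal.ofReal (4 * (Fintype.card ι + 1))
        set K := ∑ i ∈ Finset.range (j + 1), lindMoment p μ h i
        rw [mul_assoc]
        gcongr
        calc _ ≤ c₁ * 2 ^ j + 2 ^ j * (c₂ * K) + (c₁ * (2 ^ j * K) + c₂ * 2 ^ j) := le_self_add
          _ = _ := by ring

lemma exists_tailMoment_le (hc : RevCore p μ h) : ∃ C : ℝ≥0∞, C ≠ ∞ ∧ ∀ j,
    tailMoment p μ j ≤ C * (1 + ∑ i ∈ Finset.range (j + 1), lindMoment p μ h i) := by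
  refine ⟨ENNReal.ofReal (4 ^ p) * (ENNReal.ofReal (28 * Fintype.card ι) +
        ENNReal.ofReal (4 * (Fintype.card ι + 1))), by finiteness, fun j => ?_⟩
  · have key : ∫⁻ w, ∑ a, ENNReal.ofReal (tailPart j w a ^ p) ∂μ
        ≤ ENNReal.ofReal (4 ^ p) * (ENNReal.ofReal (28 * Fintype.card ι) +
        ENNReal.ofReal (4 * (Fintype.card ι + 1))) *
        (2 ^ j * (1 + ∑ i ∈ Finset.range (j + 1), lindMoment p μ h i)) := by
      have hp : 0 ≤ p := by linarith [hc.two_lt]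
      have h1 : ∀ w : ℕ → ι → ℝ, ∑ a, ENNReal.ofReal (tailPart j w a ^ p)
          = ⨆ L : ℕ, ∑ a, ENNReal.ofReal ((min (L : ℝ) (tailPart j w a)) ^ p) := by
        intro w
        refine le_antisymm ?_ (iSup_le fun L => Finset.sum_le_sum fun a _ => ?_)
        · obtain ⟨L, hL⟩ := exists_nat_ge (∑ a, tailPart j w a)
          refine le_trans (Finset.sum_le_sum fun a ha => ?_) (le_iSup
            (fun L : ℕ => ∑ a, ENNReal.ofReal ((min (L : ℝ) (tailPart j w a)) ^ p)) L)
          rw [min_eq_right]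
          exact (Finset.single_le_sum (fun b _ => tailPart_nonneg j w b) ha).trans hL
        · have := tailPart_nonneg j w a
          gcongr
          exact min_le_right _ _
      simp_rw [h1]
      rw [lintegral_iSup (fun L => by fun_prop)]
      · exact iSup_le fun L => hc.lintegral_min_tailPart_le (Nat.cast_nonneg L) j
      · intro L L' hLL w
        refine Finset.sum_le_sum fun a _ => ?_
        have := tailPart_nonneg j w a
        have hL0 : (0 : ℝ) ≤ L := Nat.cast_nonneg L
        gcongr
    rw [tailMoment]
    refine (mul_le_mul_right key _).trans (le_of_eq ?_)
    set X := (1 + ∑ i ∈ Finset.range (j + 1), lindMoment p μ h i)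
    rw [mul_left_comm, ← mul_assoc _ _ X, ENNReal.inv_mul_cancel (by simp) (by finiteness), one_mul]

end RevCore

end tailMoment

end

section

/-! ### Boundedness of the moments entering the Lindeberg scheme -/

section lindMoment

variable {ι : Type*} [Fintype ι] [DecidableEq ι] {p : ℝ} {μ : Measure (ℕ → ι → ℝ)}
  {h : ℕ → ι → ι → (ℕ → ι → ℝ) → ℝ}

/-- Dyadic weighted `L¹` size of `h`. -/
def hOne (p : ℝ) (μ : Measure (ℕ → ι → ℝ)) (h : ℕ → ι → ι → (ℕ → ι → ℝ) → ℝ) (i : ℕ) : ℝ≥0∞ :=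
  ENNReal.ofReal ((2 : ℝ) ^ ((i : ℝ) * (p / 2 - 2))) * ∑ a, ∑ b, eLpNorm (h i a b) 1 μ

/-- Dyadic weighted `L^{p/2}` size of `h`. -/
def hHalf (p : ℝ) (μ : Measure (ℕ → ι → ℝ)) (h : ℕ → ι → ι → (ℕ → ι → ℝ) → ℝ) (i : ℕ) : ℝ≥0∞ :=
  ENNReal.ofReal ((2 : ℝ) ^ (-(i : ℝ) * (2 / p))) *
    ∑ a, ∑ b, eLpNorm (h i a b) (ENNReal.ofReal (p / 2)) μ

omit [DecidableEq ι] in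
lemma tsum_mul_sum_sum_lt_top {f : ℕ → ℝ≥0∞} {g : ℕ → ι → ι → ℝ≥0∞}
    (hfg : ∀ a b, ∑' i, f i * g i a b < ∞) : ∑' i, f i * ∑ a, ∑ b, g i a b < ∞ := by
  simp_rw [Finset.mul_sum]
  rw [Summable.tsum_finsetSum fun _ _ => ENNReal.summable]
  refine ENNReal.sum_lt_top.2 fun a _ => ?_
  rw [Summable.tsum_finsetSum fun _ _ => ENNReal.summable]
  exact ENNReal.sum_lt_top.2 fun b _ => hfg a b

/-- Square root growth as an extended nonnegative real. -/
def sqrtGrowth (i : ℕ) : ℝ≥0∞ := ENNReal.ofReal (((i : ℝ) + 1) ^ (1 / 2 : ℝ))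

lemma monotone_sqrtGrowth : Monotone sqrtGrowth := fun i j hij => by
  unfold sqrtGrowth; gcongr

lemma one_le_sqrtGrowth (i : ℕ) : 1 ≤ sqrtGrowth i := by
  rw [sqrtGrowth, ENNReal.one_le_ofReal]
  exact Real.one_le_rpow (by have := Nat.cast_nonneg (α := ℝ) i; linarith) (by norm_num)

lemma ofReal_two_rpow (x : ℝ) : ENNReal.ofReal ((2 : ℝ) ^ x) = (2 : ℝ≥0∞) ^ x := by
  rw [← ENNReal.ofReal_rpow_of_pos (by norm_num), ENNReal.ofReal_ofNat]

namespace RevCore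

lemma tsum_hOne_lt_top (hc : RevCore p μ h) : ∑' i, hOne p μ h i < ∞ :=
  tsum_mul_sum_sum_lt_top hc.sum_one

lemma tsum_hHalf_lt_top (hc : RevCore p μ h) : ∑' i, hHalf p μ h i < ∞ :=
  tsum_mul_sum_sum_lt_top hc.sum_half

lemma lindMoment_zero_lt_top (hc : RevCore p μ h) : lindMoment p μ h 0 < ∞ := by
  have hp := hc.two_lt
  have e1 : ∀ x : ℝ, 0 ≤ x → ENNReal.ofReal (|x| ^ (p - 2)) * ENNReal.ofReal (x ^ 2)
      = ENNReal.ofReal x ^ p := fun x hx => by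
    rw [← ENNReal.ofReal_mul (by positivity), abs_of_nonneg hx,
      ENNReal.ofReal_rpow_of_nonneg hx (by linarith), ← Real.rpow_natCast x 2,
      ← Real.rpow_add_of_nonneg hx (by linarith) (by norm_num)]
    norm_num
  have hfin : ∀ {α : Type _} [MeasurableSpace α] {ν : Measure α} {f : α → ι → ℝ},
      MemLp f (ENNReal.ofReal p) ν → ∫⁻ x, ENNReal.ofReal ‖f x‖ ^ p ∂ν < ∞ := by
    intro α _ ν f hf
    have := lintegral_rpow_enorm_lt_top_of_eLpNorm_lt_top
      (by rw [Ne, ENNReal.ofReal_eq_zero]; linarith) ENNReal.ofReal_ne_top hf.2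
    simpa only [ENNReal.toReal_ofReal (by linarith : (0 : ℝ) ≤ p), ofReal_norm] using this
  rw [lindMoment, lintegral_lindMeas_zero (by fun_prop)]
  simp_rw [e1 _ (norm_nonneg _)]
  exact ENNReal.add_lt_top.2 ⟨hfin hc.memLp, hfin (stdG_memLp _ ENNReal.ofReal_ne_top)⟩

lemma ofReal_norm_seqSum_rpow_le (hc : RevCore p μ h) (i : ℕ) (w : ℕ → ι → ℝ) :
    ENNReal.ofReal (|‖seqSum (2 ^ i) w‖| ^ (p - 2))
      ≤ ENNReal.ofReal (tailLevel i ^ (p - 2)) + ∑ a, ENNReal.ofReal (tailPart i w a ^ (p - 2)) := by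
  have hr : 0 < p - 2 := by linarith [hc.two_lt]
  have hr1 : p - 2 ≤ 1 := by linarith [hc.le_three]
  have hl := tailLevel_nonneg i
  rw [abs_of_nonneg (norm_nonneg _)]
  rcases isEmpty_or_nonempty ι with he | hne
  · rw [Subsingleton.elim (seqSum (2 ^ i) w) 0, norm_zero, Real.zero_rpow hr.ne']; simp
  obtain ⟨a, ha⟩ := Finite.exists_max fun a => ‖seqSum (2 ^ i) w a‖
  have h1 : ‖seqSum (2 ^ i) w‖ ≤ tailLevel i + tailPart i w a := by
    refine ((pi_norm_le_iff_of_nonneg (norm_nonneg _)).2 ha).trans ?_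
    rw [Real.norm_eq_abs]
    linarith [le_max_right 0 (|seqSum (2 ^ i) w a| - tailLevel i),
      show tailPart i w a = max 0 (|seqSum (2 ^ i) w a| - tailLevel i) from rfl]
  have h2 := tailPart_nonneg i w a
  calc _ ≤ ENNReal.ofReal (tailLevel i ^ (p - 2) + tailPart i w a ^ (p - 2)) := by
        refine ENNReal.ofReal_le_ofReal ?_
        calc _ ≤ (tailLevel i + tailPart i w a) ^ (p - 2) := by gcongr
          _ ≤ _ := Real.rpow_add_le_add_rpow hl h2 hr.le hr1
    _ ≤ _ := ENNReal.ofReal_add_le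
    _ ≤ _ := by
        gcongr
        exact Finset.single_le_sum (f := fun a => ENNReal.ofReal (tailPart i w a ^ (p - 2)))
          (fun _ _ => zero_le) (Finset.mem_univ a)

lemma lintegral_hNorm (hc : RevCore p μ h) (i : ℕ) :
    ∫⁻ w, hNorm h i w ∂μ = ∑ a, ∑ b, eLpNorm (h i a b) 1 μ := by
  have := hc.h_meas
  simp only [hNorm]
  rw [lintegral_finsetSum _ fun a _ => by fun_prop]
  refine Finset.sum_congr rfl fun a _ => ?_
  rw [lintegral_finsetSum _ fun b _ => by fun_prop]
  simp_rw [eLpNorm_one_eq_lintegral_enorm]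

lemma lintegral_tailPart_mul_le (hc : RevCore p μ h) (i : ℕ) (a b c : ι) :
    ∫⁻ w, ENNReal.ofReal (tailPart i w a ^ (p - 2)) * ‖h i b c w‖ₑ ∂μ
      ≤ (2 ^ i * tailMoment p μ i) ^ ((p - 2) / p) *
        eLpNorm (h i b c) (ENNReal.ofReal (p / 2)) μ := by
  have hp := hc.two_lt
  have hm := hc.h_meas i b c
  have hconj : (p / (p - 2)).HolderConjugate (p / 2) := by
    rw [Real.holderConjugate_iff]
    constructor
    · rw [lt_div_iff₀ (by linarith)]; linarith
    · have : p ≠ 0 := by linarith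
      have : p - 2 ≠ 0 := by linarith
      field_simp; ring
  have := ENNReal.lintegral_mul_le_Lp_mul_Lq μ hconj
    (f := fun w : ℕ → ι → ℝ => ENNReal.ofReal (tailPart i w a ^ (p - 2)))
    (g := fun w => ‖h i b c w‖ₑ) (by fun_prop) (by fun_prop)
  refine this.trans ?_
  rw [eLpNorm_eq_lintegral_rpow_enorm_toReal (by rw [Ne, ENNReal.ofReal_eq_zero]; linarith)
    ENNReal.ofReal_ne_top, ENNReal.toReal_ofReal (by linarith), one_div_div]
  gcongr
  rw [tailMoment, ← mul_assoc, ENNReal.mul_inv_cancel (by simp) (by finiteness), one_mul]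
  refine lintegral_mono fun w => ?_
  have h0 := tailPart_nonneg i w a
  rw [ENNReal.ofReal_rpow_of_nonneg (by positivity) (by apply div_nonneg <;> linarith),
    ← Real.rpow_mul h0, mul_div_cancel₀ _ (by linarith)]
  exact Finset.single_le_sum (f := fun a => ENNReal.ofReal (tailPart i w a ^ p))
    (fun _ _ => zero_le) (Finset.mem_univ a)

lemma exists_lindMoment_succ_le (hc : RevCore p μ h) : ∃ C : ℝ≥0∞, C ≠ ∞ ∧ ∀ i,
    lindMoment p μ h (i + 1) ≤ C * (sqrtGrowth i * hOne p μ h i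
      + tailMoment p μ i ^ ((p - 2) / p) * hHalf p μ h i) := by
  have hp := hc.two_lt
  have hp3 := hc.le_three
  have hr : 0 < p - 2 := by linarith
  set cG := ∫⁻ y, ENNReal.ofReal (‖y‖ ^ (p - 2)) ∂(stdG ι) with hcG
  have hcGt : cG ≠ ∞ := by
    have := lintegral_rpow_enorm_lt_top_of_eLpNorm_lt_top
      (by rw [Ne, ENNReal.ofReal_eq_zero]; linarith) ENNReal.ofReal_ne_top
      (stdG_memLp (ι := ι) (ENNReal.ofReal (p - 2)) ENNReal.ofReal_ne_top).2
    refine (lt_of_eq_of_lt ?_ this).ne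
    simp_rw [ENNReal.toReal_ofReal hr.le, ← ofReal_norm,
      ENNReal.ofReal_rpow_of_nonneg (norm_nonneg _) hr.le, hcG]
  refine ⟨2 + cG + Fintype.card ι, by finiteness, fun i => ?_⟩
  have hd := dScale_pos i
  have hm := hc.measurable_hNorm i
  have hmm := hc.h_meas i
  rw [lindMoment, lintegral_lindMeas_succ hc.h_meas (by fun_prop)]
  set S₁ := ∑ a, ∑ b, eLpNorm (h i a b) 1 μ with hS₁
  set S₂ := ∑ a, ∑ b, eLpNorm (h i a b) (ENNReal.ofReal (p / 2)) μ with hS₂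
  have hdr : dScale i ^ (p - 2) = 2 ^ (i : ℝ) * 2 ^ ((i : ℝ) * (p / 2 - 2)) := by
    rw [dScale_rpow, ← Real.rpow_add (by norm_num)]; congr 1; ring
  have h2i : ENNReal.ofReal (2 ^ (i : ℝ)) = 2 ^ i := by
    rw [ofReal_two_rpow, ENNReal.rpow_natCast]
  have e1 : ∫⁻ w, ENNReal.ofReal (|‖seqSum (2 ^ i) w‖| ^ (p - 2)) * hNorm h i w ∂μ
      ≤ 2 ^ i * (2 * sqrtGrowth i * hOne p μ h i)
        + Fintype.card ι * (2 ^ i * (tailMoment p μ i ^ ((p - 2) / p) * hHalf p μ h i)) := by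
    calc _ ≤ ∫⁻ w, (ENNReal.ofReal (tailLevel i ^ (p - 2)) * hNorm h i w
          + ∑ a, ∑ b, ∑ c, ENNReal.ofReal (tailPart i w a ^ (p - 2)) * ‖h i b c w‖ₑ) ∂μ := by
          refine lintegral_mono fun w => (mul_le_mul_left
            (hc.ofReal_norm_seqSum_rpow_le i w) _).trans (le_of_eq ?_)
          rw [add_mul]
          congr 1
          rw [Finset.sum_mul]
          simp only [hNorm, Finset.mul_sum]
      _ = ENNReal.ofReal (tailLevel i ^ (p - 2)) * S₁ + ∑ a, ∑ b, ∑ c,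
          ∫⁻ w, ENNReal.ofReal (tailPart i w a ^ (p - 2)) * ‖h i b c w‖ₑ ∂μ := by
          rw [lintegral_add_left (by fun_prop), lintegral_const_mul _ hm, hc.lintegral_hNorm,
            lintegral_finsetSum _ fun a _ => by fun_prop]
          congr 1
          refine Finset.sum_congr rfl fun a _ => ?_
          rw [lintegral_finsetSum _ fun b _ => by fun_prop]
          refine Finset.sum_congr rfl fun b _ => ?_
          rw [lintegral_finsetSum _ fun c _ => by fun_prop]
      _ ≤ _ := by
          refine add_le_add ?_ ?_
          · calc _ ≤ ENNReal.ofReal (2 * (dScale i ^ (p - 2) * ((i : ℝ) + 1) ^ (1 / 2 : ℝ)))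
                  * S₁ := by
                  gcongr
                  have hs : 1 ≤ √((i : ℝ) + 1) :=
                    Real.one_le_sqrt.2 (by have := Nat.cast_nonneg (α := ℝ) i; linarith)
                  rw [tailLevel, Real.mul_rpow (by positivity) (by positivity),
                    Real.mul_rpow (by positivity) (by positivity), ← Real.sqrt_eq_rpow, mul_assoc]
                  gcongr
                  · calc (2 : ℝ) ^ (p - 2) ≤ 2 ^ (1 : ℝ) :=
                        Real.rpow_le_rpow_of_exponent_le (by norm_num) (by linarith)
                      _ = 2 := Real.rpow_one 2
                  · calc √((i : ℝ) + 1) ^ (p - 2) ≤ √((i : ℝ) + 1) ^ (1 : ℝ) :=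
                        Real.rpow_le_rpow_of_exponent_le hs (by linarith)
                      _ = _ := Real.rpow_one _
              _ = _ := by
                  rw [hdr, ENNReal.ofReal_mul (by norm_num), ENNReal.ofReal_mul (by positivity),
                    ENNReal.ofReal_mul (by positivity), h2i, sqrtGrowth, hOne,
                    ENNReal.ofReal_ofNat]
                  ring
          · calc _ ≤ ∑ _a : ι, ∑ b, ∑ c, (2 ^ i * tailMoment p μ i) ^ ((p - 2) / p) *
                  eLpNorm (h i b c) (ENNReal.ofReal (p / 2)) μ := by
                  gcongr with a _ b _ c _; exact hc.lintegral_tailPart_mul_le i a b c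
              _ = Fintype.card ι * ((2 ^ i * tailMoment p μ i) ^ ((p - 2) / p) * S₂) := by
                  rw [Finset.sum_const, Finset.card_univ, nsmul_eq_mul]
                  simp_rw [hS₂, ← Finset.mul_sum]
              _ = _ := by
                  congr 1
                  rw [ENNReal.mul_rpow_of_nonneg _ _ (by apply div_nonneg <;> linarith), hHalf,
                    ofReal_two_rpow, ← ENNReal.rpow_natCast, ← ENNReal.rpow_mul,
                    show (i : ℝ) * ((p - 2) / p) = i + (-(i : ℝ) * (2 / p)) by
                      have : p ≠ 0 := by linarith
                      field_simp; ring, ENNReal.rpow_add _ _ (by simp) (by simp)]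
                  ring
  have e2 : (∫⁻ y, ENNReal.ofReal (|‖√(2 ^ i) • y‖| ^ (p - 2)) ∂(stdG ι)) * ∫⁻ w, hNorm h i w ∂μ
      = 2 ^ i * (cG * hOne p μ h i) := by
    have : ∀ y : ι → ℝ, ENNReal.ofReal (|‖√(2 ^ i) • y‖| ^ (p - 2))
        = ENNReal.ofReal (dScale i ^ (p - 2)) * ENNReal.ofReal (‖y‖ ^ (p - 2)) := fun y => by
      rw [← ENNReal.ofReal_mul (by positivity), abs_of_nonneg (norm_nonneg _), norm_smul,
        Real.norm_of_nonneg (Real.sqrt_nonneg _), Real.mul_rpow (by positivity) (by positivity),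
        dScale]
    simp_rw [this]
    rw [lintegral_const_mul _ (by fun_prop), hc.lintegral_hNorm, hdr,
      ENNReal.ofReal_mul (by positivity), h2i, hOne]
    ring
  rw [e2]
  set X := sqrtGrowth i * hOne p μ h i
  set Y := tailMoment p μ i ^ ((p - 2) / p) * hHalf p μ h i
  have hX : hOne p μ h i ≤ X := le_mul_of_one_le_left' (one_le_sqrtGrowth i)
  calc _ ≤ ((2 : ℝ≥0∞) ^ i)⁻¹ * (2 ^ i * (2 * sqrtGrowth i * hOne p μ h i)
        + Fintype.card ι * (2 ^ i * Y) + 2 ^ i * (cG * X)) := by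
        gcongr
        · norm_num
        · lia
    _ = ((2 : ℝ≥0∞) ^ i)⁻¹ * 2 ^ i * (2 * X + Fintype.card ι * Y + cG * X) := by ring
    _ = 2 * X + Fintype.card ι * Y + cG * X := by
        rw [ENNReal.inv_mul_cancel (by simp) (by finiteness), one_mul]
    _ ≤ 2 * X + Fintype.card ι * Y + cG * X + (Fintype.card ι * X + (2 + cG) * Y) := le_self_add
    _ = _ := by ring

lemma tsum_lindMoment_lt_top (hc : RevCore p μ h) :
    ∑' i : ℕ, ENNReal.ofReal (((i : ℝ) + 1) ^ (-(1 / 2) : ℝ)) * lindMoment p μ h i < ∞ := by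
  have hp := hc.two_lt
  have hp3 := hc.le_three
  obtain ⟨C₁, hC₁, hT⟩ := hc.exists_tailMoment_le
  obtain ⟨C₂, hC₂, hK⟩ := hc.exists_lindMoment_succ_le
  have hK0 := hc.lindMoment_zero_lt_top.ne
  have hq : 0 < (p - 2) / p := div_pos (by linarith) (by linarith)
  have hq2 : (p - 2) / p ≤ 1 / 2 := by
    rw [div_le_div_iff₀ (by linarith) (by norm_num)]; linarith
  obtain ⟨B, hB, hTB⟩ := exists_bound_of_recursion (T := tailMoment p μ) (θ₁ := hOne p μ h)
    (θ₂ := hHalf p μ h) (s := sqrtGrowth)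
    (C := C₁ * (1 + lindMoment p μ h 0 + C₂)) (by finiteness) hq hq2 monotone_sqrtGrowth
    one_le_sqrtGrowth hc.tsum_hOne_lt_top.ne hc.tsum_hHalf_lt_top.ne fun j => by
      refine (hT j).trans ?_
      set Y' := ∑ i ∈ Finset.range j, (sqrtGrowth i * hOne p μ h i
        + tailMoment p μ i ^ ((p - 2) / p) * hHalf p μ h i) with hY
      set K₀ := lindMoment p μ h 0
      rw [Finset.sum_range_succ', mul_assoc]
      gcongr
      calc _ ≤ 1 + (C₂ * Y' + K₀) := by
            gcongr
            rw [hY, Finset.mul_sum]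
            exact Finset.sum_le_sum fun i _ => hK i
        _ ≤ 1 + (C₂ * Y' + K₀) + (C₂ + Y' + K₀ * Y') := le_self_add
        _ = _ := by ring
  set W : ℕ → ℝ≥0∞ := fun i => ENNReal.ofReal (((i : ℝ) + 1) ^ (-(1 / 2) : ℝ)) with hW
  have hWs : ∀ i, W i * sqrtGrowth i = 1 := fun i => by
    have : (0 : ℝ) < (i : ℝ) + 1 := by positivity
    simp only [hW, sqrtGrowth]
    rw [← ENNReal.ofReal_mul (by positivity), ← Real.rpow_add this]; norm_num
  have hW1 : ∀ i, W i ≤ 1 := fun i =>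
    (le_mul_of_one_le_right' (one_le_sqrtGrowth i)).trans (hWs i).le
  have hWW : ∀ i, W (i + 1) ≤ W i := fun i => by
    refine ENNReal.ofReal_le_ofReal (Real.rpow_le_rpow_of_nonpos (by positivity) ?_ (by norm_num))
    push_cast; linarith
  rw [tsum_eq_zero_add' ENNReal.summable]
  refine ENNReal.add_lt_top.2 ⟨ENNReal.mul_lt_top ENNReal.ofReal_lt_top hK0.lt_top, ?_⟩
  change ∑' i, W (i + 1) * lindMoment p μ h (i + 1) < ∞
  calc ∑' i, W (i + 1) * lindMoment p μ h (i + 1)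
      ≤ ∑' i, C₂ * (hOne p μ h i + (1 + B) * hHalf p μ h i) := by
        refine ENNReal.tsum_le_tsum fun i => ?_
        calc _ ≤ W i * (C₂ * (sqrtGrowth i * hOne p μ h i
              + (1 + B * sqrtGrowth i) * hHalf p μ h i)) := by
              gcongr
              · exact hWW i
              refine (hK i).trans ?_
              gcongr
              have h1 : tailMoment p μ i ^ ((p - 2) / p) ≤ 1 + tailMoment p μ i := by
                have := ENNReal.rpow_le_add_div hq hq2 le_rfl ENNReal.one_ne_top
                  (tailMoment p μ i)
                rwa [div_one] at this
              exact h1.trans (by gcongr; exact hTB i)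
          _ = C₂ * (W i * sqrtGrowth i * hOne p μ h i
              + (W i + B * (W i * sqrtGrowth i)) * hHalf p μ h i) := by ring
          _ ≤ _ := by
              rw [hWs, one_mul, mul_one]
              gcongr
              exact hW1 i
    _ < ∞ := by
        rw [ENNReal.tsum_mul_left, ENNReal.tsum_add, ENNReal.tsum_mul_left]
        exact ENNReal.mul_lt_top hC₂.lt_top (ENNReal.add_lt_top.2 ⟨hc.tsum_hOne_lt_top,
          ENNReal.mul_lt_top (ENNReal.add_lt_top.2 ⟨ENNReal.one_lt_top, hB.lt_top⟩)
          hc.tsum_hHalf_lt_top⟩)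

end RevCore

end lindMoment

end

section

/-! ### Total variation distance after one smoothing step -/

section tau

variable {ι : Type*} [Fintype ι] [DecidableEq ι] {p : ℝ} {μ : Measure (ℕ → ι → ℝ)}
  {h : ℕ → ι → ι → (ℕ → ι → ℝ) → ℝ}

omit [DecidableEq ι] in
/-- The law of the future after a block of length `2 ^ j` together with the smoothed block sum. -/
def smoothedLaw (μ : Measure (ℕ → ι → ℝ)) (j : ℕ) : Measure ((ℕ → ι → ℝ) × (ι → ℝ)) :=
  (μ.prod (stdG ι)).map fun z => (seqShift (2 ^ j) z.1, seqSum (2 ^ j) z.1 + dScale j • z.2)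

/-- The law of the sequence together with an independent Gaussian vector of variance `2 ^ j`. -/
def targetLaw (μ : Measure (ℕ → ι → ℝ)) (j : ℕ) : Measure ((ℕ → ι → ℝ) × (ι → ℝ)) :=
  μ.prod ((stdG ι).map fun y => dScale j • y)

/-- Upper bound for the total variation distance between the two laws. -/
def tvBound (μ : Measure (ℕ → ι → ℝ)) (h : ℕ → ι → ι → (ℕ → ι → ℝ) → ℝ) (j : ℕ) : ℝ≥0∞ :=
  lindErr μ h (gsMod ι (dScale j)) j
    + ENNReal.ofReal (gJ ι * (2 ^ j)⁻¹) * ∑ a, ∑ b, eLpNorm (h j a b) 1 μ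

instance [IsProbabilityMeasure μ] (j : ℕ) : IsProbabilityMeasure (smoothedLaw μ j) :=
  Measure.isProbabilityMeasure_map (by fun_prop)

instance [IsProbabilityMeasure μ] (j : ℕ) : IsProbabilityMeasure (targetLaw μ j) := by
  have : IsProbabilityMeasure ((stdG ι).map fun y => dScale j • y) :=
    Measure.isProbabilityMeasure_map (by fun_prop)
  unfold targetLaw; infer_instance

namespace RevCore

lemma enorm_real_smoothedLaw_sub_le (hc : RevCore p μ h) (j : ℕ)
    {S : Set ((ℕ → ι → ℝ) × (ι → ℝ))} (hS : MeasurableSet S) :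
    ‖(smoothedLaw μ j).real S - (targetLaw μ (j + 1)).real S‖ₑ ≤ tvBound μ h j := by
  have := hc.prob
  have hd := dScale_pos j
  set f : (ℕ → ι → ℝ) × (ι → ℝ) → ℝ := S.indicator fun _ => 1 with hf
  have hfm : Measurable f := measurable_const.indicator hS
  have hf1 : ∀ z, |f z| ≤ 1 := fun z => by
    by_cases hz : z ∈ S <;> simp [hf, hz]
  set F : (ℕ → ι → ℝ) → (ι → ℝ) → ℝ := fun w x => f (w, x) with hF
  have hJ := isJet_smoothing (ι := ι) hd (F := F) hfm fun w x => hf1 _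
  have hlin := hc.lindeberg (by unfold gsMod; fun_prop) j hJ
  have e1 : ∫ w, gsVal (dScale j) F (seqShift (2 ^ j) w) (seqSum (2 ^ j) w) ∂μ
      = (smoothedLaw μ j).real S := by
    rw [← integral_indicator_one hS]
    change _ = ∫ z, f z ∂(smoothedLaw μ j)
    rw [smoothedLaw, integral_map (by fun_prop)
      (hfm.aestronglyMeasurable), integral_prod]
    · rfl
    · exact integrable_of_abs_le (by fun_prop) fun z => hf1 _
  have e2 : ∫ w, ∫ y, gsVal (dScale j) F w (√(2 ^ j) • y) ∂(stdG ι) ∂μ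
      = (targetLaw μ (j + 1)).real S := by
    have hprob : IsProbabilityMeasure ((stdG ι).map fun y => dScale (j + 1) • y) :=
      Measure.isProbabilityMeasure_map (by fun_prop)
    rw [← integral_indicator_one hS]
    change _ = ∫ z, f z ∂(targetLaw μ (j + 1))
    rw [targetLaw, integral_prod _ (integrable_of_abs_le hfm fun z => hf1 z)]
    refine integral_congr_ae (ae_of_all _ fun w => ?_)
    have h2 := stdG_prod_map (ι := ι) (s := dScale j) (t := dScale j) (u := dScale (j + 1))
      (by rw [dScale_sq, dScale_sq, pow_succ]; ring)
    have hFm : Measurable (F w) := hfm.comp (by fun_prop)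
    change ∫ y, ∫ ξ, F w (dScale j • y + dScale j • ξ) ∂(stdG ι) ∂(stdG ι) = ∫ y, F w y ∂_
    rw [← h2, integral_map (by fun_prop) hFm.aestronglyMeasurable, integral_prod]
    exact integrable_of_abs_le (by fun_prop) fun z => hf1 _
  rw [e1, e2] at hlin
  set R := (1 / 2 : ℝ) * ∑ a, ∑ b, ∫ w, gsHess (dScale j) F w 0 a b * h j a b w ∂μ with hR
  have hR' : ‖R‖ₑ ≤ ENNReal.ofReal (gJ ι * (2 ^ j)⁻¹) * ∑ a, ∑ b, eLpNorm (h j a b) 1 μ := by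
    have hJ1 := one_le_gJ (ι := ι)
    calc ‖R‖ₑ ≤ 1 * ‖∑ a, ∑ b, ∫ w, gsHess (dScale j) F w 0 a b * h j a b w ∂μ‖ₑ := by
          rw [hR, enorm_mul]
          gcongr
          rw [Real.enorm_eq_ofReal (by norm_num), ENNReal.ofReal_le_one]
          norm_num
      _ ≤ ∑ a, ∑ b, ‖∫ w, gsHess (dScale j) F w 0 a b * h j a b w ∂μ‖ₑ := by
          rw [one_mul]
          exact (enorm_sum_le _ _).trans (Finset.sum_le_sum fun a _ => enorm_sum_le _ _)
      _ ≤ ∑ a, ∑ b, ENNReal.ofReal (gJ ι * (2 ^ j)⁻¹) * eLpNorm (h j a b) 1 μ := by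
          refine Finset.sum_le_sum fun a _ => Finset.sum_le_sum fun b _ => ?_
          refine (enorm_integral_le_lintegral_enorm _).trans ?_
          have := hc.h_meas j a b
          rw [eLpNorm_one_eq_lintegral_enorm, ← lintegral_const_mul _ (by fun_prop)]
          refine lintegral_mono fun w => ?_
          rw [enorm_mul]
          gcongr
          rw [Real.enorm_eq_ofReal_abs]
          refine ENNReal.ofReal_le_ofReal ?_
          have := abs_gsHess_le (s := dScale j) (F := F) (fun w x => hf1 _) w 0 a b
          rwa [inv_pow, dScale_sq, mul_comm] at this
      _ = _ := by simp_rw [← Finset.mul_sum]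
  calc _ = ‖((smoothedLaw μ j).real S - (targetLaw μ (j + 1)).real S - R) + R‖ₑ := by
        rw [sub_add_cancel]
    _ ≤ _ := enorm_add_le _ _
    _ ≤ _ := add_le_add hlin hR'

lemma tsum_tvBound_lt_top (hc : RevCore p μ h) :
    ∑' j, ENNReal.ofReal (scaleWeight p j) * tvBound μ h j < ∞ := by
  obtain ⟨C, hC, hle⟩ := exists_tsum_lindErr_le (μ := μ) hc.two_lt hc.le_three hc.h_meas
  have hJ1 := one_le_gJ (ι := ι)
  simp_rw [tvBound, mul_add]
  rw [ENNReal.tsum_add]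
  refine ENNReal.add_lt_top.2 ⟨hle.trans_lt
    (ENNReal.mul_lt_top hC.lt_top hc.tsum_lindMoment_lt_top), ?_⟩
  calc _ ≤ ∑' j, ENNReal.ofReal (gJ ι) * hOne p μ h j := by
        refine ENNReal.tsum_le_tsum fun j => ?_
        rw [hOne, ← mul_assoc, ← mul_assoc, ← ENNReal.ofReal_mul (scaleWeight_nonneg p j),
          ← ENNReal.ofReal_mul (by linarith)]
        refine mul_le_mul_left (ENNReal.ofReal_le_ofReal ?_) _
        have h1 : ((j : ℝ) + 1) ^ (-cExp p) ≤ 1 :=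
          Real.rpow_le_one_of_one_le_of_nonpos
            (by have := Nat.cast_nonneg (α := ℝ) j; linarith) (by linarith [cExp_pos p])
        calc scaleWeight p j * (gJ ι * (2 ^ j)⁻¹) ≤ 1 * dScale j ^ (p - 2) * (gJ ι * (2 ^ j)⁻¹) := by
              have := dScale_pos j
              unfold scaleWeight; gcongr
          _ = gJ ι * (2 ^ ((j : ℝ) * ((p - 2) / 2)) * 2 ^ (-(j : ℝ))) := by
              rw [dScale_rpow, Real.rpow_neg (by norm_num), Real.rpow_natCast]; ring
          _ = _ := by rw [← Real.rpow_add (by norm_num)]; congr 2; ring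
    _ < ∞ := by
        rw [ENNReal.tsum_mul_left]
        exact ENNReal.mul_lt_top ENNReal.ofReal_lt_top hc.tsum_hOne_lt_top

end RevCore

end tau

end

section

/-! ### Couplings from total variation bounds -/

section coupling

variable {ι : Type*} [Fintype ι]

/-- The squared euclidean norm, as an extended nonnegative real. -/
def sqN (x : ι → ℝ) : ℝ≥0∞ := ∑ a, ‖x a‖ₑ ^ 2

@[fun_prop]
lemma measurable_sqN : Measurable (sqN : (ι → ℝ) → ℝ≥0∞) := by
  unfold sqN; fun_prop

lemma enorm_sq_le_sqN (x : ι → ℝ) : ‖x‖ₑ ^ 2 ≤ sqN x := by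
  rcases isEmpty_or_nonempty ι with hι | hι
  · have : x = 0 := Subsingleton.elim _ _
    simp [this]
  · obtain ⟨a, ha⟩ : ∃ a, ‖x‖ = ‖x a‖ := by
      obtain ⟨a, ha⟩ := Finite.exists_max fun a => ‖x a‖
      exact ⟨a, le_antisymm ((pi_norm_le_iff_of_nonneg (norm_nonneg _)).2 ha) (norm_le_pi_norm x a)⟩
    have : ‖x‖ₑ = ‖x a‖ₑ := by rw [← ofReal_norm, ← ofReal_norm, ha]
    rw [this]
    exact Finset.single_le_sum (f := fun a => ‖x a‖ₑ ^ 2) (fun _ _ => zero_le) (Finset.mem_univ a)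

lemma ENNReal.add_sq_le (a b : ℝ≥0∞) : (a + b) ^ 2 ≤ 2 * (a ^ 2 + b ^ 2) := by
  rcases eq_or_ne a ∞ with rfl | ha
  · simp
  rcases eq_or_ne b ∞ with rfl | hb
  · simp
  lift a to ℝ≥0 using ha
  lift b to ℝ≥0 using hb
  norm_cast
  rw [← NNReal.coe_le_coe]
  push_cast
  nlinarith [sq_nonneg ((a : ℝ) - b)]

lemma enorm_sub_sq_le (x y : ι → ℝ) : ‖x - y‖ₑ ^ 2 ≤ 2 * (sqN x + sqN y) :=
  calc _ ≤ (‖x‖ₑ + ‖y‖ₑ) ^ 2 := by gcongr; exact enorm_sub_le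
    _ ≤ 2 * (‖x‖ₑ ^ 2 + ‖y‖ₑ ^ 2) := ENNReal.add_sq_le _ _
    _ ≤ _ := by gcongr <;> exact enorm_sq_le_sqN _

/-- Two finite measures on a product with the same first marginal admit a coupling over that
marginal. -/
lemma exists_coupling_of_fst_eq {T E : Type*} [MeasurableSpace T] [MeasurableSpace E]
    [StandardBorelSpace E] [Nonempty E] {ρ₁ ρ₂ : Measure (T × E)} [IsFiniteMeasure ρ₁]
    [IsFiniteMeasure ρ₂] (h : ρ₁.fst = ρ₂.fst) :
    ∃ κ : Measure ((T × E) × E), κ.fst = ρ₁ ∧ κ.map (fun z => (z.1.1, z.2)) = ρ₂ := by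
  set κ₀ := ρ₁.fst ⊗ₘ (ρ₁.condKernel ×ₖ ρ₂.condKernel) with hκ₀
  have e1 : κ₀.map (Prod.map id Prod.fst) = ρ₁ := by
    rw [hκ₀, ← Measure.compProd_map measurable_fst, ← Kernel.fst_eq, Kernel.fst_prod,
      ρ₁.disintegrate]
  have e2 : κ₀.map (Prod.map id Prod.snd) = ρ₂ := by
    rw [hκ₀, ← Measure.compProd_map measurable_snd, ← Kernel.snd_eq, Kernel.snd_prod, h,
      ρ₂.disintegrate]
  refine ⟨κ₀.map fun z => ((z.1, z.2.1), z.2.2), ?_, ?_⟩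
  · rw [Measure.fst, Measure.map_map (by fun_prop) (by fun_prop)]
    exact e1
  · rw [Measure.map_map (by fun_prop) (by fun_prop)]
    exact e2

/-- A coupling of two laws on `T × (ι → ℝ)` with the same first marginal which is the identity on
the first factor and whose transport cost is controlled by the total variation distance. -/
lemma exists_kernel_lintegral_le {T : Type*} [MeasurableSpace T]
    {Λ ν : Measure (T × (ι → ℝ))} [IsProbabilityMeasure Λ] [IsProbabilityMeasure ν]
    (hfst : Λ.fst = ν.fst) {τ : ℝ≥0∞}
    (hτ : ∀ S, MeasurableSet S → ‖Λ.real S - ν.real S‖ₑ ≤ τ)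
    (hq : ∫⁻ z, sqN z.2 ∂Λ = ∫⁻ z, sqN z.2 ∂ν) (hfin : ∫⁻ z, sqN z.2 ∂ν ≠ ∞)
    {c : ℝ≥0∞} {g : (ι → ℝ) → ℝ≥0∞} (hle : ∀ x, sqN x ≤ c + g x) :
    ∃ K : Kernel (T × (ι → ℝ)) (ι → ℝ), IsMarkovKernel K ∧
      (Λ ⊗ₘ K).map (fun z => (z.1.1, z.2)) = ν ∧
      ∫⁻ z, ‖z.1.2 - z.2‖ₑ ^ 2 ∂(Λ ⊗ₘ K) ≤ 4 * (c * τ + ∫⁻ z, g z.2 ∂ν) := by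
  obtain ⟨S, hS⟩ := exists_isHahnDecomposition Λ ν
  have hSm := hS.measurableSet
  set C := Λ.restrict S + ν.restrict Sᶜ with hC
  set Λ' := Λ.restrict Sᶜ - ν.restrict Sᶜ with hΛ'
  set ν' := ν.restrict S - Λ.restrict S with hν'
  have eΛ : C + Λ' = Λ := by
    rw [hC, hΛ', add_assoc, add_comm (ν.restrict Sᶜ), Measure.sub_add_cancel_of_le hS.ge_on_compl,
      Measure.restrict_add_restrict_compl hSm]
  have eν : C + ν' = ν := by
    rw [hC, hν', add_comm, ← add_assoc, Measure.sub_add_cancel_of_le hS.le_on,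
      Measure.restrict_add_restrict_compl hSm]
  have hfst' : Λ'.fst = ν'.fst := by
    have h1 : C.fst + Λ'.fst = C.fst + ν'.fst := by
      rw [← Measure.fst_add, ← Measure.fst_add, eΛ, eν, hfst]
    exact (Measure.add_right_inj _ _ _).1 h1
  have hqC : ∫⁻ z, sqN z.2 ∂C ≠ ∞ := by
    refine ne_top_of_le_ne_top hfin ?_
    conv_rhs => rw [← eν]
    exact lintegral_mono' (Measure.le_add_right le_rfl) le_rfl
  have hq' : ∫⁻ z, sqN z.2 ∂Λ' = ∫⁻ z, sqN z.2 ∂ν' := by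
    have hq := hq
    rw [← eΛ, lintegral_add_measure] at hq
    conv_rhs at hq => rw [← eν, lintegral_add_measure]
    exact (ENNReal.add_right_inj hqC).1 hq
  have hν'le : ν' ≤ ν := by
    conv_rhs => rw [← eν]
    exact Measure.le_add_left le_rfl
  have hν'univ : ν' Set.univ ≤ τ := by
    refine le_trans ?_ (hτ S hSm)
    rw [hν', Measure.sub_apply MeasurableSet.univ hS.le_on, Measure.restrict_apply_univ,
      Measure.restrict_apply_univ]
    have hle : Λ S ≤ ν S := by
      have := hS.le_on Set.univ
      simpa using this
    rw [enorm_sub_rev, Real.enorm_eq_ofReal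
      (r := ν.real S - Λ.real S)
      (sub_nonneg.2 (ENNReal.toReal_mono (measure_ne_top _ _) hle)),
      ENNReal.ofReal_sub _ measureReal_nonneg, ofReal_measureReal, ofReal_measureReal]
  have hcost : ∫⁻ z, sqN z.2 ∂ν' ≤ c * τ + ∫⁻ z, g z.2 ∂ν :=
    calc _ ≤ ∫⁻ z, (c + g z.2) ∂ν' := lintegral_mono fun z => hle _
      _ = c * ν' Set.univ + ∫⁻ z, g z.2 ∂ν' := by
          rw [lintegral_add_left measurable_const, lintegral_const]
      _ ≤ _ := add_le_add (by gcongr) (lintegral_mono' hν'le le_rfl)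
  obtain ⟨κ', hκ1, hκ2⟩ := exists_coupling_of_fst_eq hfst'
  set κ := C.map (fun z => (z, z.2)) + κ' with hκ
  have hκfst : κ.fst = Λ := by
    rw [hκ, Measure.fst_add, hκ1, Measure.fst, Measure.map_map (by fun_prop) (by fun_prop)]
    change C.map id + Λ' = Λ
    rw [Measure.map_id, eΛ]
  have hκfin : IsFiniteMeasure κ := ⟨by
    rw [← Measure.fst_univ, hκfst]; exact measure_lt_top _ _⟩
  have hdis : Λ ⊗ₘ κ.condKernel = κ := by
    rw [← hκfst]; exact κ.disintegrate _
  refine ⟨κ.condKernel, inferInstance, ?_, ?_⟩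
  · rw [hdis, hκ, Measure.map_add _ _ (by fun_prop), hκ2,
      Measure.map_map (by fun_prop) (by fun_prop)]
    change C.map id + ν' = ν
    rw [Measure.map_id, eν]
  · rw [hdis, hκ, lintegral_add_measure, lintegral_map (by fun_prop) (by fun_prop)]
    simp only [sub_self, enorm_zero, ne_eq, OfNat.ofNat_ne_zero, not_false_eq_true, zero_pow,
      lintegral_zero, zero_add]
    calc _ ≤ ∫⁻ z, 2 * (sqN z.1.2 + sqN z.2) ∂κ' := lintegral_mono fun z => enorm_sub_sq_le _ _
      _ = 2 * (∫⁻ z, sqN z.2 ∂Λ' + ∫⁻ z, sqN z.2 ∂ν') := by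
          rw [lintegral_const_mul _ (by fun_prop), lintegral_add_left (by fun_prop), ← hκ1, ← hκ2,
            Measure.fst, lintegral_map (by fun_prop) (by fun_prop),
            lintegral_map (by fun_prop) (by fun_prop)]
      _ = 4 * ∫⁻ z, sqN z.2 ∂ν' := by rw [hq', ← two_mul, ← mul_assoc]; norm_num
      _ ≤ _ := by gcongr

end coupling

end

section

/-! ### Couplings of block sums with Gaussian vectors -/

section blockCoupling

lemma lintegral_enorm_sq_eq {α : Type*} [MeasurableSpace α] {μ : Measure α} {f : α → ℝ}
    (hf : MemLp f 2 μ) : ∫⁻ x, ‖f x‖ₑ ^ 2 ∂μ = ENNReal.ofReal (∫ x, f x * f x ∂μ) := by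
  rw [ofReal_integral_eq_lintegral_ofReal (hf.integrable_fun_mul hf)
    (ae_of_all _ fun x => mul_self_nonneg _)]
  refine lintegral_congr fun x => ?_
  rw [← Real.enorm_eq_ofReal (mul_self_nonneg _), enorm_mul, sq]

lemma lintegral_enorm_sq_eq_eLpNorm {α F : Type*} [MeasurableSpace α] {μ : Measure α}
    [NormedAddCommGroup F] (f : α → F) : ∫⁻ x, ‖f x‖ₑ ^ 2 ∂μ = eLpNorm f 2 μ ^ 2 := by
  have := eLpNorm_nnreal_pow_eq_lintegral (f := f) (μ := μ) (p := 2) (by norm_num)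
  simpa using this.symm

lemma MeasureTheory.Measure.map_compProd_comap {α β γ : Type*} [MeasurableSpace α]
    [MeasurableSpace β] [MeasurableSpace γ] (π : Measure α) [SFinite π] {φ : α → β}
    (hφ : Measurable φ) (K : Kernel β γ) [IsSFiniteKernel K] :
    (π ⊗ₘ K.comap φ hφ).map (Prod.map φ id) = (π.map φ) ⊗ₘ K := by
  ext s hs
  rw [Measure.map_apply (by fun_prop) hs, Measure.compProd_apply (hs.preimage (by fun_prop)),
    Measure.compProd_apply hs, lintegral_map (Kernel.measurable_kernel_prodMk_left hs) hφ]
  rfl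

variable {ι : Type*} [Fintype ι] [DecidableEq ι] {p : ℝ} {μ : Measure (ℕ → ι → ℝ)}
  {h : ℕ → ι → ι → (ℕ → ι → ℝ) → ℝ}

namespace RevCore

lemma integral_seqSum_mul_self (hc : RevCore p μ h) (n : ℕ) (a : ι) :
    ∫ w, seqSum n w a * seqSum n w a ∂μ = n := by
  have := hc.prob
  induction n with
  | zero => simp [seqSum]
  | succ n ih =>
    have h1 : ∀ w : ℕ → ι → ℝ, seqSum (n + 1) w a * seqSum (n + 1) w a =
        w 0 a * w 0 a + 2 * (seqSum n (seqShift 1 w) a * w 0 a)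
          + seqSum n (seqShift 1 w) a * seqSum n (seqShift 1 w) a := fun w => by
      rw [add_comm n 1, seqSum_add, Pi.add_apply]
      simp only [seqSum, Finset.range_one, Finset.sum_singleton]
      ring
    have hM : MemLp (fun w : ℕ → ι → ℝ => seqSum n (seqShift 1 w) a) 2 μ :=
      (hc.memLp_two_seqSum_eval n a).comp_measurePreserving hc.mp
    have h0 : MemLp (fun w : ℕ → ι → ℝ => w 0 a) 2 μ := by
      have := hc.memLp_two_seqSum_eval 1 a
      simpa [seqSum] using this
    simp_rw [h1]
    rw [integral_add (f := fun w : ℕ → ι → ℝ => w 0 a * w 0 a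
        + 2 * (seqSum n (seqShift 1 w) a * w 0 a))
        ((h0.integrable_fun_mul h0).add ((hM.integrable_fun_mul h0).const_mul 2))
        (hM.integrable_fun_mul hM),
      integral_add (h0.integrable_fun_mul h0) ((hM.integrable_fun_mul h0).const_mul 2),
      integral_const_mul, hc.cov, hc.orth (fun w => seqSum n w a) (by fun_prop)
        (hc.memLp_two_seqSum_eval n a),
      hc.mp.integral_comp_of_measurable (f := fun w => seqSum n w a * seqSum n w a) (by fun_prop),
      ih]
    push_cast; simp; ring

lemma integral_seqSum_eval (hc : RevCore p μ h) (n : ℕ) (a : ι) :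
    ∫ w, seqSum n w a ∂μ = 0 := by
  have := hc.prob
  simpa using hc.orth_seqSum n (Z := fun _ => 1) measurable_const (memLp_const 1) a

lemma lintegral_enorm_targetLaw (hc : RevCore p μ h) (j : ℕ) (a : ι) :
    ∫⁻ z, ‖z.2 a‖ₑ ^ 2 ∂(targetLaw μ j) = 2 ^ j := by
  have := hc.prob
  have hprob : IsProbabilityMeasure ((stdG ι).map fun y => dScale j • y) :=
    Measure.isProbabilityMeasure_map (by fun_prop)
  calc _ = ∫⁻ y, ‖y a‖ₑ ^ 2 ∂((stdG ι).map fun y => dScale j • y) := by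
        rw [targetLaw, lintegral_prod _ (by fun_prop)]
        simp
    _ = ∫⁻ y, ‖dScale j * y a‖ₑ ^ 2 ∂(stdG ι) := by
        rw [lintegral_map (by fun_prop) (by fun_prop)]; rfl
    _ = _ := by
        have hm := stdG_memLp_eval a 2 (by simp)
        rw [lintegral_enorm_sq_eq (hm.const_mul _)]
        simp_rw [fun y : ι → ℝ => mul_mul_mul_comm (dScale j) (y a) (dScale j) (y a)]
        rw [integral_const_mul, stdG_integral_eval_mul, ← sq, dScale_sq]
        simp [ENNReal.ofReal_pow]

lemma lintegral_enorm_smoothedLaw (hc : RevCore p μ h) (j : ℕ) (a : ι) :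
    ∫⁻ z, ‖z.2 a‖ₑ ^ 2 ∂(smoothedLaw μ j) = 2 ^ (j + 1) := by
  have := hc.prob
  have hM := hc.memLp_two_seqSum_eval (2 ^ j) a
  have hg := (stdG_memLp_eval a 2 (by simp)).const_mul (dScale j)
  have hM' : MemLp (fun z : (ℕ → ι → ℝ) × (ι → ℝ) => seqSum (2 ^ j) z.1 a) 2 (μ.prod (stdG ι)) :=
    hM.comp_measurePreserving measurePreserving_fst
  have hg' : MemLp (fun z : (ℕ → ι → ℝ) × (ι → ℝ) => dScale j * z.2 a) 2 (μ.prod (stdG ι)) :=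
    hg.comp_measurePreserving measurePreserving_snd
  rw [smoothedLaw, lintegral_map (by fun_prop) (by fun_prop)]
  have h1 : ∀ z : (ℕ → ι → ℝ) × (ι → ℝ), (seqSum (2 ^ j) z.1 a + dScale j * z.2 a) *
      (seqSum (2 ^ j) z.1 a + dScale j * z.2 a) = seqSum (2 ^ j) z.1 a * seqSum (2 ^ j) z.1 a
        + 2 * (seqSum (2 ^ j) z.1 a * (dScale j * z.2 a))
        + (dScale j * z.2 a) * (dScale j * z.2 a) := fun z => by ring
  have e1 : ∫ z, seqSum (2 ^ j) z.1 a * seqSum (2 ^ j) z.1 a ∂(μ.prod (stdG ι)) = 2 ^ j := by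
    rw [measurePreserving_fst.integral_comp_of_measurable
      (f := fun w : ℕ → ι → ℝ => seqSum (2 ^ j) w a * seqSum (2 ^ j) w a) (by fun_prop),
      hc.integral_seqSum_mul_self]
    simp
  have e2 : ∫ z, (seqSum (2 ^ j) z.1 a * (dScale j * z.2 a)) ∂(μ.prod (stdG ι)) = 0 := by
    rw [integral_prod_mul (f := fun w : ℕ → ι → ℝ => seqSum (2 ^ j) w a)
      (g := fun y : ι → ℝ => dScale j * y a), hc.integral_seqSum_eval, zero_mul]
  have e3 : ∫ z, (dScale j * z.2 a) * (dScale j * z.2 a) ∂(μ.prod (stdG ι)) = 2 ^ j := by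
    rw [measurePreserving_snd.integral_comp_of_measurable
      (f := fun y : ι → ℝ => (dScale j * y a) * (dScale j * y a)) (by fun_prop)]
    simp_rw [fun y : ι → ℝ => mul_mul_mul_comm (dScale j) (y a) (dScale j) (y a)]
    rw [integral_const_mul, stdG_integral_eval_mul, ← sq, dScale_sq]
    simp
  have e4 := lintegral_enorm_sq_eq (hM'.add hg')
  simp only [Pi.add_apply] at e4
  simp only [Pi.add_apply, Pi.smul_apply, smul_eq_mul]
  rw [e4]
  simp_rw [h1]
  rw [integral_add (f := fun z : (ℕ → ι → ℝ) × (ι → ℝ) =>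
      seqSum (2 ^ j) z.1 a * seqSum (2 ^ j) z.1 a
        + 2 * (seqSum (2 ^ j) z.1 a * (dScale j * z.2 a)))
      ((hM'.integrable_fun_mul hM').add ((hM'.integrable_fun_mul hg').const_mul 2))
      (hg'.integrable_fun_mul hg'),
    integral_add (hM'.integrable_fun_mul hM') ((hM'.integrable_fun_mul hg').const_mul 2),
    integral_const_mul, e1, e2, e3, mul_zero, add_zero, ← two_mul, ← pow_succ']
  simp [ENNReal.ofReal_pow]

lemma lintegral_sqN_targetLaw (hc : RevCore p μ h) (j : ℕ) :
    ∫⁻ z, sqN z.2 ∂(targetLaw μ j) = Fintype.card ι * 2 ^ j := by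
  unfold sqN
  rw [lintegral_finsetSum _ fun a _ => by fun_prop]
  simp_rw [hc.lintegral_enorm_targetLaw]
  simp

lemma lintegral_sqN_smoothedLaw (hc : RevCore p μ h) (j : ℕ) :
    ∫⁻ z, sqN z.2 ∂(smoothedLaw μ j) = Fintype.card ι * 2 ^ (j + 1) := by
  unfold sqN
  rw [lintegral_finsetSum _ fun a _ => by fun_prop]
  simp_rw [hc.lintegral_enorm_smoothedLaw]
  simp

end RevCore

end blockCoupling

end

section

section blockStep

lemma ENNReal.le_rpow_half {x y : ℝ≥0∞} (h : x ^ 2 ≤ y) : x ≤ y ^ (1 / 2 : ℝ) := by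
  calc x = (x ^ 2) ^ (1 / 2 : ℝ) := by
        rw [← ENNReal.rpow_natCast, ← ENNReal.rpow_mul]; norm_num
    _ ≤ _ := by gcongr

lemma gaussian_tail_sq_le (j : ℕ) :
    ∫⁻ x, ENNReal.ofReal ((max 0 (|dScale j * x| - tailLevel j)) ^ 2) ∂(gaussianReal 0 1)
      ≤ 14 := by
  have hd := dScale_pos j
  have hj : (0 : ℝ) ≤ j := Nat.cast_nonneg j
  set t := 2 * √((j : ℝ) + 1) with ht
  have ht1 : 1 ≤ t := by
    have : 1 ≤ √((j : ℝ) + 1) := Real.one_le_sqrt.2 (by linarith)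
    linarith
  have ht2 : t ^ 2 = 4 * (j + 1) := by rw [ht, mul_pow, Real.sq_sqrt (by linarith)]; ring
  have e1 : ∀ x : ℝ, (max 0 (|dScale j * x| - tailLevel j)) ^ 2
      = dScale j ^ 2 * (max 0 (|x| - t)) ^ (2 : ℝ) := fun x => by
    rw [Real.rpow_two, ← mul_pow, mul_max_of_nonneg _ _ hd.le, mul_zero, mul_sub,
      abs_mul, abs_of_pos hd, tailLevel, ht]
    congr 3; ring
  simp_rw [e1]
  calc _ = ENNReal.ofReal (dScale j ^ 2) *
        ∫⁻ x, ENNReal.ofReal ((max 0 (|x| - t)) ^ (2 : ℝ)) ∂(gaussianReal 0 1) := by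
        rw [← lintegral_const_mul _ (by fun_prop)]
        simp_rw [ENNReal.ofReal_mul (sq_nonneg (dScale j))]
    _ ≤ ENNReal.ofReal (dScale j ^ 2) * ENNReal.ofReal (14 * Real.exp (-(t ^ 2) / 2)) := by
        gcongr; exact lintegral_rpow_gaussian_tail_le (by norm_num) (by norm_num) ht1
    _ ≤ ENNReal.ofReal 14 := by
        rw [← ENNReal.ofReal_mul (by positivity)]
        refine ENNReal.ofReal_le_ofReal ?_
        have h1 : (2 : ℝ) ^ j ≤ Real.exp j := by
          rw [← Real.exp_one_pow]
          gcongr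
          linarith [Real.add_one_le_exp (1 : ℝ)]
        have h2 : Real.exp j * Real.exp (-(t ^ 2) / 2) ≤ 1 := by
          rw [← Real.exp_add, Real.exp_le_one_iff, ht2]; linarith
        rw [dScale_sq]
        nlinarith [Real.exp_pos (-(t ^ 2) / 2)]
    _ = 14 := by simp

variable {ι : Type*} [Fintype ι] [DecidableEq ι] {p : ℝ} {μ : Measure (ℕ → ι → ℝ)}
  {h : ℕ → ι → ι → (ℕ → ι → ℝ) → ℝ}

/-- The part of the squared norm which exceeds the truncation level. -/
def sqExcess (j : ℕ) (x : ι → ℝ) : ℝ≥0∞ :=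
  ∑ a, ENNReal.ofReal (2 * (max 0 (|x a| - tailLevel j)) ^ 2)

omit [DecidableEq ι] in
lemma sqN_le_add_sqExcess (j : ℕ) (x : ι → ℝ) :
    sqN x ≤ Fintype.card ι * ENNReal.ofReal (2 * tailLevel j ^ 2) + sqExcess j x := by
  rw [← nsmul_eq_mul, ← Finset.card_univ, ← Finset.sum_const, sqExcess, ← Finset.sum_add_distrib,
    sqN]
  refine Finset.sum_le_sum fun a _ => ?_
  rw [← ENNReal.ofReal_add (by positivity) (by positivity), Real.enorm_eq_ofReal_abs,
    ← ENNReal.ofReal_pow (abs_nonneg _)]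
  refine ENNReal.ofReal_le_ofReal ?_
  have := tailLevel_nonneg j
  rcases le_total (|x a| - tailLevel j) 0 with h0 | h0
  · rw [max_eq_left h0]; nlinarith [abs_nonneg (x a)]
  · rw [max_eq_right h0]; nlinarith [sq_nonneg (|x a| - 2 * tailLevel j)]

/-- Upper bound for the squared cost of replacing one smoothed block sum by a Gaussian vector. -/
def stepCost (μ : Measure (ℕ → ι → ℝ)) (h : ℕ → ι → ι → (ℕ → ι → ℝ) → ℝ) (j : ℕ) : ℝ≥0∞ :=
  128 * Fintype.card ι * (ENNReal.ofReal (2 ^ j * (j + 1)) * tvBound μ h j + 1)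

/-- `π` couples the sequence with law `μ` and a Gaussian vector, independent of the future of the
sequence after time `2 ^ j`, which is `W`-close to the block sum in `L²`. -/
structure IsBlockCoupling (μ : Measure (ℕ → ι → ℝ)) (j : ℕ) (W : ℝ≥0∞)
    (π : Measure ((ℕ → ι → ℝ) × (ι → ℝ))) : Prop where
  fst_eq : π.fst = μ
  map_eq : π.map (fun z => (seqShift (2 ^ j) z.1, z.2)) = targetLaw μ j
  err_le : eLpNorm (fun z => seqSum (2 ^ j) z.1 - z.2) 2 π ≤ W

namespace RevCore

lemma lintegral_sqExcess_targetLaw_le (hc : RevCore p μ h) (j : ℕ) :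
    ∫⁻ z, sqExcess j z.2 ∂(targetLaw μ j) ≤ Fintype.card ι * 28 := by
  have := hc.prob
  have hprob : IsProbabilityMeasure ((stdG ι).map fun y => dScale j • y) :=
    Measure.isProbabilityMeasure_map (by fun_prop)
  unfold sqExcess
  rw [lintegral_finsetSum _ fun a _ => by fun_prop, ← nsmul_eq_mul, ← Finset.card_univ,
    ← Finset.sum_const]
  refine Finset.sum_le_sum fun a _ => ?_
  calc _ = ∫⁻ y, ENNReal.ofReal (2 * (max 0 (|y a| - tailLevel j)) ^ 2)
        ∂((stdG ι).map fun y => dScale j • y) := by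
        rw [targetLaw, lintegral_prod _ (by fun_prop)]
        simp
    _ = ∫⁻ y, ENNReal.ofReal (2 * (max 0 (|dScale j * y a| - tailLevel j)) ^ 2) ∂(stdG ι) := by
        rw [lintegral_map (by fun_prop) (by fun_prop)]; rfl
    _ = ∫⁻ y, ENNReal.ofReal (2 * (max 0 (|dScale j * y| - tailLevel j)) ^ 2)
          ∂(gaussianReal 0 1) := by
        rw [← (stdG_eval a).map_eq, lintegral_map (by fun_prop) (by fun_prop)]
    _ ≤ 2 * 14 := by
        simp_rw [ENNReal.ofReal_mul (zero_le_two (α := ℝ)), ENNReal.ofReal_ofNat]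
        rw [lintegral_const_mul _ (by fun_prop)]
        gcongr
        exact gaussian_tail_sq_le j
    _ = 28 := by norm_num

lemma exists_kernel_smoothedLaw (hc : RevCore p μ h) (j : ℕ) :
    ∃ K : Kernel ((ℕ → ι → ℝ) × (ι → ℝ)) (ι → ℝ), IsMarkovKernel K ∧
      (smoothedLaw μ j ⊗ₘ K).map (fun z => (z.1.1, z.2)) = targetLaw μ (j + 1) ∧
      ∫⁻ z, ‖z.1.2 - z.2‖ₑ ^ 2 ∂(smoothedLaw μ j ⊗ₘ K) ≤ stepCost μ h j := by
  have := hc.prob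
  have hprob : IsProbabilityMeasure ((stdG ι).map fun y => dScale (j + 1) • y) :=
    Measure.isProbabilityMeasure_map (by fun_prop)
  obtain ⟨K, hK, hK1, hK2⟩ := exists_kernel_lintegral_le (Λ := smoothedLaw μ j)
    (ν := targetLaw μ (j + 1)) (τ := tvBound μ h j)
    (c := Fintype.card ι * ENNReal.ofReal (2 * tailLevel (j + 1) ^ 2)) (g := sqExcess (j + 1)) (by
      rw [smoothedLaw, targetLaw, Measure.fst_prod, Measure.fst,
        Measure.map_map (by fun_prop) (by fun_prop)]
      exact ((hc.mpn (2 ^ j)).comp measurePreserving_fst).map_eq)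
    (fun S hS => hc.enorm_real_smoothedLaw_sub_le j hS)
    (by rw [hc.lintegral_sqN_smoothedLaw, hc.lintegral_sqN_targetLaw])
    (by rw [hc.lintegral_sqN_targetLaw]; finiteness) (sqN_le_add_sqExcess (j + 1))
  refine ⟨K, hK, hK1, hK2.trans ?_⟩
  have hT : ENNReal.ofReal (2 * tailLevel (j + 1) ^ 2) ≤ 32 * ENNReal.ofReal (2 ^ j * (j + 1)) := by
    rw [← ENNReal.ofReal_ofNat, ← ENNReal.ofReal_mul (by norm_num)]
    refine ENNReal.ofReal_le_ofReal ?_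
    have hj : (0 : ℝ) ≤ j := Nat.cast_nonneg j
    rw [tailLevel, mul_pow, mul_pow, dScale_sq, Real.sq_sqrt (by positivity)]
    have : (0 : ℝ) < 2 ^ j := by positivity
    push_cast
    rw [pow_succ (2 : ℝ) j]
    nlinarith
  calc _ ≤ 4 * (Fintype.card ι * (32 * ENNReal.ofReal (2 ^ j * (j + 1))) * tvBound μ h j
        + Fintype.card ι * 32) := by
        gcongr
        refine (hc.lintegral_sqExcess_targetLaw_le (j + 1)).trans ?_
        gcongr; norm_num
    _ = _ := by
        rw [stepCost]; ring

lemma exists_isBlockCoupling_succ (hc : RevCore p μ h) {j : ℕ} {W : ℝ≥0∞}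
    {π : Measure ((ℕ → ι → ℝ) × (ι → ℝ))} (hπ : IsBlockCoupling μ j W π) :
    ∃ π', IsBlockCoupling μ (j + 1) (W + stepCost μ h j ^ (1 / 2 : ℝ)) π' := by
  have := hc.prob
  have hπp : IsProbabilityMeasure π := ⟨by rw [← Measure.fst_univ, hπ.fst_eq]; simp⟩
  obtain ⟨K, hK, hK1, hK2⟩ := hc.exists_kernel_smoothedLaw j
  set φ : (ℕ → ι → ℝ) × (ι → ℝ) → (ℕ → ι → ℝ) × (ι → ℝ) := fun z =>
    (seqShift (2 ^ (j + 1)) z.1, seqSum (2 ^ j) (seqShift (2 ^ j) z.1) + z.2) with hφ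
  have hφm : Measurable φ := by fun_prop
  have e2 : 2 ^ j + 2 ^ j = 2 ^ (j + 1) := by rw [pow_succ]; ring
  have hπφ : π.map φ = smoothedLaw μ j := by
    have h1 : π.map φ = (targetLaw μ j).map (fun z : (ℕ → ι → ℝ) × (ι → ℝ) =>
        (seqShift (2 ^ j) z.1, seqSum (2 ^ j) z.1 + z.2)) := by
      rw [← hπ.map_eq, Measure.map_map (by fun_prop) (by fun_prop)]
      congr 1
      funext z
      simp [hφ, seqShift_seqShift, e2]
    have h2 : targetLaw μ j = (μ.prod (stdG ι)).map (Prod.map id fun y => dScale j • y) := by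
      rw [targetLaw, ← Measure.map_prod_map _ _ measurable_id (by fun_prop), Measure.map_id]
    rw [h1, h2, Measure.map_map (by fun_prop) (by fun_prop)]
    rfl
  set π₂ := π ⊗ₘ K.comap φ hφm with hπ₂
  have hmap : π₂.map (Prod.map φ id) = smoothedLaw μ j ⊗ₘ K := by
    rw [hπ₂, Measure.map_compProd_comap, hπφ]
  have hfst : π₂.fst = π := Measure.fst_compProd _ _
  refine ⟨π₂.map fun z => (z.1.1, z.2), ?_, ?_, ?_⟩
  · rw [← hπ.fst_eq, ← hfst, Measure.fst, Measure.fst, Measure.fst,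
      Measure.map_map (by fun_prop) (by fun_prop), Measure.map_map (by fun_prop) (by fun_prop)]
    rfl
  · rw [← hK1, ← hmap, Measure.map_map (by fun_prop) (by fun_prop),
      Measure.map_map (by fun_prop) (by fun_prop)]
    rfl
  · rw [eLpNorm_map_measure (by fun_prop) (by fun_prop)]
    have hdec : ((fun z : (ℕ → ι → ℝ) × (ι → ℝ) => seqSum (2 ^ (j + 1)) z.1 - z.2) ∘
        fun z : ((ℕ → ι → ℝ) × (ι → ℝ)) × (ι → ℝ) => (z.1.1, z.2)) =
        (fun z => seqSum (2 ^ j) z.1.1 - z.1.2) + fun z => (φ z.1).2 - z.2 := by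
      funext z
      simp only [Function.comp, Pi.add_apply, hφ, ← e2, seqSum_add]
      abel
    rw [hdec]
    refine (eLpNorm_add_le (by fun_prop) (by fun_prop) (by norm_num)).trans
      (add_le_add ?_ ?_)
    · refine le_trans (le_of_eq ?_) hπ.err_le
      conv_rhs => rw [← hfst, Measure.fst]
      rw [eLpNorm_map_measure (by fun_prop) (by fun_prop)]
      rfl
    · refine ENNReal.le_rpow_half (le_trans (le_of_eq ?_) hK2)
      rw [← lintegral_enorm_sq_eq_eLpNorm, ← hmap, lintegral_map (by fun_prop) (by fun_prop)]
      rfl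

/-- Bound for the `L²` distance between a block sum and its Gaussian approximation. -/
def _root_.blockErr (μ : Measure (ℕ → ι → ℝ)) (h : ℕ → ι → ι → (ℕ → ι → ℝ) → ℝ) (j : ℕ) : ℝ≥0∞ :=
  eLpNorm (fun z : (ℕ → ι → ℝ) × (ι → ℝ) => seqSum 1 z.1 - z.2) 2 (targetLaw μ 0)
    + ∑ i ∈ Finset.range j, stepCost μ h i ^ (1 / 2 : ℝ)

lemma exists_isBlockCoupling (hc : RevCore p μ h) (j : ℕ) :
    ∃ π, IsBlockCoupling μ j (blockErr μ h j) π := by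
  have := hc.prob
  have hprob : IsProbabilityMeasure ((stdG ι).map fun y => dScale 0 • y) :=
    Measure.isProbabilityMeasure_map (by fun_prop)
  induction j with
  | zero =>
    refine ⟨targetLaw μ 0, ?_, ?_, by simp [blockErr]⟩
    · rw [targetLaw, Measure.fst_prod]
    · have := Measure.map_prod_map μ ((stdG ι).map fun y => dScale 0 • y) (hc.mpn 1).measurable
        measurable_id
      rw [Measure.map_id, (hc.mpn 1).map_eq] at this
      rw [targetLaw, pow_zero]
      conv_rhs => rw [this]
      rfl
  | succ j ih =>
    obtain ⟨π, hπ⟩ := ih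
    rw [blockErr, Finset.sum_range_succ, ← add_assoc]
    exact hc.exists_isBlockCoupling_succ hπ

end RevCore

end blockStep

end

section

section blockSeries

lemma ENNReal.add_sq_le_weighted (a b : ℝ≥0∞) :
    (a + b) ^ 2 ≤ ENNReal.ofReal (5 / 4) * a ^ 2 + 5 * b ^ 2 := by
  rcases eq_or_ne a ∞ with rfl | ha
  · simp [ENNReal.mul_top]
  rcases eq_or_ne b ∞ with rfl | hb
  · simp
  rw [← ENNReal.ofReal_toReal ha, ← ENNReal.ofReal_toReal hb]
  have h1 := ENNReal.toReal_nonneg (a := a)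
  have h2 := ENNReal.toReal_nonneg (a := b)
  rw [← ENNReal.ofReal_add h1 h2, ← ENNReal.ofReal_pow (by positivity), ← ENNReal.ofReal_pow h1,
    ← ENNReal.ofReal_pow h2, ← ENNReal.ofReal_ofNat, ← ENNReal.ofReal_mul (by norm_num),
    ← ENNReal.ofReal_mul (by norm_num), ← ENNReal.ofReal_add (by positivity) (by positivity)]
  refine ENNReal.ofReal_le_ofReal ?_
  nlinarith [sq_nonneg (a.toReal / 2 - 2 * b.toReal)]

lemma ENNReal.tsum_le_of_contraction {T s : ℕ → ℝ≥0∞} {r : ℝ} (hr0 : 0 ≤ r) (hr : r < 1)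
    (hT : ∀ j, T (j + 1) ≤ ENNReal.ofReal r * T j + s j) :
    ∑' j, T j ≤ ENNReal.ofReal ((1 - r)⁻¹) * (T 0 + ∑' j, s j) := by
  set K := ENNReal.ofReal ((1 - r)⁻¹) with hK
  have hr' : 0 < 1 - r := by linarith
  have hKr : 1 + ENNReal.ofReal r * K = K := by
    rw [hK, ← ENNReal.ofReal_mul hr0, ← ENNReal.ofReal_one,
      ← ENNReal.ofReal_add zero_le_one (by positivity)]
    congr 1
    field_simp
    ring
  rw [ENNReal.tsum_eq_iSup_nat]
  refine iSup_le fun n => ?_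
  induction n with
  | zero => simp
  | succ n ih =>
    rw [Finset.sum_range_succ']
    calc ∑ k ∈ Finset.range n, T (k + 1) + T 0
        ≤ ∑ k ∈ Finset.range n, (ENNReal.ofReal r * T k + s k) + T 0 :=
          add_le_add (Finset.sum_le_sum fun k _ => hT k) le_rfl
      _ = ENNReal.ofReal r * ∑ k ∈ Finset.range n, T k + ∑ k ∈ Finset.range n, s k + T 0 := by
          rw [Finset.sum_add_distrib, Finset.mul_sum]
      _ ≤ ENNReal.ofReal r * (K * (T 0 + ∑' j, s j)) + ∑' j, s j + T 0 := by
          refine add_le_add (add_le_add (mul_le_mul_right ih _) (ENNReal.sum_le_tsum _)) le_rfl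
      _ = (1 + ENNReal.ofReal r * K) * (T 0 + ∑' j, s j) := by ring
      _ = K * (T 0 + ∑' j, s j) := by rw [hKr]

/-- The weight attached to the squared approximation error of the blocks of length `2 ^ j`. -/
def blockWeight (p : ℝ) (j : ℕ) : ℝ≥0∞ :=
  ENNReal.ofReal (((j : ℝ) + 1) ^ (-1 - cExp p) * 2 ^ (-(j : ℝ) * (2 - p / 2)))

lemma blockWeight_succ_le {p : ℝ} (hp3 : p ≤ 3) (j : ℕ) :
    ENNReal.ofReal (5 / 4) * blockWeight p (j + 1) ≤ ENNReal.ofReal (9 / 10) * blockWeight p j := by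
  have hj : (0 : ℝ) ≤ j := Nat.cast_nonneg j
  have hc := cExp_pos p
  unfold blockWeight
  rw [← ENNReal.ofReal_mul (by norm_num), ← ENNReal.ofReal_mul (by norm_num)]
  refine ENNReal.ofReal_le_ofReal ?_
  have h1 : (((j + 1 : ℕ) : ℝ) + 1) ^ (-1 - cExp p) ≤ ((j : ℝ) + 1) ^ (-1 - cExp p) :=
    Real.rpow_le_rpow_of_nonpos (by positivity) (by push_cast; linarith) (by linarith)
  have h2 : (2 : ℝ) ^ (-((j + 1 : ℕ) : ℝ) * (2 - p / 2))
      ≤ 18 / 25 * 2 ^ (-(j : ℝ) * (2 - p / 2)) := by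
    have e : -((j + 1 : ℕ) : ℝ) * (2 - p / 2) = -(2 - p / 2) + -(j : ℝ) * (2 - p / 2) := by
      push_cast; ring
    rw [e, Real.rpow_add (by norm_num)]
    gcongr
    calc (2 : ℝ) ^ (-(2 - p / 2)) ≤ 2 ^ (-(1 / 2) : ℝ) :=
          Real.rpow_le_rpow_of_exponent_le (by norm_num) (by linarith)
      _ ≤ 18 / 25 := by
          rw [Real.rpow_neg (by norm_num), ← Real.sqrt_eq_rpow, inv_le_comm₀ (by positivity)
            (by norm_num)]
          exact Real.le_sqrt_of_sq_le (by norm_num)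
  calc _ ≤ 5 / 4 * (((j : ℝ) + 1) ^ (-1 - cExp p) * (18 / 25 * 2 ^ (-(j : ℝ) * (2 - p / 2)))) := by
        gcongr
    _ = _ := by ring

lemma tsum_blockWeight_lt_top {p : ℝ} (hp3 : p ≤ 3) : ∑' j, blockWeight p j < ∞ := by
  refine (ENNReal.tsum_le_of_contraction (T := blockWeight p) (s := 0) (r := 9 / 10)
    (by norm_num) (by norm_num) fun j => ?_).trans_lt ?_
  · refine le_trans ?_ ((blockWeight_succ_le hp3 j).trans le_self_add)
    refine le_mul_of_one_le_left zero_le ?_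
    rw [ENNReal.one_le_ofReal]; norm_num
  · simp only [Pi.zero_apply, tsum_zero, add_zero, blockWeight]
    exact ENNReal.mul_lt_top (by norm_num) ENNReal.ofReal_lt_top

variable {ι : Type*} [Fintype ι] [DecidableEq ι] {p : ℝ} {μ : Measure (ℕ → ι → ℝ)}
  {h : ℕ → ι → ι → (ℕ → ι → ℝ) → ℝ}

namespace RevCore

lemma blockErr_zero_lt_top (hc : RevCore p μ h) : blockErr μ h 0 < ∞ := by
  have := hc.prob
  have hprob : IsProbabilityMeasure ((stdG ι).map fun y => dScale 0 • y) :=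
    Measure.isProbabilityMeasure_map (by fun_prop)
  simp only [blockErr, Finset.range_zero, Finset.sum_empty, add_zero]
  refine (eLpNorm_sub_le (Measurable.aestronglyMeasurable (by fun_prop))
    (Measurable.aestronglyMeasurable (by fun_prop)) (by norm_num)).trans_lt
    (ENNReal.add_lt_top.2 ⟨?_, ?_⟩)
  · exact ((hc.memLp_two_seqSum 1).comp_measurePreserving
      (measurePreserving_fst (μ := μ) (ν := (stdG ι).map fun y => dScale 0 • y))).2
  · have h1 : MemLp (fun y : ι → ℝ => y) 2 ((stdG ι).map fun y => dScale 0 • y) := by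
      rw [memLp_map_measure_iff (by fun_prop) (by fun_prop)]
      exact (stdG_memLp 2 (by simp)).const_smul (dScale 0)
    exact (h1.comp_measurePreserving
      (measurePreserving_snd (μ := μ) (ν := (stdG ι).map fun y => dScale 0 • y))).2

lemma tsum_blockErr_lt_top (hc : RevCore p μ h) :
    ∑' j, blockWeight p j * blockErr μ h j ^ 2 < ∞ := by
  refine (ENNReal.tsum_le_of_contraction (T := fun j => blockWeight p j * blockErr μ h j ^ 2)
    (s := fun j => 5 * (blockWeight p j * stepCost μ h j)) (r := 9 / 10) (by norm_num)
    (by norm_num) fun j => ?_).trans_lt ?_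
  · have e : blockErr μ h (j + 1) = blockErr μ h j + stepCost μ h j ^ (1 / 2 : ℝ) := by
      rw [blockErr, Finset.sum_range_succ, ← add_assoc]; rfl
    have e2 : (stepCost μ h j ^ (1 / 2 : ℝ)) ^ 2 = stepCost μ h j := by
      rw [← ENNReal.rpow_natCast, ← ENNReal.rpow_mul]; norm_num
    have hw : blockWeight p (j + 1) ≤ blockWeight p j := by
      have h1 : 1 ≤ ENNReal.ofReal (5 / 4) := by rw [ENNReal.one_le_ofReal]; norm_num
      have h2 : ENNReal.ofReal (9 / 10) ≤ 1 := by rw [ENNReal.ofReal_le_one]; norm_num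
      calc _ ≤ ENNReal.ofReal (5 / 4) * blockWeight p (j + 1) := le_mul_of_one_le_left zero_le h1
        _ ≤ _ := blockWeight_succ_le hc.le_three j
        _ ≤ _ := mul_le_of_le_one_left zero_le h2
    rw [e]
    calc _ ≤ blockWeight p (j + 1) * (ENNReal.ofReal (5 / 4) * blockErr μ h j ^ 2
          + 5 * stepCost μ h j) := by
          gcongr
          refine (ENNReal.add_sq_le_weighted _ _).trans_eq ?_
          rw [e2]
      _ = (ENNReal.ofReal (5 / 4) * blockWeight p (j + 1)) * blockErr μ h j ^ 2
          + 5 * (blockWeight p (j + 1) * stepCost μ h j) := by ring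
      _ ≤ (ENNReal.ofReal (9 / 10) * blockWeight p j) * blockErr μ h j ^ 2
          + 5 * (blockWeight p j * stepCost μ h j) := by
          refine add_le_add ?_ ?_
          · exact mul_le_mul_left (blockWeight_succ_le hc.le_three j) _
          · gcongr
      _ = _ := by ring
  · have hs : ∀ j, blockWeight p j * stepCost μ h j = 128 * Fintype.card ι *
        (ENNReal.ofReal (scaleWeight p j) * tvBound μ h j + blockWeight p j) := fun j => by
      have hj : (0 : ℝ) < (j : ℝ) + 1 := by positivity
      have e : ENNReal.ofReal (scaleWeight p j)
          = blockWeight p j * ENNReal.ofReal (2 ^ j * (j + 1)) := by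
        rw [blockWeight, ← ENNReal.ofReal_mul (by positivity), scaleWeight, dScale_rpow]
        congr 1
        have h1 : ((j : ℝ) + 1) ^ (-cExp p) = ((j : ℝ) + 1) ^ (-1 - cExp p) * (j + 1) := by
          rw [← Real.rpow_add_one hj.ne']; congr 1; ring
        have h2 : (2 : ℝ) ^ ((j : ℝ) * ((p - 2) / 2))
            = 2 ^ (-(j : ℝ) * (2 - p / 2)) * 2 ^ j := by
          rw [← Real.rpow_add_natCast (by norm_num)]; congr 1; ring
        rw [h1, h2]; ring
      rw [stepCost, e]; ring
    have h0 := hc.blockErr_zero_lt_top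
    refine ENNReal.mul_lt_top (by norm_num) (ENNReal.add_lt_top.2 ⟨?_, ?_⟩)
    · exact ENNReal.mul_lt_top ENNReal.ofReal_lt_top (ENNReal.pow_lt_top h0)
    · simp_rw [hs]
      rw [ENNReal.tsum_mul_left, ENNReal.tsum_mul_left, ENNReal.tsum_add]
      refine ENNReal.mul_lt_top (by norm_num) (ENNReal.mul_lt_top
        (ENNReal.mul_lt_top (by norm_num) (by simp)) (ENNReal.add_lt_top.2
          ⟨hc.tsum_tvBound_lt_top, tsum_blockWeight_lt_top hc.le_three⟩))

end RevCore

end blockSeries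

end

section

section iidSeq

/-- The law of a sequence of independent variables with common law `ν`. -/
def iidSeq {E : Type*} [MeasurableSpace E] (ν : Measure E) : Measure (ℕ → E) :=
  Measure.infinitePi fun _ : ℕ => ν

/-- The sequence which follows `x` before time `s` and restarts with `v` at time `s`. -/
def seqCat {E : Type*} (s : ℕ) (x v : ℕ → E) : ℕ → E := fun k => if k < s then x k else v (k - s)

/-- The sequence `x` frozen to `0` from time `s` on. -/
def seqTrunc {E : Type*} [Zero E] (s : ℕ) (x : ℕ → E) : ℕ → E := seqCat s x 0

variable {E : Type*} [MeasurableSpace E] {ν : Measure E} [IsProbabilityMeasure ν]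

instance : IsProbabilityMeasure (iidSeq ν) := by unfold iidSeq; infer_instance

@[fun_prop]
lemma measurable_seqCat (s : ℕ) :
    Measurable (fun z : (ℕ → E) × (ℕ → E) => seqCat s z.1 z.2) := by
  refine measurable_pi_lambda _ fun k => ?_
  unfold seqCat
  by_cases h : k < s <;> simp only [h, if_true, if_false] <;> fun_prop

@[fun_prop]
lemma measurable_seqTrunc [Zero E] (s : ℕ) : Measurable (seqTrunc s : (ℕ → E) → ℕ → E) :=
  (measurable_seqCat s).comp (measurable_id.prodMk measurable_const)

lemma iidSeq_map_seqCat (s : ℕ) :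
    ((iidSeq ν).prod (iidSeq ν)).map (fun z => seqCat s z.1 z.2) = iidSeq ν := by
  refine Measure.eq_infinitePi _ fun S t ht => ?_
  rw [Measure.map_apply (by fun_prop)
    (MeasurableSet.pi (Finset.countable_toSet S) fun k _ => ht k)]
  have h1 : (fun z : (ℕ → E) × (ℕ → E) => seqCat s z.1 z.2) ⁻¹' (Set.pi S t) =
      (Set.pi (S.filter (· < s)) t) ×ˢ
        (Set.pi ((S.filter (¬ · < s)).image (· - s)) fun k => t (k + s)) := by
    ext z
    simp only [Set.mem_preimage, Set.mem_pi, Finset.mem_coe, Set.mem_prod, Finset.mem_filter,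
      Finset.mem_image, seqCat]
    constructor
    · refine fun h => ⟨fun k hk => by simpa [hk.2] using h k hk.1, ?_⟩
      rintro _ ⟨k, ⟨hk, hks⟩, rfl⟩
      have := h k hk
      rw [if_neg hks] at this
      rwa [Nat.sub_add_cancel (by lia)]
    · rintro ⟨h1, h2⟩ k hk
      by_cases hks : k < s
      · simpa [hks] using h1 k ⟨hk, hks⟩
      · have := h2 (k - s) ⟨k, ⟨hk, hks⟩, rfl⟩
        rw [Nat.sub_add_cancel (by lia)] at this
        simpa [hks] using this
  rw [h1, Measure.prod_prod, iidSeq, Measure.infinitePi_pi _ fun k _ => ht k,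
    Measure.infinitePi_pi _ fun k _ => ht (k + s), Finset.prod_image]
  · rw [← Finset.prod_filter_mul_prod_filter_not S (· < s)]
    congr 1
    refine Finset.prod_congr rfl fun k hk => ?_
    rw [Nat.sub_add_cancel]
    have := (Finset.mem_filter.1 hk).2
    lia
  · intro k hk l hl h
    have h1 := (Finset.mem_filter.1 (Finset.mem_coe.1 hk)).2
    have h2 := (Finset.mem_filter.1 (Finset.mem_coe.1 hl)).2
    simp only at h
    lia

lemma measurePreserving_seqShift_iidSeq (n : ℕ) :
    MeasurePreserving (seqShift n) (iidSeq ν) (iidSeq ν) := by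
  refine ⟨by fun_prop, ?_⟩
  exact Measure.map_infinitePi_infinitePi_of_inj (f := fun k => k + n) fun a b => by simp

lemma measurePreserving_eval_iidSeq (k : ℕ) :
    MeasurePreserving (fun v : ℕ → E => v k) (iidSeq ν) ν :=
  measurePreserving_eval_infinitePi (fun _ : ℕ => ν) k

lemma iidSeq_map_zero_pair {n : ℕ} (hn : 0 < n) :
    (iidSeq ν).map (fun v => (v 0, seqShift n v)) = ν.prod (iidSeq ν) := by
  conv_lhs => rw [← iidSeq_map_seqCat (ν := ν) n]
  rw [Measure.map_map (by fun_prop) (by fun_prop)]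
  have : ((fun v : ℕ → E => (v 0, seqShift n v)) ∘ fun z : (ℕ → E) × (ℕ → E) => seqCat n z.1 z.2) =
      Prod.map (fun v : ℕ → E => v 0) id := by
    funext z
    simp only [Function.comp, Prod.map]
    congr 1
    · simp [seqCat, hn]
    · funext l
      simp [seqCat, seqShift]
  rw [this, ← Measure.map_prod_map _ _ (by fun_prop) (by fun_prop),
    (measurePreserving_eval_iidSeq 0).map_eq, Measure.map_id]

lemma iidSeq_map_seqSum_pair [AddCommMonoid E] [MeasurableAdd₂ E] (n : ℕ) :
    (iidSeq ν).map (fun v => (seqSum n v, seqShift n v)) =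
      ((iidSeq ν).map (seqSum n)).prod (iidSeq ν) := by
  conv_lhs => rw [← iidSeq_map_seqCat (ν := ν) n]
  rw [Measure.map_map (by fun_prop) (by fun_prop)]
  have : ((fun v : ℕ → E => (seqSum n v, seqShift n v)) ∘
      fun z : (ℕ → E) × (ℕ → E) => seqCat n z.1 z.2) = Prod.map (seqSum n) id := by
    funext z
    simp only [Function.comp, Prod.map]
    congr 1
    · exact Finset.sum_congr rfl fun k hk => by simp [seqCat, Finset.mem_range.1 hk]
    · funext l
      simp [seqCat, seqShift]
  rw [this, ← Measure.map_prod_map _ _ (by fun_prop) (by fun_prop), Measure.map_id]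

omit [MeasurableSpace E] in
lemma seqCat_seqTrunc [Zero E] (s : ℕ) (x v : ℕ → E) :
    seqCat s (seqTrunc s x) v = seqCat s x v := by
  funext k
  simp only [seqTrunc, seqCat]
  split_ifs <;> rfl

/-- A measure on sequences is the law of an i.i.d. sequence as soon as its truncations at
arbitrarily large times are. -/
lemma eq_iidSeq_of_seqTrunc [Zero E] {ρ : Measure (ℕ → E)}
    (h : ∀ m, ∃ s, m ≤ s ∧ ρ.map (seqTrunc s) = (iidSeq ν).map (seqTrunc s)) :
    ρ = iidSeq ν := by
  refine Measure.eq_infinitePi _ fun S t ht => ?_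
  obtain ⟨s, hs, h⟩ := h (S.sup id + 1)
  have hm : MeasurableSet (Set.pi (S : Set ℕ) t) :=
    MeasurableSet.pi (Finset.countable_toSet S) fun k _ => ht k
  have h1 : seqTrunc s ⁻¹' (Set.pi (S : Set ℕ) t) = Set.pi (S : Set ℕ) t := by
    ext x
    simp only [Set.mem_preimage, Set.mem_pi]
    refine forall₂_congr fun k hk => ?_
    have : k ≤ S.sup id := Finset.le_sup (f := id) (Finset.mem_coe.1 hk)
    have hk' : k < s := by lia
    simp [seqTrunc, seqCat, hk']
  rw [← h1, ← Measure.map_apply (by fun_prop) hm, h, Measure.map_apply (by fun_prop) hm, h1, iidSeq,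
    Measure.infinitePi_pi _ fun k _ => ht k]

lemma iidSeq_stdG_map_seqSum {ι : Type*} [Fintype ι] (n : ℕ) :
    (iidSeq (stdG ι)).map (seqSum n) = (stdG ι).map fun x => √(n : ℝ) • x := by
  induction n with
  | zero =>
    have h1 : (seqSum 0 : (ℕ → ι → ℝ) → ι → ℝ) = fun _ => 0 := by funext v; simp [seqSum]
    rw [h1]
    simp [Measure.map_const]
  | succ n ih =>
    have h1 : (seqSum (n + 1) : (ℕ → ι → ℝ) → ι → ℝ) =
        (fun z => z.1 + z.2 0) ∘ fun v => (seqSum n v, seqShift n v) := by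
      funext v
      simp [seqSum, seqShift, Finset.sum_range_succ]
    rw [h1, ← Measure.map_map (by fun_prop) (by fun_prop), iidSeq_map_seqSum_pair, ih]
    have h2 : (fun z : (ι → ℝ) × (ℕ → ι → ℝ) => z.1 + z.2 0) =
        (fun z : (ι → ℝ) × (ι → ℝ) => z.1 + z.2) ∘ Prod.map id (fun v => v 0) := rfl
    rw [h2, ← Measure.map_map (by fun_prop) (by fun_prop),
      ← Measure.map_prod_map _ _ (by fun_prop) (by fun_prop),
      (measurePreserving_eval_iidSeq 0).map_eq]
    have h3 : ((stdG ι).map fun x => √(n : ℝ) • x).prod ((stdG ι).map id) =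
        ((stdG ι).prod (stdG ι)).map (Prod.map (fun x => √(n : ℝ) • x) id) :=
      Measure.map_prod_map _ _ (by fun_prop) (by fun_prop)
    rw [Measure.map_id] at h3 ⊢
    rw [h3, Measure.map_map (by fun_prop) (by fun_prop),
      ← stdG_prod_map (s := √(n : ℝ)) (t := 1) (u := √((n + 1 : ℕ) : ℝ))]
    · congr 1
      funext z
      simp
    · rw [Real.sq_sqrt (by positivity), Real.sq_sqrt (by positivity)]
      push_cast
      ring

end iidSeq

end

section blockMap

/-- A measure with first marginal `μ` is the law of the graph of a randomized map. -/
lemma exists_measurable_map_prodMk_eq {α β : Type*} [MeasurableSpace α] [MeasurableSpace β]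
    [StandardBorelSpace β] [Nonempty β] {μ : Measure α} [IsProbabilityMeasure μ]
    {σ : Measure (α × β)} (h : σ.fst = μ) :
    ∃ F : α × unitInterval → β, Measurable F ∧
      (μ.prod volume).map (fun z => (z.1, F z)) = σ := by
  have hσ : IsProbabilityMeasure σ := by
    refine ⟨?_⟩
    rw [← Measure.fst_univ, h, measure_univ]
  obtain ⟨f, hf, hf2⟩ := σ.condKernel.exists_measurable_map_eq_unitInterval
  refine ⟨Function.uncurry f, hf, ?_⟩
  have h1 : σ = μ ⊗ₘ σ.condKernel := by rw [← h, σ.disintegrate]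
  rw [h1]
  refine Measure.ext_of_lintegral _ fun g hg => ?_
  rw [lintegral_map hg (by fun_prop), Measure.lintegral_compProd hg,
    lintegral_prod _ (by fun_prop)]
  refine lintegral_congr fun x => ?_
  have h2 : Measurable (f x) := hf.comp (measurable_const.prodMk measurable_id)
  rw [← hf2 x, lintegral_map (by fun_prop) h2]
  rfl

lemma IsBlockCoupling.exists_seq {ι : Type*} [Fintype ι] {μ : Measure (ℕ → ι → ℝ)}
    [IsProbabilityMeasure μ]
    {j : ℕ} {W : ℝ≥0∞} {π : Measure ((ℕ → ι → ℝ) × (ι → ℝ))} (h : IsBlockCoupling μ j W π) :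
    ∃ σ : Measure ((ℕ → ι → ℝ) × (ℕ → ι → ℝ)), σ.fst = μ ∧
      σ.map (fun z => (seqShift (2 ^ j) z.1, z.2)) = μ.prod (iidSeq (stdG ι)) ∧
      eLpNorm (fun z => seqSum (2 ^ j) z.1 - seqSum (2 ^ j) z.2) 2 σ ≤ W := by
  have hπ : IsProbabilityMeasure π := by
    refine ⟨?_⟩
    rw [← Measure.fst_univ, h.fst_eq, measure_univ]
  set γ : Measure (ι → ℝ) := (iidSeq (stdG ι)).map (seqSum (2 ^ j)) with hγ
  have hγp : IsProbabilityMeasure γ := Measure.isProbabilityMeasure_map (by fun_prop)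
  have hγ' : γ = (stdG ι).map fun y => dScale j • y := by
    rw [hγ, iidSeq_stdG_map_seqSum]
    simp [dScale]
  set ρ : Measure ((ι → ℝ) × (ℕ → ι → ℝ)) :=
    (iidSeq (stdG ι)).map fun v => (seqSum (2 ^ j) v, v) with hρ
  have hρp : IsProbabilityMeasure ρ := Measure.isProbabilityMeasure_map (by fun_prop)
  have hρ1 : ρ.fst = γ := by rw [hρ, Measure.fst_map_prodMk (by fun_prop)]
  have hρ2 : ρ.snd = iidSeq (stdG ι) := by
    rw [hρ, Measure.snd_map_prodMk (by fun_prop), Measure.map_id']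
  set K := ρ.condKernel
  have hK : γ ⊗ₘ K = ρ := by rw [← hρ1, ρ.disintegrate]
  set K' : Kernel ((ℕ → ι → ℝ) × (ι → ℝ)) (ℕ → ι → ℝ) := K.comap Prod.snd measurable_snd with hK'
  set φ : (ℕ → ι → ℝ) × (ι → ℝ) → (ℕ → ι → ℝ) × (ι → ℝ) :=
    fun z => (seqShift (2 ^ j) z.1, z.2) with hφ
  have hφm : Measurable φ := by fun_prop
  set π' := π ⊗ₘ K' with hπ'
  have h_fst : (π'.map fun z => (z.1.1, z.2)).fst = μ := by
    rw [Measure.fst, Measure.map_map (by fun_prop) (by fun_prop), ← h.fst_eq, Measure.fst]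
    have : Prod.fst ∘ (fun z : ((ℕ → ι → ℝ) × (ι → ℝ)) × (ℕ → ι → ℝ) => (z.1.1, z.2)) =
      Prod.fst ∘ Prod.fst := rfl
    rw [this, ← Measure.map_map (by fun_prop) (by fun_prop)]
    congr 1
    exact Measure.fst_compProd _ _
  have h_law : (μ.prod γ) ⊗ₘ K' =
      π'.map (Prod.map φ id) := by
    have h1 : K' = K'.comap φ hφm := rfl
    rw [hπ', h1, Measure.map_compProd_comap, h.map_eq, targetLaw, hγ']
    rfl
  have h_snd : π'.map (fun z => (z.1.2, z.2)) = ρ := by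
    have h2 := Measure.map_compProd_comap π (measurable_snd (α := ℕ → ι → ℝ)) K
    have h3 : π.map Prod.snd = γ := by
      have := congrArg (Measure.map Prod.snd) h.map_eq
      rw [Measure.map_map (by fun_prop) (by fun_prop), targetLaw, Measure.map_snd_prod,
        measure_univ, one_smul] at this
      rw [hγ', ← this]
      rfl
    rw [h3, hK] at h2
    exact h2
  have h_ae : ∀ᵐ z ∂π', seqSum (2 ^ j) z.2 = z.1.2 := by
    have h4 : ∀ᵐ z ∂ρ, seqSum (2 ^ j) z.2 = z.1 := by
      rw [hρ, ae_map_iff (by fun_prop) (measurableSet_eq_fun (by fun_prop) (by fun_prop))]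
      exact ae_of_all _ fun v => rfl
    rw [← h_snd] at h4
    exact ae_of_ae_map (by fun_prop) h4
  refine ⟨π'.map fun z => (z.1.1, z.2), h_fst, ?_, ?_⟩
  · rw [Measure.map_map (by fun_prop) (by fun_prop)]
    have h5 : (fun z : (ℕ → ι → ℝ) × (ℕ → ι → ℝ) => (seqShift (2 ^ j) z.1, z.2)) ∘
        (fun z : ((ℕ → ι → ℝ) × (ι → ℝ)) × (ℕ → ι → ℝ) => (z.1.1, z.2)) =
        (fun z => (z.1.1, z.2)) ∘ Prod.map φ id := rfl
    rw [h5, ← Measure.map_map (by fun_prop) (by fun_prop), ← h_law]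
    symm
    refine Measure.prod_eq fun s t hs ht => ?_
    rw [Measure.map_apply (by fun_prop) (hs.prod ht), Measure.compProd_apply (by measurability),
      ← hρ2, ← hK, Measure.snd_apply ht, Measure.compProd_apply (ht.preimage measurable_snd),
      lintegral_prod _ ((Kernel.measurable_kernel_prodMk_left (by measurability)).aemeasurable)]
    have h6 : ∀ x y, (K' (x, y))
        (Prod.mk (x, y) ⁻¹' ((fun z : ((ℕ → ι → ℝ) × (ι → ℝ)) × (ℕ → ι → ℝ) => (z.1.1, z.2)) ⁻¹'
          s ×ˢ t)) = s.indicator 1 x * K y t := by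
      intro x y
      by_cases hx : x ∈ s
      · simp [hx, Set.preimage, hK', Kernel.comap_apply]
      · simp [hx, Set.preimage, hK', Kernel.comap_apply]
    simp_rw [h6]
    have h7 : Measurable fun y => K y t := K.measurable_coe ht
    simp_rw [lintegral_const_mul _ h7]
    rw [lintegral_mul_const _ (measurable_one.indicator hs), lintegral_indicator_one hs]
    rfl
  · rw [eLpNorm_map_measure (Measurable.aestronglyMeasurable (by fun_prop)) (by fun_prop)]
    refine le_trans (le_of_eq ?_) h.err_le
    have h8 : π = π'.map Prod.fst := (Measure.fst_compProd _ _).symm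
    rw [h8, eLpNorm_map_measure (Measurable.aestronglyMeasurable (by fun_prop)) (by fun_prop)]
    refine eLpNorm_congr_ae ?_
    filter_upwards [h_ae] with z hz
    simp [hz]

lemma RevCore.exists_blockMap {ι : Type*} [Fintype ι] [DecidableEq ι] {p : ℝ}
    {μ : Measure (ℕ → ι → ℝ)} {h : ℕ → ι → ι → (ℕ → ι → ℝ) → ℝ} (hc : RevCore p μ h) (j : ℕ) :
    ∃ F : (ℕ → ι → ℝ) × unitInterval → ℕ → ι → ℝ, Measurable F ∧
      (μ.prod volume).map (fun z => (seqShift (2 ^ j) z.1, F z)) = μ.prod (iidSeq (stdG ι)) ∧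
      eLpNorm (fun z => seqSum (2 ^ j) z.1 - seqSum (2 ^ j) (F z)) 2 (μ.prod volume) ≤
        blockErr μ h j := by
  have := hc.prob
  obtain ⟨π, hπ⟩ := hc.exists_isBlockCoupling j
  obtain ⟨σ, h1, h2, h3⟩ := hπ.exists_seq
  obtain ⟨F, hF, h4⟩ := exists_measurable_map_prodMk_eq h1
  refine ⟨F, hF, ?_, ?_⟩
  · rw [← h2, ← h4, Measure.map_map (by fun_prop) (by fun_prop)]
    rfl
  · refine le_trans (le_of_eq ?_) h3
    rw [← h4, eLpNorm_map_measure (Measurable.aestronglyMeasurable (by fun_prop)) (by fun_prop)]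
    rfl

end blockMap

section

section reversedDoob

variable {Y : Type*} [MeasurableSpace Y] {ρ : Measure Y} [IsProbabilityMeasure ρ] {T : Y → Y}
  {X : Y → ℝ}

/-- The points for which some final segment `S_L - S_k` of the Birkhoff sum of length `L` is at
least `2 x` in absolute value. -/
def tailExceed {Y : Type*} (T : Y → Y) (X : Y → ℝ) (x : ℝ) : ℕ → Set Y
  | 0 => ∅
  | L + 1 => T ⁻¹' tailExceed T X x L ∪ {y | 2 * x ≤ |birkhoffSum T X (L + 1) y|}

omit [MeasurableSpace Y] in
lemma abs_birkhoffSum_sub_lt {x : ℝ} (hx : 0 < x) {L : ℕ} :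
    ∀ {y : Y}, y ∉ tailExceed T X x L → ∀ k ≤ L,
      |birkhoffSum T X L y - birkhoffSum T X k y| < 2 * x := by
  induction L with
  | zero =>
    intro y _ k hk
    obtain rfl : k = 0 := by lia
    simpa using hx
  | succ L ih =>
    intro y hy k hk
    simp only [tailExceed, Set.mem_union, Set.mem_preimage, Set.mem_ofPred_eq, not_or, not_le] at hy
    rcases k with _ | k
    · simpa using hy.2
    · have := ih hy.1 k (by lia)
      rw [birkhoffSum_succ', birkhoffSum_succ']
      simpa using this

@[fun_prop]
lemma measurable_birkhoffSum (hT : Measurable T) (hX : Measurable X) (n : ℕ) :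
    Measurable (birkhoffSum T X n) := by
  unfold birkhoffSum
  exact Finset.measurable_fun_sum _ fun k _ => hX.comp (hT.iterate k)

lemma measurableSet_tailExceed (hT : Measurable T) (hX : Measurable X) (x : ℝ) (L : ℕ) :
    MeasurableSet (tailExceed T X x L) := by
  induction L with
  | zero => exact MeasurableSet.empty
  | succ L ih =>
    exact (hT ih).union (measurableSet_le measurable_const
      (measurable_birkhoffSum hT hX (L + 1)).abs)

omit [IsProbabilityMeasure ρ] in
lemma memLp_birkhoffSum (hT : MeasurePreserving T ρ ρ) (hX : MemLp X 2 ρ) (n : ℕ) :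
    MemLp (birkhoffSum T X n) 2 ρ := by
  unfold birkhoffSum
  exact memLp_finsetSum _ fun k _ => hX.comp_measurePreserving (hT.iterate k)

lemma mul_real_tailExceed_le (hT : MeasurePreserving T ρ ρ) (hX : Measurable X)
    (hX2 : MemLp X 2 ρ)
    (horth : ∀ Z : Y → ℝ, Measurable Z → MemLp Z 2 ρ → ∫ y, Z (T y) * X y ∂ρ = 0)
    (x : ℝ) (L : ℕ) :
    2 * x * ρ.real (tailExceed T X x L) ≤
      ∫ y in tailExceed T X x L, |birkhoffSum T X L y| ∂ρ := by
  classical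
  induction L with
  | zero => simp [tailExceed]
  | succ L ih =>
    set A := tailExceed T X x L with hA
    set S := birkhoffSum T X L with hS
    set S' := birkhoffSum T X (L + 1) with hS'
    have hAm : MeasurableSet A := measurableSet_tailExceed hT.measurable hX x L
    have hSm : Measurable S := measurable_birkhoffSum hT.measurable hX L
    have hSm' : Measurable S' := measurable_birkhoffSum hT.measurable hX (L + 1)
    have hS2 : Integrable S ρ := (memLp_birkhoffSum hT hX2 L).integrable one_le_two
    have hS2' : Integrable S' ρ := (memLp_birkhoffSum hT hX2 (L + 1)).integrable one_le_two
    have hB : MeasurableSet {y | 2 * x ≤ |S' y|} := measurableSet_le measurable_const hSm'.abs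
    have h1 : tailExceed T X x (L + 1) = T ⁻¹' A ∪ ({y | 2 * x ≤ |S' y|} \ T ⁻¹' A) := by
      rw [Set.union_sdiff_self]; rfl
    have hd : Disjoint (T ⁻¹' A) ({y | 2 * x ≤ |S' y|} \ T ⁻¹' A) := Set.disjoint_sdiff_right
    have hm2 : MeasurableSet ({y | 2 * x ≤ |S' y|} \ T ⁻¹' A) := hB.diff (hT.measurable hAm)
    rw [h1, measureReal_union hd hm2, setIntegral_union hd hm2 hS2'.abs.integrableOn
      hS2'.abs.integrableOn, mul_add]
    refine add_le_add ?_ ?_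
    · set Z : Y → ℝ := A.indicator fun y => (SignType.sign (S y) : ℝ) with hZ
      have hsm : Measurable fun y => (SignType.sign (S y) : ℝ) := by
        have : Measurable fun t : ℝ => (SignType.sign t : ℝ) := by
          have h0 : (fun t : ℝ => (SignType.sign t : ℝ)) =
              fun t => if 0 < t then 1 else if t < 0 then -1 else 0 := by
            funext t
            simp only [sign_apply]
            split_ifs <;> simp
          rw [h0]
          exact Measurable.ite measurableSet_Ioi measurable_const
            (Measurable.ite measurableSet_Iio measurable_const measurable_const)
        exact this.comp hSm
      have hZm : Measurable Z := hsm.indicator hAm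
      have hZ1 : ∀ y, |Z y| ≤ 1 := by
        intro y
        rw [hZ, Set.indicator_apply]
        split_ifs
        · rcases SignType.sign (S y) with _ | _ | _ <;> simp
        · simp
      have hZ2 : MemLp Z 2 ρ := MemLp.of_bound hZm.aestronglyMeasurable 1 (ae_of_all _ hZ1)
      have h2 := horth Z hZm hZ2
      have hi1 : Integrable (fun y => Z (T y) * X y) ρ :=
        (hX2.integrable one_le_two).bdd_mul
          (hZm.comp hT.measurable).aestronglyMeasurable (ae_of_all _ fun y => hZ1 (T y))
      have h3 : ∀ y, Z y * S y = A.indicator (fun y => |S y|) y := by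
        intro y
        rw [hZ, Set.indicator_apply, Set.indicator_apply]
        split_ifs
        · exact sign_mul_self (S y)
        · simp
      have hi2 : Integrable (fun y => Z (T y) * S (T y)) ρ := by
        have : Integrable (fun y => Z y * S y) ρ := by
          simp_rw [h3]; exact hS2.abs.indicator hAm
        exact hT.integrable_comp_of_integrable this
      calc 2 * x * ρ.real (T ⁻¹' A) = 2 * x * ρ.real A := by
            rw [measureReal_def, hT.measure_preimage hAm.nullMeasurableSet, measureReal_def]
        _ ≤ ∫ y in A, |S y| ∂ρ := ih
        _ = ∫ y, Z y * S y ∂ρ := by simp_rw [h3]; rw [integral_indicator hAm]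
        _ = ∫ y, Z (T y) * S (T y) ∂ρ :=
            (hT.integral_comp_of_measurable (hZm.mul hSm)).symm
        _ = ∫ y, (Z (T y) * X y + Z (T y) * S (T y)) ∂ρ := by
            rw [integral_add hi1 hi2, h2, zero_add]
        _ ≤ ∫ y, (T ⁻¹' A).indicator (fun y => |S' y|) y ∂ρ := by
            refine integral_mono (hi1.add hi2) (hS2'.abs.indicator (hT.measurable hAm)) fun y => ?_
            simp only
            rw [← mul_add, ← birkhoffSum_succ', ← hS']
            by_cases hy : T y ∈ A
            · rw [Set.indicator_of_mem (s := T ⁻¹' A) hy]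
              refine (le_abs_self _).trans ?_
              rw [abs_mul]
              exact mul_le_of_le_one_left (abs_nonneg _) (hZ1 _)
            · rw [Set.indicator_of_notMem (s := T ⁻¹' A) hy, hZ, Set.indicator_of_notMem hy,
                zero_mul]
        _ = ∫ y in T ⁻¹' A, |S' y| ∂ρ := integral_indicator (hT.measurable hAm)
    · refine setIntegral_ge_of_const_le_real hm2 (measure_ne_top _ _) (fun y hy => hy.1)
        hS2'.abs.integrableOn

/-- Maximal inequality for stationary reversed martingale differences. -/
lemma sq_mul_measure_exceed_le (hT : MeasurePreserving T ρ ρ) (hX : Measurable X)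
    (hX2 : MemLp X 2 ρ)
    (horth : ∀ Z : Y → ℝ, Measurable Z → MemLp Z 2 ρ → ∫ y, Z (T y) * X y ∂ρ = 0)
    {x : ℝ} (hx : 0 < x) (L : ℕ) :
    ENNReal.ofReal (x ^ 2) * ρ {y | ∃ k ≤ L, 4 * x ≤ |birkhoffSum T X k y|} ≤
      ∫⁻ y, {y | x < |birkhoffSum T X L y|}.indicator
        (fun y => ‖birkhoffSum T X L y‖ₑ ^ 2) y ∂ρ := by
  set S := birkhoffSum T X L with hS
  set A := tailExceed T X x L with hA
  have hAm : MeasurableSet A := measurableSet_tailExceed hT.measurable hX x L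
  have hSm : Measurable S := measurable_birkhoffSum hT.measurable hX L
  have hS2 : MemLp S 2 ρ := memLp_birkhoffSum hT hX2 L
  have hS1 : Integrable S ρ := hS2.integrable one_le_two
  have hB : MeasurableSet {y | x < |S y|} := measurableSet_lt measurable_const hSm.abs
  have h1 := mul_real_tailExceed_le hT hX hX2 horth x L
  rw [← hA, ← hS] at h1
  have hi : Integrable ({y | x < |S y|}.indicator fun y => S y ^ 2) ρ :=
    hS2.integrable_sq.indicator hB
  have h2 : x ^ 2 * ρ.real A ≤ ∫ y, {y | x < |S y|}.indicator (fun y => S y ^ 2) y ∂ρ := by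
    have h3 : x * ∫ y in A, |S y| ∂ρ ≤
        x ^ 2 * ρ.real A + ∫ y, {y | x < |S y|}.indicator (fun y => S y ^ 2) y ∂ρ := by
      rw [← integral_const_mul]
      have h4 : ∫ y in A, x * |S y| ∂ρ ≤
          ∫ y in A, (x ^ 2 + {y | x < |S y|}.indicator (fun y => S y ^ 2) y) ∂ρ := by
        refine integral_mono (hS1.abs.const_mul x).integrableOn
          ((integrable_const _).add hi).integrableOn fun y => ?_
        simp only [Set.indicator_apply, Set.mem_ofPred_eq]
        split_ifs with h
        · rw [← sq_abs (S y)]; nlinarith [abs_nonneg (S y)]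
        · push Not at h; nlinarith [abs_nonneg (S y)]
      refine h4.trans ?_
      rw [integral_add (integrable_const _) hi.integrableOn, setIntegral_const, smul_eq_mul,
        mul_comm]
      refine add_le_add le_rfl (setIntegral_le_integral hi (ae_of_all _ fun y => ?_))
      exact Set.indicator_nonneg (fun y _ => sq_nonneg _) y
    nlinarith
  have h5 : {y | ∃ k ≤ L, 4 * x ≤ |birkhoffSum T X k y|} ⊆ A := by
    rintro y ⟨k, hk, hky⟩
    by_contra hyA
    have ha := abs_birkhoffSum_sub_lt hx hyA k hk
    have hb := abs_birkhoffSum_sub_lt hx hyA 0 (Nat.zero_le _)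
    simp only [birkhoffSum_zero, sub_zero] at hb
    have hc : |birkhoffSum T X k y| ≤ |S y| + |S y - birkhoffSum T X k y| := by
      have := abs_sub (S y) (S y - birkhoffSum T X k y)
      simpa using this
    linarith
  calc ENNReal.ofReal (x ^ 2) * ρ {y | ∃ k ≤ L, 4 * x ≤ |birkhoffSum T X k y|}
      ≤ ENNReal.ofReal (x ^ 2) * ρ A := by gcongr
    _ = ENNReal.ofReal (x ^ 2 * ρ.real A) := by
        rw [ENNReal.ofReal_mul (by positivity), ofReal_measureReal]
    _ ≤ ENNReal.ofReal (∫ y, {y | x < |S y|}.indicator (fun y => S y ^ 2) y ∂ρ) :=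
        ENNReal.ofReal_le_ofReal h2
    _ = _ := by
        rw [ofReal_integral_eq_lintegral_ofReal hi
          (ae_of_all _ fun y => Set.indicator_nonneg (fun y _ => sq_nonneg _) y)]
        refine lintegral_congr fun y => ?_
        simp only [Set.indicator_apply]
        split_ifs
        · rw [← sq_abs, ENNReal.ofReal_pow (abs_nonneg _), Real.enorm_eq_ofReal_abs]
        · simp

end reversedDoob

end

section

section glue

lemma MeasureTheory.Measure.map_prod_prod_swap {α β γ : Type*} [MeasurableSpace α]
    [MeasurableSpace β] [MeasurableSpace γ] (μ : Measure α) (ν : Measure β) (ρ : Measure γ)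
    [SFinite μ] [SFinite ν] [SFinite ρ] :
    ((μ.prod ν).prod ρ).map (fun z => ((z.1.1, z.2), z.1.2)) = (μ.prod ρ).prod ν := by
  refine Measure.ext_of_lintegral _ fun g hg => ?_
  rw [lintegral_map hg (by fun_prop), lintegral_prod _ (by fun_prop), lintegral_prod _ (by fun_prop),
    lintegral_prod _ (by fun_prop), lintegral_prod _ (by fun_prop)]
  exact lintegral_congr fun x => lintegral_lintegral_swap (by fun_prop)

/-- The simultaneous shift on a sequence and its randomization. -/
def pairShift {E U : Type*} (n : ℕ) (z : (ℕ → E) × (ℕ → U)) : (ℕ → E) × (ℕ → U) :=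
  (seqShift n z.1, seqShift n z.2)

/-- The law of a sequence together with an independent sequence of uniform variables. -/
def randLaw {E : Type*} [MeasurableSpace E] (μ : Measure (ℕ → E)) :
    Measure ((ℕ → E) × (ℕ → unitInterval)) :=
  μ.prod (iidSeq volume)

/-- The beginning of the block containing `k`, for blocks of length `2 ^ J N` between `2 ^ N` and
`2 ^ (N + 1)`. -/
def blockStart (J : ℕ → ℕ) (k : ℕ) : ℕ := k / 2 ^ J (Nat.log 2 k) * 2 ^ J (Nat.log 2 k)

/-- The sequence obtained by concatenating the blocks produced by the maps `F j`. -/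
def glueSeq {E : Type*} (F : ℕ → (ℕ → E) × unitInterval → ℕ → E) (J : ℕ → ℕ)
    (z : (ℕ → E) × (ℕ → unitInterval)) : ℕ → E := fun k =>
  F (J (Nat.log 2 k)) (seqShift (blockStart J k) z.1, z.2 (blockStart J k)) (k - blockStart J k)

variable {E : Type*} [MeasurableSpace E] {μ : Measure (ℕ → E)} [IsProbabilityMeasure μ]
  {ν : Measure E} [IsProbabilityMeasure ν] {F : ℕ → (ℕ → E) × unitInterval → ℕ → E} {J : ℕ → ℕ}

instance : IsProbabilityMeasure (randLaw μ) := by unfold randLaw; infer_instance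

@[fun_prop]
lemma measurable_pairShift {U : Type*} [MeasurableSpace U] (n : ℕ) :
    Measurable (pairShift n : (ℕ → E) × (ℕ → U) → (ℕ → E) × (ℕ → U)) := by
  unfold pairShift; fun_prop

lemma measurePreserving_pairShift (h : MeasurePreserving (seqShift 1) μ μ) (n : ℕ) :
    MeasurePreserving (pairShift n) (randLaw μ) (randLaw μ) :=
  (measurePreserving_seqShift h n).prod (measurePreserving_seqShift_iidSeq n)

lemma measurable_glueSeq (hF : ∀ j, Measurable (F j)) : Measurable (glueSeq F J) := by
  refine measurable_pi_lambda _ fun k => ?_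
  unfold glueSeq
  have := hF (J (Nat.log 2 k))
  fun_prop

lemma randLaw_map_block {n : ℕ} (hn : 0 < n) {f : (ℕ → E) × unitInterval → ℕ → E}
    (hf : Measurable f)
    (hlaw : (μ.prod volume).map (fun z => (seqShift n z.1, f z)) = μ.prod (iidSeq ν)) :
    (randLaw μ).map (fun z => (pairShift n z, f (z.1, z.2 0))) =
      (randLaw μ).prod (iidSeq ν) := by
  have h1 : (randLaw μ).map (fun z => ((z.1, z.2 0), seqShift n z.2)) =
      (μ.prod volume).prod (iidSeq volume) := by
    have h2 : (fun z : (ℕ → E) × (ℕ → unitInterval) => ((z.1, z.2 0), seqShift n z.2)) =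
        MeasurableEquiv.prodAssoc.symm ∘ Prod.map id (fun u => (u 0, seqShift n u)) := rfl
    rw [h2, ← Measure.map_map (by fun_prop) (by fun_prop), randLaw,
      ← Measure.map_prod_map _ _ (by fun_prop) (by fun_prop), iidSeq_map_zero_pair hn,
      Measure.map_id, ← Measure.prodAssoc_prod, Measure.map_map (by fun_prop) (by fun_prop)]
    simp
  have h3 : (fun z : (ℕ → E) × (ℕ → unitInterval) => (pairShift n z, f (z.1, z.2 0))) =
      (fun z : ((ℕ → E) × (ℕ → E)) × (ℕ → unitInterval) => ((z.1.1, z.2), z.1.2)) ∘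
      Prod.map (fun z => (seqShift n z.1, f z)) id ∘
      fun z => ((z.1, z.2 0), seqShift n z.2) := rfl
  rw [h3, ← Measure.map_map (by fun_prop) (by fun_prop),
    ← Measure.map_map (by fun_prop) (by fun_prop), h1,
    ← Measure.map_prod_map _ _ (by fun_prop) (by fun_prop), hlaw, Measure.map_id,
    Measure.map_prod_prod_swap, randLaw]

lemma add_two_pow_le_of_dvd {s : ℕ} {j : ℕ} (hj : j ≤ Nat.log 2 s)
    (h : 2 ^ j ∣ s) : s + 2 ^ j ≤ 2 ^ (Nat.log 2 s + 1) := by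
  have h1 : s < 2 ^ (Nat.log 2 s + 1) := Nat.lt_pow_succ_log_self (by norm_num) s
  have h2 : 2 ^ j ∣ 2 ^ (Nat.log 2 s + 1) := pow_dvd_pow 2 (by lia)
  obtain ⟨a, ha⟩ := h
  obtain ⟨b, hb⟩ := h2
  have h1' := h1
  rw [hb] at h1'
  nth_rw 1 [ha] at h1'
  have h3 : a < b := lt_of_mul_lt_mul_left h1' (Nat.zero_le _)
  have h4 := Nat.mul_le_mul_left (2 ^ j) (Nat.succ_le_of_lt h3)
  rw [← hb, Nat.mul_succ, ← ha] at h4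
  exact h4

lemma log_eq_of_mem_block (hJ : ∀ N, J N ≤ N) {s : ℕ} (hs : 2 ^ J (Nat.log 2 s) ∣ s) {k : ℕ}
    (h1 : s ≤ k) (h2 : k < s + 2 ^ J (Nat.log 2 s)) : Nat.log 2 k = Nat.log 2 s := by
  rcases Nat.eq_zero_or_pos s with rfl | hpos
  · have h0 : J 0 = 0 := by have := hJ 0; lia
    simp [h0] at h2
    rw [h2]
  · have := add_two_pow_le_of_dvd (hJ _) hs
    refine Nat.log_eq_of_pow_le_of_lt_pow ?_ (by lia)
    exact (Nat.pow_log_le_self 2 hpos.ne').trans h1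

lemma blockStart_eq_of_mem_block (hJ : ∀ N, J N ≤ N) {s : ℕ} (hs : 2 ^ J (Nat.log 2 s) ∣ s) {k : ℕ}
    (h1 : s ≤ k) (h2 : k < s + 2 ^ J (Nat.log 2 s)) : blockStart J k = s := by
  have h3 := log_eq_of_mem_block hJ hs h1 h2
  rw [blockStart, h3]
  obtain ⟨a, ha⟩ := hs
  set m := 2 ^ J (Nat.log 2 s)
  have hm : 0 < m := by positivity
  have : k / m = a :=
    Nat.div_eq_of_lt_le (by rw [mul_comm, ← ha]; exact h1) (by rw [mul_comm, Nat.mul_succ, ← ha]; exact h2)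
  rw [this, mul_comm, ← ha]

lemma two_pow_dvd_next (hJ : ∀ N, J N ≤ N) {s : ℕ} (hs : 2 ^ J (Nat.log 2 s) ∣ s) :
    2 ^ J (Nat.log 2 (s + 2 ^ J (Nat.log 2 s))) ∣ s + 2 ^ J (Nat.log 2 s) := by
  have h0 : J 0 = 0 := by have := hJ 0; lia
  rcases Nat.eq_zero_or_pos s with rfl | hpos
  · simp [h0]
  · have h1 := add_two_pow_le_of_dvd (hJ _) hs
    rcases h1.lt_or_eq with h2 | h2
    · have h3 : Nat.log 2 (s + 2 ^ J (Nat.log 2 s)) = Nat.log 2 s :=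
        Nat.log_eq_of_pow_le_of_lt_pow
          ((Nat.pow_log_le_self 2 hpos.ne').trans (Nat.le_add_right _ _)) h2
      rw [h3]
      exact dvd_add hs dvd_rfl
    · rw [h2, Nat.log_pow (by norm_num)]
      exact pow_dvd_pow 2 (hJ _)

omit [MeasurableSpace E] in
lemma seqTrunc_glueSeq [Zero E] (hJ : ∀ N, J N ≤ N) {s : ℕ} (hs : 2 ^ J (Nat.log 2 s) ∣ s)
    (z : (ℕ → E) × (ℕ → unitInterval)) :
    seqTrunc (s + 2 ^ J (Nat.log 2 s)) (glueSeq F J z) =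
      seqTrunc (s + 2 ^ J (Nat.log 2 s)) (seqCat s (seqTrunc s (glueSeq F J z))
        (F (J (Nat.log 2 s)) ((pairShift s z).1, (pairShift s z).2 0))) := by
  funext k
  rw [seqCat_seqTrunc]
  simp only [seqTrunc, seqCat]
  split_ifs with h1 h2
  · rfl
  · have h3 := log_eq_of_mem_block hJ hs (by lia) h1
    have h4 := blockStart_eq_of_mem_block hJ hs (by lia) h1
    simp [glueSeq, h3, h4, pairShift, seqShift]
  · rfl

lemma randLaw_map_seqTrunc_glueSeq [Zero E] (hJ : ∀ N, J N ≤ N) (hF : ∀ j, Measurable (F j))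
    (hlaw : ∀ j, (μ.prod volume).map (fun z => (seqShift (2 ^ j) z.1, F j z)) =
      μ.prod (iidSeq ν)) (m : ℕ) :
    ∃ s, m ≤ s ∧ 2 ^ J (Nat.log 2 s) ∣ s ∧
      (randLaw μ).map (fun z => (pairShift s z, seqTrunc s (glueSeq F J z))) =
        (randLaw μ).prod ((iidSeq ν).map (seqTrunc s)) := by
  have hG : Measurable (glueSeq F J) := measurable_glueSeq hF
  induction m with
  | zero =>
    refine ⟨0, le_rfl, dvd_zero _, ?_⟩
    have h1 : (seqTrunc 0 : (ℕ → E) → ℕ → E) = fun _ => 0 := by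
      funext x k; simp [seqTrunc, seqCat]
    have h2 : (pairShift 0 : (ℕ → E) × (ℕ → unitInterval) → _) = id := rfl
    simp only [h1, h2, Measure.map_const, measure_univ, one_smul, id_eq]
    exact Measure.prod_dirac 0 |>.symm
  | succ m ih =>
    obtain ⟨s, hms, hs, h⟩ := ih
    refine ⟨s + 2 ^ J (Nat.log 2 s), ?_, two_pow_dvd_next hJ hs, ?_⟩
    · have : 0 < 2 ^ J (Nat.log 2 s) := by positivity
      lia
    set j := J (Nat.log 2 s)
    have hp : IsProbabilityMeasure ((iidSeq ν).map (seqTrunc s)) :=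
      Measure.isProbabilityMeasure_map (by fun_prop)
    have hFj := hF j
    have h3 : (fun z => (pairShift (s + 2 ^ j) z, seqTrunc (s + 2 ^ j) (glueSeq F J z))) =
        Prod.map id (fun z => seqTrunc (s + 2 ^ j) (seqCat s z.2 z.1)) ∘ MeasurableEquiv.prodAssoc ∘
        Prod.map (fun z => (pairShift (2 ^ j) z, F j (z.1, z.2 0))) id ∘
        fun z => (pairShift s z, seqTrunc s (glueSeq F J z)) := by
      funext z
      rw [seqTrunc_glueSeq hJ hs]
      simp [pairShift, seqShift_seqShift, add_comm, MeasurableEquiv.prodAssoc, j]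
    have hm : Measurable fun z : (ℕ → E) × (ℕ → E) => seqTrunc (s + 2 ^ j) (seqCat s z.2 z.1) :=
      (measurable_seqTrunc _).comp ((measurable_seqCat s).comp measurable_swap)
    rw [h3, ← Measure.map_map (by fun_prop) (by fun_prop),
      ← Measure.map_map (by fun_prop) (by fun_prop),
      ← Measure.map_map (by fun_prop) (by fun_prop), h,
      ← Measure.map_prod_map _ _ (by fun_prop) (by fun_prop),
      randLaw_map_block (by positivity) hFj (hlaw j), Measure.map_id, Measure.prodAssoc_prod,
      ← Measure.map_prod_map _ _ (by fun_prop) (by fun_prop), Measure.map_id]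
    congr 1
    have h4 : (iidSeq ν).prod ((iidSeq ν).map (seqTrunc s)) =
        ((iidSeq ν).prod (iidSeq ν)).map (Prod.map id (seqTrunc s)) := by
      rw [← Measure.map_prod_map _ _ (by fun_prop) (by fun_prop), Measure.map_id]
    rw [h4, Measure.map_map (by fun_prop) (by fun_prop)]
    have h5 : (fun z : (ℕ → E) × (ℕ → E) => seqTrunc (s + 2 ^ j) (seqCat s z.2 z.1)) ∘
        Prod.map id (seqTrunc s) =
        seqTrunc (s + 2 ^ j) ∘ (fun z => seqCat s z.1 z.2) ∘ Prod.swap := by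
      funext z
      simp [seqCat_seqTrunc]
    rw [h5, ← Measure.map_map (by fun_prop) (by fun_prop),
      ← Measure.map_map (by fun_prop) (by fun_prop), Measure.prod_swap, iidSeq_map_seqCat]

/-- The concatenation of the blocks is an i.i.d. sequence. -/
lemma randLaw_map_glueSeq [Zero E] (hJ : ∀ N, J N ≤ N) (hF : ∀ j, Measurable (F j))
    (hlaw : ∀ j, (μ.prod volume).map (fun z => (seqShift (2 ^ j) z.1, F j z)) =
      μ.prod (iidSeq ν)) :
    (randLaw μ).map (glueSeq F J) = iidSeq ν := by
  have hG : Measurable (glueSeq F J) := measurable_glueSeq hF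
  refine eq_iidSeq_of_seqTrunc fun m => ?_
  obtain ⟨s, hs, -, h⟩ := randLaw_map_seqTrunc_glueSeq hJ hF hlaw m
  refine ⟨s, hs, ?_⟩
  have hp : IsProbabilityMeasure ((iidSeq ν).map (seqTrunc s)) :=
    Measure.isProbabilityMeasure_map (by fun_prop)
  have h1 := congrArg Measure.snd h
  rw [Measure.snd_prod, Measure.snd_map_prodMk (by fun_prop)] at h1
  rw [Measure.map_map (by fun_prop) hG]
  exact h1

end glue

end

section

section blockMaximal

lemma indicator_enorm_sq_le (s g x : ℝ) :
    {t : ℝ | x < |t|}.indicator (fun t => ‖t‖ₑ ^ 2) s ≤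
      4 * ‖s - g‖ₑ ^ 2 + 2 * {t : ℝ | x / 2 < |t|}.indicator (fun t => ‖t‖ₑ ^ 2) g := by
  have hsq : ∀ t : ℝ, ‖t‖ₑ ^ 2 = ENNReal.ofReal (t ^ 2) := fun t => by
    rw [← sq_abs, ENNReal.ofReal_pow (abs_nonneg _), Real.enorm_eq_ofReal_abs]
  have h4 : (4 : ℝ≥0∞) = ENNReal.ofReal 4 := by simp
  have h2 : (2 : ℝ≥0∞) = ENNReal.ofReal 2 := by simp
  simp only [Set.indicator_apply, Set.mem_ofPred_eq]
  split_ifs with h5 h6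
  · rw [hsq, hsq, hsq, h4, h2, ← ENNReal.ofReal_mul (by norm_num),
      ← ENNReal.ofReal_mul (by norm_num), ← ENNReal.ofReal_add (by positivity) (by positivity)]
    refine ENNReal.ofReal_le_ofReal ?_
    nlinarith [sq_nonneg (s - 2 * g), sq_nonneg (s - g)]
  · rw [hsq, hsq, h4, mul_zero, add_zero, ← ENNReal.ofReal_mul (by norm_num)]
    refine ENNReal.ofReal_le_ofReal ?_
    push Not at h6
    have h7 : |s| ≤ 2 * |s - g| := by
      have := abs_sub_abs_le_abs_sub s g
      linarith
    rw [← sq_abs s, ← sq_abs (s - g)]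
    nlinarith [abs_nonneg s, abs_nonneg (s - g)]
  · exact zero_le
  · exact zero_le

lemma lintegral_sq_eq_ofReal {Y : Type*} [MeasurableSpace Y] {ρ : Measure Y} {f : Y → ℝ}
    (hf : MemLp f 2 ρ) : ∫⁻ y, ‖f y‖ₑ ^ 2 ∂ρ = ENNReal.ofReal (∫ y, f y ^ 2 ∂ρ) := by
  rw [ofReal_integral_eq_lintegral_ofReal hf.integrable_sq (ae_of_all _ fun y => sq_nonneg _)]
  refine lintegral_congr fun y => ?_
  rw [← sq_abs, ENNReal.ofReal_pow (abs_nonneg _), Real.enorm_eq_ofReal_abs]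

lemma lintegral_birkhoffSum_sq {Y : Type*} [MeasurableSpace Y] {ρ : Measure Y}
    {T : Y → Y} {X : Y → ℝ} (hT : MeasurePreserving T ρ ρ) (hX : Measurable X)
    (hX2 : MemLp X 2 ρ)
    (horth : ∀ Z : Y → ℝ, Measurable Z → MemLp Z 2 ρ → ∫ y, Z (T y) * X y ∂ρ = 0) (L : ℕ) :
    ∫⁻ y, ‖birkhoffSum T X L y‖ₑ ^ 2 ∂ρ = L * ∫⁻ y, ‖X y‖ₑ ^ 2 ∂ρ := by
  have hS : ∀ L, MemLp (birkhoffSum T X L) 2 ρ := memLp_birkhoffSum hT hX2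
  rw [lintegral_sq_eq_ofReal (hS L), lintegral_sq_eq_ofReal hX2, ← ENNReal.ofReal_natCast,
    ← ENNReal.ofReal_mul (by positivity)]
  congr 1
  induction L with
  | zero => simp
  | succ L ih =>
    have hm := measurable_birkhoffSum hT.measurable hX L
    have h1 : MemLp (fun y => birkhoffSum T X L (T y)) 2 ρ := (hS L).comp_measurePreserving hT
    have h2 : ∀ y, birkhoffSum T X (L + 1) y ^ 2 = X y ^ 2 +
        (2 * (birkhoffSum T X L (T y) * X y) + birkhoffSum T X L (T y) ^ 2) := by
      intro y
      rw [birkhoffSum_succ']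
      ring
    have hi1 : Integrable (fun y => 2 * (birkhoffSum T X L (T y) * X y)) ρ :=
      (h1.integrable_fun_mul hX2).const_mul 2
    have hi2 : Integrable (fun y => birkhoffSum T X L (T y) ^ 2) ρ := h1.integrable_sq
    simp_rw [h2]
    rw [integral_add (f := fun y => X y ^ 2) (g := fun y => 2 * (birkhoffSum T X L (T y) * X y) +
        birkhoffSum T X L (T y) ^ 2) hX2.integrable_sq (hi1.add hi2), integral_add hi1 hi2, integral_const_mul,
      horth _ hm (hS L), hT.integral_comp_of_measurable (hm.pow_const 2), ih]
    push_cast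
    ring

/-- The second moment of a centered Gaussian variable with standard deviation `s` outside
`[-y, y]`. -/
def gaussExcess (s y : ℝ) : ℝ≥0∞ :=
  ∫⁻ v, {v | y < |s * v|}.indicator (fun v => ‖s * v‖ₑ ^ 2) v ∂(gaussianReal 0 1)

lemma gaussExcess_anti (s : ℝ) {x y : ℝ} (h : x ≤ y) : gaussExcess s y ≤ gaussExcess s x :=
  lintegral_mono fun _ => Set.indicator_le_indicator_of_subset (fun _ hv => h.trans_lt hv)
    (fun _ => zero_le) _

variable {ι : Type*} [Fintype ι]

lemma measurePreserving_iidSeq_seqSum_eval (j : ℕ) (a : ι) :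
    MeasurePreserving (fun v : ℕ → ι → ℝ => seqSum (2 ^ j) v a) (iidSeq (stdG ι))
      ((gaussianReal 0 1).map fun v => dScale j * v) := by
  refine ⟨by fun_prop, ?_⟩
  have h1 : (fun v : ℕ → ι → ℝ => seqSum (2 ^ j) v a) = (fun x => x a) ∘ seqSum (2 ^ j) := rfl
  rw [h1, ← Measure.map_map (by fun_prop) (by fun_prop), iidSeq_stdG_map_seqSum,
    Measure.map_map (by fun_prop) (by fun_prop), ← (stdG_eval a).map_eq,
    Measure.map_map (by fun_prop) (by fun_prop)]
  congr 1
  funext x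
  simp [dScale]

lemma memLp_iidSeq_eval (a : ι) (k : ℕ) :
    MemLp (fun v : ℕ → ι → ℝ => v k a) 2 (iidSeq (stdG ι)) :=
  (stdG_memLp_eval a 2 (by simp)).comp_measurePreserving (measurePreserving_eval_iidSeq k)

lemma memLp_iidSeq_seqSum (a : ι) (n : ℕ) :
    MemLp (fun v : ℕ → ι → ℝ => seqSum n v a) 2 (iidSeq (stdG ι)) := by
  simp only [seqSum, Finset.sum_apply]
  exact memLp_finsetSum _ fun k _ => memLp_iidSeq_eval a k

lemma integral_iidSeq_seqSum (a : ι) (n : ℕ) :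
    ∫ v : ℕ → ι → ℝ, seqSum n v a ∂(iidSeq (stdG ι)) = 0 := by
  simp only [seqSum, Finset.sum_apply]
  rw [integral_finsetSum _ fun k _ => (memLp_iidSeq_eval a k).integrable one_le_two]
  refine Finset.sum_eq_zero fun k _ => ?_
  rw [(measurePreserving_eval_iidSeq (ν := stdG ι) k).integral_comp_of_measurable
    (f := fun x => x a) (by fun_prop), stdG_integral_eval]

lemma lintegral_iidSeq_seqSum_excess (j : ℕ) (a : ι) (x : ℝ) :
    ∫⁻ v : ℕ → ι → ℝ, {v : ℕ → ι → ℝ | x < |seqSum (2 ^ j) v a|}.indicator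
      (fun v : ℕ → ι → ℝ => ‖seqSum (2 ^ j) v a‖ₑ ^ 2) v ∂(iidSeq (stdG ι)) = gaussExcess (dScale j) x := by
  have hm : Measurable fun t : ℝ => {t | x < |t|}.indicator (fun t => ‖t‖ₑ ^ 2) t :=
    Measurable.indicator (by fun_prop) (measurableSet_lt measurable_const measurable_id.abs)
  have h := (measurePreserving_iidSeq_seqSum_eval j a).lintegral_comp hm
  rw [lintegral_map hm (by fun_prop)] at h
  exact h

omit [Fintype ι] in
lemma birkhoffSum_seqShift (a : ι) (r : ℕ) (w : ℕ → ι → ℝ) :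
    birkhoffSum (seqShift 1) (fun w : ℕ → ι → ℝ => w 0 a) r w = seqSum r w a := by
  induction r generalizing w with
  | zero => simp [seqSum]
  | succ r ih =>
    rw [birkhoffSum_succ', ih, add_comm r 1, seqSum_add]
    simp [seqSum]

lemma iidSeq_exceed_le (j : ℕ) (a : ι) {x : ℝ} (hx : 0 < x) :
    ENNReal.ofReal (x ^ 2) *
      iidSeq (stdG ι) {v | ∃ r ≤ 2 ^ j, 4 * x ≤ |seqSum r v a|} ≤ gaussExcess (dScale j) x := by
  have h := sq_mul_measure_exceed_le (ρ := iidSeq (stdG ι))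
    (measurePreserving_seqShift_iidSeq 1) (X := fun v => v 0 a) (by fun_prop)
    (memLp_iidSeq_eval a 0) ?_ hx (2 ^ j)
  · simp only [birkhoffSum_seqShift] at h
    rwa [lintegral_iidSeq_seqSum_excess] at h
  · intro Z hZ _
    have h1 := integral_map (μ := iidSeq (stdG ι))
      (φ := fun v : ℕ → ι → ℝ => (v 0, seqShift 1 v)) (by fun_prop)
      (f := fun z => z.1 a * Z z.2) (Measurable.aestronglyMeasurable (by fun_prop))
    rw [iidSeq_map_zero_pair one_pos, integral_prod_mul (fun x : ι → ℝ => x a) Z,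
      stdG_integral_eval, zero_mul] at h1
    rw [h1]
    exact integral_congr_ae (ae_of_all _ fun v => mul_comm _ _)

variable [DecidableEq ι] {p : ℝ} {μ : Measure (ℕ → ι → ℝ)}
  {h : ℕ → ι → ι → (ℕ → ι → ℝ) → ℝ}

/-- The error of one block, coordinatewise. -/
def blockDiff (n : ℕ) (f : (ℕ → ι → ℝ) × unitInterval → ℕ → ι → ℝ) (a : ι)
    (z : (ℕ → ι → ℝ) × (ℕ → unitInterval)) : ℝ :=
  seqSum n z.1 a - seqSum n (f (z.1, z.2 0)) a

/-- `f` produces Gaussian blocks of length `2 ^ j`, independent of the future of the sequence after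
time `2 ^ j`, whose sum is `W`-close to that of the sequence in `L²`. -/
structure IsBlockMap (μ : Measure (ℕ → ι → ℝ)) (j : ℕ) (W : ℝ≥0∞)
    (f : (ℕ → ι → ℝ) × unitInterval → ℕ → ι → ℝ) : Prop where
  meas : Measurable f
  map_eq : (μ.prod volume).map (fun z => (seqShift (2 ^ j) z.1, f z)) = μ.prod (iidSeq (stdG ι))
  err_le : eLpNorm (fun z => seqSum (2 ^ j) z.1 - seqSum (2 ^ j) (f z)) 2 (μ.prod volume) ≤ W

namespace IsBlockMap

variable {j : ℕ} {W : ℝ≥0∞} {f : (ℕ → ι → ℝ) × unitInterval → ℕ → ι → ℝ}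

omit [DecidableEq ι] in
lemma measurable_blockDiff (hf : IsBlockMap μ j W f) (a : ι) :
    Measurable (blockDiff (2 ^ j) f a) := by
  have := hf.meas
  unfold blockDiff
  fun_prop

omit [DecidableEq ι] in
lemma map_pair (hμ : IsProbabilityMeasure μ) (hf : IsBlockMap μ j W f) :
    (randLaw μ).map (fun z => (pairShift (2 ^ j) z, f (z.1, z.2 0))) =
      (randLaw μ).prod (iidSeq (stdG ι)) :=
  randLaw_map_block (by positivity) hf.meas hf.map_eq

omit [DecidableEq ι] in
lemma measurePreserving_block (hμ : IsProbabilityMeasure μ) (hf : IsBlockMap μ j W f) :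
    MeasurePreserving (fun z : (ℕ → ι → ℝ) × (ℕ → unitInterval) => f (z.1, z.2 0))
      (randLaw μ) (iidSeq (stdG ι)) := by
  have hm := hf.meas
  refine ⟨by fun_prop, ?_⟩
  have h1 := congrArg Measure.snd (hf.map_pair hμ)
  rwa [Measure.snd_prod, Measure.snd_map_prodMk (by fun_prop)] at h1

lemma memLp_blockDiff (hc : RevCore p μ h) (hf : IsBlockMap μ j W f) (a : ι) :
    MemLp (blockDiff (2 ^ j) f a) 2 (randLaw μ) := by
  have := hc.prob
  exact ((hc.memLp_two_seqSum_eval (2 ^ j) a).comp_measurePreserving measurePreserving_fst).sub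
    ((memLp_iidSeq_seqSum a (2 ^ j)).comp_measurePreserving (hf.measurePreserving_block this))

lemma lintegral_blockDiff_le (hc : RevCore p μ h) (hf : IsBlockMap μ j W f) (a : ι) :
    ∫⁻ z, ‖blockDiff (2 ^ j) f a z‖ₑ ^ 2 ∂(randLaw μ) ≤ W ^ 2 := by
  have := hc.prob
  have hm := hf.meas
  have hmp : MeasurePreserving (fun z : (ℕ → ι → ℝ) × (ℕ → unitInterval) => (z.1, z.2 0))
      (randLaw μ) (μ.prod volume) :=
    (MeasurePreserving.id μ).prod (measurePreserving_eval_iidSeq 0)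
  have h1 : Measurable fun z : (ℕ → ι → ℝ) × unitInterval =>
    ‖seqSum (2 ^ j) z.1 - seqSum (2 ^ j) (f z)‖ₑ ^ 2 := by fun_prop
  calc ∫⁻ z, ‖blockDiff (2 ^ j) f a z‖ₑ ^ 2 ∂(randLaw μ)
      ≤ ∫⁻ z, ‖seqSum (2 ^ j) z.1 - seqSum (2 ^ j) (f (z.1, z.2 0))‖ₑ ^ 2 ∂(randLaw μ) := by
        refine lintegral_mono fun z => ?_
        gcongr
        rw [enorm_le_iff_norm_le]
        exact norm_le_pi_norm (seqSum (2 ^ j) z.1 - seqSum (2 ^ j) (f (z.1, z.2 0))) a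
    _ = ∫⁻ z, ‖seqSum (2 ^ j) z.1 - seqSum (2 ^ j) (f z)‖ₑ ^ 2 ∂(μ.prod volume) :=
        hmp.lintegral_comp h1
    _ = eLpNorm (fun z => seqSum (2 ^ j) z.1 - seqSum (2 ^ j) (f z)) 2 (μ.prod volume) ^ 2 :=
        lintegral_enorm_sq_eq_eLpNorm _
    _ ≤ W ^ 2 := by gcongr; exact hf.err_le

lemma integral_mul_blockDiff (hc : RevCore p μ h) (hf : IsBlockMap μ j W f) (a : ι)
    {Z : (ℕ → ι → ℝ) × (ℕ → unitInterval) → ℝ} (hZ : Measurable Z) (hZ2 : MemLp Z 2 (randLaw μ)) :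
    ∫ z, Z (pairShift (2 ^ j) z) * blockDiff (2 ^ j) f a z ∂(randLaw μ) = 0 := by
  have := hc.prob
  have hm := hf.meas
  have hS := (hc.memLp_two_seqSum_eval (2 ^ j) a).comp_measurePreserving
    (measurePreserving_fst (μ := μ) (ν := iidSeq (volume : Measure unitInterval)))
  have hV := (memLp_iidSeq_seqSum a (2 ^ j)).comp_measurePreserving
    (hf.measurePreserving_block this)
  have hZs := hZ2.comp_measurePreserving (measurePreserving_pairShift hc.mp (2 ^ j))
  have hi1 : Integrable (fun z : (ℕ → ι → ℝ) × (ℕ → unitInterval) =>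
      Z (pairShift (2 ^ j) z) * seqSum (2 ^ j) z.1 a) (randLaw μ) := hZs.integrable_fun_mul hS
  have hi2 : Integrable (fun z : (ℕ → ι → ℝ) × (ℕ → unitInterval) =>
      Z (pairShift (2 ^ j) z) * seqSum (2 ^ j) (f (z.1, z.2 0)) a) (randLaw μ) :=
    hZs.integrable_fun_mul hV
  have h1 : ∫ z : (ℕ → ι → ℝ) × (ℕ → unitInterval),
      Z (pairShift (2 ^ j) z) * seqSum (2 ^ j) z.1 a ∂(randLaw μ) = 0 := by
    rw [randLaw] at hi1 ⊢
    rw [integral_prod_symm _ hi1]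
    have hZ3 : MemLp (fun z => Z (Prod.map id (seqShift (2 ^ j)) z)) 2
        (μ.prod (iidSeq (volume : Measure unitInterval))) :=
      hZ2.comp_measurePreserving
        ((MeasurePreserving.id μ).prod (measurePreserving_seqShift_iidSeq (2 ^ j)))
    have h2 := hZ3.integrable_sq.prod_left_ae
    rw [← integral_zero (ℕ → unitInterval) ℝ (μ := iidSeq volume)]
    refine integral_congr_ae ?_
    filter_upwards [h2] with u hu
    refine hc.orth_seqSum (2 ^ j) (Z := fun w => Z (w, seqShift (2 ^ j) u)) (by fun_prop) ?_ a
    rw [memLp_two_iff_integrable_sq (Measurable.aestronglyMeasurable (by fun_prop))]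
    exact hu
  have h2 : ∫ z : (ℕ → ι → ℝ) × (ℕ → unitInterval),
      Z (pairShift (2 ^ j) z) * seqSum (2 ^ j) (f (z.1, z.2 0)) a ∂(randLaw μ) = 0 := by
    have h3 := integral_map (μ := randLaw μ)
      (φ := fun z => (pairShift (2 ^ j) z, f (z.1, z.2 0))) (by fun_prop)
      (f := fun z => Z z.1 * seqSum (2 ^ j) z.2 a) (Measurable.aestronglyMeasurable (by fun_prop))
    rw [hf.map_pair this, integral_prod_mul Z fun v : ℕ → ι → ℝ => seqSum (2 ^ j) v a,
      integral_iidSeq_seqSum, mul_zero] at h3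
    exact h3.symm
  simp only [blockDiff, mul_sub]
  rw [integral_sub hi1 hi2, h1, h2, sub_zero]

/-- Second moment of the block sums outside `[-x, x]`. -/
lemma lintegral_seqSum_excess_le (hc : RevCore p μ h) (hf : IsBlockMap μ j W f) (a : ι) (x : ℝ) :
    ∫⁻ w : ℕ → ι → ℝ, {w : ℕ → ι → ℝ | x < |seqSum (2 ^ j) w a|}.indicator
      (fun w : ℕ → ι → ℝ => ‖seqSum (2 ^ j) w a‖ₑ ^ 2) w ∂μ ≤ 4 * W ^ 2 + 2 * gaussExcess (dScale j) (x / 2) := by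
  have := hc.prob
  have hm := hf.meas
  have hd := hf.measurable_blockDiff a
  have hm1 : Measurable fun w : ℕ → ι → ℝ => {w : ℕ → ι → ℝ | x < |seqSum (2 ^ j) w a|}.indicator
      (fun w : ℕ → ι → ℝ => ‖seqSum (2 ^ j) w a‖ₑ ^ 2) w :=
    Measurable.indicator (by fun_prop) (measurableSet_lt measurable_const (by fun_prop))
  have hm2 : Measurable fun w : ℕ → ι → ℝ => {w : ℕ → ι → ℝ | x / 2 < |seqSum (2 ^ j) w a|}.indicator
      (fun w : ℕ → ι → ℝ => ‖seqSum (2 ^ j) w a‖ₑ ^ 2) w :=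
    Measurable.indicator (by fun_prop) (measurableSet_lt measurable_const (by fun_prop))
  have hfst : MeasurePreserving Prod.fst (randLaw μ) μ := measurePreserving_fst
  rw [← hfst.lintegral_comp hm1, ← lintegral_iidSeq_seqSum_excess j a,
    ← (hf.measurePreserving_block this).lintegral_comp hm2]
  calc _ ≤ ∫⁻ z : (ℕ → ι → ℝ) × (ℕ → unitInterval), (4 * ‖blockDiff (2 ^ j) f a z‖ₑ ^ 2 +
        2 * {w : ℕ → ι → ℝ | x / 2 < |seqSum (2 ^ j) w a|}.indicator
          (fun w : ℕ → ι → ℝ => ‖seqSum (2 ^ j) w a‖ₑ ^ 2) (f (z.1, z.2 0))) ∂(randLaw μ) := by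
        refine lintegral_mono fun z => ?_
        exact indicator_enorm_sq_le _ _ x
    _ ≤ _ := by
        have hm3 : Measurable fun z : (ℕ → ι → ℝ) × (ℕ → unitInterval) =>
            {w : ℕ → ι → ℝ | x / 2 < |seqSum (2 ^ j) w a|}.indicator
              (fun w : ℕ → ι → ℝ => ‖seqSum (2 ^ j) w a‖ₑ ^ 2) (f (z.1, z.2 0)) :=
          hm2.comp (hf.measurePreserving_block this).measurable
        rw [lintegral_add_left (by fun_prop), lintegral_const_mul _ (by fun_prop),
          lintegral_const_mul _ hm3]
        gcongr
        · exact hf.lintegral_blockDiff_le hc a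

end IsBlockMap

end blockMaximal

end

section

section dyadicBlock

/-- The concatenation of blocks of the same length `2 ^ j` produced by `f`. -/
def constGlue {E : Type*} (j : ℕ) (f : (ℕ → E) × unitInterval → ℕ → E)
    (z : (ℕ → E) × (ℕ → unitInterval)) : ℕ → E := fun k =>
  f (seqShift (k / 2 ^ j * 2 ^ j) z.1, z.2 (k / 2 ^ j * 2 ^ j)) (k % 2 ^ j)

lemma pairShift_pairShift {E U : Type*} (m n : ℕ) (z : (ℕ → E) × (ℕ → U)) :
    pairShift m (pairShift n z) = pairShift (m + n) z := by
  simp [pairShift, seqShift_seqShift]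

lemma pairShift_zero {E U : Type*} (z : (ℕ → E) × (ℕ → U)) : pairShift 0 z = z := by
  simp [pairShift, seqShift_zero]

lemma seqShift_constGlue {E : Type*} (j M : ℕ) (f : (ℕ → E) × unitInterval → ℕ → E)
    (z : (ℕ → E) × (ℕ → unitInterval)) :
    seqShift (M * 2 ^ j) (constGlue j f z) = constGlue j f (pairShift (M * 2 ^ j) z) := by
  funext k
  have h1 : (k + M * 2 ^ j) / 2 ^ j = k / 2 ^ j + M := Nat.add_mul_div_right _ _ (by positivity)
  rw [seqShift, constGlue, h1, Nat.add_mul_mod_self_right, add_mul, ← seqShift_seqShift]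
  rfl

variable {ι : Type*} [Fintype ι]

omit [Fintype ι] in
lemma seqSum_constGlue_of_le {j r : ℕ} (hr : r ≤ 2 ^ j)
    (f : (ℕ → ι → ℝ) × unitInterval → ℕ → ι → ℝ) (z : (ℕ → ι → ℝ) × (ℕ → unitInterval)) :
    seqSum r (constGlue j f z) = seqSum r (f (z.1, z.2 0)) := by
  unfold seqSum
  refine Finset.sum_congr rfl fun k hk => ?_
  have hk' : k < 2 ^ j := (Finset.mem_range.1 hk).trans_le hr
  simp [constGlue, Nat.div_eq_of_lt hk', Nat.mod_eq_of_lt hk', seqShift_zero]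

omit [Fintype ι] in
lemma seqSum_sub_constGlue {j r : ℕ} (hr : r ≤ 2 ^ j) (M : ℕ)
    (f : (ℕ → ι → ℝ) × unitInterval → ℕ → ι → ℝ) (a : ι) (z : (ℕ → ι → ℝ) × (ℕ → unitInterval)) :
    seqSum (M * 2 ^ j + r) z.1 a - seqSum (M * 2 ^ j + r) (constGlue j f z) a =
      birkhoffSum (pairShift (2 ^ j)) (blockDiff (2 ^ j) f a) M z +
        (seqSum r (seqShift (M * 2 ^ j) z.1) a -
          seqSum r (f ((pairShift (M * 2 ^ j) z).1, (pairShift (M * 2 ^ j) z).2 0)) a) := by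
  induction M generalizing z with
  | zero => simp [pairShift_zero, seqShift_zero, seqSum_constGlue_of_le hr]
  | succ M ih =>
    have h1 : (M + 1) * 2 ^ j + r = 2 ^ j + (M * 2 ^ j + r) := by ring
    have h2 := seqShift_constGlue j 1 f z
    rw [one_mul] at h2
    have h3 : (M + 1) * 2 ^ j = M * 2 ^ j + 2 ^ j := by ring
    have h4 := ih (pairShift (2 ^ j) z)
    rw [pairShift_pairShift, ← h3] at h4
    have h5 : seqShift (M * 2 ^ j) (pairShift (2 ^ j) z).1 = seqShift ((M + 1) * 2 ^ j) z.1 := by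
      rw [h3, ← seqShift_seqShift]; rfl
    rw [h5] at h4
    have h6 : seqShift (2 ^ j) z.1 = (pairShift (2 ^ j) z).1 := rfl
    rw [h1, seqSum_add (2 ^ j), seqSum_add (2 ^ j), birkhoffSum_succ', h2, Pi.add_apply, Pi.add_apply,
      seqSum_constGlue_of_le le_rfl, h6, blockDiff]
    linear_combination h4

lemma measurableSet_exists_le_abs {Y : Type*} [MeasurableSpace Y] {g : ℕ → Y → ℝ}
    (hg : ∀ k, Measurable (g k)) (n : ℕ) (c : ℝ) :
    MeasurableSet {y | ∃ k ≤ n, c ≤ |g k y|} := by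
  have h1 : {y | ∃ k ≤ n, c ≤ |g k y|} = ⋃ k, ⋃ (_ : k ≤ n), {y | c ≤ |g k y|} := by ext; simp
  rw [h1]
  exact .iUnion fun k => .iUnion fun _ => measurableSet_le measurable_const (hg k).abs

namespace IsBlockMap

variable [DecidableEq ι] {p : ℝ} {μ : Measure (ℕ → ι → ℝ)}
  {h : ℕ → ι → ι → (ℕ → ι → ℝ) → ℝ} {j : ℕ} {W : ℝ≥0∞}
  {f : (ℕ → ι → ℝ) × unitInterval → ℕ → ι → ℝ}

lemma birkhoff_exceed_le (hc : RevCore p μ h) (hf : IsBlockMap μ j W f) (a : ι) {x : ℝ}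
    (hx : 0 < x) (L : ℕ) :
    ENNReal.ofReal (x ^ 2) * randLaw μ {z | ∃ M ≤ L,
      4 * x ≤ |birkhoffSum (pairShift (2 ^ j)) (blockDiff (2 ^ j) f a) M z|} ≤ L * W ^ 2 := by
  have := hc.prob
  have hT := measurePreserving_pairShift (μ := μ) hc.mp (2 ^ j)
  have hX := hf.measurable_blockDiff a
  have hX2 := hf.memLp_blockDiff hc a
  have ho := fun Z hZ hZ2 => hf.integral_mul_blockDiff hc a (Z := Z) hZ hZ2
  calc _ ≤ _ := sq_mul_measure_exceed_le hT hX hX2 ho hx L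
    _ ≤ ∫⁻ z, ‖birkhoffSum (pairShift (2 ^ j)) (blockDiff (2 ^ j) f a) L z‖ₑ ^ 2 ∂(randLaw μ) :=
      lintegral_mono fun z => Set.indicator_le_self _ _ _
    _ = _ := lintegral_birkhoffSum_sq hT hX hX2 ho L
    _ ≤ _ := by
      gcongr
      exact hf.lintegral_blockDiff_le hc a

lemma source_exceed_le (hc : RevCore p μ h) (hf : IsBlockMap μ j W f) (a : ι) {x : ℝ}
    (hx : 0 < x) (n : ℕ) :
    ENNReal.ofReal (x ^ 2) * randLaw μ {z | ∃ r ≤ 2 ^ j,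
      4 * x ≤ |seqSum r (seqShift n z.1) a|} ≤ 4 * W ^ 2 + 2 * gaussExcess (dScale j) (x / 2) := by
  have := hc.prob
  have h1 := sq_mul_measure_exceed_le hc.mp (X := fun w => w 0 a) (by fun_prop)
    ((hc.memLp_two_seqSum_eval 1 a).congr_norm (Measurable.aestronglyMeasurable (by fun_prop))
      (ae_of_all _ fun w => by simp [seqSum])) (fun Z hZ hZ2 => hc.orth Z hZ hZ2 a) hx (2 ^ j)
  simp only [birkhoffSum_seqShift] at h1
  refine le_trans (le_of_eq ?_) (h1.trans (hf.lintegral_seqSum_excess_le hc a x))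
  have hmp : MeasurePreserving (fun z : (ℕ → ι → ℝ) × (ℕ → unitInterval) => seqShift n z.1)
    (randLaw μ) μ := (measurePreserving_seqShift hc.mp n).comp measurePreserving_fst
  rw [← hmp.measure_preimage (measurableSet_exists_le_abs (fun k => by fun_prop) _ _
    |>.nullMeasurableSet)]
  rfl

lemma target_exceed_le (hc : RevCore p μ h) (hf : IsBlockMap μ j W f) (a : ι) {x : ℝ}
    (hx : 0 < x) (n : ℕ) :
    ENNReal.ofReal (x ^ 2) * randLaw μ {z | ∃ r ≤ 2 ^ j,
      4 * x ≤ |seqSum r (f ((pairShift n z).1, (pairShift n z).2 0)) a|} ≤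
        gaussExcess (dScale j) (x / 2) := by
  have := hc.prob
  refine le_trans (le_of_eq ?_) ((iidSeq_exceed_le j a hx).trans
    (gaussExcess_anti _ (by linarith)))
  have hmp := (hf.measurePreserving_block this).comp (measurePreserving_pairShift (μ := μ) hc.mp n)
  rw [← hmp.measure_preimage (measurableSet_exists_le_abs (fun k => by fun_prop) _ _
    |>.nullMeasurableSet)]
  rfl

lemma exceed_le (hc : RevCore p μ h) (hf : IsBlockMap μ j W f) {x : ℝ}
    (hx : 0 < x) {N : ℕ} (hj : j ≤ N) :
    ENNReal.ofReal (x ^ 2) * randLaw μ {z | ∃ l ≤ 2 ^ N, ∃ a,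
      12 * x ≤ |seqSum l z.1 a - seqSum l (constGlue j f z) a|} ≤
        Fintype.card ι * (2 ^ (N - j) * (5 * W ^ 2 + 3 * gaussExcess (dScale j) (x / 2))) := by
  set L := 2 ^ (N - j) with hL
  have hLN : 2 ^ N = L * 2 ^ j := by rw [hL, ← pow_add, Nat.sub_add_cancel hj]
  set B1 : ι → Set ((ℕ → ι → ℝ) × (ℕ → unitInterval)) := fun a => {z | ∃ M ≤ L,
      4 * x ≤ |birkhoffSum (pairShift (2 ^ j)) (blockDiff (2 ^ j) f a) M z|}
  set B2 : ι → ℕ → Set ((ℕ → ι → ℝ) × (ℕ → unitInterval)) := fun a M => {z | ∃ r ≤ 2 ^ j,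
      4 * x ≤ |seqSum r (seqShift (M * 2 ^ j) z.1) a|}
  set B3 : ι → ℕ → Set ((ℕ → ι → ℝ) × (ℕ → unitInterval)) := fun a M => {z | ∃ r ≤ 2 ^ j,
      4 * x ≤ |seqSum r (f ((pairShift (M * 2 ^ j) z).1, (pairShift (M * 2 ^ j) z).2 0)) a|}
  have hsub : {z : (ℕ → ι → ℝ) × (ℕ → unitInterval) | ∃ l ≤ 2 ^ N, ∃ a,
      12 * x ≤ |seqSum l z.1 a - seqSum l (constGlue j f z) a|} ⊆
      ⋃ a, (B1 a ∪ ⋃ M ∈ Finset.range L, (B2 a M ∪ B3 a M)) := by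
    rintro z ⟨l, hl, a, hla⟩
    have hr : l % 2 ^ j < 2 ^ j := Nat.mod_lt _ (by positivity)
    have hdm : l / 2 ^ j * 2 ^ j + l % 2 ^ j = l := Nat.div_add_mod' l _
    have hM : l / 2 ^ j ≤ L := by
      rw [hLN] at hl
      exact Nat.div_le_of_le_mul (by linarith [mul_comm L (2 ^ j)])
    have hdec := seqSum_sub_constGlue hr.le (l / 2 ^ j) f a z
    rw [hdm] at hdec
    rw [hdec] at hla
    refine Set.mem_iUnion.2 ⟨a, ?_⟩
    by_cases h1 : z ∈ B1 a
    · exact Or.inl h1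
    refine Or.inr ?_
    have h1' : |birkhoffSum (pairShift (2 ^ j)) (blockDiff (2 ^ j) f a) (l / 2 ^ j) z| < 4 * x := by
      by_contra hcon
      exact h1 ⟨_, hM, not_lt.1 hcon⟩
    have hML : l / 2 ^ j < L := by
      refine lt_of_le_of_ne hM fun he => ?_
      have h0 : l % 2 ^ j = 0 := by
        rw [he, ← hLN] at hdm
        lia
      rw [h0] at hla
      simp only [seqSum, Finset.range_zero, Finset.sum_empty, Pi.zero_apply, sub_zero,
        add_zero] at hla
      linarith
    simp only [Set.mem_iUnion, Finset.mem_range]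
    refine ⟨_, hML, ?_⟩
    by_contra hcon
    have h2 : |seqSum (l % 2 ^ j) (seqShift (l / 2 ^ j * 2 ^ j) z.1) a| < 4 * x := by
      by_contra h
      exact hcon (Or.inl ⟨_, hr.le, not_lt.1 h⟩)
    have h3 : |seqSum (l % 2 ^ j) (f ((pairShift (l / 2 ^ j * 2 ^ j) z).1,
        (pairShift (l / 2 ^ j * 2 ^ j) z).2 0)) a| < 4 * x := by
      by_contra h
      exact hcon (Or.inr ⟨_, hr.le, not_lt.1 h⟩)
    have h4 := hla.trans ((abs_add_le _ _).trans (add_le_add_right (abs_sub _ _) _))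
    linarith
  have hB : ∀ a, ENNReal.ofReal (x ^ 2) *
      randLaw μ (B1 a ∪ ⋃ M ∈ Finset.range L, (B2 a M ∪ B3 a M)) ≤
        L * (5 * W ^ 2 + 3 * gaussExcess (dScale j) (x / 2)) := by
    intro a
    calc _ ≤ ENNReal.ofReal (x ^ 2) * (randLaw μ (B1 a) +
          ∑ M ∈ Finset.range L, (randLaw μ (B2 a M) + randLaw μ (B3 a M))) := by
          refine mul_le_mul_right ((measure_union_le _ _).trans (add_le_add le_rfl
            ((measure_biUnion_finset_le _ _).trans
              (Finset.sum_le_sum fun M _ => measure_union_le _ _)))) _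
      _ = ENNReal.ofReal (x ^ 2) * randLaw μ (B1 a) + ∑ M ∈ Finset.range L,
          (ENNReal.ofReal (x ^ 2) * randLaw μ (B2 a M) +
            ENNReal.ofReal (x ^ 2) * randLaw μ (B3 a M)) := by
          simp_rw [mul_add, Finset.mul_sum, mul_add]
      _ ≤ L * W ^ 2 + ∑ M ∈ Finset.range L,
          ((4 * W ^ 2 + 2 * gaussExcess (dScale j) (x / 2)) +
            gaussExcess (dScale j) (x / 2)) :=
          add_le_add (hf.birkhoff_exceed_le hc a hx L) (Finset.sum_le_sum fun M _ =>
            add_le_add (hf.source_exceed_le hc a hx _) (hf.target_exceed_le hc a hx _))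
      _ = _ := by
          rw [Finset.sum_const, Finset.card_range, nsmul_eq_mul]
          ring
  calc _ ≤ ENNReal.ofReal (x ^ 2) *
        ∑ a, randLaw μ (B1 a ∪ ⋃ M ∈ Finset.range L, (B2 a M ∪ B3 a M)) :=
        mul_le_mul_right ((measure_mono hsub).trans (measure_iUnion_fintype_le _ _)) _
    _ ≤ ∑ _a : ι, (L : ℝ≥0∞) * (5 * W ^ 2 + 3 * gaussExcess (dScale j) (x / 2)) := by
        rw [Finset.mul_sum]
        exact Finset.sum_le_sum fun a _ => hB a
    _ = _ := by
        rw [Finset.sum_const, Finset.card_univ, nsmul_eq_mul, hL]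
        push_cast
        rfl

end IsBlockMap

omit [Fintype ι] in
lemma seqSum_glueSeq_block (F : ℕ → (ℕ → ι → ℝ) × unitInterval → ℕ → ι → ℝ) {J : ℕ → ℕ} {N : ℕ}
    (hJ : J N ≤ N) {l : ℕ} (hl : l ≤ 2 ^ N) (z : (ℕ → ι → ℝ) × (ℕ → unitInterval)) :
    seqSum l (seqShift (2 ^ N) (glueSeq F J z)) =
      seqSum l (constGlue (J N) (F (J N)) (pairShift (2 ^ N) z)) := by
  unfold seqSum
  refine Finset.sum_congr rfl fun k hk => ?_
  have hk' : k < 2 ^ N := (Finset.mem_range.1 hk).trans_le hl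
  have hlog : Nat.log 2 (k + 2 ^ N) = N :=
    Nat.log_eq_of_pow_le_of_lt_pow (by lia) (by rw [pow_succ]; lia)
  have hdiv : (k + 2 ^ N) / 2 ^ J N = k / 2 ^ J N + 2 ^ (N - J N) := by
    have h1 : 2 ^ N = 2 ^ (N - J N) * 2 ^ J N := by rw [← pow_add, Nat.sub_add_cancel hJ]
    rw [h1, Nat.add_mul_div_right _ _ (by positivity)]
  have hst : blockStart J (k + 2 ^ N) = k / 2 ^ J N * 2 ^ J N + 2 ^ N := by
    rw [blockStart, hlog, hdiv, add_mul, ← pow_add, Nat.sub_add_cancel hJ]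
  have hmod : k + 2 ^ N - (k / 2 ^ J N * 2 ^ J N + 2 ^ N) = k % 2 ^ J N := by
    have := Nat.div_add_mod' k (2 ^ J N)
    lia
  rw [seqShift, glueSeq, hlog, hst, hmod, ← seqShift_seqShift]
  rfl

end dyadicBlock

end

section scales

/-- The binary logarithm of the optimal block length between times `2 ^ N` and `2 ^ (N + 1)`. -/
def blockExp (p : ℝ) (N : ℕ) : ℝ := 2 * N / p + 2 * cExp p / p * Real.logb 2 (N + 1)

/-- The size of the error allowed between times `2 ^ N` and `2 ^ (N + 1)`. -/
def threshold (p ε : ℝ) (N : ℕ) : ℝ :=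
  2 ^ ((N : ℝ) / p) * (N + 1 : ℝ) ^ (cExp p / p + 1 / 2 + ε / 2)

lemma logb_succ_nonneg (N : ℕ) : 0 ≤ Real.logb 2 (N + 1 : ℝ) :=
  Real.logb_nonneg one_lt_two (by linarith [N.cast_nonneg (α := ℝ)])

lemma two_rpow_logb_succ (N : ℕ) : (2 : ℝ) ^ Real.logb 2 (N + 1 : ℝ) = N + 1 :=
  Real.rpow_logb two_pos (by norm_num) (by positivity)

lemma blockExp_nonneg {p : ℝ} (hp : 0 < p) (N : ℕ) : 0 ≤ blockExp p N := by
  have := logb_succ_nonneg N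
  have := cExp_pos p
  unfold blockExp
  positivity

lemma threshold_sq (p ε : ℝ) (N : ℕ) :
    threshold p ε N ^ 2 =
      2 ^ (2 * N / p + (2 * cExp p / p + 1 + ε) * Real.logb 2 (N + 1 : ℝ)) := by
  unfold threshold
  rw [← two_rpow_logb_succ N, two_rpow_logb_succ N, ← Real.rpow_natCast]
  conv_lhs => rw [← two_rpow_logb_succ N]
  rw [← Real.rpow_mul (by norm_num), ← Real.rpow_add two_pos, ← Real.rpow_mul (by norm_num)]
  congr 1
  push_cast
  ring

lemma one_le_threshold {p ε : ℝ} (hp : 0 < p) (hε : 0 < ε) (N : ℕ) : 1 ≤ threshold p ε N := by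
  have := cExp_pos p
  exact one_le_mul_of_one_le_of_one_le (Real.one_le_rpow one_le_two (by positivity))
    (Real.one_le_rpow (by linarith [N.cast_nonneg (α := ℝ)]) (by positivity))

lemma threshold_growth {p ε : ℝ} (hp : 0 < p) (hε : 0 < ε) (N : ℕ) :
    2 ^ (1 / p) * threshold p ε N ≤ threshold p ε (N + 1) := by
  have := cExp_pos p
  unfold threshold
  rw [← mul_assoc, ← Real.rpow_add two_pos]
  have h1 : 1 / p + N / p = ((N + 1 : ℕ) : ℝ) / p := by push_cast; ring
  rw [h1]
  refine mul_le_mul_of_nonneg_left (Real.rpow_le_rpow (by positivity) ?_ (by positivity))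
    (by positivity)
  push_cast
  linarith

/-- Thresholds are summed by the last one up to a constant. -/
lemma exists_sum_threshold_le {p ε : ℝ} (hp : 0 < p) (hε : 0 < ε) :
    ∃ K : ℝ, 0 ≤ K ∧ ∀ N, ∑ M ∈ Finset.range (N + 1), threshold p ε M ≤ K * threshold p ε N := by
  set r : ℝ := 2 ^ (1 / p) with hr
  have hr1 : 1 < r := Real.one_lt_rpow one_lt_two (by positivity)
  have hr0 : 0 < r - 1 := by linarith
  refine ⟨r / (r - 1), by positivity, fun N => ?_⟩
  induction N with
  | zero =>
    have h1 := one_le_threshold (N := 0) hp hε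
    have h2 : 1 ≤ r / (r - 1) := by rw [le_div_iff₀ hr0]; linarith
    simp only [zero_add, Finset.range_one, Finset.sum_singleton]
    nlinarith
  | succ N ih =>
    have h1 := threshold_growth hp hε N
    rw [Finset.sum_range_succ]
    have h3 : r / (r - 1) = 1 + 1 / (r - 1) := by field_simp; ring
    have h4 : r / (r - 1) * threshold p ε N ≤ 1 / (r - 1) * threshold p ε (N + 1) := by
      rw [div_mul_eq_mul_div, div_mul_eq_mul_div, one_mul]
      gcongr
    calc _ ≤ 1 / (r - 1) * threshold p ε (N + 1) + threshold p ε (N + 1) := by linarith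
      _ = _ := by rw [h3]; ring

lemma two_pow_mul_le_threshold_sq {p ε : ℝ} {N j : ℕ} (hj : (j : ℝ) ≤ blockExp p N) :
    2 ^ j * (N + 1 : ℝ) ^ (1 + ε) ≤ threshold p ε N ^ 2 := by
  rw [threshold_sq, ← Real.rpow_natCast 2 j]
  conv_lhs => rw [← two_rpow_logb_succ N]
  rw [← Real.rpow_mul (by norm_num), ← Real.rpow_add two_pos]
  refine Real.rpow_le_rpow_of_exponent_le one_le_two ?_
  unfold blockExp at hj
  linarith

lemma inv_threshold_sq_mul_le {p ε : ℝ} (hp : 2 < p) (hp3 : p ≤ 3) (hε : 0 < ε) {N j : ℕ}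
    (hjN : j ≤ N) (hj : blockExp p N < j + 1) :
    (threshold p ε N ^ 2)⁻¹ * 2 ^ (N - j) ≤
      2 * (((j : ℝ) + 1) ^ (-1 - cExp p) * 2 ^ (-(j : ℝ) * (2 - p / 2))) := by
  have hc := cExp_pos p
  set c := cExp p with hcdef
  set lam := Real.logb 2 (N + 1 : ℝ) with hlam
  have hlam0 : 0 ≤ lam := logb_succ_nonneg N
  have h1 : ((2 : ℝ) ^ lam) ^ (-1 - c) ≤ ((j : ℝ) + 1) ^ (-1 - c) := by
    rw [hlam, two_rpow_logb_succ]
    exact Real.rpow_le_rpow_of_nonpos (by positivity) (by gcongr) (by linarith)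
  refine le_trans ?_ (mul_le_mul_of_nonneg_left (mul_le_mul_of_nonneg_right h1 (by positivity))
    two_pos.le)
  have h2 : (2 : ℝ) ^ (N - j) = 2 ^ ((N : ℝ) - j) := by
    rw [← Real.rpow_natCast, Nat.cast_sub hjN]
  rw [threshold_sq, ← Real.rpow_neg two_pos.le, h2, ← Real.rpow_add two_pos,
    ← Real.rpow_mul two_pos.le, ← Real.rpow_add two_pos]
  have h6 : (2 : ℝ) * 2 ^ (lam * (-1 - c) + -(j : ℝ) * (2 - p / 2)) =
      2 ^ (1 + (lam * (-1 - c) + -(j : ℝ) * (2 - p / 2))) := by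
    rw [Real.rpow_add two_pos 1, Real.rpow_one]
  rw [h6]
  refine Real.rpow_le_rpow_of_exponent_le one_le_two ?_
  have h3 : (2 * N / p + 2 * c / p * lam) * (p / 2 - 1) ≤ (j + 1) * (p / 2 - 1) :=
    mul_le_mul_of_nonneg_right hj.le (by linarith)
  have h4 : (2 * N / p + 2 * c / p * lam) * (p / 2 - 1) =
      N + c * lam - 2 * N / p - 2 * c / p * lam := by
    field_simp
    ring
  rw [h4] at h3
  have h5 : 0 ≤ ε * lam := by positivity
  linarith

lemma eventually_blockExp_le {p : ℝ} (hp : 2 < p) : ∀ᶠ N : ℕ in atTop, blockExp p N ≤ N := by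
  have h1 : (fun N : ℕ => Real.log (N + 1)) =o[atTop] fun N : ℕ => (N + 1 : ℝ) :=
    Real.isLittleO_log_id_atTop.comp_tendsto
      (tendsto_atTop_add_const_right _ _ tendsto_natCast_atTop_atTop)
  have hp1 : 0 < 1 - 2 / p := by
    rw [sub_pos, div_lt_one (by linarith)]; exact hp
  have hc := cExp_pos p
  have hl2 : 0 < Real.log 2 := Real.log_pos one_lt_two
  have hc' : 0 < 2 * cExp p / p / Real.log 2 := by positivity
  have h2 := h1.bound (c := (1 - 2 / p) / 2 / (2 * cExp p / p / Real.log 2)) (by positivity)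
  filter_upwards [h2, eventually_ge_atTop 1] with N hN hN1
  rw [Real.norm_of_nonneg (Real.log_nonneg (by linarith [N.cast_nonneg (α := ℝ)])),
    Real.norm_of_nonneg (by positivity)] at hN
  have h3 : 2 * cExp p / p * Real.logb 2 (N + 1 : ℝ) =
      2 * cExp p / p / Real.log 2 * Real.log (N + 1) := by
    rw [Real.logb]; ring
  have h4 : 2 * cExp p / p / Real.log 2 * Real.log (N + 1) ≤ (1 - 2 / p) / 2 * (N + 1) := by
    calc _ ≤ _ := mul_le_mul_of_nonneg_left hN hc'.le
      _ = _ := by field_simp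
  have h5 : (1 : ℝ) ≤ N := by exact_mod_cast hN1
  have h6 : (1 - 2 / p) / 2 * (N + 1) ≤ (1 - 2 / p) * N := by nlinarith
  unfold blockExp
  rw [h3]
  calc _ ≤ 2 * N / p + (1 - 2 / p) * N := by linarith
    _ = N := by ring

lemma floor_blockExp_lt {p : ℝ} (hp : 2 < p) (hp3 : p ≤ 3) (N : ℕ) :
    ⌊blockExp p N⌋₊ < ⌊blockExp p (N + 2)⌋₊ := by
  have hp0 : 0 < p := by linarith
  have hc := cExp_pos p
  have h1 : blockExp p N + 1 ≤ blockExp p (N + 2) := by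
    unfold blockExp
    have h2 : Real.logb 2 (N + 1 : ℝ) ≤ Real.logb 2 ((N + 2 : ℕ) + 1 : ℝ) :=
      Real.logb_le_logb_of_le one_lt_two (by positivity) (by push_cast; linarith)
    have h3 : 2 * cExp p / p * Real.logb 2 (N + 1 : ℝ) ≤
      2 * cExp p / p * Real.logb 2 ((N + 2 : ℕ) + 1 : ℝ) :=
      mul_le_mul_of_nonneg_left h2 (by positivity)
    have h4 : 2 * ((N + 2 : ℕ) : ℝ) / p = 2 * N / p + 4 / p := by push_cast; ring
    have h5 : 1 ≤ 4 / p := by rw [le_div_iff₀ hp0]; linarith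
    linarith
  rw [Nat.lt_iff_add_one_le, ← Nat.floor_add_one (blockExp_nonneg hp0 N)]
  exact Nat.floor_le_floor h1

lemma tsum_floor_blockExp_le {p : ℝ} (hp : 2 < p) (hp3 : p ≤ 3) (g : ℕ → ℝ≥0∞) (N₀ : ℕ) :
    ∑' N, g ⌊blockExp p (N + N₀)⌋₊ ≤ 2 * ∑' j, g j := by
  have h1 : ∀ b, ∑' n : ℕ, g ⌊blockExp p (2 * n + b)⌋₊ ≤ ∑' j, g j := by
    intro b
    have hinj : StrictMono fun n : ℕ => ⌊blockExp p (2 * n + b)⌋₊ := by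
      refine strictMono_nat_of_lt_succ fun n => ?_
      have h2 : 2 * (n + 1) + b = 2 * n + b + 2 := by ring
      simpa only [h2] using floor_blockExp_lt hp hp3 (2 * n + b)
    exact ENNReal.tsum_comp_le_tsum_of_injective hinj.injective g
  rw [← tsum_even_add_odd (f := fun N => g ⌊blockExp p (N + N₀)⌋₊) ENNReal.summable
    ENNReal.summable, two_mul]
  refine add_le_add (h1 N₀) ?_
  simpa only [add_assoc] using h1 (1 + N₀)

lemma gaussExcess_le {s y : ℝ} (hs : 0 < s) (hy : 2 * s ≤ y) :
    gaussExcess s y ≤ ENNReal.ofReal (s ^ 2 * 56 * Real.exp (-(y ^ 2 / s ^ 2) / 8)) := by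
  set t := y / s / 2 with ht
  have ht1 : 1 ≤ t := by
    rw [ht, le_div_iff₀ two_pos, le_div_iff₀ hs]; linarith
  have h1 := lintegral_rpow_gaussian_tail_le (p := 2) two_pos (by norm_num) ht1
  have h2 : ∀ v : ℝ, {v | y < |s * v|}.indicator (fun v => ‖s * v‖ₑ ^ 2) v ≤
      ENNReal.ofReal (s ^ 2 * 4) * ENNReal.ofReal ((max 0 (|v| - t)) ^ (2 : ℝ)) := by
    intro v
    rw [← ENNReal.ofReal_mul (by positivity)]
    by_cases hv : v ∈ {v : ℝ | y < |s * v|}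
    swap
    · rw [Set.indicator_of_notMem hv]
      exact zero_le
    rw [Set.indicator_of_mem hv]
    replace hv : y < |s * v| := hv
    rw [Real.enorm_eq_ofReal_abs, ← ENNReal.ofReal_pow (abs_nonneg _)]
    refine ENNReal.ofReal_le_ofReal ?_
    rw [abs_mul, abs_of_pos hs] at hv
    have h3 : 2 * t < |v| := by
      rw [ht, mul_div_cancel₀ _ two_ne_zero, div_lt_iff₀ hs]; linarith
    rw [max_eq_right (by linarith), Real.rpow_two, abs_mul, abs_of_pos hs, mul_pow, mul_assoc]
    refine mul_le_mul_of_nonneg_left ?_ (by positivity)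
    nlinarith
  calc gaussExcess s y ≤ ∫⁻ v, ENNReal.ofReal (s ^ 2 * 4) *
        ENNReal.ofReal ((max 0 (|v| - t)) ^ (2 : ℝ)) ∂(gaussianReal 0 1) := lintegral_mono h2
    _ ≤ ENNReal.ofReal (s ^ 2 * 4) * ENNReal.ofReal (14 * Real.exp (-(t ^ 2) / 2)) := by
        rw [lintegral_const_mul _ (by fun_prop)]
        exact mul_le_mul_right h1 _
    _ = _ := by
        rw [← ENNReal.ofReal_mul (by positivity)]
        have h5 : -(t ^ 2) / 2 = -(y ^ 2 / s ^ 2) / 8 := by rw [ht]; ring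
        rw [h5]
        congr 1
        ring

lemma eventually_gaussExcess_le {p ε : ℝ} (hp : 0 < p) (hε : 0 < ε) :
    ∀ᶠ N : ℕ in atTop, ∀ j ≤ N, (j : ℝ) ≤ blockExp p N →
      2 ^ (N - j) * gaussExcess (dScale j) (threshold p ε N / 2) ≤
        ENNReal.ofReal (56 * Real.exp (-N)) := by
  have h1 : Tendsto (fun N : ℕ => (N + 1 : ℝ) ^ ε) atTop atTop :=
    (tendsto_rpow_atTop hε).comp
      (tendsto_atTop_add_const_right _ _ tendsto_natCast_atTop_atTop)
  filter_upwards [h1.eventually_ge_atTop 64] with N hN j hjN hj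
  have h2 := two_pow_mul_le_threshold_sq (ε := ε) hj
  have h3 : (64 : ℝ) * (N + 1) ≤ (N + 1 : ℝ) ^ (1 + ε) := by
    rw [Real.rpow_add (by positivity), Real.rpow_one]
    nlinarith [N.cast_nonneg (α := ℝ)]
  have hs := dScale_pos j
  have hs2 := dScale_sq j
  have hx := one_le_threshold hp hε N
  set x := threshold p ε N with hxdef
  have h4 : dScale j ^ 2 * (64 * (N + 1)) ≤ x ^ 2 := by
    rw [hs2]
    exact (mul_le_mul_of_nonneg_left h3 (by positivity)).trans h2
  have hN0 := N.cast_nonneg (α := ℝ)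
  have h5 : 2 * dScale j ≤ x / 2 := by
    have h6 : (4 * dScale j) ^ 2 ≤ x ^ 2 := by nlinarith [sq_nonneg (dScale j)]
    have h7 := abs_le_of_sq_le_sq h6 (by linarith)
    linarith [le_abs_self (4 * dScale j), h7]
  have h8 : 2 * (N + 1 : ℝ) ≤ ((x / 2) ^ 2 / dScale j ^ 2) / 8 := by
    rw [le_div_iff₀ (by norm_num), le_div_iff₀ (by positivity)]
    nlinarith
  calc _ ≤ ENNReal.ofReal (2 ^ (N - j)) * ENNReal.ofReal (dScale j ^ 2 * 56 *
        Real.exp (-((x / 2) ^ 2 / dScale j ^ 2) / 8)) := by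
        refine mul_le_mul' (le_of_eq ?_) (gaussExcess_le hs h5)
        rw [ENNReal.ofReal_pow two_pos.le, ENNReal.ofReal_ofNat]
    _ ≤ _ := by
        rw [← ENNReal.ofReal_mul (by positivity)]
        refine ENNReal.ofReal_le_ofReal ?_
        have h9 : (2 : ℝ) ^ (N - j) * dScale j ^ 2 = 2 ^ N := by
          rw [hs2, ← pow_add, Nat.sub_add_cancel hjN]
        have h10 : (2 : ℝ) ^ N ≤ Real.exp N := by
          have : (2 : ℝ) ≤ Real.exp 1 := by linarith [Real.add_one_le_exp (1 : ℝ)]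
          calc (2 : ℝ) ^ N ≤ Real.exp 1 ^ N := by gcongr
            _ = _ := by rw [← Real.exp_nat_mul, mul_one]
        calc _ = 56 * (2 ^ N * Real.exp (-((x / 2) ^ 2 / dScale j ^ 2) / 8)) := by
              rw [← h9]; ring
          _ ≤ 56 * (Real.exp N * Real.exp (-(2 * N))) := by
              gcongr
              linarith
          _ = _ := by
              rw [← Real.exp_add]
              congr 2
              ring

end scales

section

section gluedCoupling

variable {ι : Type*} [Fintype ι]

omit [Fintype ι] in
lemma abs_seqSum_sub_le_sum {v w : ℕ → ι → ℝ} {a : ι} {x : ℕ → ℝ} {N₁ : ℕ} (hx : ∀ N, 0 ≤ x N)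
    (hv : ∀ N ≥ N₁, ∀ l ≤ 2 ^ N,
      |seqSum l (seqShift (2 ^ N) v) a - seqSum l (seqShift (2 ^ N) w) a| ≤ x N)
    {N l : ℕ} (hN : N₁ ≤ N) (hl : l ≤ 2 ^ N) :
    |seqSum (2 ^ N + l) v a - seqSum (2 ^ N + l) w a| ≤
      |seqSum (2 ^ N₁) v a - seqSum (2 ^ N₁) w a| + ∑ M ∈ Finset.range (N + 1), x M := by
  induction N, hN using Nat.le_induction generalizing l with
  | base =>
    have h1 := hv N₁ le_rfl l hl
    have h2 : x N₁ ≤ ∑ M ∈ Finset.range (N₁ + 1), x M :=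
      Finset.single_le_sum (fun M _ => hx M) (Finset.mem_range.2 (Nat.lt_succ_self _))
    rw [seqSum_add, seqSum_add, Pi.add_apply, Pi.add_apply, add_sub_add_comm]
    exact (abs_add_le _ _).trans (by linarith)
  | succ N hN ih =>
    have h1 := hv (N + 1) (by lia) l hl
    have h2 := ih (le_refl (2 ^ N))
    rw [← two_mul, ← pow_succ'] at h2
    rw [seqSum_add, seqSum_add, Pi.add_apply, Pi.add_apply, add_sub_add_comm,
      Finset.sum_range_succ]
    exact (abs_add_le _ _).trans (by linarith)

lemma threshold_log_le {p ε : ℝ} (hp : 1 ≤ p) (hε : 0 < ε) {n : ℕ} (hn : 3 ≤ n) :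
    threshold p ε (Nat.log 2 (n + 1)) ≤ 2 * 4 ^ (cExp p / p + 1 / 2 + ε / 2) *
      ((n : ℝ) ^ (1 / p) * Real.log n ^ (cExp p / p + 1 / 2 + ε / 2)) := by
  have hp0 : 0 < p := by linarith
  have hc := cExp_pos p
  set β := cExp p / p + 1 / 2 + ε / 2 with hβ
  have hβ0 : 0 < β := by positivity
  set N := Nat.log 2 (n + 1) with hN
  have h1 : 2 ^ N ≤ n + 1 := Nat.pow_log_le_self 2 (by lia)
  have h2 : (2 : ℝ) ^ N ≤ 2 * n := by
    have : 2 ^ N ≤ 2 * n := by lia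
    exact_mod_cast this
  have hn3 : (3 : ℝ) ≤ n := by exact_mod_cast hn
  have hlog1 : 1 ≤ Real.log n := by
    rw [Real.le_log_iff_exp_le (by linarith)]
    linarith [Real.exp_one_lt_d9]
  have h3 : (2 : ℝ) ^ ((N : ℝ) / p) ≤ 2 * (n : ℝ) ^ (1 / p) := by
    have e1 : (2 : ℝ) ^ ((N : ℝ) / p) = ((2 : ℝ) ^ N) ^ (1 / p) := by
      rw [← Real.rpow_natCast, ← Real.rpow_mul two_pos.le, mul_one_div]
    rw [e1]
    calc _ ≤ (2 * n : ℝ) ^ (1 / p) := Real.rpow_le_rpow (by positivity) h2 (by positivity)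
      _ = 2 ^ (1 / p) * (n : ℝ) ^ (1 / p) := Real.mul_rpow (by norm_num) (by positivity)
      _ ≤ 2 ^ (1 : ℝ) * (n : ℝ) ^ (1 / p) := by
        gcongr
        · norm_num
        · rw [div_le_one hp0]; exact hp
      _ = _ := by rw [Real.rpow_one]
  have h4 : (N : ℝ) + 1 ≤ 4 * Real.log n := by
    have e1 := Real.log_le_log (by positivity) h2
    rw [Real.log_pow, Real.log_mul (by norm_num) (by positivity)] at e1
    have e2 := Real.log_two_gt_d9
    have e3 := Real.log_two_lt_d9
    nlinarith [N.cast_nonneg (α := ℝ)]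
  calc threshold p ε N ≤ (2 * (n : ℝ) ^ (1 / p)) * (4 * Real.log n) ^ β := by
        unfold threshold
        gcongr
    _ = _ := by
        rw [Real.mul_rpow (by norm_num) (by linarith)]
        ring

lemma isLittleO_threshold_log {p ε : ℝ} (hp : 1 ≤ p) (hε : 0 < ε) :
    (fun n : ℕ => threshold p ε (Nat.log 2 (n + 1))) =o[atTop]
      fun n : ℕ => (n : ℝ) ^ (1 / p) * Real.log n ^ (cExp p / p + 1 / 2 + ε) := by
  have h1 : (fun n : ℕ => threshold p ε (Nat.log 2 (n + 1))) =O[atTop]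
      fun n : ℕ => (n : ℝ) ^ (1 / p) * Real.log n ^ (cExp p / p + 1 / 2 + ε / 2) := by
    refine IsBigO.of_bound (2 * 4 ^ (cExp p / p + 1 / 2 + ε / 2)) ?_
    filter_upwards [eventually_ge_atTop 3] with n hn
    have h2 := one_le_threshold (p := p) (N := Nat.log 2 (n + 1)) (by linarith) hε
    rw [Real.norm_of_nonneg (by linarith)]
    exact (threshold_log_le hp hε hn).trans
      (mul_le_mul_of_nonneg_left (Real.le_norm_self _) (by positivity))
  refine h1.trans_isLittleO ((isBigO_refl _ _).mul_isLittleO ?_)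
  have h2 : (fun x : ℝ => x ^ (cExp p / p + 1 / 2 + ε / 2)) =o[atTop]
      fun x => x ^ (cExp p / p + 1 / 2 + ε) := by
    refine isLittleO_of_tendsto' ?_ ((tendsto_rpow_neg_atTop (half_pos hε)).congr' ?_)
    · filter_upwards [eventually_gt_atTop 0] with x hx h0
      exact absurd h0 (Real.rpow_pos_of_pos hx _).ne'
    · filter_upwards [eventually_gt_atTop 0] with x hx
      rw [← Real.rpow_sub hx]
      congr 1
      ring
  exact h2.comp_tendsto
    (Real.tendsto_log_atTop.comp tendsto_natCast_atTop_atTop)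

variable [DecidableEq ι] {p : ℝ} {μ : Measure (ℕ → ι → ℝ)}
  {h : ℕ → ι → ι → (ℕ → ι → ℝ) → ℝ}

namespace RevCore

/-- The probability of a large error between times `2 ^ N` and `2 ^ (N + 1)` is summable. -/
lemma tsum_measure_exceed_lt_top (hc : RevCore p μ h) {ε : ℝ} (hε : 0 < ε)
    {F : ℕ → (ℕ → ι → ℝ) × unitInterval → ℕ → ι → ℝ}
    (hF : ∀ j, IsBlockMap μ j (blockErr μ h j) (F j)) :
    ∃ N₀, (∀ N, ⌊blockExp p (N + N₀)⌋₊ ≤ N + N₀) ∧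
      ∑' N, randLaw μ {z | ∃ l ≤ 2 ^ (N + N₀), ∃ a, 12 * threshold p ε (N + N₀) ≤
        |seqSum l z.1 a - seqSum l (constGlue ⌊blockExp p (N + N₀)⌋₊
          (F ⌊blockExp p (N + N₀)⌋₊) z) a|} ≠ ∞ := by
  have hp := hc.two_lt
  have hp0 : 0 < p := by linarith
  obtain ⟨N₀, hN₀⟩ := eventually_atTop.1
    ((eventually_blockExp_le hp).and (eventually_gaussExcess_le hp0 hε))
  have hfl : ∀ N, ⌊blockExp p (N + N₀)⌋₊ ≤ N + N₀ := fun N =>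
    Nat.floor_le_of_le (hN₀ (N + N₀) (by lia)).1
  refine ⟨N₀, hfl, ?_⟩
  set g : ℕ → ℝ≥0∞ := fun j => blockWeight p j * blockErr μ h j ^ 2 with hg
  have hterm : ∀ N, randLaw μ {z | ∃ l ≤ 2 ^ (N + N₀), ∃ a, 12 * threshold p ε (N + N₀) ≤
        |seqSum l z.1 a - seqSum l (constGlue ⌊blockExp p (N + N₀)⌋₊
          (F ⌊blockExp p (N + N₀)⌋₊) z) a|} ≤
      Fintype.card ι * (10 * g ⌊blockExp p (N + N₀)⌋₊ +
        3 * ENNReal.ofReal (56 * Real.exp (-(N : ℝ)))) := by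
    intro N
    set n := N + N₀ with hn
    set j := ⌊blockExp p n⌋₊ with hj
    have hjn : j ≤ n := hfl N
    have hjb : (j : ℝ) ≤ blockExp p n := Nat.floor_le (blockExp_nonneg hp0 n)
    have hx := one_le_threshold hp0 hε n
    have hx2 : 0 < threshold p ε n ^ 2 := by positivity
    have h1 := (hF j).exceed_le hc (x := threshold p ε n) (by linarith) hjn
    have h2 := inv_threshold_sq_mul_le hp hc.le_three hε hjn (Nat.lt_floor_add_one _)
    have h3 := (hN₀ n (by lia)).2 j hjn hjb
    rw [ENNReal.mul_le_iff_le_inv (ENNReal.ofReal_pos.2 hx2).ne' ENNReal.ofReal_ne_top] at h1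
    refine h1.trans ?_
    have h4 : (ENNReal.ofReal (threshold p ε n ^ 2))⁻¹ * 2 ^ (n - j) ≤ 2 * blockWeight p j := by
      rw [← ENNReal.ofReal_inv_of_pos hx2, blockWeight, ← ENNReal.ofReal_ofNat 2,
        ← ENNReal.ofReal_pow two_pos.le, ← ENNReal.ofReal_mul (by positivity),
        ← ENNReal.ofReal_mul two_pos.le]
      exact ENNReal.ofReal_le_ofReal h2
    have h5 : (ENNReal.ofReal (threshold p ε n ^ 2))⁻¹ ≤ 1 := by
      rw [ENNReal.inv_le_one, ENNReal.one_le_ofReal]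
      exact one_le_pow₀ hx
    have h6 : ENNReal.ofReal (56 * Real.exp (-(n : ℝ))) ≤
        ENNReal.ofReal (56 * Real.exp (-(N : ℝ))) := by
      refine ENNReal.ofReal_le_ofReal ?_
      have : (N : ℝ) ≤ n := by exact_mod_cast Nat.le_add_right _ _
      gcongr
    calc _ = Fintype.card ι * (((ENNReal.ofReal (threshold p ε n ^ 2))⁻¹ * 2 ^ (n - j)) *
            (5 * blockErr μ h j ^ 2) + (ENNReal.ofReal (threshold p ε n ^ 2))⁻¹ *
            (3 * (2 ^ (n - j) * gaussExcess (dScale j) (threshold p ε n / 2)))) := by ring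
      _ ≤ Fintype.card ι * ((2 * blockWeight p j) * (5 * blockErr μ h j ^ 2) +
            1 * (3 * ENNReal.ofReal (56 * Real.exp (-(N : ℝ))))) := by
          refine mul_le_mul_right (add_le_add (mul_le_mul_left h4 _)
            (mul_le_mul' h5 (mul_le_mul_right (h3.trans h6) _))) _
      _ = _ := by
          rw [hg]
          ring
  refine ne_top_of_le_ne_top ?_ (ENNReal.tsum_le_tsum hterm)
  rw [ENNReal.tsum_mul_left, ENNReal.tsum_add, ENNReal.tsum_mul_left, ENNReal.tsum_mul_left]
  have h7 : ∑' N, g ⌊blockExp p (N + N₀)⌋₊ ≠ ∞ :=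
    ne_top_of_le_ne_top (ENNReal.mul_ne_top (by simp) hc.tsum_blockErr_lt_top.ne)
      (tsum_floor_blockExp_le hp hc.le_three g N₀)
  have h8 : ∑' N : ℕ, ENNReal.ofReal (56 * Real.exp (-(N : ℝ))) ≠ ∞ :=
    (Real.summable_exp_neg_nat.mul_left 56).tsum_ofReal_ne_top
  exact ENNReal.mul_ne_top (by simp) (ENNReal.add_ne_top.2
    ⟨ENNReal.mul_ne_top (by simp) h7, ENNReal.mul_ne_top (by simp) h8⟩)

theorem exists_coupling (hc : RevCore p μ h) {ε : ℝ} (hε : 0 < ε) :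
    ∃ G : (ℕ → ι → ℝ) × (ℕ → unitInterval) → ℕ → ι → ℝ, Measurable G ∧
      (randLaw μ).map G = iidSeq (stdG ι) ∧
      ∀ᵐ z ∂(randLaw μ), ∀ a, (fun n => ∑ k ∈ Finset.Icc 1 n, (z.1 k a - G z k a)) =o[atTop]
        fun n : ℕ => (n : ℝ) ^ (1 / p) * Real.log n ^ (cExp p / p + 1 / 2 + ε) := by
  have := hc.prob
  have hp0 : 0 < p := by linarith [hc.two_lt]
  choose F hFm hFe hFW using hc.exists_blockMap
  have hF : ∀ j, IsBlockMap μ j (blockErr μ h j) (F j) := fun j => ⟨hFm j, hFe j, hFW j⟩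
  obtain ⟨N₀, hfl, hsum⟩ := hc.tsum_measure_exceed_lt_top hε hF
  set J : ℕ → ℕ := fun N => min N ⌊blockExp p N⌋₊ with hJdef
  have hJ : ∀ N, J N ≤ N := fun N => min_le_left _ _
  have hJN : ∀ N, J (N + N₀) = ⌊blockExp p (N + N₀)⌋₊ := fun N => by
    simpa [hJdef] using hfl N
  refine ⟨glueSeq F J, measurable_glueSeq hFm, randLaw_map_glueSeq hJ hFm hFe, ?_⟩
  have hBC : ∑' N, randLaw μ {z | ∃ l ≤ 2 ^ (N + N₀), ∃ a, 12 * threshold p ε (N + N₀) ≤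
      |seqSum l (seqShift (2 ^ (N + N₀)) z.1) a -
        seqSum l (seqShift (2 ^ (N + N₀)) (glueSeq F J z)) a|} ≠ ∞ := by
    refine ne_top_of_le_ne_top hsum (ENNReal.tsum_le_tsum fun N => ?_)
    have hmp := measurePreserving_pairShift (μ := μ) hc.mp (2 ^ (N + N₀))
    conv_rhs => rw [← hmp.map_eq]
    refine le_trans (measure_mono ?_) (Measure.le_map_apply hmp.measurable.aemeasurable _)
    rintro z ⟨l, hl, a, hla⟩
    refine ⟨l, hl, a, ?_⟩
    rwa [seqSum_glueSeq_block F (hJ _) hl, hJN] at hla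
  obtain ⟨K, hK, hsumK⟩ := exists_sum_threshold_le hp0 hε
  filter_upwards [ae_eventually_notMem hBC] with z hz a
  obtain ⟨i₁, hi₁⟩ := eventually_atTop.1 hz
  have hv : ∀ N ≥ i₁ + N₀, ∀ l ≤ 2 ^ N, |seqSum l (seqShift (2 ^ N) z.1) a -
      seqSum l (seqShift (2 ^ N) (glueSeq F J z)) a| ≤ 12 * threshold p ε N := by
    intro N hN l hl
    by_contra hcon
    have h1 := hi₁ (N - N₀) (by lia)
    rw [Nat.sub_add_cancel (by lia)] at h1
    exact h1 ⟨l, hl, a, (not_le.1 hcon).le⟩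
  have hbound : ∀ᶠ n : ℕ in atTop, ‖∑ k ∈ Finset.Icc 1 n, (z.1 k a - glueSeq F J z k a)‖ ≤
      (|z.1 0 a - glueSeq F J z 0 a| + |seqSum (2 ^ (i₁ + N₀)) z.1 a -
        seqSum (2 ^ (i₁ + N₀)) (glueSeq F J z) a| + 12 * K) *
        ‖threshold p ε (Nat.log 2 (n + 1))‖ := by
    filter_upwards [eventually_ge_atTop (2 ^ (i₁ + N₀))] with n hn
    set N := Nat.log 2 (n + 1) with hN
    have h1 : 2 ^ N ≤ n + 1 := Nat.pow_log_le_self 2 (by lia)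
    have h2 : n + 1 < 2 ^ (N + 1) := Nat.lt_pow_succ_log_self one_lt_two _
    have h3 : i₁ + N₀ ≤ N := Nat.le_log_of_pow_le one_lt_two (by lia)
    rw [pow_succ] at h2
    have h4 := abs_seqSum_sub_le_sum (fun N => by
      linarith [one_le_threshold (N := N) hp0 hε]) hv h3 (l := n + 1 - 2 ^ N) (by lia)
    rw [Nat.add_sub_cancel' h1, ← Finset.mul_sum] at h4
    have h5 : ∑ k ∈ Finset.Icc 1 n, (z.1 k a - glueSeq F J z k a) =
        (seqSum (n + 1) z.1 a - seqSum (n + 1) (glueSeq F J z) a) -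
          (z.1 0 a - glueSeq F J z 0 a) := by
      simp only [seqSum, Finset.sum_apply, ← Finset.sum_sub_distrib]
      rw [Finset.range_eq_Ico, Finset.sum_eq_sum_Ico_succ_bot (by lia), zero_add,
        Finset.Ico_add_one_right_eq_Icc]
      ring
    have hx := one_le_threshold (N := N) hp0 hε
    rw [h5, Real.norm_eq_abs, Real.norm_of_nonneg (by linarith)]
    have h6 := abs_sub (seqSum (n + 1) z.1 a - seqSum (n + 1) (glueSeq F J z) a)
      (z.1 0 a - glueSeq F J z 0 a)
    have h7 := hsumK N
    have h8 := le_mul_of_one_le_right (abs_nonneg (z.1 0 a - glueSeq F J z 0 a)) hx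
    have h9 := le_mul_of_one_le_right (abs_nonneg (seqSum (2 ^ (i₁ + N₀)) z.1 a -
      seqSum (2 ^ (i₁ + N₀)) (glueSeq F J z) a)) hx
    linarith
  exact (IsBigO.of_bound _ hbound).trans_isLittleO (isLittleO_threshold_log (by linarith [hc.two_lt]) hε)

end RevCore

end gluedCoupling

end

lemma exists_tail_le {Ω : Type*} [MeasurableSpace Ω] (P : Measure Ω) [IsProbabilityMeasure P]
    {X : Ω → ℝ} (hX : Measurable X) {u : ℝ} (hu : 0 < u) :
    ∃ x : ℝ, (P {ω | x < |X ω|}).toReal ≤ u := by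
  have : IsProbabilityMeasure (P.map fun ω => |X ω|) :=
    Measure.isProbabilityMeasure_map (by fun_prop)
  have h1 := tendsto_cdf_atTop (P.map fun ω => |X ω|)
  obtain ⟨x, hx⟩ := (h1.eventually (lt_mem_nhds (show 1 - u < 1 by linarith))).exists
  refine ⟨x, ?_⟩
  rw [cdf_eq_real, map_measureReal_apply (by fun_prop) measurableSet_Iic] at hx
  have h2 : {ω | x < |X ω|} = ((fun ω => |X ω|) ⁻¹' Set.Iic x)ᶜ := by
    ext ω; simp
  have h3 : (P {ω | x < |X ω|}).toReal = 1 - P.real ((fun ω => |X ω|) ⁻¹' Set.Iic x) := by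
    rw [h2, ← Measure.real, probReal_compl_eq_one_sub (measurableSet_Iic.preimage (by fun_prop))]
  linarith

/-- The `L¹` norm is dominated by the envelope norm. -/
lemma eLpNorm_one_le_envNorm {Ω : Type*} [MeasurableSpace Ω] (P : Measure Ω)
    [IsProbabilityMeasure P] {X : Ω → ℝ} (hX : Measurable X) {p : ℝ} (hp : 2 ≤ p) :
    eLpNorm X 1 P ≤ envNorm P p X := by
  set T : ℝ → ℝ := fun x => (P {ω | x < |X ω|}).toReal with hT
  have hTanti : Antitone T := fun x y hxy => ENNReal.toReal_mono (measure_ne_top _ _)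
    (measure_mono fun ω (hω : y < |X ω|) => lt_of_le_of_lt hxy hω)
  have hTm : Measurable T := hTanti.measurable
  have hT1 : ∀ x, T x ≤ 1 := fun x => measureReal_le_one
  have hQ : ∀ u ∈ Set.Ioo (0 : ℝ) 1, ∀ t, u < T t → t ≤ absQuantile P X u := by
    intro u hu t ht
    refine le_csInf (exists_tail_le P hX hu.1) fun y hy => ?_
    by_contra! hyt
    exact absurd (ht.trans_le (hTanti hyt.le)) (not_lt.2 hy)
  have h1 : eLpNorm X 1 P = ∫⁻ t in Set.Ioi (0 : ℝ), P {ω | t < |X ω|} := by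
    rw [eLpNorm_one_eq_lintegral_enorm, ← lintegral_eq_lintegral_meas_lt P
      (ae_of_all _ fun ω => abs_nonneg (X ω)) (by fun_prop)]
    exact lintegral_congr fun ω => Real.enorm_eq_ofReal_abs _
  set F : ℝ → ℝ → ℝ≥0∞ := fun t u => {z : ℝ × ℝ | z.2 < T z.1}.indicator 1 (t, u) with hF
  have hFm : Measurable (Function.uncurry F) :=
    measurable_const.indicator (measurableSet_lt (by fun_prop) (by fun_prop))
  have h2 : ∀ t, P {ω | t < |X ω|} = ∫⁻ u in Set.Ioo (0 : ℝ) 1, F t u := by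
    intro t
    have e : ∀ u, F t u = (Set.Iio (T t)).indicator 1 u := by
      intro u; simp [hF, Set.indicator_apply]
    simp_rw [e]
    rw [lintegral_indicator_one measurableSet_Iio, Measure.restrict_apply measurableSet_Iio]
    have e2 : Set.Iio (T t) ∩ Set.Ioo 0 1 = Set.Ioo 0 (T t) := by
      ext u
      simp only [Set.mem_inter_iff, Set.mem_Iio, Set.mem_Ioo]
      have := hT1 t
      constructor
      · rintro ⟨h, h', _⟩; exact ⟨h', h⟩
      · rintro ⟨h, h'⟩; exact ⟨h', h, by linarith⟩
    rw [e2, Real.volume_Ioo, sub_zero, ENNReal.ofReal_toReal (measure_ne_top _ _)]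
  rw [h1]
  simp_rw [h2]
  rw [lintegral_lintegral_swap hFm.aemeasurable, envNorm]
  refine setLIntegral_mono_ae' measurableSet_Ioo (ae_of_all _ fun u hu => ?_)
  calc ∫⁻ t in Set.Ioi 0, F t u
      ≤ ∫⁻ t, (Set.Ioc 0 (absQuantile P X u)).indicator 1 t := by
        rw [← lintegral_indicator measurableSet_Ioi]
        refine lintegral_mono fun t => ?_
        by_cases ht : t ∈ Set.Ioi (0 : ℝ)
        · by_cases hut : u < T t
          · rw [Set.indicator_of_mem (show t ∈ Set.Ioc 0 (absQuantile P X u) from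
              ⟨ht, hQ u hu t hut⟩)]
            simp only [Set.indicator_apply, hF]
            split_ifs <;> simp
          · simp [hF, hut, Set.indicator_apply]
        · simp [Set.indicator_of_notMem ht]
    _ = ENNReal.ofReal (absQuantile P X u) := by
        rw [lintegral_indicator_one measurableSet_Ioc, Real.volume_Ioc, sub_zero]
    _ ≤ _ := by
        rw [ENNReal.ofReal_mul (by positivity)]
        refine le_mul_of_one_le_left zero_le ?_
        rw [ENNReal.one_le_ofReal]
        exact Real.one_le_rpow (le_max_left _ _) (by linarith)

/-- For a subadditive sequence, weighted summability along the integers implies weighted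
summability along powers of two. -/
lemma tsum_two_pow_lt_top_of_subadditive {a : ℕ → ℝ≥0∞}
    (hsub : ∀ m n, 1 ≤ m → 1 ≤ n → a (m + n) ≤ a m + a n) {s : ℝ}
    (hs : 1 < s)
    (hsum : ∑' n : ℕ, ENNReal.ofReal ((n + 1 : ℝ) ^ (-s)) * a (n + 1) < ∞) :
    ∑' i : ℕ, ENNReal.ofReal ((2 : ℝ) ^ ((i : ℝ) * (1 - s))) * a (2 ^ i) < ∞ := by
  set A : ℕ → ℝ≥0∞ := fun i => ∑ k ∈ Finset.Ico 1 (2 ^ i), a k with hA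
  set B : ℕ → ℝ≥0∞ := fun i => ∑ k ∈ Finset.Ico (2 ^ i) (2 ^ (i + 1)), a k with hB
  have hAB : ∀ i, A (i + 1) = A i + B i := fun i =>
    (Finset.sum_Ico_consecutive _ Nat.one_le_two_pow
      (Nat.pow_le_pow_right (by norm_num) (Nat.le_succ i))).symm
  have h1 : ∀ i, ((2 ^ i - 1 : ℕ) : ℝ≥0∞) * a (2 ^ i) ≤ 2 * A i := by
    intro i
    have hrefl : ∑ k ∈ Finset.Ico 1 (2 ^ i), a (2 ^ i - k) = A i :=
      Finset.sum_Ico_reflect a 1 (m := 2 ^ i) (n := 2 ^ i) (Nat.le_succ _) |>.trans (by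
        simp [hA])
    calc ((2 ^ i - 1 : ℕ) : ℝ≥0∞) * a (2 ^ i)
        = ∑ k ∈ Finset.Ico 1 (2 ^ i), a (2 ^ i) := by simp
      _ ≤ ∑ k ∈ Finset.Ico 1 (2 ^ i), (a k + a (2 ^ i - k)) := by
          refine Finset.sum_le_sum fun k hk => ?_
          rw [Finset.mem_Ico] at hk
          have := hsub k (2 ^ i - k) hk.1 (by lia)
          rwa [show k + (2 ^ i - k) = 2 ^ i by lia] at this
      _ = 2 * A i := by rw [Finset.sum_add_distrib, hrefl, two_mul]
  set T : ℕ → ℝ≥0∞ := fun i => ENNReal.ofReal ((2 : ℝ) ^ (-(i : ℝ) * s)) * A i with hT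
  set S : ℕ → ℝ≥0∞ := fun i => ENNReal.ofReal ((2 : ℝ) ^ (-((i + 1 : ℕ) : ℝ) * s)) * B i with hS
  have hTS : ∀ i, T (i + 1) ≤ ENNReal.ofReal ((2 : ℝ) ^ (-s)) * T i + S i := by
    intro i
    rw [hT, hS]
    simp only
    rw [hAB, mul_add, ← mul_assoc, ← ENNReal.ofReal_mul (by positivity),
      ← Real.rpow_add (by norm_num)]
    refine le_of_eq ?_
    congr 4
    push_cast
    ring
  have hSsum : ∑' i, S i ≤ ∑' n : ℕ, ENNReal.ofReal ((n + 1 : ℝ) ^ (-s)) * a (n + 1) := by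
    set g : ℕ → ℝ≥0∞ := fun k => ENNReal.ofReal ((k : ℝ) ^ (-s)) * a k with hg
    have e1 : ∀ n : ℕ, ENNReal.ofReal ((n + 1 : ℝ) ^ (-s)) * a (n + 1) = g (n + 1) := by
      intro n; simp [hg]
    simp_rw [e1]
    have hSi : ∀ i, S i ≤ ∑ k ∈ Finset.Ico (2 ^ i) (2 ^ (i + 1)), g k := by
      intro i
      simp only [hS, hB, Finset.mul_sum]
      refine Finset.sum_le_sum fun k hk => ?_
      rw [Finset.mem_Ico] at hk
      refine mul_le_mul_left (ENNReal.ofReal_le_ofReal ?_) _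
      have hk0 : (0 : ℝ) < k := by
        have : 0 < 2 ^ i := by positivity
        exact_mod_cast this.trans_le hk.1
      have : (2 : ℝ) ^ (-((i + 1 : ℕ) : ℝ) * s) = ((2 : ℝ) ^ (i + 1)) ^ (-s) := by
        rw [← Real.rpow_natCast, ← Real.rpow_mul (by norm_num)]; ring_nf
      rw [this]
      refine Real.rpow_le_rpow_of_nonpos hk0 (by exact_mod_cast hk.2.le) (by linarith)
    rw [ENNReal.tsum_eq_iSup_nat]
    refine iSup_le fun n => ?_
    calc ∑ i ∈ Finset.range n, S i
        ≤ ∑ i ∈ Finset.range n, ∑ k ∈ Finset.Ico (2 ^ i) (2 ^ (i + 1)), g k :=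
          Finset.sum_le_sum fun i _ => hSi i
      _ = ∑ k ∈ Finset.Ico 1 (2 ^ n), g k := by
          induction n with
          | zero => simp
          | succ n ih =>
            rw [Finset.sum_range_succ, ih]
            exact Finset.sum_Ico_consecutive _ Nat.one_le_two_pow
              (Nat.pow_le_pow_right (by norm_num) (Nat.le_succ n))
      _ = ∑ k ∈ Finset.range (2 ^ n - 1), g (k + 1) := by
          rw [Finset.sum_Ico_eq_sum_range]
          simp_rw [add_comm 1]
      _ ≤ _ := ENNReal.sum_le_tsum _
  have hTsum : ∑' i, T i < ∞ := by
    refine (ENNReal.tsum_le_of_contraction (by positivity)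
      (Real.rpow_lt_one_of_one_lt_of_neg (by norm_num) (by linarith)) hTS).trans_lt ?_
    refine ENNReal.mul_lt_top ENNReal.ofReal_lt_top (ENNReal.add_lt_top.2 ⟨?_, ?_⟩)
    · simp [hT, hA]
    · exact hSsum.trans_lt hsum
  have hterm : ∀ i, ENNReal.ofReal ((2 : ℝ) ^ (((i + 1 : ℕ) : ℝ) * (1 - s))) * a (2 ^ (i + 1))
      ≤ 4 * T (i + 1) := by
    intro i
    have h3 : ((2 : ℝ≥0∞) ^ (i + 1)) * a (2 ^ (i + 1)) ≤ 4 * A (i + 1) := by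
      have h4 : (2 : ℝ≥0∞) ^ (i + 1) ≤ 2 * ((2 ^ (i + 1) - 1 : ℕ) : ℝ≥0∞) := by
        have : 2 ^ (i + 1) ≤ 2 * (2 ^ (i + 1) - 1) := by
          have : 1 ≤ 2 ^ i := Nat.one_le_two_pow
          lia
        exact_mod_cast this
      calc _ ≤ 2 * ((2 ^ (i + 1) - 1 : ℕ) : ℝ≥0∞) * a (2 ^ (i + 1)) := mul_le_mul_left h4 _
        _ ≤ 2 * (2 * A (i + 1)) := by
          rw [mul_assoc]; exact mul_le_mul_right (h1 _) _
        _ = _ := by ring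
    have h5 : ENNReal.ofReal ((2 : ℝ) ^ (((i + 1 : ℕ) : ℝ) * (1 - s)))
        = ENNReal.ofReal ((2 : ℝ) ^ (-((i + 1 : ℕ) : ℝ) * s)) * (2 : ℝ≥0∞) ^ (i + 1) := by
      rw [show (2 : ℝ≥0∞) ^ (i + 1) = ENNReal.ofReal ((2 : ℝ) ^ ((i + 1 : ℕ) : ℝ)) by
        rw [Real.rpow_natCast, ENNReal.ofReal_pow (by norm_num), ENNReal.ofReal_ofNat],
        ← ENNReal.ofReal_mul (by positivity), ← Real.rpow_add (by norm_num)]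
      ring_nf
    rw [h5, mul_assoc]
    refine (mul_le_mul_right h3 _).trans (le_of_eq ?_)
    simp only [hT]
    ring
  rw [tsum_eq_zero_add' ENNReal.summable]
  refine ENNReal.add_lt_top.2 ⟨?_, ?_⟩
  · simpa using (ENNReal.le_tsum 0).trans_lt hsum
  calc _ ≤ ∑' i, 4 * T (i + 1) := ENNReal.tsum_le_tsum hterm
    _ = 4 * ∑' i, T (i + 1) := ENNReal.tsum_mul_left
    _ ≤ 4 * ∑' i, T i := mul_le_mul_right
      (ENNReal.tsum_comp_le_tsum_of_injective (add_left_injective 1) T) _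
    _ < ∞ := ENNReal.mul_lt_top (by norm_num) hTsum

section

lemma comp_ae_eq_condExp_comap {Ω F : Type*} [MeasurableSpace Ω] [mF : MeasurableSpace F]
    {P : Measure Ω} [IsFiniteMeasure P] {T : Ω → F} (hT : Measurable T) {Y : Ω → ℝ}
    (hY : Integrable Y P) {g : F → ℝ} (hg : Measurable g)
    (hgi : Integrable (fun ω => g (T ω)) P)
    (hspec : ∀ Z : F → ℝ, Measurable Z → (∃ B, ∀ x, |Z x| ≤ B) →
      ∫ ω, Z (T ω) * g (T ω) ∂P = ∫ ω, Z (T ω) * Y ω ∂P) :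
    (fun ω => g (T ω)) =ᵐ[P] P[Y | mF.comap T] := by
  refine ae_eq_condExp_of_forall_setIntegral_eq hT.comap_le hY (fun _ _ _ => hgi.integrableOn)
    ?_ (hg.comp (comap_measurable T)).stronglyMeasurable.aestronglyMeasurable
  rintro s ⟨B, hB, rfl⟩ -
  have h1 := hspec (B.indicator 1) (measurable_one.indicator hB)
    ⟨1, fun x => by by_cases hx : x ∈ B <;> simp [hx]⟩
  have h2 : ∀ f : Ω → ℝ, ∫ ω in T ⁻¹' B, f ω ∂P
      = ∫ ω, B.indicator (1 : F → ℝ) (T ω) * f ω ∂P := by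
    intro f
    rw [← integral_indicator (hT hB)]
    refine integral_congr_ae (ae_of_all _ fun ω => ?_)
    by_cases hx : T ω ∈ B <;> simp [hx]
  rw [h2, h2, h1]

lemma exists_condExp_comap_eq_comp {Ω F : Type*} [MeasurableSpace Ω] [mF : MeasurableSpace F]
    {P : Measure Ω} [IsFiniteMeasure P] {T : Ω → F} (hT : Measurable T) {Y : Ω → ℝ}
    (hY : Integrable Y P) :
    ∃ g : F → ℝ, Measurable g ∧ Integrable (fun ω => g (T ω)) P ∧
      ∀ Z : F → ℝ, Measurable Z → (∃ B, ∀ x, |Z x| ≤ B) →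
        ∫ ω, Z (T ω) * g (T ω) ∂P = ∫ ω, Z (T ω) * Y ω ∂P := by
  have hsm : StronglyMeasurable[mF.comap T] (P[Y | mF.comap T]) := stronglyMeasurable_condExp
  obtain ⟨g, hg, hgT⟩ := hsm.exists_eq_measurable_comp
  have hgT' : ∀ ω, g (T ω) = (P[Y | mF.comap T]) ω := fun ω => (congrFun hgT ω).symm
  refine ⟨g, hg.measurable, ?_, ?_⟩
  · simp_rw [hgT']
    exact integrable_condExp
  · rintro Z hZ ⟨B, hB⟩
    simp_rw [hgT']
    have hZT : StronglyMeasurable[mF.comap T] (fun ω => Z (T ω)) :=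
      (hZ.comp (comap_measurable T)).stronglyMeasurable
    have hi : Integrable (fun ω => Z (T ω) * Y ω) P := hY.abs_le_mul (hZ.comp hT) fun ω => hB _
    have := condExp_mul_of_stronglyMeasurable_left hZT hi hY
    rw [← integral_condExp hT.comap_le (f := fun ω => Z (T ω) * Y ω)]
    exact (integral_congr_ae this).symm

namespace RevStationary

variable {ι : Type*} [Fintype ι] {μ : Measure (ℕ → ι → ℝ)}

lemma eLpNorm_add_le (hc : RevStationary μ) {a b : ι} {e : ℝ}
    {h : ℕ → (ℕ → ι → ℝ) → ℝ} (h_meas : ∀ n, Measurable (h n)) (h_int : ∀ n, Integrable (h n) μ)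
    (h_spec : ∀ n (Z : (ℕ → ι → ℝ) → ℝ), Measurable Z → (∃ B, ∀ w, |Z w| ≤ B) →
      ∫ w, Z (seqShift n w) * (seqSum n w a * seqSum n w b - n * e) ∂μ = ∫ w, Z w * h n w ∂μ)
    (m n : ℕ) {q : ℝ≥0∞} (hq : 1 ≤ q) :
    eLpNorm (h (m + n)) q μ ≤ eLpNorm (h m) q μ + eLpNorm (h n) q μ := by
  have := hc.prob
  have hgm : Measurable fun w => h (m + n) w - h m w := (h_meas _).sub (h_meas _)
  have hgi : Integrable (fun w => h (m + n) w - h m w) μ := (h_int _).sub (h_int _)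
  have hce := comp_ae_eq_condExp_comap (P := μ) (T := seqShift m) (measurable_seqShift m)
    (h_int n) hgm ((hc.mpn m).integrable_comp_of_integrable hgi) (by
      rintro Z hZ ⟨B, hB⟩
      rw [(hc.mpn m).integral_comp_of_measurable (f := fun w => Z w * (h (m + n) w - h m w))
        (hZ.mul hgm)]
      simp_rw [mul_sub]
      rw [integral_sub ((h_int _).abs_le_mul hZ hB) ((h_int _).abs_le_mul hZ hB),
        hc.integral_mul_add (h_spec m) (h_spec n) (h_spec (m + n)) hZ hB]
      ring)
  have h1 : eLpNorm (fun w => h (m + n) w - h m w) q μ ≤ eLpNorm (h n) q μ := by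
    rw [← eLpNorm_comp_measurePreserving hgm.aestronglyMeasurable (hc.mpn m)]
    refine (le_of_eq (eLpNorm_congr_ae hce)).trans (eLpNorm_condExp_le_eLpNorm _ hq)
  have h2 : h (m + n) = h m + fun w => h (m + n) w - h m w := by
    funext w; simp
  calc eLpNorm (h (m + n)) q μ = eLpNorm (h m + fun w => h (m + n) w - h m w) q μ := by rw [← h2]
    _ ≤ _ := (MeasureTheory.eLpNorm_add_le (h_meas m).aestronglyMeasurable hgm.aestronglyMeasurable hq).trans
      (add_le_add le_rfl h1)

end RevStationary

end

lemma Matrix.PosSemidef.exists_rank_factorization {n : Type} [Fintype n] [DecidableEq n]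
    {A : Matrix n n ℝ} (hA : A.PosSemidef) :
    ∃ (ι : Type) (_ : Fintype ι) (_ : DecidableEq ι) (c : Matrix ι n ℝ) (l : Matrix n ι ℝ),
      c * A * c.transpose = 1 ∧ l * l.transpose = A ∧ l * c * A = A := by
  classical
  set lam := hA.1.eigenvalues with hlam
  set V : Matrix n n ℝ := (hA.1.eigenvectorUnitary : Matrix n n ℝ) with hV
  have hV1 : V.transpose * V = 1 := by
    have := Matrix.UnitaryGroup.star_mul_self hA.1.eigenvectorUnitary
    rwa [Matrix.star_eq_conjTranspose, Matrix.conjTranspose_eq_transpose_of_trivial] at this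
  have hsp : A = V * Matrix.diagonal lam * V.transpose := by
    have := hA.1.spectral_theorem
    rw [Unitary.conjStarAlgAut_apply] at this
    rw [Matrix.star_eq_conjTranspose, Matrix.conjTranspose_eq_transpose_of_trivial] at this
    exact this
  have hnn : ∀ i, 0 ≤ lam i := hA.eigenvalues_nonneg
  set R : Matrix {i : n // lam i ≠ 0} n ℝ :=
    Matrix.of fun i j => if (i : n) = j then (Real.sqrt (lam j))⁻¹ else 0 with hR
  set R' : Matrix n {i : n // lam i ≠ 0} ℝ :=
    Matrix.of fun j i => if (i : n) = j then Real.sqrt (lam j) else 0 with hR'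
  have e1 : R * Matrix.diagonal lam * R.transpose = 1 := by
    ext i j
    have hi := i.2
    have hpos : 0 < lam i := lt_of_le_of_ne (hnn _) (Ne.symm hi)
    rw [Matrix.mul_apply]
    simp only [Matrix.mul_diagonal, hR, Matrix.transpose_apply, Matrix.of_apply, ite_mul,
      zero_mul, Finset.sum_ite_eq, Finset.mem_univ, if_true, Matrix.one_apply]
    by_cases hij : i = j
    · subst hij
      simp only [if_true]
      have := Real.mul_self_sqrt hpos.le
      have h0 : Real.sqrt (lam i) ≠ 0 := (Real.sqrt_pos.2 hpos).ne'
      field_simp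
      linarith
    · have : ¬ ((j : n) = i) := fun h => hij (Subtype.ext h.symm)
      simp [hij, this]
  have e2 : R' * R'.transpose = Matrix.diagonal lam := by
    ext i j
    simp only [Matrix.mul_apply, hR', Matrix.transpose_apply, Matrix.of_apply,
      Matrix.diagonal_apply]
    by_cases hij : i = j
    · subst hij
      by_cases hi : lam i = 0
      · simp [hi]
      · rw [Finset.sum_eq_single ⟨i, hi⟩]
        · simp [Real.mul_self_sqrt (hnn i)]
        · intro b _ hb
          have : ¬ ((b : n) = i) := fun h => hb (Subtype.ext h)
          simp [this]
        · simp
    · rw [if_neg hij]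
      refine Finset.sum_eq_zero fun k _ => ?_
      by_cases hk : (k : n) = i
      · have : ¬ ((k : n) = j) := fun h => hij (hk.symm.trans h)
        simp [this]
      · simp [hk]
  have e3 : R' * R * Matrix.diagonal lam = Matrix.diagonal lam := by
    ext i j
    rw [Matrix.mul_diagonal, Matrix.mul_apply, Matrix.diagonal_apply]
    simp only [hR', hR, Matrix.of_apply]
    by_cases hj : lam j = 0
    · split_ifs with h
      · subst h; simp [hj]
      · simp [hj]
    have hpos : 0 < lam j := lt_of_le_of_ne (hnn _) (Ne.symm hj)
    rw [Finset.sum_eq_single ⟨j, hj⟩]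
    · have h0 : Real.sqrt (lam j) ≠ 0 := (Real.sqrt_pos.2 hpos).ne'
      by_cases hij : i = j
      · subst hij; simp [h0]
      · simp [hij, Ne.symm hij]
    · intro b _ hb
      have : ¬ ((b : n) = j) := fun h => hb (Subtype.ext h)
      simp [this]
    · simp
  refine ⟨_, inferInstance, inferInstance, R * V.transpose, V * R', ?_, ?_, ?_⟩
  · rw [hsp]
    calc _ = R * (V.transpose * V) * Matrix.diagonal lam * (V.transpose * V) * R.transpose := by
          simp only [Matrix.transpose_mul, Matrix.transpose_transpose, Matrix.mul_assoc]
      _ = 1 := by rw [hV1, Matrix.mul_one, Matrix.mul_one, e1]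
  · calc _ = V * (R' * R'.transpose) * V.transpose := by
          simp only [Matrix.transpose_mul, Matrix.mul_assoc]
      _ = A := by rw [e2, ← hsp]
  · nth_rewrite 1 [hsp]
    calc _ = V * (R' * R) * (V.transpose * V) * Matrix.diagonal lam * V.transpose := by
          simp only [Matrix.mul_assoc]
      _ = V * (R' * R * Matrix.diagonal lam) * V.transpose := by
          rw [hV1, Matrix.mul_one]; simp only [Matrix.mul_assoc]
      _ = A := by rw [e3, ← hsp]

section

section linear

variable {Ω : Type*} [MeasurableSpace Ω] {P : Measure Ω} {κ : Type*} [Fintype κ]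
  {f : κ → Ω → ℝ}

lemma integral_sum_mul_sum (hf : ∀ a, MemLp (f a) 2 P) (x y : κ → ℝ) :
    ∫ ω, (∑ a, x a * f a ω) * (∑ b, y b * f b ω) ∂P
      = ∑ a, ∑ b, x a * y b * ∫ ω, f a ω * f b ω ∂P := by
  have h1 : ∀ ω, (∑ a, x a * f a ω) * (∑ b, y b * f b ω)
      = ∑ a, ∑ b, x a * y b * (f a ω * f b ω) := by
    intro ω
    rw [Finset.sum_mul_sum]
    exact Finset.sum_congr rfl fun a _ => Finset.sum_congr rfl fun b _ => by ring
  have h2 : ∀ a b, Integrable (fun ω => x a * y b * (f a ω * f b ω)) P := fun a b =>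
    ((hf a).integrable_fun_mul (hf b)).const_mul _
  simp_rw [h1]
  rw [integral_finsetSum _ fun a _ => integrable_finsetSum _ fun b _ => h2 a b]
  refine Finset.sum_congr rfl fun a _ => ?_
  rw [integral_finsetSum _ fun b _ => h2 a b]
  exact Finset.sum_congr rfl fun b _ => integral_const_mul _ _

lemma memLp_sum_mul (hf : ∀ a, MemLp (f a) 2 P) (x : κ → ℝ) :
    MemLp (fun ω => ∑ a, x a * f a ω) 2 P :=
  memLp_finsetSum _ fun a _ => (hf a).const_mul (x a)

lemma ae_sum_mul_eq_zero (hf : ∀ a, MemLp (f a) 2 P) {x : κ → ℝ}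
    (hx : ∀ b, ∑ a, x a * ∫ ω, f a ω * f b ω ∂P = 0) : ∀ᵐ ω ∂P, ∑ a, x a * f a ω = 0 := by
  have h1 : ∫ ω, (∑ a, x a * f a ω) * (∑ b, x b * f b ω) ∂P = 0 := by
    rw [integral_sum_mul_sum hf, Finset.sum_comm]
    refine Finset.sum_eq_zero fun b _ => ?_
    rw [← mul_zero (x b), ← hx b, Finset.mul_sum]
    exact Finset.sum_congr rfl fun a _ => by ring
  have hm := memLp_sum_mul hf x
  rw [integral_eq_zero_iff_of_nonneg (fun ω => mul_self_nonneg _)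
    (hm.integrable_fun_mul hm)] at h1
  filter_upwards [h1] with ω hω
  exact mul_self_eq_zero.1 hω

lemma posSemidef_integral_mul (hf : ∀ a, MemLp (f a) 2 P) :
    (Matrix.of fun a b => ∫ ω, f a ω * f b ω ∂P : Matrix κ κ ℝ).PosSemidef := by
  refine Matrix.PosSemidef.of_dotProduct_mulVec_nonneg ?_ fun x => ?_
  · ext a b
    simp [Matrix.conjTranspose_apply, mul_comm]
  · have h1 : star x ⬝ᵥ ((Matrix.of fun a b => ∫ ω, f a ω * f b ω ∂P : Matrix κ κ ℝ).mulVec x)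
        = ∫ ω, (∑ a, x a * f a ω) * (∑ b, x b * f b ω) ∂P := by
      rw [integral_sum_mul_sum hf]
      simp only [dotProduct, Matrix.mulVec, Matrix.of_apply, Pi.star_apply, star_trivial,
        Finset.mul_sum]
      exact Finset.sum_congr rfl fun a _ => Finset.sum_congr rfl fun b _ => by ring
    rw [h1]
    exact integral_nonneg fun ω => mul_self_nonneg _

end linear

/-- The image under `C` of the sequence `d`, started at time `j`. -/
def tailPath {Ω E F : Type*} (C : E → F) (d : ℤ → Ω → E) (j : ℤ) (ω : Ω) : ℕ → F :=
  fun m => C (d (m + j) ω)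

lemma seqShift_tailPath {Ω E F : Type*} (C : E → F) (d : ℤ → Ω → E) (j : ℤ) (n : ℕ) (ω : Ω) :
    seqShift n (tailPath C d j ω) = tailPath C d (j + n) ω := by
  funext m
  simp only [seqShift, tailPath]
  push_cast
  rw [add_assoc, add_comm (n : ℤ) j]

section stationary

variable {Ω E F : Type*} [mΩ : MeasurableSpace Ω] [MeasurableSpace E] [mF : MeasurableSpace F]
  {P : Measure Ω} {C : E → F} {d : ℤ → Ω → E}

lemma measurable_tailPath (hC : Measurable C) (hd : ∀ n, Measurable (d n)) (j : ℤ) :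
    Measurable (tailPath C d j) :=
  measurable_pi_lambda _ fun _ => hC.comp (hd _)

lemma map_tailPath_eq (hC : Measurable C) (hd : ∀ n, Measurable (d n))
    (hstat : ∀ k : ℤ, Measure.map (fun ω => fun n : ℤ => d (n + k) ω) P
      = Measure.map (fun ω => fun n : ℤ => d n ω) P) (j k : ℤ) :
    P.map (tailPath C d j) = P.map (tailPath C d k) := by
  have h0 : ∀ j, P.map (tailPath C d j) = P.map (tailPath C d 0) := by
    intro j
    set G : (ℤ → E) → ℕ → F := fun x m => C (x m) with hG
    have hGm : Measurable G := measurable_pi_lambda _ fun m => hC.comp (measurable_pi_apply _)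
    have h1 := congrArg (Measure.map G) (hstat j)
    rw [Measure.map_map hGm (measurable_pi_lambda _ fun n => hd _),
      Measure.map_map hGm (measurable_pi_lambda _ fun n => hd _)] at h1
    have e1 : tailPath C d j = G ∘ fun ω n => d (n + j) ω := rfl
    have e0 : tailPath C d 0 = G ∘ fun ω n => d n ω := by
      funext ω m
      simp [tailPath, hG]
    rw [e1, e0, h1]
  rw [h0 j, h0 k]

lemma map_eq_of_stationary (hd : ∀ n, Measurable (d n))
    (hstat : ∀ k : ℤ, Measure.map (fun ω => fun n : ℤ => d (n + k) ω) P
      = Measure.map (fun ω => fun n : ℤ => d n ω) P) (j k : ℤ) : P.map (d j) = P.map (d k) := by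
  have h1 := congrArg (Measure.map fun x : ℕ → E => x 0)
    (map_tailPath_eq (C := id) measurable_id hd hstat j k)
  rw [Measure.map_map (measurable_pi_apply _) (measurable_tailPath measurable_id hd _),
    Measure.map_map (measurable_pi_apply _) (measurable_tailPath measurable_id hd _)] at h1
  simpa [tailPath, Function.comp_def] using h1

lemma measurePreserving_seqShift_map_tailPath (hC : Measurable C) (hd : ∀ n, Measurable (d n))
    (hstat : ∀ k : ℤ, Measure.map (fun ω => fun n : ℤ => d (n + k) ω) P
      = Measure.map (fun ω => fun n : ℤ => d n ω) P) (j : ℤ) :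
    MeasurePreserving (seqShift 1) (P.map (tailPath C d j)) (P.map (tailPath C d j)) := by
  refine ⟨measurable_seqShift 1, ?_⟩
  rw [Measure.map_map (measurable_seqShift 1) (measurable_tailPath hC hd j),
    ← map_tailPath_eq hC hd hstat (j + (1 : ℕ)) j]
  congr 1
  funext ω
  exact seqShift_tailPath C d j 1 ω

end stationary

end

section

section euclidean

variable {Ω : Type*} [mΩ : MeasurableSpace Ω] {P : Measure Ω} {D : ℕ}
  {𝒢 : ℤ → MeasurableSpace Ω} {d : ℤ → Ω → EuclideanSpace ℝ (Fin D)}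

lemma memLp_of_stationary (hd : ∀ n, Measurable (d n))
    (hstat : ∀ k : ℤ, Measure.map (fun ω => fun n : ℤ => d (n + k) ω) P
      = Measure.map (fun ω => fun n : ℤ => d n ω) P) {q : ℝ≥0∞} (hL : MemLp (d 0) q P) (k : ℤ) :
    MemLp (d k) q P := by
  have h1 : MemLp id q (P.map (d 0)) :=
    (memLp_map_measure_iff (by fun_prop) (hd 0).aemeasurable).2 hL
  rw [map_eq_of_stationary hd hstat 0 k] at h1
  exact (memLp_map_measure_iff (by fun_prop) (hd k).aemeasurable).1 h1

lemma integral_mul_of_stationary (hd : ∀ n, Measurable (d n))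
    (hstat : ∀ k : ℤ, Measure.map (fun ω => fun n : ℤ => d (n + k) ω) P
      = Measure.map (fun ω => fun n : ℤ => d n ω) P) (k : ℤ) (a b : Fin D) :
    ∫ ω, d k ω a * d k ω b ∂P = ∫ ω, d 0 ω a * d 0 ω b ∂P := by
  have h1 : ∀ k, ∫ ω, d k ω a * d k ω b ∂P = ∫ x, x a * x b ∂(P.map (d k)) := fun k =>
    (integral_map (f := fun x : EuclideanSpace ℝ (Fin D) => x a * x b) (hd k).aemeasurable
      (Measurable.aestronglyMeasurable (by fun_prop))).symm
  rw [h1, h1, map_eq_of_stationary hd hstat k 0]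

lemma memLp_apply {q : ℝ≥0∞} {k : ℤ} (h : MemLp (d k) q P) (a : Fin D) :
    MemLp (fun ω => d k ω a) q P :=
  (EuclideanSpace.proj (𝕜 := ℝ) a).comp_memLp' h

omit mΩ in
lemma measurable_tailPath_of_adapted {F : Type*} [MeasurableSpace F] (hanti : Antitone 𝒢)
    (hadp : ∀ n, Measurable[𝒢 n] (d n)) {C : EuclideanSpace ℝ (Fin D) → F} (hC : Measurable C)
    (j : ℤ) : Measurable[𝒢 j] (tailPath C d j) :=
  @measurable_pi_lambda _ _ _ (𝒢 j) _ _ fun m =>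
    hC.comp ((hadp (m + j)).mono (hanti (by lia)) le_rfl)

lemma revStationary_map_tailPath [IsProbabilityMeasure P] {ι : Type*} [Fintype ι]
    (hanti : Antitone 𝒢)
    (hle : ∀ n, 𝒢 n ≤ mΩ) (hadp : ∀ n, Measurable[𝒢 n] (d n))
    (hmds : ∀ n : ℤ, P[d n | 𝒢 (n + 1)] =ᵐ[P] 0)
    (hstat : ∀ k : ℤ, Measure.map (fun ω => fun n : ℤ => d (n + k) ω) P
      = Measure.map (fun ω => fun n : ℤ => d n ω) P) (hL : MemLp (d 0) 2 P)
    (C : EuclideanSpace ℝ (Fin D) →L[ℝ] (ι → ℝ)) : RevStationary (P.map (tailPath C d 1)) := by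
  have hd : ∀ n, Measurable (d n) := fun n => (hadp n).mono (hle n) le_rfl
  have hC : Measurable C := C.continuous.measurable
  have hT := fun j => measurable_tailPath hC hd j
  refine ⟨Measure.isProbabilityMeasure_map (hT 1).aemeasurable,
    measurePreserving_seqShift_map_tailPath hC hd hstat 1, ?_, ?_⟩
  · refine (memLp_map_measure_iff (Measurable.aestronglyMeasurable (by fun_prop))
      (hT 1).aemeasurable).2 ?_
    have := C.comp_memLp' (memLp_of_stationary hd hstat hL 1)
    simpa [tailPath, Function.comp_def] using this
  · intro Z hZ hZ2 a
    rw [integral_map (f := fun w : ℕ → ι → ℝ => Z (seqShift 1 w) * w 0 a) (hT 1).aemeasurable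
      (Measurable.aestronglyMeasurable (by fun_prop))]
    set g : EuclideanSpace ℝ (Fin D) →L[ℝ] ℝ := (ContinuousLinearMap.proj a).comp C with hg
    have e : ∀ ω, Z (seqShift 1 (tailPath C d 1 ω)) * tailPath C d 1 ω 0 a
        = Z (tailPath C d 2 ω) * (g ∘ d 1) ω := by
      intro ω
      rw [seqShift_tailPath]
      simp [tailPath, hg]
    simp_rw [e]
    have hd1 : MemLp (d 1) 2 P := memLp_of_stationary hd hstat hL 1
    have hdi : Integrable (d 1) P := hd1.integrable (by norm_num)
    have hg2 : MemLp (g ∘ d 1) 2 P := g.comp_memLp' hd1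
    have hmp : MeasurePreserving (tailPath C d 2) P (P.map (tailPath C d 1)) :=
      ⟨hT 2, map_tailPath_eq hC hd hstat 2 1⟩
    have hZ2' : MemLp (fun ω => Z (tailPath C d 2 ω)) 2 P := hZ2.comp_measurePreserving hmp
    have hZm : StronglyMeasurable[𝒢 2] (fun ω => Z (tailPath C d 2 ω)) :=
      (hZ.comp (measurable_tailPath_of_adapted hanti hadp hC 2)).stronglyMeasurable
    have hprod : Integrable (fun ω => Z (tailPath C d 2 ω) * (g ∘ d 1) ω) P :=
      hZ2'.integrable_fun_mul hg2
    have h1 := condExp_mul_of_stronglyMeasurable_left hZm hprod (hg2.integrable (by norm_num))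
    have h2 : P[g ∘ d 1 | 𝒢 2] =ᵐ[P] 0 := by
      refine (g.comp_condExp_comm hdi).symm.trans ?_
      filter_upwards [hmds 1] with ω hω
      have : (P[d 1 | 𝒢 2]) ω = 0 := hω
      simp [this]
    rw [← integral_condExp (hle 2)]
    refine (integral_congr_ae (h1.trans (h2.mono fun ω hω => ?_))).trans (integral_zero Ω ℝ)
    simp [hω]

end euclidean

lemma RevStationary.integral_seqSum_mul_seqSum {ι : Type*} [Fintype ι]
    {μ : Measure (ℕ → ι → ℝ)} (hc : RevStationary μ) (n : ℕ) (a b : ι) :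
    ∫ w, seqSum n w a * seqSum n w b ∂μ = n * ∫ w, w 0 a * w 0 b ∂μ := by
  induction n with
  | zero => simp [seqSum]
  | succ n ih =>
    have h0 := fun c => memLp_pi_iff.1 hc.memLp_two c
    have hm : ∀ c, Measurable fun w : ℕ → ι → ℝ => seqSum n w c := by intros; fun_prop
    have h1 := fun c => hc.memLp_two_seqSum_eval n c
    have h1' : ∀ c, MemLp (fun w : ℕ → ι → ℝ => seqSum n (seqShift 1 w) c) 2 μ := fun c =>
      (h1 c).comp_measurePreserving hc.mp
    have hpt : ∀ w : ℕ → ι → ℝ, seqSum (n + 1) w a * seqSum (n + 1) w b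
        = w 0 a * w 0 b + seqSum n (seqShift 1 w) a * seqSum n (seqShift 1 w) b
        + seqSum n (seqShift 1 w) a * w 0 b + seqSum n (seqShift 1 w) b * w 0 a := by
      intro w
      rw [add_comm n 1, seqSum_add]
      simp only [Pi.add_apply, seqSum, Finset.sum_range_one]
      ring
    simp_rw [hpt]
    rw [integral_fun_add₄ ((h0 a).integrable_fun_mul (h0 b))
      ((h1' a).integrable_fun_mul (h1' b)) ((h1' a).integrable_fun_mul (h0 b))
      ((h1' b).integrable_fun_mul (h0 a)), hc.orth (fun w => seqSum n w a) (hm a) (h1 a),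
      hc.orth (fun w => seqSum n w b) (hm b) (h1 b),
      hc.mp.integral_comp_of_measurable (f := fun w => seqSum n w a * seqSum n w b) (by fun_prop),
      ih]
    push_cast
    ring

end

section

lemma eLpNorm_condExp_sum_smul_le {Ω κ : Type*} [Fintype κ] {m mΩ : MeasurableSpace Ω}
    {P : Measure Ω} {f : κ → Ω → ℝ} (hf : ∀ x, Integrable (f x) P) (k : κ → ℝ) {q : ℝ≥0∞}
    (hq : 1 ≤ q) :
    eLpNorm (P[∑ x, k x • f x | m]) q P ≤ ∑ x, ‖k x‖ₑ * eLpNorm (P[f x | m]) q P := by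
  rw [eLpNorm_congr_ae (condExp_finsetSum (fun x _ => (hf x).smul (k x)) m)]
  refine (eLpNorm_sum_le (fun x _ => integrable_condExp.1) hq).trans
    (Finset.sum_le_sum fun x _ => ?_)
  rw [eLpNorm_congr_ae (condExp_smul (k x) (f x) m)]
  exact eLpNorm_const_smul_le

section euclidean

variable {Ω : Type*} [mΩ : MeasurableSpace Ω] {P : Measure Ω} {D : ℕ}
  {𝒢 : ℤ → MeasurableSpace Ω} {d : ℤ → Ω → EuclideanSpace ℝ (Fin D)}

omit mΩ in
lemma partialSum_eq_sum_range (n : ℕ) (ω : Ω) :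
    partialSum d n ω = ∑ k ∈ Finset.range n, d ((k : ℤ) + 1) ω := by
  unfold partialSum
  symm
  refine Finset.sum_nbij (fun k : ℕ => (k : ℤ) + 1) ?_ ?_ ?_ fun _ _ => rfl
  · intro k hk
    simp only [Finset.mem_range, Finset.mem_Icc] at hk ⊢
    lia
  · intro a _ b _ hab
    simpa using hab
  · intro k hk
    simp only [Finset.coe_Icc, Set.mem_Icc] at hk
    refine ⟨(k - 1).toNat, ?_, ?_⟩
    · simp only [Finset.coe_range, Set.mem_Iio]
      lia
    · simp only
      lia

omit mΩ in
lemma seqSum_tailPath {ι : Type*} (C : EuclideanSpace ℝ (Fin D) →L[ℝ] (ι → ℝ))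
    (n : ℕ) (ω : Ω) : seqSum n (tailPath C d 1 ω) = C (partialSum d n ω) := by
  rw [partialSum_eq_sum_range, map_sum]
  rfl

/-- The centered conditional second moments of the partial sums given the future. -/
def condMoment (P : Measure Ω) (𝒢 : ℤ → MeasurableSpace Ω)
    (d : ℤ → Ω → EuclideanSpace ℝ (Fin D)) (n : ℕ) (i j : Fin D) (ω : Ω) : ℝ :=
  (P[fun ω' => partialSum d n ω' i * partialSum d n ω' j | 𝒢 ((n : ℤ) + 1)]) ω
    - ∫ ω', partialSum d n ω' i * partialSum d n ω' j ∂P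

variable [IsProbabilityMeasure P]

lemma eLpNorm_le_sum_condMoment {ι : Type*} [Fintype ι] [DecidableEq ι] (hanti : Antitone 𝒢)
    (hle : ∀ n, 𝒢 n ≤ mΩ) (hadp : ∀ n, Measurable[𝒢 n] (d n))
    (hmds : ∀ n : ℤ, P[d n | 𝒢 (n + 1)] =ᵐ[P] 0)
    (hstat : ∀ k : ℤ, Measure.map (fun ω => fun n : ℤ => d (n + k) ω) P
      = Measure.map (fun ω => fun n : ℤ => d n ω) P) (hL : MemLp (d 0) 2 P)
    {C : EuclideanSpace ℝ (Fin D) →L[ℝ] (ι → ℝ)} {c : ι → Fin D → ℝ}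
    (hCc : ∀ x i, C x i = ∑ a, c i a * x a)
    (n : ℕ) (a b : ι) {g : (ℕ → ι → ℝ) → ℝ} (hg : Measurable g)
    (hgi : Integrable g (P.map (tailPath C d 1)))
    (hspec : ∀ Z : (ℕ → ι → ℝ) → ℝ, Measurable Z → (∃ B, ∀ w, |Z w| ≤ B) →
      ∫ w, Z (seqShift n w) * (seqSum n w a * seqSum n w b
        - n * ∫ w, w 0 a * w 0 b ∂(P.map (tailPath C d 1))) ∂(P.map (tailPath C d 1))
        = ∫ w, Z w * g w ∂(P.map (tailPath C d 1))) {q : ℝ≥0∞} (hq : 1 ≤ q) :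
    eLpNorm g q (P.map (tailPath C d 1)) ≤
      ∑ x : Fin D × Fin D, ‖c a x.1 * c b x.2‖ₑ * eLpNorm (condMoment P 𝒢 d n x.1 x.2) q P := by
  have hd : ∀ n, Measurable (d n) := fun n => (hadp n).mono (hle n) le_rfl
  have hC : Measurable C := C.continuous.measurable
  have hT := fun j => measurable_tailPath hC hd j
  have hc := revStationary_map_tailPath hanti hle hadp hmds hstat hL C
  set μ := P.map (tailPath C d 1) with hμ
  set T := tailPath C d ((n : ℤ) + 1) with hTdef
  have hmp : MeasurePreserving T P μ := ⟨hT _, map_tailPath_eq hC hd hstat _ 1⟩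
  have hM2 : ∀ i, MemLp (fun ω => partialSum d n ω i) 2 P := by
    intro i
    have : MemLp (partialSum d n) 2 P :=
      memLp_finsetSum _ fun k _ => memLp_of_stationary hd hstat hL k
    exact (EuclideanSpace.proj (𝕜 := ℝ) i).comp_memLp' this
  set f : Fin D × Fin D → Ω → ℝ := fun x ω => partialSum d n ω x.1 * partialSum d n ω x.2
    - ∫ ω', partialSum d n ω' x.1 * partialSum d n ω' x.2 ∂P with hf
  have hMi : ∀ x : Fin D × Fin D,
      Integrable (fun ω => partialSum d n ω x.1 * partialSum d n ω x.2) P := fun x =>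
    (hM2 x.1).integrable_fun_mul (hM2 x.2)
  have hfi : ∀ x, Integrable (f x) P := fun x => (hMi x).sub (integrable_const _)
  set Y : Ω → ℝ := ∑ x : Fin D × Fin D, (c a x.1 * c b x.2) • f x with hY
  have hYi : Integrable Y P := integrable_finsetSum' _ fun x _ => (hfi x).smul _
  have hmean : n * ∫ w, w 0 a * w 0 b ∂μ = ∑ x : Fin D × Fin D, (c a x.1 * c b x.2) *
      ∫ ω', partialSum d n ω' x.1 * partialSum d n ω' x.2 ∂P := by
    rw [← hc.integral_seqSum_mul_seqSum n a b, hμ,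
      integral_map (f := fun w : ℕ → ι → ℝ => seqSum n w a * seqSum n w b) (hT 1).aemeasurable
      (Measurable.aestronglyMeasurable (by
        have : ∀ c, Measurable fun w : ℕ → ι → ℝ => seqSum n w c := by intros; fun_prop
        fun_prop))]
    simp_rw [seqSum_tailPath, hCc]
    rw [integral_sum_mul_sum hM2, Fintype.sum_prod_type]
  have hYeq : ∀ ω, Y ω = seqSum n (tailPath C d 1 ω) a * seqSum n (tailPath C d 1 ω) b
      - n * ∫ w, w 0 a * w 0 b ∂μ := by
    intro ω
    rw [hmean, seqSum_tailPath, hCc, hCc, Finset.sum_mul_sum, ← Fintype.sum_prod_type',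
      ← Finset.sum_sub_distrib, hY, Finset.sum_apply]
    refine Finset.sum_congr rfl fun x _ => ?_
    simp only [hf, Pi.smul_apply, smul_eq_mul]
    ring
  have hce := comp_ae_eq_condExp_comap (P := P) (T := T) (hT _) hYi hg
    (hmp.integrable_comp_of_integrable hgi) (by
      rintro Z hZ ⟨B, hB⟩
      rw [hmp.integral_comp_of_measurable (f := fun w => Z w * g w) (hZ.mul hg),
        ← hspec Z hZ ⟨B, hB⟩]
      conv_lhs => rw [hμ]
      rw [integral_map (hT 1).aemeasurable (Measurable.aestronglyMeasurable (by
        have : ∀ c, Measurable fun w : ℕ → ι → ℝ => seqSum n w c := by intros; fun_prop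
        fun_prop))]
      refine integral_congr_ae (ae_of_all _ fun ω => ?_)
      simp only [hYeq]
      rw [seqShift_tailPath, add_comm (1 : ℤ)])
  have hTle : MeasurableSpace.comap T inferInstance ≤ 𝒢 ((n : ℤ) + 1) :=
    (measurable_tailPath_of_adapted hanti hadp hC _).comap_le
  rw [← eLpNorm_comp_measurePreserving hg.aestronglyMeasurable hmp]
  calc eLpNorm (fun ω => g (T ω)) q P
      = eLpNorm (P[P[Y | 𝒢 ((n : ℤ) + 1)] | MeasurableSpace.comap T inferInstance]) q P :=
        eLpNorm_congr_ae (hce.trans (condExp_condExp_of_le hTle (hle _)).symm)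
    _ ≤ eLpNorm (P[Y | 𝒢 ((n : ℤ) + 1)]) q P := eLpNorm_condExp_le_eLpNorm _ hq
    _ ≤ ∑ x : Fin D × Fin D, ‖c a x.1 * c b x.2‖ₑ *
        eLpNorm (P[f x | 𝒢 ((n : ℤ) + 1)]) q P := eLpNorm_condExp_sum_smul_le hfi _ hq
    _ = _ := by
        refine Finset.sum_congr rfl fun x _ => ?_
        congr 1
        refine eLpNorm_congr_ae ((condExp_sub (hMi x) (integrable_const _) _).trans ?_)
        rw [condExp_const (hle _)]
        exact ae_of_all _ fun ω => rfl

end euclidean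

end

section

lemma ENNReal.tsum_mul_lt_top_of_le_sum {κ : Type*} [Fintype κ] {w a : ℕ → ℝ≥0∞}
    {K : κ → ℝ≥0∞} {r : κ → ℕ → ℝ≥0∞} (hK : ∀ x, K x ≠ ∞)
    (ha : ∀ n, a n ≤ ∑ x, K x * r x n) (hr : ∀ x, ∑' n, w n * r x n < ∞) :
    ∑' n, w n * a n < ∞ := by
  calc ∑' n, w n * a n ≤ ∑' n, ∑ x, K x * (w n * r x n) := by
        refine ENNReal.tsum_le_tsum fun n => (mul_le_mul_right (ha n) _).trans (le_of_eq ?_)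
        rw [Finset.mul_sum]
        exact Finset.sum_congr rfl fun x _ => by ring
    _ = ∑ x, K x * ∑' n, w n * r x n := by
        rw [Summable.tsum_finsetSum fun _ _ => ENNReal.summable]
        simp_rw [ENNReal.tsum_mul_left]
    _ < ∞ := ENNReal.sum_lt_top.2 fun x _ => ENNReal.mul_lt_top (hK x).lt_top (hr x)

section euclidean

variable {Ω : Type*} [mΩ : MeasurableSpace Ω] {P : Measure Ω} {D : ℕ}
  {𝒢 : ℤ → MeasurableSpace Ω} {d : ℤ → Ω → EuclideanSpace ℝ (Fin D)}

lemma condMoment_succ (n : ℕ) (i j : Fin D) : condMoment P 𝒢 d (n + 1) i j = fun ω =>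
    (P[fun ω' => partialSum d (n + 1) ω' i * partialSum d (n + 1) ω' j | 𝒢 ((n : ℤ) + 2)]) ω
      - ∫ ω', partialSum d (n + 1) ω' i * partialSum d (n + 1) ω' j ∂P := by
  have : ((n + 1 : ℕ) : ℤ) + 1 = (n : ℤ) + 2 := by push_cast; ring
  funext ω
  rw [condMoment, this]

lemma measurable_condMoment (hle : ∀ n, 𝒢 n ≤ mΩ) (n : ℕ) (i j : Fin D) :
    Measurable (condMoment P 𝒢 d n i j) :=
  (stronglyMeasurable_condExp.mono (hle _)).measurable.sub_const _

variable [IsProbabilityMeasure P]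

/-- The image of the sequence under a linear map normalizing its covariance satisfies the
hypotheses of the coupling theorem. -/
lemma exists_revCore {ι : Type*} [Fintype ι] [DecidableEq ι] {p : ℝ} (hp : 2 < p) (hp3 : p ≤ 3)
    (hanti : Antitone 𝒢)
    (hle : ∀ n, 𝒢 n ≤ mΩ) (hadp : ∀ n, Measurable[𝒢 n] (d n))
    (hmds : ∀ n : ℤ, P[d n | 𝒢 (n + 1)] =ᵐ[P] 0)
    (hstat : ∀ k : ℤ, Measure.map (fun ω => fun n : ℤ => d (n + k) ω) P
      = Measure.map (fun ω => fun n : ℤ => d n ω) P) (hL : MemLp (d 0) (ENNReal.ofReal p) P)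
    (hC1 : ∀ i j : Fin D, ∑' n : ℕ, ENNReal.ofReal ((n + 1 : ℝ) ^ (-(3 - p / 2))) *
      eLpNorm (condMoment P 𝒢 d (n + 1) i j) 1 P < ⊤)
    (hC2 : ∀ i j : Fin D, ∑' n : ℕ, ENNReal.ofReal ((n + 1 : ℝ) ^ (-(1 + 2 / p))) *
      eLpNorm (condMoment P 𝒢 d (n + 1) i j) (ENNReal.ofReal (p / 2)) P < ⊤)
    {C : EuclideanSpace ℝ (Fin D) →L[ℝ] (ι → ℝ)} {c : ι → Fin D → ℝ}
    (hCc : ∀ x i, C x i = ∑ a, c i a * x a)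
    (hcov : ∀ i j, ∑ a, ∑ b, c i a * c j b * ∫ ω, d 0 ω a * d 0 ω b ∂P
      = if i = j then 1 else 0) :
    ∃ h, RevCore p (P.map (tailPath C d 1)) h := by
  have hd : ∀ n, Measurable (d n) := fun n => (hadp n).mono (hle n) le_rfl
  have hC : Measurable C := C.continuous.measurable
  have hT := fun j => measurable_tailPath hC hd j
  have hL2 : MemLp (d 0) 2 P := by
    refine hL.mono_exponent ?_
    rw [← ENNReal.ofReal_ofNat 2]
    exact ENNReal.ofReal_le_ofReal hp.le
  have hq : 1 ≤ ENNReal.ofReal (p / 2) := by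
    rw [ENNReal.one_le_ofReal]; linarith
  have hc := revStationary_map_tailPath hanti hle hadp hmds hstat hL2 C
  set μ := P.map (tailPath C d 1) with hμ
  have := hc.prob
  have hSm : ∀ n i, Measurable fun w : ℕ → ι → ℝ => seqSum n w i := by intros; fun_prop
  have hmcov : ∀ i j, ∫ w, w 0 i * w 0 j ∂μ = if i = j then 1 else 0 := by
    intro i j
    rw [hμ, integral_map (f := fun w : ℕ → ι → ℝ => w 0 i * w 0 j) (hT 1).aemeasurable
      (Measurable.aestronglyMeasurable (by fun_prop)), ← hcov]
    simp_rw [← integral_mul_of_stationary hd hstat ((0 : ℕ) + 1)]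
    rw [← integral_sum_mul_sum (fun a => memLp_apply (memLp_of_stationary hd hstat hL2 _) a)]
    simp_rw [tailPath, hCc]
  have hex : ∀ (n : ℕ) (i j : ι), ∃ g : (ℕ → ι → ℝ) → ℝ, Measurable g ∧ Integrable g μ ∧
      ∀ Z : (ℕ → ι → ℝ) → ℝ, Measurable Z → (∃ B, ∀ w, |Z w| ≤ B) →
        ∫ w, Z (seqShift n w) * (seqSum n w i * seqSum n w j - n * ∫ w, w 0 i * w 0 j ∂μ) ∂μ
          = ∫ w, Z w * g w ∂μ := by
    intro n i j
    obtain ⟨g, hg, hgi, hgs⟩ := exists_condExp_comap_eq_comp (P := μ) (T := seqShift n)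
      (measurable_seqShift n) (Y := fun w => seqSum n w i * seqSum n w j
        - n * ∫ w, w 0 i * w 0 j ∂μ) ((hc.integrable_mul_seqSum n i j).sub (integrable_const _))
    refine ⟨g, hg, ((hc.mpn n).integrable_comp hg.aestronglyMeasurable).1 hgi, fun Z hZ hB => ?_⟩
    rw [← hgs Z hZ hB]
    exact (hc.mpn n).integral_comp_of_measurable (f := fun w => Z w * g w) (hZ.mul hg)
  choose g hg hgi hgs using hex
  have hbound := fun n i j (q : ℝ≥0∞) (hq : 1 ≤ q) => eLpNorm_le_sum_condMoment hanti hle hadp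
    hmds hstat hL2 hCc n i j (hg n i j) (hgi n i j) (hgs n i j) hq
  have hsub := fun i j (m n : ℕ) (q : ℝ≥0∞) (hq : 1 ≤ q) => hc.eLpNorm_add_le
    (fun n => hg n i j) (fun n => hgi n i j) (fun n => hgs n i j) m n hq
  have hs1 : ∀ i j, ∑' n : ℕ, ENNReal.ofReal ((n + 1 : ℝ) ^ (-(3 - p / 2))) *
      eLpNorm (g (n + 1) i j) 1 μ < ∞ := fun i j =>
    ENNReal.tsum_mul_lt_top_of_le_sum (fun x => enorm_ne_top)
      (fun n => hbound (n + 1) i j 1 le_rfl) fun x => hC1 x.1 x.2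
  have hs2 : ∀ i j, ∑' n : ℕ, ENNReal.ofReal ((n + 1 : ℝ) ^ (-(1 + 2 / p))) *
      eLpNorm (g (n + 1) i j) (ENNReal.ofReal (p / 2)) μ < ∞ := fun i j =>
    ENNReal.tsum_mul_lt_top_of_le_sum (fun x => enorm_ne_top)
      (fun n => hbound (n + 1) i j _ hq) fun x => hC2 x.1 x.2
  refine ⟨fun i => g (2 ^ i), ⟨hc.prob, hp, hp3, hc.mp, ?_, hc.orth, hmcov, fun i => hg _,
    fun i a b => ⟨(hg _ a b).aestronglyMeasurable, ?_⟩, ?_, fun a b => ?_, fun a b => ?_⟩⟩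
  · refine (memLp_map_measure_iff (Measurable.aestronglyMeasurable (by fun_prop))
      (hT 1).aemeasurable).2 ?_
    have := C.comp_memLp' (memLp_of_stationary hd hstat hL 1)
    simpa [tailPath, Function.comp_def] using this
  · have h1 := (ENNReal.le_tsum (2 ^ i - 1)).trans_lt (hs2 a b)
    have h2 : 2 ^ i - 1 + 1 = 2 ^ i := Nat.sub_add_cancel Nat.one_le_two_pow
    rw [h2] at h1
    refine ENNReal.lt_top_of_mul_ne_top_right h1.ne (ENNReal.ofReal_pos.2 ?_).ne'
    positivity
  · intro i a b Z hZ hB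
    rw [← hgs (2 ^ i) a b Z hZ hB, hmcov]
    push_cast
    rfl
  · have := tsum_two_pow_lt_top_of_subadditive
      (fun m n _ _ => hsub a b m n 1 le_rfl) (show 1 < 3 - p / 2 by linarith) (hs1 a b)
    rwa [show 1 - (3 - p / 2) = p / 2 - 2 by ring] at this
  · have := tsum_two_pow_lt_top_of_subadditive
      (fun m n _ _ => hsub a b m n _ hq) (show 1 < 1 + 2 / p by
        have : 0 < 2 / p := by positivity
        linarith) (hs2 a b)
    convert this using 6
    ring

end euclidean

end

section

section stdG

variable {ι : Type*} [Fintype ι]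

lemma stdG_map_sum_mul (s : ι → ℝ) :
    (stdG ι).map (fun x => ∑ i, s i * x i) = gaussianReal 0 (Real.toNNReal (∑ i, s i ^ 2)) := by
  have hm : Measurable fun x : ι → ℝ => ∑ i, s i * x i := by fun_prop
  have := Measure.isProbabilityMeasure_map (μ := stdG ι) hm.aemeasurable
  refine Measure.ext_of_charFun (funext fun t => ?_)
  rw [charFun_gaussianReal, charFun_apply_real, integral_map hm.aemeasurable
    (Measurable.aestronglyMeasurable (by fun_prop))]
  have h1 : ∀ x : ι → ℝ, Complex.exp (t * ((∑ i, s i * x i : ℝ) : ℂ) * Complex.I)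
      = ∏ i, Complex.exp (((t * s i : ℝ) : ℂ) * x i * Complex.I) := by
    intro x
    rw [← Complex.exp_sum]
    congr 1
    push_cast
    rw [Finset.mul_sum, Finset.sum_mul]
    exact Finset.sum_congr rfl fun i _ => by ring
  simp_rw [h1]
  rw [stdG, integral_fintype_prod_eq_prod (fun i (y : ℝ) =>
    Complex.exp (((t * s i : ℝ) : ℂ) * y * Complex.I))]
  simp_rw [← charFun_apply_real, charFun_gaussianReal]
  rw [← Complex.exp_sum, Real.coe_toNNReal _ (Finset.sum_nonneg fun i _ => sq_nonneg _)]
  congr 1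
  push_cast
  rw [Finset.sum_mul, Finset.sum_div, mul_zero, zero_mul, zero_sub, ← Finset.sum_neg_distrib]
  exact Finset.sum_congr rfl fun i _ => by ring

/-- The image of the standard Gaussian measure under a matrix is a centered Gaussian law. -/
lemma isCenteredGaussianCov_map {D : ℕ} {l : Matrix (Fin D) ι ℝ}
    {L : (ι → ℝ) →L[ℝ] EuclideanSpace ℝ (Fin D)} (hL : ∀ y a, L y a = ∑ i, l a i * y i) :
    IsCenteredGaussianCov D (l * l.transpose) ((stdG ι).map L) := by
  refine ⟨Measure.isProbabilityMeasure_map (by fun_prop), fun t => ?_⟩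
  rw [Measure.map_map (by fun_prop) (by fun_prop)]
  have h1 : (fun x : EuclideanSpace ℝ (Fin D) => ∑ a, t a * x a) ∘ L
      = fun y => ∑ i, (∑ a, t a * l a i) * y i := by
    funext y
    simp_rw [Function.comp_apply, hL, Finset.mul_sum, Finset.sum_mul]
    rw [Finset.sum_comm]
    exact Finset.sum_congr rfl fun i _ => Finset.sum_congr rfl fun a _ => by ring
  rw [h1, stdG_map_sum_mul]
  congr 2
  simp_rw [Matrix.mul_apply, Matrix.transpose_apply, sq, Finset.sum_mul_sum, Finset.mul_sum,
    Finset.sum_mul]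
  rw [Finset.sum_comm]
  refine Finset.sum_congr rfl fun a _ => ?_
  rw [Finset.sum_comm]
  exact Finset.sum_congr rfl fun b _ => Finset.sum_congr rfl fun i _ => by ring

end stdG

lemma iIndepFun_comp_iidSeq {Ω' E F : Type*} [MeasurableSpace Ω'] [MeasurableSpace E]
    [MeasurableSpace F] {P' : Measure Ω'} [IsProbabilityMeasure P'] {ν : Measure E}
    [IsProbabilityMeasure ν] {G : Ω' → ℕ → E} (hG : Measurable G) (hlaw : P'.map G = iidSeq ν)
    {f : E → F} (hf : Measurable f) :
    iIndepFun (fun i z => f (G z i)) P' ∧ ∀ i, P'.map (fun z => f (G z i)) = ν.map f := by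
  have hGi : ∀ i, Measurable fun z => G z i := fun i => (measurable_pi_apply i).comp hG
  have h1 : ∀ i, P'.map (fun z => G z i) = ν := by
    intro i
    rw [← (measurePreserving_eval_iidSeq (ν := ν) i).map_eq, ← hlaw,
      Measure.map_map (measurable_pi_apply i) hG]
    rfl
  refine ⟨?_, fun i => ?_⟩
  · refine iIndepFun.comp ((iIndepFun_iff_map_fun_eq_infinitePi_map hGi).2 ?_) (fun _ => f)
      (fun _ => hf)
    simp_rw [h1]
    exact hlaw
  · rw [← h1 i, Measure.map_map hf (hGi i)]
    rfl

end

section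

section euclidean

variable {Ω : Type*} [MeasurableSpace Ω] {P : Measure Ω} {D : ℕ}
  {d : ℤ → Ω → EuclideanSpace ℝ (Fin D)}

/-- If `l * c` fixes the covariance matrix, then it fixes almost every value. -/
lemma ae_mul_eq_self {ι : Type*} [Fintype ι] (hd : ∀ n, Measurable (d n))
    (hstat : ∀ k : ℤ, Measure.map (fun ω => fun n : ℤ => d (n + k) ω) P
      = Measure.map (fun ω => fun n : ℤ => d n ω) P) (hL : MemLp (d 0) 2 P)
    {c : Matrix ι (Fin D) ℝ} {l : Matrix (Fin D) ι ℝ}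
    (hlc : l * c * Matrix.of (fun a b => ∫ ω, d 0 ω a * d 0 ω b ∂P)
      = Matrix.of fun a b => ∫ ω, d 0 ω a * d 0 ω b ∂P) :
    ∀ᵐ ω ∂P, ∀ (k : ℤ) (a : Fin D), ∑ i, l a i * ∑ b, c i b * d k ω b = d k ω a := by
  refine ae_all_iff.2 fun k => ae_all_iff.2 fun a => ?_
  have h1 := ae_sum_mul_eq_zero (P := P) (f := fun b ω => d k ω b)
    (x := fun b => (l * c) a b - (1 : Matrix (Fin D) (Fin D) ℝ) a b)
    (fun b => memLp_apply (memLp_of_stationary hd hstat hL k) b) (fun b => by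
      simp_rw [integral_mul_of_stationary hd hstat k, sub_mul, Finset.sum_sub_distrib]
      have h2 := congrFun (congrFun hlc a) b
      rw [Matrix.mul_apply] at h2
      simp only [Matrix.of_apply] at h2
      rw [h2]
      simp [Matrix.one_apply])
  filter_upwards [h1] with ω hω
  simp_rw [sub_mul, Finset.sum_sub_distrib] at hω
  have h3 : ∑ b, (1 : Matrix (Fin D) (Fin D) ℝ) a b * d k ω b = d k ω a := by
    simp [Matrix.one_apply]
  rw [h3, sub_eq_zero] at hω
  rw [← hω]
  simp_rw [Matrix.mul_apply, Finset.mul_sum, Finset.sum_mul]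
  rw [Finset.sum_comm]
  exact Finset.sum_congr rfl fun b _ => Finset.sum_congr rfl fun i _ => by ring

omit [MeasurableSpace Ω] in
/-- Integer-indexed partial sums over `[1, n]` as sums over the natural numbers. -/
lemma partialSum_eq_sum_Icc (n : ℕ) (ω : Ω) :
    partialSum d n ω = ∑ k ∈ Finset.Icc 1 n, d (k : ℤ) ω := by
  rw [partialSum_eq_sum_range, Finset.range_eq_Ico]
  exact_mod_cast Finset.sum_Ico_add' (fun k : ℕ => d (k : ℤ) ω) 0 n 1

lemma measurable_sum_Icc_comp {E F : Type*} [MeasurableSpace E] [MeasurableSpace F]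
    [AddCommMonoid F] [MeasurableAdd₂ F] {f : E → F} (hf : Measurable f) :
    Measurable fun (w : ℕ → E) (n : ℕ) => ∑ k ∈ Finset.Icc 1 n, f (w k) := by
  fun_prop

lemma map_sum_tailPath {ι : Type*} [Fintype ι] (hd : ∀ n, Measurable (d n))
    (hstat : ∀ k : ℤ, Measure.map (fun ω => fun n : ℤ => d (n + k) ω) P
      = Measure.map (fun ω => fun n : ℤ => d n ω) P)
    {C : EuclideanSpace ℝ (Fin D) →L[ℝ] (ι → ℝ)} {L : (ι → ℝ) →L[ℝ] EuclideanSpace ℝ (Fin D)}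
    (hLC : ∀ᵐ ω ∂P, ∀ k, L (C (d k ω)) = d k ω) (j : ℤ) :
    (P.map (tailPath C d j)).map (fun w n => ∑ k ∈ Finset.Icc 1 n, L (w k))
      = P.map fun ω n => partialSum d n ω := by
  rw [map_tailPath_eq C.measurable hd hstat j 0, Measure.map_map
    (measurable_sum_Icc_comp L.measurable) (measurable_tailPath C.measurable hd 0)]
  refine Measure.map_congr ?_
  filter_upwards [hLC] with ω hω
  funext n
  simp only [Function.comp_apply, tailPath, add_zero, hω, partialSum_eq_sum_Icc]

end euclidean

end

/-- **Remark 2.7 (ASIP for reversed martingale differences).** -/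
theorem asip_reversed_martingale_differences
    {Ω : Type*} [MeasurableSpace Ω] (P : Measure Ω) [IsProbabilityMeasure P]
    (D : ℕ) (p : ℝ) (hp : 2 < p) (hp3 : p ≤ 3)
    (𝒢 : ℤ → MeasurableSpace Ω) (hanti : Antitone 𝒢)
    (hle : ∀ n, 𝒢 n ≤ ‹MeasurableSpace Ω›)
    (d : ℤ → Ω → EuclideanSpace ℝ (Fin D))
    (hadp : ∀ n, StronglyMeasurable[𝒢 n] (d n))
    (hint : ∀ n, Integrable (d n) P)
    (hmds : ∀ n : ℤ, P[d n | 𝒢 (n + 1)] =ᵐ[P] 0)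
    -- stationarity of the sequence
    (hstat : ∀ k : ℤ,
      Measure.map (fun ω => fun n : ℤ => d (n + k) ω) P
        = Measure.map (fun ω => fun n : ℤ => d n ω) P)
    -- moment of order `p`
    (hmom : MemLp (d 0) (ENNReal.ofReal p) P)
    -- condition (C1)
    (hC1 : ∀ i j : Fin D,
      ∑' n : ℕ, ENNReal.ofReal ((n + 1 : ℝ) ^ (-(3 - p / 2))) *
        envNorm P p (fun ω =>
          (P[fun ω' => partialSum d (n + 1) ω' i * partialSum d (n + 1) ω' j | 𝒢 ((n : ℤ) + 2)]) ω
            - ∫ ω', partialSum d (n + 1) ω' i * partialSum d (n + 1) ω' j ∂P) < ⊤)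
    -- condition (C2)
    (hC2 : ∀ i j : Fin D,
      ∑' n : ℕ, ENNReal.ofReal ((n + 1 : ℝ) ^ (-(1 + 2 / p))) *
        eLpNorm (fun ω =>
          (P[fun ω' => partialSum d (n + 1) ω' i * partialSum d (n + 1) ω' j | 𝒢 ((n : ℤ) + 2)]) ω
            - ∫ ω', partialSum d (n + 1) ω' i * partialSum d (n + 1) ω' j ∂P)
          (ENNReal.ofReal (p / 2)) P < ⊤) :
    ∀ ε > (0 : ℝ),
      ∃ (Ω' : Type) (_ : MeasurableSpace Ω') (P' : Measure Ω'),
        IsProbabilityMeasure P' ∧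
        ∃ (S : Ω' → ℕ → EuclideanSpace ℝ (Fin D)) (N : ℕ → Ω' → EuclideanSpace ℝ (Fin D)),
          -- `S` is a copy of the sequence of partial sums `(M_n)`
          Measure.map S P' = Measure.map (fun ω => fun n : ℕ => partialSum d n ω) P ∧
          -- `(N_i)` are iid centered Gaussian with covariance `E(d₀ d₀ᵗ)`
          iIndepFun N P' ∧
          (∀ i : ℕ, IsCenteredGaussianCov D
            (fun a b => ∫ ω, d 0 ω a * d 0 ω b ∂P) (Measure.map (N i) P')) ∧
          ∀ᵐ ω' ∂P',
            (fun n : ℕ => S ω' n - ∑ i ∈ Finset.Icc 1 n, N i ω')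
              =o[atTop]
            (fun n : ℕ => (n : ℝ) ^ (1 / p) *
              Real.log n ^ (if p = 3 then 1 + ε else (p + 1) / (2 * p) + ε)) := by
  intro ε hε
  have hd : ∀ n, Measurable (d n) := fun n => (hadp n).measurable.mono (hle n) le_rfl
  have hL2 : MemLp (d 0) 2 P := hmom.mono_exponent (by
    rw [← ENNReal.ofReal_ofNat]; exact ENNReal.ofReal_le_ofReal hp.le)
  have hC1' : ∀ i j, ∑' n : ℕ, ENNReal.ofReal ((n + 1 : ℝ) ^ (-(3 - p / 2))) *
      eLpNorm (condMoment P 𝒢 d (n + 1) i j) 1 P < ∞ := fun i j =>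
    (ENNReal.tsum_le_tsum fun n => mul_le_mul_right (by
      rw [← condMoment_succ]
      exact eLpNorm_one_le_envNorm P (measurable_condMoment hle _ i j) hp.le) _).trans_lt (hC1 i j)
  have hC2' : ∀ i j, ∑' n : ℕ, ENNReal.ofReal ((n + 1 : ℝ) ^ (-(1 + 2 / p))) *
      eLpNorm (condMoment P 𝒢 d (n + 1) i j) (ENNReal.ofReal (p / 2)) P < ∞ := fun i j => by
    simp_rw [condMoment_succ]
    exact hC2 i j
  obtain ⟨ι, _, _, c, l, hc1, hll, hlc⟩ := Matrix.PosSemidef.exists_rank_factorization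
    (posSemidef_integral_mul (P := P) (f := fun a ω => d 0 ω a) fun a => memLp_apply hL2 a)
  obtain ⟨C, hCc⟩ : ∃ C : EuclideanSpace ℝ (Fin D) →L[ℝ] (ι → ℝ),
      ∀ x i, C x i = ∑ a, c i a * x a :=
    ⟨ContinuousLinearMap.pi fun i => ∑ a, c i a • EuclideanSpace.proj a, fun x i => by simp⟩
  obtain ⟨L, hL⟩ : ∃ L : (ι → ℝ) →L[ℝ] EuclideanSpace ℝ (Fin D),
      ∀ y a, L y a = ∑ i, l a i * y i :=
    ⟨(EuclideanSpace.equiv (Fin D) ℝ).symm.toContinuousLinearMap.comp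
      (ContinuousLinearMap.pi fun a => ∑ i, l a i • ContinuousLinearMap.proj i),
      fun y a => by simp⟩
  have hLC : ∀ᵐ ω ∂P, ∀ k, L (C (d k ω)) = d k ω := by
    filter_upwards [ae_mul_eq_self hd hstat hL2 hlc] with ω hω k
    ext a
    simp_rw [hL, hCc, hω]
  obtain ⟨h, hcore⟩ := exists_revCore hp hp3 hanti hle (fun n => (hadp n).measurable) hmds hstat
    hmom hC1' hC2' hCc fun i j => by
      have h1 := congrFun (congrFun hc1 i) j
      rw [Matrix.one_apply] at h1
      rw [← h1]
      simp_rw [Matrix.mul_apply, Matrix.transpose_apply, Matrix.of_apply, Finset.sum_mul]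
      rw [Finset.sum_comm]
      exact Finset.sum_congr rfl fun b _ => Finset.sum_congr rfl fun a _ => by ring
  obtain ⟨G, hG, hGlaw, hGo⟩ := hcore.exists_coupling hε
  have := hcore.prob
  obtain ⟨hN1, hN2⟩ := iIndepFun_comp_iidSeq hG hGlaw L.measurable
  refine ⟨_, inferInstance, randLaw (P.map (tailPath C d 1)), inferInstance,
    fun z n => ∑ k ∈ Finset.Icc 1 n, L (z.1 k), fun i z => L (G z i), ?_, hN1, fun i => ?_, ?_⟩
  · rw [← map_sum_tailPath hd hstat hLC 1]
    nth_rewrite 2 [← (measurePreserving_fst (μ := P.map (tailPath C d 1))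
      (ν := iidSeq (volume : Measure unitInterval))).map_eq]
    rw [Measure.map_map (measurable_sum_Icc_comp L.measurable) measurable_fst]
    rfl
  · rw [hN2 i]
    have := isCenteredGaussianCov_map hL
    rw [hll] at this
    exact this
  · filter_upwards [hGo] with z hz
    have h1 : (fun n : ℕ => ∑ k ∈ Finset.Icc 1 n, (z.1 k - G z k)) =o[atTop]
        fun n : ℕ => (n : ℝ) ^ (1 / p) * Real.log n ^ (cExp p / p + 1 / 2 + ε) :=
      isLittleO_pi.2 fun a => by simpa only [Finset.sum_apply, Pi.sub_apply] using hz a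
    have h2 := (L.isBigO_comp (fun n : ℕ => ∑ k ∈ Finset.Icc 1 n, (z.1 k - G z k))
      atTop).trans_isLittleO h1
    have h3 : cExp p / p + 1 / 2 + ε = if p = 3 then 1 + ε else (p + 1) / (2 * p) + ε := by
      have : p ≠ 0 := by linarith
      unfold cExp
      split_ifs with hp3
      · rw [hp3]; norm_num
      · field_simp
        ring
    rw [h3] at h2
    simpa only [map_sum, map_sub, Finset.sum_sub_distrib] using h2

end
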